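/- Let Ω ⊆ ℍ² be a nonempty open connected geodesically convex set of finite hyperbolic area (∫_Ω dA < ∞). Let μ ∈ (0, 1/4]. Suppose u is a nonconstant real-valued function, smooth on Ω and C¹ up to ∂Ω ∩ ℍ², with ∫_Ω u² dA < ∞ and ∫_Ω |∇u|² dx dy < ∞, satisfying −Δu = μu pointwise in Ω together with the Neumann boundary condition, and suppose μ is the least element of the positive Neumann spectrum in the variational sense. Then u has no interior critical points: for every p ∈ Ω, the gradient of u at p is nonzero. -/

import Mathlib

open MeasureTheory Filter Set Topology

noncomputable section

/-- The upper half-plane model of the hyperbolic plane. -/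
def H2 : Set (ℝ × ℝ) := {p | 0 < p.2}

/-- Inverse hyperbolic cosine. -/
def arcosh (t : ℝ) : ℝ := Real.log (t + Real.sqrt (t ^ 2 - 1))

/-- Hyperbolic distance in the upper half-plane model. -/
def hypDist (a b : ℝ × ℝ) : ℝ :=
  arcosh (1 + ((a.1 - b.1) ^ 2 + (a.2 - b.2) ^ 2) / (2 * a.2 * b.2))

/-- Partial derivative in the `x` direction. -/
def pdx (u : ℝ × ℝ → ℝ) (p : ℝ × ℝ) : ℝ := fderiv ℝ u p (1, 0)

/-- Partial derivative in the `y` direction. -/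
def pdy (u : ℝ × ℝ → ℝ) (p : ℝ × ℝ) : ℝ := fderiv ℝ u p (0, 1)

/-- Squared Euclidean norm of the gradient. -/
def gradSq (u : ℝ × ℝ → ℝ) (p : ℝ × ℝ) : ℝ := pdx u p ^ 2 + pdy u p ^ 2

/-- The hyperbolic Laplacian `Δu = y²(u_xx + u_yy)`. -/
def hypLap (u : ℝ × ℝ → ℝ) (p : ℝ × ℝ) : ℝ :=
  p.2 ^ 2 * (pdx (pdx u) p + pdy (pdy u) p)

/-- Geodesic convexity in the hyperbolic metric. -/
def GeodesicallyConvex (Ω : Set (ℝ × ℝ)) : Prop :=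
  ∀ a ∈ Ω, ∀ b ∈ Ω, ∀ c ∈ H2, hypDist a c + hypDist c b = hypDist a b → c ∈ Ω

/-- `ν` is a Euclidean unit vector, the boundary of `Ω` has a tangent line at `q`
(the line through `q` orthogonal to `ν`), and `ν` points outward from `Ω`. -/
def IsOutwardNormalAt (Ω : Set (ℝ × ℝ)) (q ν : ℝ × ℝ) : Prop :=
  ν.1 ^ 2 + ν.2 ^ 2 = 1 ∧
  Tendsto (fun x : ℝ × ℝ =>
      |(x.1 - q.1) * ν.1 + (x.2 - q.2) * ν.2| /
        Real.sqrt ((x.1 - q.1) ^ 2 + (x.2 - q.2) ^ 2))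
    (𝓝[frontier Ω \ {q}] q) (𝓝 0) ∧
  ∀ᶠ t in 𝓝[>] (0 : ℝ), q + t • ν ∉ Ω

/-- The map straightening hyperbolic geodesics of the upper half-plane. -/
def straighten (z : ℝ × ℝ) : ℝ × ℝ := (z.1, z.1 ^ 2 + z.2 ^ 2)

/-- A right inverse of `straighten`, with values in the closed upper half-plane. -/
def unstraighten (w : ℝ × ℝ) : ℝ × ℝ := (w.1, Real.sqrt (w.2 - w.1 ^ 2))

lemma unstraighten_straighten {z : ℝ × ℝ} (hz : z ∈ H2) : unstraighten (straighten z) = z := by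
  have : 0 < z.2 := hz
  ext
  · rfl
  · simp [unstraighten, straighten, Real.sqrt_sq this.le]

lemma straighten_unstraighten {w : ℝ × ℝ} (hw : w.1 ^ 2 ≤ w.2) :
    straighten (unstraighten w) = w := by
  ext
  · rfl
  · simp only [unstraighten, straighten]
    rw [Real.sq_sqrt (by linarith)]; ring

lemma unstraighten_mem {w : ℝ × ℝ} (hw : w.1 ^ 2 < w.2) : unstraighten w ∈ H2 := by
  simp only [unstraighten, H2, mem_ofPred_eq]
  exact Real.sqrt_pos.2 (by linarith)

lemma lt_straighten {z : ℝ × ℝ} (hz : z ∈ H2) : (straighten z).1 ^ 2 < (straighten z).2 := by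
  have : 0 < z.2 := hz
  simp only [straighten]; nlinarith

lemma continuous_straighten : Continuous straighten := by
  unfold straighten; fun_prop

lemma continuous_unstraighten : Continuous unstraighten := by
  unfold unstraighten; fun_prop

lemma contDiff_straighten : ContDiff ℝ (⊤ : ℕ∞) straighten := by
  unfold straighten; fun_prop

lemma hypDist_add_eq {a b c : ℝ × ℝ} (ha : a ∈ H2) (hb : b ∈ H2) (hc : c ∈ H2) {t : ℝ}
    (ht0 : 0 ≤ t) (ht1 : t ≤ 1)
    (h1 : c.1 = (1 - t) * a.1 + t * b.1)
    (h2 : c.1 ^ 2 + c.2 ^ 2 = (1 - t) * (a.1 ^ 2 + a.2 ^ 2) + t * (b.1 ^ 2 + b.2 ^ 2)) :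
    hypDist a c + hypDist c b = hypDist a b := by
  have ha' : 0 < a.2 := ha
  have hb' : 0 < b.2 := hb
  have hc' : 0 < c.2 := hc
  set X := 1 + ((a.1 - b.1) ^ 2 + (a.2 - b.2) ^ 2) / (2 * a.2 * b.2) with hX
  have hX1 : 1 ≤ X := by rw [hX]; have : 0 ≤ ((a.1 - b.1) ^ 2 + (a.2 - b.2) ^ 2) / (2 * a.2 * b.2) := by positivity
                         linarith
  have hXe : 2 * a.2 * b.2 * X = (a.1 - b.1) ^ 2 + a.2 ^ 2 + b.2 ^ 2 := by
    rw [hX]; field_simp; ring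
  set S := Real.sqrt (X ^ 2 - 1) with hS
  have hS0 : 0 ≤ S := Real.sqrt_nonneg _
  have hSS : S ^ 2 = X ^ 2 - 1 := Real.sq_sqrt (by nlinarith)
  set A := (1 - t) * a.2
  set B := t * b.2
  have hA : 0 ≤ A := mul_nonneg (by linarith) ha'.le
  have hB : 0 ≤ B := mul_nonneg ht0 hb'.le
  have hC : c.2 ^ 2 = A ^ 2 + B ^ 2 + 2 * A * B * X := by
    have : 2 * A * B * X = t * (1 - t) * (2 * a.2 * b.2 * X) := by simp only [A, B]; ring
    rw [this, hXe]; simp only [A, B]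
    have h1' : c.1 ^ 2 = ((1 - t) * a.1 + t * b.1) ^ 2 := by rw [h1]
    linear_combination h2 - h1'
  have e1 : 1 + ((a.1 - c.1) ^ 2 + (a.2 - c.2) ^ 2) / (2 * a.2 * c.2) = (A + B * X) / c.2 := by
    field_simp
    have h : 2 * a.2 * (A + B * X) = (1 - t) * (2 * a.2 ^ 2) + t * (2 * a.2 * b.2 * X) := by
      simp only [A, B]; ring
    linear_combination h2 - 2 * a.1 * h1 - h - t * hXe
  have e2 : 1 + ((c.1 - b.1) ^ 2 + (c.2 - b.2) ^ 2) / (2 * c.2 * b.2) = (A * X + B) / c.2 := by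
    field_simp
    have h : 2 * b.2 * (A * X + B) = (1 - t) * (2 * a.2 * b.2 * X) + t * (2 * b.2 ^ 2) := by
      simp only [A, B]; ring
    linear_combination h2 - 2 * b.1 * h1 - h - (1 - t) * hXe
  have s1 : Real.sqrt (((A + B * X) / c.2) ^ 2 - 1) = B * S / c.2 := by
    rw [show ((A + B * X) / c.2) ^ 2 - 1 = (B * S / c.2) ^ 2 by
      rw [div_pow, div_pow, mul_pow, hSS]; field_simp; rw [hC]; ring]
    exact Real.sqrt_sq (by positivity)
  have s2 : Real.sqrt (((A * X + B) / c.2) ^ 2 - 1) = A * S / c.2 := by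
    rw [show ((A * X + B) / c.2) ^ 2 - 1 = (A * S / c.2) ^ 2 by
      rw [div_pow, div_pow, mul_pow, hSS]; field_simp; rw [hC]; ring]
    exact Real.sqrt_sq (by positivity)
  have hAB : 0 < A + B := by
    rcases ht0.eq_or_lt with h | h
    · simp only [A, B, ← h]; simpa using ha'
    · have : 0 < B := mul_pos h hb'
      linarith
  unfold hypDist arcosh
  rw [e1, e2, s1, s2, ← Real.log_mul]
  · congr 1
    rw [← hX, ← hS]
    field_simp
    rw [hC]
    linear_combination (A * B) * hSS
  · have : 0 < A + B * X + B * S := by nlinarith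
    rw [← add_div]; positivity
  · have : 0 < A * X + B + A * S := by nlinarith
    rw [← add_div]; positivity

lemma GeodesicallyConvex.convex_image {Ω : Set (ℝ × ℝ)} (hΩ : Ω ⊆ H2)
    (h : GeodesicallyConvex Ω) : Convex ℝ (straighten '' Ω) := by
  rw [convex_iff_add_mem]
  rintro _ ⟨a, ha, rfl⟩ _ ⟨b, hb, rfl⟩ s t hs ht hst
  obtain rfl : s = 1 - t := by linarith
  set w := (1 - t) • straighten a + t • straighten b with hw
  have w1 : w.1 = (1 - t) * a.1 + t * b.1 := by simp [hw, straighten]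
  have w2 : w.2 = (1 - t) * (a.1 ^ 2 + a.2 ^ 2) + t * (b.1 ^ 2 + b.2 ^ 2) := by
    simp [hw, straighten]
  have ha2 : 0 < a.2 := hΩ ha
  have hb2 : 0 < b.2 := hΩ hb
  have hlt : w.1 ^ 2 < w.2 := by
    rw [w1, w2]
    have h3 : 0 < (1 - t) * a.2 ^ 2 + t * b.2 ^ 2 := by
      rcases ht.eq_or_lt with h | h
      · rw [← h]; simp; positivity
      · have : 0 < t * b.2 ^ 2 := by positivity
        have : 0 ≤ (1 - t) * a.2 ^ 2 := by positivity
        linarith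
    have h4 : 0 ≤ (1 - t) * t * (a.1 - b.1) ^ 2 := by positivity
    nlinarith
  refine ⟨unstraighten w, ?_, straighten_unstraighten hlt.le⟩
  refine h a ha b hb _ (unstraighten_mem hlt)
    (hypDist_add_eq (hΩ ha) (hΩ hb) (unstraighten_mem hlt) ht (by linarith) w1 ?_)
  have := congrArg Prod.snd (straighten_unstraighten hlt.le)
  simp only [straighten] at this
  rw [this, w2]

lemma image_straighten_eq {Ω : Set (ℝ × ℝ)} (hΩ : Ω ⊆ H2) :
    straighten '' Ω = {w | w.1 ^ 2 < w.2} ∩ unstraighten ⁻¹' Ω := by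
  ext w; constructor
  · rintro ⟨z, hz, rfl⟩
    exact ⟨lt_straighten (hΩ hz), by simpa [unstraighten_straighten (hΩ hz)] using hz⟩
  · rintro ⟨h1, h2⟩
    exact ⟨_, h2, straighten_unstraighten (le_of_lt h1)⟩

lemma isOpen_image_straighten {Ω : Set (ℝ × ℝ)} (hΩ : Ω ⊆ H2) (ho : IsOpen Ω) :
    IsOpen (straighten '' Ω) := by
  rw [image_straighten_eq hΩ]
  exact (isOpen_lt (by fun_prop) (by fun_prop)).inter (ho.preimage continuous_unstraighten)

/-- The Beta weight of the Euler integral for the Legendre function. -/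
def betaWeight (s ξ : ℝ) : ℝ := ξ ^ (-s) * (1 - ξ) ^ (s - 1)

/-- Euler integral for (a shift of) the Legendre function. -/
def eulerInt (s : ℝ) (k : ℕ) (x : ℝ) : ℝ :=
  ∫ ξ in Ioo (0 : ℝ) 1, betaWeight s ξ * ξ ^ k * (1 + x * ξ) ^ (-(s + k))

lemma betaWeight_pos {s ξ : ℝ} (hξ : ξ ∈ Ioo (0 : ℝ) 1) : 0 < betaWeight s ξ := by
  have h1 := hξ.1
  have h2 : 0 < 1 - ξ := by linarith [hξ.2]
  unfold betaWeight; positivity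

lemma integrableOn_betaWeight {s : ℝ} (hs : s ∈ Ioo (0 : ℝ) 1) :
    IntegrableOn (betaWeight s) (Ioo 0 1) := by
  have h := Complex.betaIntegral_convergent (u := ((1 - s : ℝ) : ℂ)) (v := (s : ℂ))
    (by rw [Complex.ofReal_re]; linarith [hs.2]) (by rw [Complex.ofReal_re]; exact hs.1)
  rw [intervalIntegrable_iff_integrableOn_Ioo_of_le zero_le_one] at h
  refine (integrableOn_congr_fun ?_ measurableSet_Ioo).1 h.norm
  intro ξ hξ
  have h2 : 0 < 1 - ξ := by linarith [hξ.2]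
  simp only [norm_mul]
  rw [Complex.norm_cpow_eq_rpow_re_of_pos hξ.1, show (1 - (ξ : ℂ)) = ((1 - ξ : ℝ) : ℂ) by simp,
    Complex.norm_cpow_eq_rpow_re_of_pos h2]
  simp [betaWeight]

lemma one_add_mul_ge {x ξ : ℝ} (hξ : ξ ∈ Ioo (0 : ℝ) 1) : min 1 (1 + x) ≤ 1 + x * ξ := by
  rcases le_total 0 x with h | h
  · exact (min_le_left _ _).trans (by nlinarith [hξ.1])
  · exact (min_le_right _ _).trans (by nlinarith [hξ.2])

lemma one_add_mul_pos {x ξ : ℝ} (hx : -1 < x) (hξ : ξ ∈ Ioo (0 : ℝ) 1) : 0 < 1 + x * ξ :=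
  (lt_min one_pos (by linarith)).trans_le (one_add_mul_ge hξ)

lemma continuousOn_eulerInt_integrand {s x : ℝ} (hx : -1 < x) (k : ℕ) (r : ℝ) :
    ContinuousOn (fun ξ => betaWeight s ξ * ξ ^ k * (1 + x * ξ) ^ r) (Ioo 0 1) := by
  unfold betaWeight
  refine ((ContinuousOn.mul ?_ ?_).mul (by fun_prop)).mul ?_
  · exact continuousOn_id.rpow_const fun ξ hξ => Or.inl hξ.1.ne'
  · refine ContinuousOn.rpow_const (by fun_prop) fun ξ hξ => Or.inl ?_
    have := hξ.2; simp only [mem_Ioo] at hξ; linarith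
  · exact ContinuousOn.rpow_const (by fun_prop) fun ξ hξ => Or.inl (one_add_mul_pos hx hξ).ne'

lemma eulerInt_integrand_le {s x c : ℝ} {k j : ℕ} {ξ : ℝ} (hs : s ∈ Ioo (0 : ℝ) 1)
    (hc : 0 < c) (hcx : c ≤ min 1 (1 + x)) (hξ : ξ ∈ Ioo (0 : ℝ) 1) :
    ‖betaWeight s ξ * ξ ^ k * (1 + x * ξ) ^ (-(s + j))‖ ≤ betaWeight s ξ * c ^ (-(s + j)) := by
  have h1 : c ≤ 1 + x * ξ := hcx.trans (one_add_mul_ge hξ)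
  have h2 := (betaWeight_pos (s := s) hξ).le
  have h3 := hξ.1.le
  have h4 : 0 < 1 + x * ξ := hc.trans_le h1
  rw [Real.norm_of_nonneg (by positivity)]
  have h5 : (1 + x * ξ) ^ (-(s + j)) ≤ c ^ (-(s + j)) :=
    Real.rpow_le_rpow_of_nonpos hc h1 (by have := hs.1; have : (0 : ℝ) ≤ j := j.cast_nonneg; linarith)
  have h6 : ξ ^ k ≤ 1 := pow_le_one₀ h3 hξ.2.le
  calc _ ≤ betaWeight s ξ * 1 * c ^ (-(s + j)) := by gcongr
    _ = _ := by ring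

lemma integrableOn_eulerInt_integrand {s x : ℝ} (hs : s ∈ Ioo (0 : ℝ) 1) (hx : -1 < x)
    (k j : ℕ) :
    IntegrableOn (fun ξ => betaWeight s ξ * ξ ^ k * (1 + x * ξ) ^ (-(s + j))) (Ioo 0 1) := by
  refine Integrable.mono' ((integrableOn_betaWeight hs).mul_const ((min 1 (1 + x)) ^ (-(s + j))))
    ((continuousOn_eulerInt_integrand hx k _).aestronglyMeasurable measurableSet_Ioo) ?_
  refine ae_restrict_of_forall_mem measurableSet_Ioo fun ξ hξ => ?_
  exact eulerInt_integrand_le hs (lt_min one_pos (by linarith)) le_rfl hξ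

lemma hasDerivAt_eulerInt {s x : ℝ} (hs : s ∈ Ioo (0 : ℝ) 1) (hx : -1 < x) (k : ℕ) :
    HasDerivAt (eulerInt s k) (-(s + k) * eulerInt s (k + 1) x) x := by
  set c := min 1 ((1 + x) / 2) with hc
  have hc0 : 0 < c := lt_min one_pos (by linarith)
  have key := hasDerivAt_integral_of_dominated_loc_of_deriv_le (μ := volume.restrict (Ioo 0 1))
    (F := fun x ξ => betaWeight s ξ * ξ ^ k * (1 + x * ξ) ^ (-(s + k)))
    (F' := fun x ξ => -(s + k) * (betaWeight s ξ * ξ ^ (k + 1) * (1 + x * ξ) ^ (-(s + (k + 1 : ℕ)))))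
    (bound := fun ξ => (s + k) * (betaWeight s ξ * c ^ (-(s + (k + 1 : ℕ)))))
    (s := Ioi ((x - 1) / 2)) (x₀ := x) (Ioi_mem_nhds (by linarith)) ?_
    (integrableOn_eulerInt_integrand hs hx k k) ?_ ?_ ?_ ?_
  · have := key.2
    rw [integral_const_mul] at this
    exact this
  · filter_upwards [Ioi_mem_nhds hx] with y hy
    exact (continuousOn_eulerInt_integrand hy k _).aestronglyMeasurable measurableSet_Ioo
  · exact ((continuousOn_eulerInt_integrand hx (k + 1) _).aestronglyMeasurable
      measurableSet_Ioo).const_mul _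
  · refine ae_restrict_of_forall_mem measurableSet_Ioo fun ξ hξ y hy => ?_
    have hsk : 0 < s + k := by have := hs.1; positivity
    rw [norm_mul, norm_neg, Real.norm_of_nonneg hsk.le]
    gcongr
    refine eulerInt_integrand_le hs hc0 ?_ hξ
    simp only [mem_Ioi] at hy
    exact min_le_min_left _ (by linarith)
  · exact ((integrableOn_betaWeight hs).mul_const _).const_mul _
  · refine ae_restrict_of_forall_mem measurableSet_Ioo fun ξ hξ y hy => ?_
    simp only [mem_Ioi] at hy
    have h1 : 0 < 1 + y * ξ := one_add_mul_pos (by linarith) hξ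
    have h2 : HasDerivAt (fun y => 1 + y * ξ) ξ y := by
      simpa using ((hasDerivAt_id y).mul_const ξ).const_add 1
    have h3 := (h2.rpow_const (p := -(s + k)) (Or.inl h1.ne')).const_mul (betaWeight s ξ * ξ ^ k)
    refine h3.congr_deriv ?_
    rw [show -(s + ((k + 1 : ℕ) : ℝ)) = -(s + k) - 1 by push_cast; ring]
    ring

lemma contDiffOn_eulerInt {s : ℝ} (hs : s ∈ Ioo (0 : ℝ) 1) (k : ℕ) :
    ContDiffOn ℝ (⊤ : ℕ∞) (eulerInt s k) (Ioi (-1)) := by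
  rw [contDiffOn_infty]
  intro n
  induction n generalizing k with
  | zero =>
    exact contDiffOn_zero.2 fun x hx => (hasDerivAt_eulerInt hs hx k).continuousAt.continuousWithinAt
  | succ n ih =>
    rw [Nat.cast_succ, contDiffOn_succ_iff_deriv_of_isOpen isOpen_Ioi]
    refine ⟨fun x hx => (hasDerivAt_eulerInt hs hx k).differentiableAt.differentiableWithinAt,
      by simp, ?_⟩
    exact ((ih (k + 1)).const_smul (-(s + k))).congr fun x hx =>
      by simpa using (hasDerivAt_eulerInt hs hx k).deriv

lemma eulerInt_nonneg {s x : ℝ} (hx : -1 < x) (k : ℕ) : 0 ≤ eulerInt s k x := by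
  refine setIntegral_nonneg measurableSet_Ioo fun ξ hξ => ?_
  have := (betaWeight_pos (s := s) hξ).le
  have := (one_add_mul_pos hx hξ).le
  have := hξ.1.le
  positivity

lemma eulerInt_zero_pos {s x : ℝ} (hs : s ∈ Ioo (0 : ℝ) 1) (hx : -1 < x) : 0 < eulerInt s 0 x := by
  have h := integrableOn_eulerInt_integrand hs hx 0 0
  have hpos : ∀ ξ ∈ Ioo (0 : ℝ) 1, 0 < betaWeight s ξ * ξ ^ 0 * (1 + x * ξ) ^ (-(s + (0 : ℕ))) := by
    intro ξ hξ
    have := (betaWeight_pos (s := s) hξ)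
    have := (one_add_mul_pos hx hξ)
    positivity
  unfold eulerInt
  rw [setIntegral_pos_iff_support_of_nonneg_ae
    (ae_restrict_of_forall_mem measurableSet_Ioo fun ξ hξ => (hpos ξ hξ).le) h]
  refine lt_of_lt_of_le ?_ (measure_mono (s := Ioo (0 : ℝ) 1)
    fun ξ hξ => ⟨(hpos ξ hξ).ne', hξ⟩)
  simp

lemma eulerInt_zero_le {s x : ℝ} (hs : s ∈ Ioo (0 : ℝ) 1) (hx : 0 ≤ x) :
    eulerInt s 0 x ≤ eulerInt s 0 0 := by
  refine setIntegral_mono_on (integrableOn_eulerInt_integrand hs (by linarith) 0 0)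
    (integrableOn_eulerInt_integrand hs (by linarith) 0 0) measurableSet_Ioo fun ξ hξ => ?_
  have := (betaWeight_pos (s := s) hξ).le
  gcongr ?_ * ?_
  refine Real.rpow_le_rpow_of_nonpos (by simp) ?_ (by simpa using hs.1.le)
  have := hξ.1
  nlinarith

lemma eulerInt_one_le {s x : ℝ} (hs : s ∈ Ioo (0 : ℝ) 1) (hx : 0 ≤ x) :
    eulerInt s 1 x ≤ (∫ ξ in Ioo (0 : ℝ) 1, betaWeight s ξ) / (1 + x) := by
  rw [← integral_div]
  refine setIntegral_mono_on (integrableOn_eulerInt_integrand hs (by linarith) 1 1)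
    ((integrableOn_betaWeight hs).div_const _) measurableSet_Ioo fun ξ hξ => ?_
  have h1 := (betaWeight_pos (s := s) hξ).le
  have h2 := hξ.1
  have h3 : (1 + x * ξ) ^ (-(s + (1 : ℕ))) ≤ (1 + x * ξ) ^ (-1 : ℝ) :=
    Real.rpow_le_rpow_of_exponent_le (by nlinarith) (by simpa using hs.1.le)
  have h4 : (1 + x * ξ) ^ (-1 : ℝ) ≤ (ξ * (1 + x)) ^ (-1 : ℝ) :=
    Real.rpow_le_rpow_of_nonpos (by positivity) (by nlinarith [hξ.2]) (by norm_num)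
  calc _ ≤ betaWeight s ξ * ξ ^ 1 * (ξ * (1 + x)) ^ (-1 : ℝ) := by gcongr; exact h3.trans h4
    _ = _ := by rw [Real.rpow_neg_one]; field_simp

lemma eulerInt_ode {s x : ℝ} (hs : s ∈ Ioo (0 : ℝ) 1) (hx : -1 < x) :
    x * (1 + x) * (s * (s + 1) * eulerInt s 2 x) - (1 + 2 * x) * (s * eulerInt s 1 x)
      + s * (1 - s) * eulerInt s 0 x = 0 := by
  have i0 := integrableOn_eulerInt_integrand hs hx 0 0
  have i1 := integrableOn_eulerInt_integrand hs hx 1 1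
  have i2 := integrableOn_eulerInt_integrand hs hx 2 2
  set I : ℝ → ℝ := fun ξ =>
    x * (1 + x) * (s + 1) * (betaWeight s ξ * ξ ^ 2 * (1 + x * ξ) ^ (-(s + (2 : ℕ))))
    - (1 + 2 * x) * (betaWeight s ξ * ξ ^ 1 * (1 + x * ξ) ^ (-(s + (1 : ℕ))))
      + (1 - s) * (betaWeight s ξ * ξ ^ 0 * (1 + x * ξ) ^ (-(s + (0 : ℕ)))) with hI
  have h_int : IntegrableOn I (Ioo 0 1) :=
    ((i2.const_mul _).sub (i1.const_mul _)).add (i0.const_mul _)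
  have hval : ∫ ξ in Ioo (0 : ℝ) 1, I ξ = x * (1 + x) * (s + 1) * eulerInt s 2 x
      - (1 + 2 * x) * eulerInt s 1 x + (1 - s) * eulerInt s 0 x := by
    simp only [hI]
    refine (integral_add ((i2.const_mul _).sub (i1.const_mul _)) (i0.const_mul _)).trans ?_
    refine congrArg₂ _ ((integral_sub (i2.const_mul _) (i1.const_mul _)).trans ?_) ?_
    · simp only [integral_const_mul]; rfl
    · simp only [integral_const_mul]; rfl
  set T : ℝ → ℝ := fun ξ => ξ ^ (1 - s) * (1 - ξ) ^ s * (1 + x * ξ) ^ (-s - 1) with hT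
  have hder : ∀ ξ ∈ Ioo (0 : ℝ) 1, HasDerivAt T (I ξ) ξ := by
    intro ξ hξ
    have p1 := hξ.1
    have p2 : 0 < 1 - ξ := by linarith [hξ.2]
    have p3 := one_add_mul_pos hx hξ
    have d1 := Real.hasDerivAt_rpow_const (x := ξ) (p := 1 - s) (Or.inl p1.ne')
    have d2 := ((hasDerivAt_id ξ).const_sub 1).rpow_const (p := s) (Or.inl p2.ne')
    have d3 := (((hasDerivAt_id ξ).const_mul x).const_add 1).rpow_const (p := -s - 1)
      (Or.inl p3.ne')
    refine ((d1.mul d2).mul d3).congr_deriv ?_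
    simp only [id, hI, betaWeight, Pi.mul_apply]
    have e1 : ξ ^ (1 - s) = ξ ^ (-s) * ξ := by
      rw [← Real.rpow_add_one p1.ne']; ring_nf
    have e2 : (1 - ξ) ^ s = (1 - ξ) ^ (s - 1) * (1 - ξ) := by
      rw [← Real.rpow_add_one p2.ne']; ring_nf
    have e3 : (1 + x * ξ) ^ (-s - 1) = (1 + x * ξ) ^ (-s - 2) * (1 + x * ξ) := by
      rw [← Real.rpow_add_one p3.ne']; ring_nf
    have e4 : (1 + x * ξ) ^ (-s) = (1 + x * ξ) ^ (-s - 2) * (1 + x * ξ) ^ 2 := by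
      rw [← Real.rpow_natCast (1 + x * ξ) 2, ← Real.rpow_add p3]; norm_num
    have e5 : (1 - s - 1) = -s := by ring
    have e6 : -s - 1 - 1 = -s - 2 := by ring
    have e7 : -(s + ((2 : ℕ) : ℝ)) = -s - 2 := by push_cast; ring
    have e8 : -(s + ((1 : ℕ) : ℝ)) = -s - 1 := by push_cast; ring
    have e9 : -(s + ((0 : ℕ) : ℝ)) = -s := by push_cast; ring
    rw [e5, e6, e7, e8, e9, e4, e3, e1, e2]
    ring
  have hcont : ContinuousOn T (Icc 0 1) := by
    refine ((continuousOn_id.rpow_const ?_).mul (ContinuousOn.rpow_const (by fun_prop) ?_)).mul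
      (ContinuousOn.rpow_const (by fun_prop) ?_)
    · exact fun _ _ => Or.inr (by linarith [hs.2])
    · exact fun _ _ => Or.inr hs.1.le
    · intro ξ hξ; refine Or.inl (ne_of_gt ?_)
      rcases le_total 0 x with h | h
      · nlinarith [hξ.1]
      · nlinarith [hξ.2]
  have hFTC := intervalIntegral.integral_eq_sub_of_hasDerivAt_of_le zero_le_one hcont hder
    ((intervalIntegrable_iff_integrableOn_Ioo_of_le zero_le_one).2 h_int)
  rw [intervalIntegral.integral_of_le zero_le_one, integral_Ioc_eq_integral_Ioo, hval] at hFTC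
  have hT0 : T 0 = 0 := by simp [hT, Real.zero_rpow (show (1 - s) ≠ 0 by linarith [hs.2])]
  have hT1 : T 1 = 0 := by simp [hT, Real.zero_rpow hs.1.ne']
  rw [hT0, hT1] at hFTC
  linear_combination s * hFTC

/-- A positive, bounded solution of the radial equation on the hyperbolic plane. -/
lemma exists_radial_solution {μ : ℝ} (hμ : 0 < μ) (hμ' : μ ≤ 1 / 4) :
    ∃ f : ℝ → ℝ, ContDiffOn ℝ (⊤ : ℕ∞) f (Ioi (-1)) ∧
      (∀ x, -1 < x → x * (1 + x) * deriv (deriv f) x + (1 + 2 * x) * deriv f x + μ * f x = 0) ∧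
      (∀ x, 0 ≤ x → 0 < f x ∧ f x ≤ f 0 ∧ deriv f x ≤ 0) ∧
      ∃ C, 0 < C ∧ ∀ x, 0 ≤ x → |deriv f x| ≤ C / (1 + x) := by
  obtain ⟨s, hs, hsμ⟩ : ∃ s ∈ Ioo (0 : ℝ) 1, s * (1 - s) = μ := by
    have h1 : Real.sqrt (1 - 4 * μ) < 1 := by
      rw [Real.sqrt_lt' one_pos]; linarith
    have h0 := Real.sqrt_nonneg (1 - 4 * μ)
    refine ⟨(1 - Real.sqrt (1 - 4 * μ)) / 2, ⟨by linarith, by linarith⟩, ?_⟩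
    have := Real.sq_sqrt (show 0 ≤ 1 - 4 * μ by linarith)
    linear_combination (-1 / 4) * this
  have hd : ∀ x, -1 < x → deriv (eulerInt s 0) x = -s * eulerInt s 1 x := fun x hx => by
    simpa using (hasDerivAt_eulerInt hs hx 0).deriv
  refine ⟨eulerInt s 0, contDiffOn_eulerInt hs 0, fun x hx => ?_, fun x hx => ⟨?_, ?_, ?_⟩,
    s * (∫ ξ in Ioo (0 : ℝ) 1, betaWeight s ξ) + 1, ?_, fun x hx => ?_⟩
  · have : deriv (eulerInt s 0) =ᶠ[𝓝 x] fun x => -s * eulerInt s 1 x := by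
      filter_upwards [Ioi_mem_nhds hx] with y hy using hd y hy
    rw [this.deriv_eq, hd x hx, ((hasDerivAt_eulerInt hs hx 1).const_mul (-s)).deriv, ← hsμ]
    have := eulerInt_ode hs hx
    push_cast
    linear_combination this
  · exact eulerInt_zero_pos hs (by linarith)
  · exact eulerInt_zero_le hs hx
  · rw [hd x (by linarith)]
    have := eulerInt_nonneg (s := s) (x := x) (by linarith) 1
    nlinarith [hs.1]
  · have : 0 ≤ ∫ ξ in Ioo (0 : ℝ) 1, betaWeight s ξ :=
      setIntegral_nonneg measurableSet_Ioo fun ξ hξ => (betaWeight_pos hξ).le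
    have := hs.1
    positivity
  · rw [hd x (by linarith), abs_mul, abs_neg, abs_of_pos hs.1,
      abs_of_nonneg (eulerInt_nonneg (by linarith) 1)]
    have := eulerInt_one_le hs hx
    calc s * eulerInt s 1 x ≤ s * ((∫ ξ in Ioo (0 : ℝ) 1, betaWeight s ξ) / (1 + x)) := by
          gcongr; exact hs.1.le
      _ ≤ _ := by rw [← mul_div_assoc]; gcongr; linarith

/-- Directional derivative of a complex-valued function on the plane. -/
def dirDeriv (e : ℝ × ℝ) (F : ℝ × ℝ → ℂ) (z : ℝ × ℝ) : ℂ := fderiv ℝ F z e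

/-- `F` is smooth at `p` and vanishes there to order at least `m`. -/
def VanOrder (p : ℝ × ℝ) : ℕ → (ℝ × ℝ → ℂ) → Prop
  | 0, F => ContDiffAt ℝ (⊤ : ℕ∞) F p
  | m + 1, F => ContDiffAt ℝ (⊤ : ℕ∞) F p ∧ F p = 0 ∧
      VanOrder p m (dirDeriv (1, 0) F) ∧ VanOrder p m (dirDeriv (0, 1) F)

/-- The complex coordinate centred at `p`. -/
def cplx (p z : ℝ × ℝ) : ℂ := ⟨z.1 - p.1, z.2 - p.2⟩

section Van

variable {p : ℝ × ℝ} {F G : ℝ × ℝ → ℂ}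

lemma ContDiffAt.eventually_differentiableAt {E : Type*} [NormedAddCommGroup E] [NormedSpace ℝ E]
    {F : ℝ × ℝ → E} (hF : ContDiffAt ℝ (⊤ : ℕ∞) F p) :
    ∀ᶠ z in 𝓝 p, DifferentiableAt ℝ F z :=
  (((hF.of_le (m := 1) (by norm_cast) : ContDiffAt ℝ 1 F p)).eventually (by simp)).mono
    fun _ h => h.differentiableAt one_ne_zero

lemma ContDiffAt.dirDeriv (hF : ContDiffAt ℝ (⊤ : ℕ∞) F p) (e : ℝ × ℝ) :
    ContDiffAt ℝ (⊤ : ℕ∞) (dirDeriv e F) p :=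
  (hF.fderiv_right (m := (⊤ : ℕ∞)) (by exact_mod_cast le_rfl)).clm_apply (contDiffAt_const (c := e))

lemma Filter.EventuallyEq.dirDeriv (h : F =ᶠ[𝓝 p] G) (e : ℝ × ℝ) :
    dirDeriv e F =ᶠ[𝓝 p] dirDeriv e G := by
  filter_upwards [h.fderiv (𝕜 := ℝ)] with z hz
  simp only [_root_.dirDeriv, hz]

lemma VanOrder.contDiffAt {m : ℕ} (h : VanOrder p m F) : ContDiffAt ℝ (⊤ : ℕ∞) F p := by
  cases m with
  | zero => exact h
  | succ m => exact h.1

lemma VanOrder.congr {m : ℕ} (h : VanOrder p m F) (hFG : F =ᶠ[𝓝 p] G) : VanOrder p m G := by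
  induction m generalizing F G with
  | zero => exact ContDiffAt.congr_of_eventuallyEq h hFG.symm
  | succ m ih =>
    exact ⟨h.1.congr_of_eventuallyEq hFG.symm, hFG.self_of_nhds ▸ h.2.1,
      ih h.2.2.1 (hFG.dirDeriv _), ih h.2.2.2 (hFG.dirDeriv _)⟩

lemma VanOrder.of_succ {m : ℕ} (h : VanOrder p (m + 1) F) : VanOrder p m F := by
  induction m generalizing F with
  | zero => exact h.1
  | succ m ih => exact ⟨h.1, h.2.1, ih h.2.2.1, ih h.2.2.2⟩

lemma dirDeriv_add (hF : ContDiffAt ℝ (⊤ : ℕ∞) F p) (hG : ContDiffAt ℝ (⊤ : ℕ∞) G p)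
    (e : ℝ × ℝ) : dirDeriv e (F + G) =ᶠ[𝓝 p] dirDeriv e F + dirDeriv e G := by
  filter_upwards [hF.eventually_differentiableAt, hG.eventually_differentiableAt] with z h1 h2
  simp [dirDeriv, fderiv_add h1 h2]

lemma dirDeriv_mul (hF : ContDiffAt ℝ (⊤ : ℕ∞) F p) (hG : ContDiffAt ℝ (⊤ : ℕ∞) G p)
    (e : ℝ × ℝ) : dirDeriv e (F * G) =ᶠ[𝓝 p] F * dirDeriv e G + dirDeriv e F * G := by
  filter_upwards [hF.eventually_differentiableAt, hG.eventually_differentiableAt] with z h1 h2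
  simp [dirDeriv, fderiv_mul h1 h2, mul_comm]

lemma VanOrder.add {m : ℕ} (hF : VanOrder p m F) (hG : VanOrder p m G) :
    VanOrder p m (F + G) := by
  induction m generalizing F G with
  | zero => exact ContDiffAt.add hF hG
  | succ m ih =>
    exact ⟨hF.1.add hG.1, by simp [hF.2.1, hG.2.1],
      (ih hF.2.2.1 hG.2.2.1).congr (dirDeriv_add hF.1 hG.1 _).symm,
      (ih hF.2.2.2 hG.2.2.2).congr (dirDeriv_add hF.1 hG.1 _).symm⟩

lemma VanOrder.mul_left {m : ℕ} (hF : ContDiffAt ℝ (⊤ : ℕ∞) F p) (hG : VanOrder p m G) :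
    VanOrder p m (F * G) := by
  induction m generalizing F G with
  | zero => exact ContDiffAt.mul hF hG
  | succ m ih =>
    exact ⟨hF.mul hG.1, by simp [hG.2.1],
      ((ih hF hG.2.2.1).add (ih (hF.dirDeriv _) hG.of_succ)).congr
        (dirDeriv_mul hF hG.1 _).symm,
      ((ih hF hG.2.2.2).add (ih (hF.dirDeriv _) hG.of_succ)).congr
        (dirDeriv_mul hF hG.1 _).symm⟩

lemma VanOrder.const_mul {m : ℕ} (a : ℂ) (hG : VanOrder p m G) :
    VanOrder p m (fun z => a * G z) :=
  VanOrder.mul_left (F := fun _ => a) contDiffAt_const hG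

lemma dirDeriv_comm (hF : ContDiffAt ℝ (⊤ : ℕ∞) F p) (e e' : ℝ × ℝ) :
    dirDeriv e (dirDeriv e' F) =ᶠ[𝓝 p] dirDeriv e' (dirDeriv e F) := by
  filter_upwards [(hF.of_le (m := 2) (by norm_cast)).eventually (by simp)] with z hz
  have hd : DifferentiableAt ℝ (fderiv ℝ F) z :=
    (hz.fderiv_right (m := 1) (by norm_num)).differentiableAt one_ne_zero
  have key : ∀ a b : ℝ × ℝ, dirDeriv a (dirDeriv b F) z = fderiv ℝ (fderiv ℝ F) z a b := by
    intro a b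
    have : dirDeriv b F = fun w => fderiv ℝ F w b := rfl
    rw [dirDeriv, this, fderiv_clm_apply hd (differentiableAt_const _)]
    simp
  rw [key, key]
  exact (hz.isSymmSndFDerivAt (by simp)) e e'

lemma contDiff_cplx : ContDiff ℝ (⊤ : ℕ∞) (cplx p) := by
  have : cplx p = fun z : ℝ × ℝ => ((z.1 - p.1 : ℝ) : ℂ) + ((z.2 - p.2 : ℝ) : ℂ) * Complex.I := by
    funext z; apply Complex.ext <;> simp [cplx]
  rw [this]
  have h := Complex.ofRealCLM.contDiff (n := (⊤ : ℕ∞))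
  exact (h.comp (by fun_prop : ContDiff ℝ (⊤ : ℕ∞) fun z : ℝ × ℝ => z.1 - p.1)).add
    ((h.comp (by fun_prop : ContDiff ℝ (⊤ : ℕ∞) fun z : ℝ × ℝ => z.2 - p.2)).mul contDiff_const)

lemma hasFDerivAt_cplx (z : ℝ × ℝ) :
    HasFDerivAt (cplx p) (Complex.equivRealProdCLM.symm : ℝ × ℝ →L[ℝ] ℂ) z := by
  have : cplx p = fun z => Complex.equivRealProdCLM.symm z - Complex.equivRealProdCLM.symm p := by
    funext z; apply Complex.ext <;> rfl
  rw [this]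
  exact (Complex.equivRealProdCLM.symm : ℝ × ℝ →L[ℝ] ℂ).hasFDerivAt.sub_const _

lemma dirDeriv_cplx_pow (a : ℂ) (m : ℕ) (e z : ℝ × ℝ) :
    dirDeriv e (fun z => a * cplx p z ^ (m + 1)) z
      = a * (m + 1) * cplx p z ^ m * ⟨e.1, e.2⟩ := by
  have h := ((hasFDerivAt_cplx (p := p) z).pow (m + 1)).const_mul a
  rw [dirDeriv, h.fderiv]
  have : (Complex.equivRealProdCLM.symm e) = (⟨e.1, e.2⟩ : ℂ) := rfl
  simp [this]; ring

/-- The Cauchy–Riemann operator `2∂̄`. -/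
def dbar2 (F : ℝ × ℝ → ℂ) : ℝ × ℝ → ℂ :=
  fun z => dirDeriv (1, 0) F z + Complex.I * dirDeriv (0, 1) F z

lemma dirDeriv_dbar2 (hF : ContDiffAt ℝ (⊤ : ℕ∞) F p) (e : ℝ × ℝ) :
    dirDeriv e (dbar2 F) =ᶠ[𝓝 p] dbar2 (dirDeriv e F) := by
  have h1 := hF.dirDeriv (1, 0)
  have h2 : ContDiffAt ℝ (⊤ : ℕ∞) (fun _ : ℝ × ℝ => Complex.I) p := contDiffAt_const
  have h3 := hF.dirDeriv (0, 1)
  have e1 : dbar2 F = dirDeriv (1, 0) F + (fun _ => Complex.I) * dirDeriv (0, 1) F := rfl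
  rw [e1]
  filter_upwards [dirDeriv_add h1 (h2.mul h3) e, dirDeriv_mul h2 h3 e,
    dirDeriv_comm hF e (1, 0), dirDeriv_comm hF e (0, 1)] with z k1 k2 k3 k4
  refine k1.trans ?_
  change _ + dirDeriv e ((fun _ => Complex.I) * dirDeriv (0, 1) F) z = _
  rw [k2, k3]
  simp only [Pi.add_apply, Pi.mul_apply, k4, dbar2]
  simp [dirDeriv]

lemma exists_leading_coeff {m : ℕ} {g : ℝ × ℝ → ℂ} (hg : VanOrder p m g)
    (hd : VanOrder p m (dbar2 g)) :
    ∃ c : ℂ, VanOrder p (m + 1) (fun z => g z - c * cplx p z ^ m) := by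
  induction m generalizing g with
  | zero =>
    have : ContDiffAt ℝ (⊤ : ℕ∞) (fun z => g z - g p * cplx p z ^ 0) p := by
      simpa using ContDiffAt.sub hg (contDiffAt_const (c := g p))
    exact ⟨g p, this, by simp, this.dirDeriv _, this.dirDeriv _⟩
  | succ m ih =>
    have hgx := hg.2.2.1
    obtain ⟨c', hc'⟩ := ih hgx (hd.2.2.1.congr (dirDeriv_dbar2 hg.1 _))
    set c := c' / (m + 1) with hc
    have hm : ((m : ℂ) + 1) ≠ 0 := by exact_mod_cast m.succ_ne_zero
    have hP : ContDiffAt ℝ (⊤ : ℕ∞) (fun z => -(c * cplx p z ^ (m + 1))) p :=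
      (contDiffAt_const.mul (contDiff_cplx.contDiffAt.pow _)).neg
    have hGs : ContDiffAt ℝ (⊤ : ℕ∞) (fun z => g z - c * cplx p z ^ (m + 1)) p := by
      simpa [sub_eq_add_neg] using hg.1.add hP
    have hder : ∀ e, dirDeriv e (fun z => g z - c * cplx p z ^ (m + 1)) =ᶠ[𝓝 p]
        fun z => dirDeriv e g z - c' * cplx p z ^ m * ⟨e.1, e.2⟩ := by
      intro e
      filter_upwards [dirDeriv_add hg.1 hP e] with z hz
      have : (g + fun z => -(c * cplx p z ^ (m + 1))) = fun z => g z - c * cplx p z ^ (m + 1) := by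
        funext z; simp [sub_eq_add_neg]
      rw [this] at hz
      rw [hz, Pi.add_apply]
      have h2 : (fun z => -(c * cplx p z ^ (m + 1))) = fun z => (-c) * cplx p z ^ (m + 1) := by
        funext z; ring
      rw [h2, dirDeriv_cplx_pow, hc]
      field_simp; ring
    have hx : VanOrder p (m + 1) (dirDeriv (1, 0) (fun z => g z - c * cplx p z ^ (m + 1))) := by
      refine hc'.congr ?_
      filter_upwards [hder (1, 0)] with z hz
      rw [hz, show (⟨((1 : ℝ), (0 : ℝ)).1, ((1 : ℝ), (0 : ℝ)).2⟩ : ℂ) = 1 from rfl, mul_one]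
    refine ⟨c, hGs, by simp [hg.2.1, cplx, Complex.ext_iff], hx, ?_⟩
    refine ((hd.add (hx.const_mul (-1))).const_mul (-Complex.I)).congr ?_
    filter_upwards [hder (1, 0), hder (0, 1)] with z h1 h2
    simp only [Pi.add_apply, h1, h2, dbar2,
      show (⟨((1 : ℝ), (0 : ℝ)).1, ((1 : ℝ), (0 : ℝ)).2⟩ : ℂ) = 1 from rfl,
      show (⟨((0 : ℝ), (1 : ℝ)).1, ((0 : ℝ), (1 : ℝ)).2⟩ : ℂ) = Complex.I from rfl]
    linear_combination (-dirDeriv (0, 1) g z) * Complex.I_sq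

lemma norm_fderiv_le_dirDeriv (z : ℝ × ℝ) :
    ‖fderiv ℝ F z‖ ≤ ‖dirDeriv (1, 0) F z‖ + ‖dirDeriv (0, 1) F z‖ := by
  refine ContinuousLinearMap.opNorm_le_bound _ (by positivity) fun w => ?_
  have : fderiv ℝ F z w = w.1 • dirDeriv (1, 0) F z + w.2 • dirDeriv (0, 1) F z := by
    unfold dirDeriv
    rw [← map_smul, ← map_smul, ← map_add]
    simp
  rw [this, add_mul]
  refine (norm_add_le _ _).trans ?_
  rw [norm_smul, norm_smul, mul_comm, mul_comm ‖w.2‖]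
  gcongr
  · exact norm_fst_le w
  · exact norm_snd_le w

lemma isBigO_of_fderiv {E : Type*} [NormedAddCommGroup E] [NormedSpace ℝ E] {F : ℝ × ℝ → E}
    {m : ℕ} (hF : ContDiffAt ℝ (⊤ : ℕ∞) F p) (h0 : F p = 0)
    (h : fderiv ℝ F =O[𝓝 p] fun z => ‖z - p‖ ^ m) : F =O[𝓝 p] fun z => ‖z - p‖ ^ (m + 1) := by
  obtain ⟨C, hC⟩ := h.bound
  obtain ⟨r, hr, hball⟩ := Metric.eventually_nhds_iff_ball.1 (hC.and hF.eventually_differentiableAt)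
  refine Asymptotics.IsBigO.of_bound C ?_
  filter_upwards [Metric.ball_mem_nhds p hr] with z hz
  have hsub : Metric.closedBall p ‖z - p‖ ⊆ Metric.ball p r :=
    Metric.closedBall_subset_ball (by simpa [dist_eq_norm] using hz)
  have hCn : 0 ≤ C * ‖z - p‖ ^ m := (norm_nonneg _).trans
    (by simpa using (hball z (hsub (by simp [dist_eq_norm]))).1)
  have := (convex_closedBall p ‖z - p‖).norm_image_sub_le_of_norm_fderiv_le (𝕜 := ℝ) (f := F)
    (C := C * ‖z - p‖ ^ m) (fun w hw => (hball w (hsub hw)).2) (fun w hw => ?_)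
    (Metric.mem_closedBall_self (norm_nonneg _)) (y := z) (by simp [dist_eq_norm])
  · rw [h0, sub_zero] at this
    simpa [pow_succ, mul_assoc] using this
  · have h1 := (hball w (hsub hw)).1
    rw [norm_pow, norm_norm] at h1
    refine h1.trans ?_
    have hw' : ‖w - p‖ ≤ ‖z - p‖ := by simpa [dist_eq_norm] using hw
    rcases le_or_gt 0 C with hC0 | hC0
    · gcongr
    · have : ‖z - p‖ ^ m ≤ 0 := by
        by_contra hcon
        push Not at hcon
        nlinarith
      have h2 := pow_le_pow_left₀ (norm_nonneg _) hw' m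
      have h3 : 0 ≤ ‖w - p‖ ^ m := by positivity
      nlinarith

lemma VanOrder.isBigO {m : ℕ} (h : VanOrder p m F) : F =O[𝓝 p] fun z => ‖z - p‖ ^ m := by
  induction m generalizing F with
  | zero => simpa using h.continuousAt.norm.isBoundedUnder_le.isBigO_one ℝ
  | succ m ih =>
    refine isBigO_of_fderiv h.1 h.2.1 ?_
    have h1 := (ih h.2.2.1).norm_left.add (ih h.2.2.2).norm_left
    refine Asymptotics.IsBigO.trans (Asymptotics.IsBigO.of_bound 1 ?_) h1
    refine Eventually.of_forall fun z => ?_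
    rw [one_mul, Real.norm_of_nonneg (by positivity)]
    exact norm_fderiv_le_dirDeriv z

end Van

section Van

variable {p : ℝ × ℝ} {F G : ℝ × ℝ → ℂ}

lemma dirDeriv_clm_comp (L : ℂ →L[ℝ] ℂ) (hF : ContDiffAt ℝ (⊤ : ℕ∞) F p) (e : ℝ × ℝ) :
    dirDeriv e (L ∘ F) =ᶠ[𝓝 p] L ∘ dirDeriv e F := by
  filter_upwards [hF.eventually_differentiableAt] with z h1
  simp [dirDeriv, (L.hasFDerivAt.comp z h1.hasFDerivAt).fderiv]

lemma VanOrder.clm_comp {m : ℕ} (L : ℂ →L[ℝ] ℂ) (hF : VanOrder p m F) :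
    VanOrder p m (L ∘ F) := by
  induction m generalizing F with
  | zero => exact L.contDiff.contDiffAt.comp p hF
  | succ m ih =>
    exact ⟨L.contDiff.contDiffAt.comp p hF.1, by simp [hF.2.1],
      (ih hF.2.2.1).congr (dirDeriv_clm_comp L hF.1 _).symm,
      (ih hF.2.2.2).congr (dirDeriv_clm_comp L hF.1 _).symm⟩

lemma dirDeriv_ofReal {v : ℝ × ℝ → ℝ} {z : ℝ × ℝ} (hv : DifferentiableAt ℝ v z) (e : ℝ × ℝ) :
    dirDeriv e (fun z => (v z : ℂ)) z = (fderiv ℝ v z e : ℂ) := by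
  have h : HasFDerivAt (fun z => (v z : ℂ)) (Complex.ofRealCLM.comp (fderiv ℝ v z)) z :=
    Complex.ofRealCLM.hasFDerivAt.comp z hv.hasFDerivAt
  rw [dirDeriv, h.fderiv]; rfl

lemma ContDiffAt.fderiv_apply_const {v : ℝ × ℝ → ℝ} (hv : ContDiffAt ℝ (⊤ : ℕ∞) v p)
    (e : ℝ × ℝ) : ContDiffAt ℝ (⊤ : ℕ∞) (fun z => fderiv ℝ v z e) p :=
  (hv.fderiv_right (m := (⊤ : ℕ∞)) (by exact_mod_cast le_rfl)).clm_apply (contDiffAt_const (c := e))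

/-- The complex gradient `∂ₓv - i∂ᵧv`. -/
def cgrad (v : ℝ × ℝ → ℝ) (z : ℝ × ℝ) : ℂ :=
  dirDeriv (1, 0) (fun z => (v z : ℂ)) z + -Complex.I * dirDeriv (0, 1) (fun z => (v z : ℂ)) z

variable {v q : ℝ × ℝ → ℝ}

lemma cgrad_eq {z : ℝ × ℝ} (hv : DifferentiableAt ℝ v z) :
    cgrad v z = ⟨pdx v z, -pdy v z⟩ := by
  rw [cgrad, dirDeriv_ofReal hv, dirDeriv_ofReal hv]
  apply Complex.ext <;> simp [pdx, pdy]

lemma ContDiffAt.ofReal_comp (hv : ContDiffAt ℝ (⊤ : ℕ∞) v p) :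
    ContDiffAt ℝ (⊤ : ℕ∞) (fun z => (v z : ℂ)) p :=
  Complex.ofRealCLM.contDiff.contDiffAt.comp p hv

lemma dbar2_cgrad (hv : ContDiffAt ℝ (⊤ : ℕ∞) v p) :
    dbar2 (cgrad v) =ᶠ[𝓝 p] fun z => ((pdx (pdx v) z + pdy (pdy v) z : ℝ) : ℂ) := by
  have hV := hv.ofReal_comp
  set V : ℝ × ℝ → ℂ := fun z => (v z : ℂ) with hVdef
  have hI : ContDiffAt ℝ (⊤ : ℕ∞) (fun _ : ℝ × ℝ => -Complex.I) p := contDiffAt_const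
  have hx := hV.dirDeriv (1, 0)
  have hy := hV.dirDeriv (0, 1)
  have hg : cgrad v = dirDeriv (1, 0) V + (fun _ => -Complex.I) * dirDeriv (0, 1) V := rfl
  have hd : ∀ e, dirDeriv e (cgrad v) =ᶠ[𝓝 p]
      fun z => dirDeriv e (dirDeriv (1, 0) V) z - Complex.I * dirDeriv e (dirDeriv (0, 1) V) z := by
    intro e
    filter_upwards [dirDeriv_add hx (hI.mul hy) e, dirDeriv_mul hI hy e] with z h1 h2
    rw [hg]
    refine h1.trans ?_
    refine (congrArg (fun w => dirDeriv e (dirDeriv (1, 0) V) z + w) h2).trans ?_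
    simp [dirDeriv, sub_eq_add_neg]
  have h2 : ∀ e, dirDeriv e (dirDeriv e V) =ᶠ[𝓝 p]
      fun z => ((fderiv ℝ (fun z => fderiv ℝ v z e) z e : ℝ) : ℂ) := by
    intro e
    have h3 : dirDeriv e V =ᶠ[𝓝 p] fun z => (fderiv ℝ v z e : ℂ) := by
      filter_upwards [hv.eventually_differentiableAt] with z hz using dirDeriv_ofReal hz e
    filter_upwards [h3.dirDeriv e, (hv.fderiv_apply_const e).eventually_differentiableAt]
      with z h4 h5
    rw [h4, dirDeriv_ofReal h5]
  filter_upwards [hd (1, 0), hd (0, 1), h2 (1, 0), h2 (0, 1), dirDeriv_comm hV (1, 0) (0, 1)]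
    with z h1 h2 h3 h4 h5
  rw [dbar2, h1, h2, h3, h4, h5]
  simp only [pdx, pdy]
  push_cast
  change _ = (((fderiv ℝ (fun z => fderiv ℝ v z (1, 0)) z (1, 0) : ℝ) : ℂ))
    + ((fderiv ℝ (fun z => fderiv ℝ v z (0, 1)) z (0, 1) : ℝ) : ℂ)
  linear_combination (-((fderiv ℝ (fun z => fderiv ℝ v z (0, 1)) z (0, 1) : ℝ) : ℂ)) * Complex.I_sq

lemma VanOrder.of_cgrad {m : ℕ} (hv : ContDiffAt ℝ (⊤ : ℕ∞) v p) (h0 : v p = 0)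
    (h : VanOrder p m (cgrad v)) : VanOrder p (m + 1) (fun z => (v z : ℂ)) := by
  have hc := h.clm_comp (Complex.conjCLE : ℂ →L[ℝ] ℂ)
  have key : ∀ z, DifferentiableAt ℝ v z →
      dirDeriv (1, 0) (fun z => (v z : ℂ)) z = (pdx v z : ℂ) ∧
      dirDeriv (0, 1) (fun z => (v z : ℂ)) z = (pdy v z : ℂ) := fun z hz =>
    ⟨dirDeriv_ofReal hz _, dirDeriv_ofReal hz _⟩
  refine ⟨hv.ofReal_comp, by simp [h0], ?_, ?_⟩
  · refine ((h.add hc).const_mul (1 / 2)).congr ?_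
    filter_upwards [hv.eventually_differentiableAt] with z hz
    rw [(key z hz).1, Pi.add_apply, Function.comp_apply, cgrad_eq hz]
    apply Complex.ext <;> simp
    ring
  · refine ((h.add (hc.const_mul (-1))).const_mul (Complex.I / 2)).congr ?_
    filter_upwards [hv.eventually_differentiableAt] with z hz
    rw [(key z hz).2, Pi.add_apply, Function.comp_apply, cgrad_eq hz]
    apply Complex.ext <;> simp
    ring

lemma norm_sub_le_norm_cplx (z : ℝ × ℝ) : ‖z - p‖ ≤ ‖cplx p z‖ := by
  refine max_le ?_ ?_
  · exact Complex.abs_re_le_norm (cplx p z)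
  · exact Complex.abs_im_le_norm (cplx p z)

lemma fderiv_apply_eq (v : ℝ × ℝ → ℝ) (z w : ℝ × ℝ) :
    fderiv ℝ v z w = w.1 * pdx v z + w.2 * pdy v z := by
  have : w = w.1 • ((1 : ℝ), (0 : ℝ)) + w.2 • ((0 : ℝ), (1 : ℝ)) := by simp
  conv_lhs => rw [this]
  rw [map_add, map_smul, map_smul]; rfl

lemma norm_fderiv_le (v : ℝ × ℝ → ℝ) (z : ℝ × ℝ) :
    ‖fderiv ℝ v z‖ ≤ |pdx v z| + |pdy v z| := by
  refine ContinuousLinearMap.opNorm_le_bound _ (by positivity) fun w => ?_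
  rw [fderiv_apply_eq, add_mul]
  refine (norm_add_le _ _).trans ?_
  rw [norm_mul, norm_mul, mul_comm, mul_comm ‖w.2‖]
  have h1 := norm_fst_le w
  have h2 := norm_snd_le w
  gcongr <;> simp

/-- At a critical zero, a solution of `Δv = q v` either vanishes to infinite order or is, to
leading order, the real part of a monomial of degree at least two. -/
lemma flat_or_expansion (hv : ContDiffAt ℝ (⊤ : ℕ∞) v p) (hq : ContDiffAt ℝ (⊤ : ℕ∞) q p)
    (heq : ∀ᶠ z in 𝓝 p, pdx (pdx v) z + pdy (pdy v) z = q z * v z)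
    (h0 : v p = 0) (h1 : fderiv ℝ v p = 0) :
    (∀ m : ℕ, v =O[𝓝 p] (fun z => ‖z - p‖ ^ m) ∧ fderiv ℝ v =O[𝓝 p] fun z => ‖z - p‖ ^ m) ∨
    ∃ k : ℕ, 2 ≤ k ∧ ∃ c : ℂ, c ≠ 0 ∧
      (fun z => v z - (c * cplx p z ^ k).re) =O[𝓝 p] (fun z => ‖z - p‖ ^ (k + 1)) ∧
      ∀ᶠ z in 𝓝[≠] p, fderiv ℝ v z ≠ 0 := by
  have hV := hv.ofReal_comp
  have hgs : ContDiffAt ℝ (⊤ : ℕ∞) (cgrad v) p :=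
    (hV.dirDeriv (1, 0)).add (contDiffAt_const.mul (hV.dirDeriv (0, 1)))
  have hg1 : VanOrder p 1 (cgrad v) := by
    refine ⟨hgs, ?_, hgs.dirDeriv _, hgs.dirDeriv _⟩
    rw [cgrad_eq (hv.differentiableAt (by simp))]
    simp [pdx, pdy, h1, Complex.ext_iff]
  have hlead : ∀ m, VanOrder p m (cgrad v) →
      ∃ c : ℂ, VanOrder p (m + 1) (fun z => cgrad v z - c * cplx p z ^ m) := by
    intro m hm
    refine exists_leading_coeff hm ?_
    refine (VanOrder.mul_left hq.ofReal_comp (VanOrder.of_cgrad hv h0 hm).of_succ).congr ?_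
    filter_upwards [dbar2_cgrad hv, heq] with z h2 h3
    rw [h2, h3]; simp
  have hgrad : ∀ {m : ℕ}, VanOrder p m (cgrad v) → fderiv ℝ v =O[𝓝 p] fun z => ‖z - p‖ ^ m := by
    intro m hm
    refine Asymptotics.IsBigO.trans (Asymptotics.IsBigO.of_bound 2 ?_) hm.isBigO
    filter_upwards [hv.eventually_differentiableAt] with z hz
    refine (norm_fderiv_le v z).trans ?_
    have h2 := Complex.abs_re_le_norm (cgrad v z)
    have h3 := Complex.abs_im_le_norm (cgrad v z)
    rw [cgrad_eq hz] at h2 h3 ⊢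
    simp only [abs_neg] at h2 h3
    linarith
  by_cases hall : ∀ m, VanOrder p m (cgrad v)
  · left
    intro m
    refine ⟨?_, hgrad (hall m)⟩
    have := (VanOrder.of_cgrad hv h0 (hall m)).of_succ.isBigO
    refine Asymptotics.IsBigO.trans (Asymptotics.IsBigO.of_bound 1 ?_) this
    exact Eventually.of_forall fun z => by simp
  right
  obtain ⟨m, hm1, hm, hm'⟩ : ∃ m, 1 ≤ m ∧ VanOrder p m (cgrad v) ∧
      ¬ VanOrder p (m + 1) (cgrad v) := by
    by_contra hcon
    push Not at hcon
    refine hall fun m => ?_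
    rcases Nat.eq_zero_or_pos m with rfl | hm
    · exact hg1.of_succ
    · induction m, hm using Nat.le_induction with
      | base => exact hg1
      | succ n hn ih => exact hcon n hn ih
  obtain ⟨c, hc⟩ := hlead m hm
  have hc0 : c ≠ 0 := by
    rintro rfl; exact hm' (by simpa using hc)
  have hmC : ((m : ℂ) + 1) ≠ 0 := by exact_mod_cast m.succ_ne_zero
  refine ⟨m + 1, by omega, c / (m + 1), div_ne_zero hc0 hmC, ?_, ?_⟩
  · set P : ℝ × ℝ → ℝ := fun z => (c / (m + 1) * cplx p z ^ (m + 1)).re with hP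
    have hPs : ContDiff ℝ (⊤ : ℕ∞) P :=
      Complex.reCLM.contDiff.comp (contDiff_const.mul (contDiff_cplx.pow _))
    have hPd : ∀ z e, fderiv ℝ P z e = (c * cplx p z ^ m * ⟨e.1, e.2⟩).re := by
      intro z e
      have hd : DifferentiableAt ℝ (fun z => c / (m + 1) * cplx p z ^ (m + 1)) z :=
        ((contDiff_const.mul (contDiff_cplx.pow _)).contDiffAt (n := (⊤ : ℕ∞))).differentiableAt
          (by simp)
      have h2 : HasFDerivAt P (Complex.reCLM.comp
          (fderiv ℝ (fun z => c / (m + 1) * cplx p z ^ (m + 1)) z)) z :=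
        Complex.reCLM.hasFDerivAt.comp z hd.hasFDerivAt
      rw [h2.fderiv]
      have h3 := dirDeriv_cplx_pow (p := p) (c / (m + 1)) m e z
      rw [dirDeriv] at h3
      simp only [ContinuousLinearMap.comp_apply, h3, Complex.reCLM_apply]
      congr 2
      field_simp
    have hDs : ContDiffAt ℝ (⊤ : ℕ∞) (fun z => v z - P z) p := hv.sub hPs.contDiffAt
    have hpp : cplx p p = 0 := by simp [cplx, Complex.ext_iff]
    refine isBigO_of_fderiv hDs (by simp [h0, hpp]) ?_
    refine Asymptotics.IsBigO.trans (Asymptotics.IsBigO.of_bound 2 ?_) hc.isBigO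
    filter_upwards [hv.eventually_differentiableAt] with z hz
    refine (norm_fderiv_le _ z).trans ?_
    have hPz : DifferentiableAt ℝ P z := hPs.contDiffAt.differentiableAt (by simp)
    have hx : pdx (fun z => v z - P z) z = (cgrad v z - c * cplx p z ^ m).re := by
      rw [pdx, fderiv_fun_sub hz hPz, cgrad_eq hz]
      simp only [sub_apply, hPd]
      simp [pdx]
    have hy : pdy (fun z => v z - P z) z = -(cgrad v z - c * cplx p z ^ m).im := by
      rw [pdy, fderiv_fun_sub hz hPz, cgrad_eq hz]
      simp only [sub_apply, hPd]
      simp [pdy]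
      ring
    rw [hx, hy, abs_neg]
    linarith [Complex.abs_re_le_norm (cgrad v z - c * cplx p z ^ m),
      Complex.abs_im_le_norm (cgrad v z - c * cplx p z ^ m)]
  · obtain ⟨C, hC⟩ := hc.isBigO.bound
    have ht : Tendsto (fun z => C * ‖z - p‖) (𝓝 p) (𝓝 (C * ‖p - p‖)) :=
      Continuous.tendsto (by fun_prop) p
    have hsmall := ht.eventually_lt_const (u := ‖c‖) (by simpa using hc0)
    filter_upwards [nhdsWithin_le_nhds hC, nhdsWithin_le_nhds hsmall,
      nhdsWithin_le_nhds hv.eventually_differentiableAt, self_mem_nhdsWithin] with z h2 h3 h4 h5 h6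
    have hgz : cgrad v z = 0 := by
      rw [cgrad_eq h4]; simp [pdx, pdy, h6, Complex.ext_iff]
    rw [hgz, zero_sub, norm_neg, norm_mul, norm_pow, norm_pow, norm_norm] at h2
    have hpos : 0 < ‖z - p‖ := norm_pos_iff.2 (sub_ne_zero.2 h5)
    have h7 := norm_sub_le_norm_cplx (p := p) z
    have h8 := pow_le_pow_left₀ (norm_nonneg _) h7 m
    have h9 : ‖c‖ * ‖z - p‖ ^ m ≤ C * ‖z - p‖ * ‖z - p‖ ^ m := by
      calc _ ≤ ‖c‖ * ‖cplx p z‖ ^ m := by gcongr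
        _ ≤ _ := h2
        _ = _ := by ring
    have := le_of_mul_le_mul_right h9 (by positivity)
    linarith

end Van

lemma hasDerivAt_integral_param {F F' : ℝ → ℝ → ℝ} {s₀ s₁ : ℝ} (hs : s₀ < s₁) (a b : ℝ)
    (hF : ∀ s < s₁, Continuous (F s))
    (hF' : ContinuousOn (Function.uncurry F') (Iio s₁ ×ˢ univ))
    (hd : ∀ s < s₁, ∀ θ, HasDerivAt (fun s => F s θ) (F' s θ) s) :
    HasDerivAt (fun s => ∫ θ in a..b, F s θ) (∫ θ in a..b, F' s₀ θ) s₀ := by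
  set r := (s₁ - s₀) / 2 with hr
  have hr0 : 0 < r := by linarith
  have hsub : Icc (s₀ - r) (s₀ + r) ×ˢ uIcc a b ⊆ Iio s₁ ×ˢ (univ : Set ℝ) :=
    prod_mono (fun x hx => by simp only [mem_Iio]; linarith [hx.2]) (subset_univ _)
  obtain ⟨M, hM⟩ := (isCompact_Icc.prod isCompact_uIcc).exists_bound_of_continuousOn
    (hF'.mono hsub)
  have hF'c : Continuous (F' s₀) := by
    have : ContinuousOn (fun θ => Function.uncurry F' (s₀, θ)) univ :=
      hF'.comp (by fun_prop) fun θ _ => ⟨hs, trivial⟩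
    exact continuousOn_univ.1 this
  refine (intervalIntegral.hasDerivAt_integral_of_dominated_loc_of_deriv_le (bound := fun _ => M)
    (Icc_mem_nhds (by linarith : s₀ - r < s₀) (by linarith : s₀ < s₀ + r)) ?_ ((hF s₀ hs).intervalIntegrable _ _)
    hF'c.aestronglyMeasurable ?_ intervalIntegrable_const ?_).2
  · filter_upwards [Iio_mem_nhds hs] with s hs using (hF s hs).aestronglyMeasurable
  · exact Eventually.of_forall fun θ hθ s hs => hM (s, θ) ⟨hs, uIoc_subset_uIcc hθ⟩
  · exact Eventually.of_forall fun θ hθ s hs => hd s (hsub (mk_mem_prod hs (uIoc_subset_uIcc hθ))).1 θ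

/-- A solution of `m'' = (n² - b) m` with bounded `b ≥ 0` that decays faster than every
exponential at `-∞` vanishes. -/
lemma eq_zero_of_superexp_decay {m m₁ b : ℝ → ℝ} {n C s₁ : ℝ} (hn : 0 ≤ n)
    (hm : ∀ s < s₁, HasDerivAt m (m₁ s) s)
    (hm₁ : ∀ s < s₁, HasDerivAt m₁ ((n ^ 2 - b s) * m s) s)
    (hb : ∀ s < s₁, 0 ≤ b s ∧ b s ≤ C)
    (hdecay : ∀ K : ℕ, ∃ M, ∀ᶠ s in atBot,
      |m s| ≤ M * Real.exp (K * s) ∧ |m₁ s| ≤ M * Real.exp (K * s)) :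
    ∀ s < s₁, m s = 0 := by
  set N := n + 1 with hN
  set D := 2 * N + C with hD
  set E : ℝ → ℝ := fun s => Real.exp (-D * s) * ((m₁ s - N * m s) ^ 2 + (2 * n + 1) * m s ^ 2)
    with hE
  have hEd : ∀ s < s₁, HasDerivAt E (Real.exp (-D * s) *
      (-D * ((m₁ s - N * m s) ^ 2 + (2 * n + 1) * m s ^ 2)
        + (2 * (m₁ s - N * m s) * ((n ^ 2 - b s) * m s - N * m₁ s)
          + (2 * n + 1) * (2 * m s * m₁ s)))) s := by
    intro s hs
    have h1 := (((hasDerivAt_id s).const_mul (-D)).exp).mul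
      ((((hm₁ s hs).sub ((hm s hs).const_mul N)).pow 2).add
        (((hm s hs).pow 2).const_mul (2 * n + 1)))
    refine h1.congr_deriv ?_
    simp only [id, Pi.add_apply, Pi.sub_apply, Pi.pow_apply, Nat.cast_ofNat, mul_one]
    ring
  have hanti : AntitoneOn E (Iio s₁) := by
    refine antitoneOn_of_deriv_nonpos (convex_Iio _)
      (fun s hs => (hEd s hs).continuousAt.continuousWithinAt) ?_ ?_
    · rw [interior_Iio]
      exact fun s hs => (hEd s hs).differentiableAt.differentiableWithinAt
    · rw [interior_Iio]
      intro s hs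
      rw [(hEd s hs).deriv]
      refine mul_nonpos_of_nonneg_of_nonpos (Real.exp_pos _).le ?_
      obtain ⟨hb0, hbC⟩ := hb s hs
      set a := m₁ s - N * m s with ha
      have : m₁ s = a + N * m s := by rw [ha]; ring
      rw [this]
      have h1 : 0 ≤ n * a ^ 2 := by positivity
      have h2 : 0 ≤ b s * (a + m s) ^ 2 := by positivity
      have h3 : 0 ≤ (C - b s) * (a ^ 2 + (2 * n + 1) * m s ^ 2) := by
        have : 0 ≤ C - b s := by linarith
        positivity
      have h4 : 0 ≤ b s * n * m s ^ 2 := by positivity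
      have h5 : 0 ≤ a ^ 2 := by positivity
      simp only [hD, hN]
      nlinarith
  have hlim : Tendsto E atBot (𝓝 0) := by
    obtain ⟨K, hK⟩ := exists_nat_gt D
    have hK' : 0 < 2 * (K : ℝ) - D := by
      have : (0 : ℝ) ≤ K := K.cast_nonneg
      linarith
    obtain ⟨M, hM⟩ := hdecay K
    have h1 : Tendsto (fun s => ((1 + |N|) ^ 2 * M ^ 2 + (2 * n + 1) * M ^ 2) *
        Real.exp ((2 * K - D) * s)) atBot (𝓝 0) := by
      have : Tendsto (fun s : ℝ => (2 * (K : ℝ) - D) * s) atBot atBot :=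
        tendsto_id.const_mul_atBot hK'
      simpa using (Real.tendsto_exp_atBot.comp this).const_mul
        ((1 + |N|) ^ 2 * M ^ 2 + (2 * n + 1) * M ^ 2)
    refine squeeze_zero' (Eventually.of_forall fun s => by positivity) ?_ h1
    filter_upwards [hM] with s ⟨k1, k2⟩
    have e1 : Real.exp ((2 * K - D) * s) = Real.exp (-D * s) * Real.exp (K * s) ^ 2 := by
      rw [← Real.exp_nat_mul, ← Real.exp_add]; push_cast; ring_nf
    set e := Real.exp (K * s)
    have k3 : |m₁ s - N * m s| ≤ (1 + |N|) * (M * e) := by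
      calc _ ≤ |m₁ s| + |N * m s| := abs_sub _ _
        _ = |m₁ s| + |N| * |m s| := by rw [abs_mul]
        _ ≤ M * e + |N| * (M * e) := by gcongr
        _ = _ := by ring
    have k4 : (m₁ s - N * m s) ^ 2 ≤ ((1 + |N|) * (M * e)) ^ 2 := by
      rw [← sq_abs]; gcongr
    have k5 : (m s) ^ 2 ≤ (M * e) ^ 2 := by
      rw [← sq_abs]; gcongr
    calc E s ≤ Real.exp (-D * s) * (((1 + |N|) * (M * e)) ^ 2 + (2 * n + 1) * (M * e) ^ 2) := by
          simp only [hE]; gcongr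
      _ = _ := by rw [e1]; ring
  intro s hs
  have hE0 : E s ≤ 0 := by
    refine ge_of_tendsto hlim ?_
    filter_upwards [eventually_le_atBot s] with t ht
    exact hanti (lt_of_le_of_lt ht hs) hs ht
  have h1 : 0 < Real.exp (-D * s) := Real.exp_pos _
  have h2 : (m₁ s - N * m s) ^ 2 + (2 * n + 1) * m s ^ 2 ≤ 0 := by
    by_contra hcon
    push Not at hcon
    exact absurd (mul_pos h1 hcon) (not_lt.2 hE0)
  have h3 : 0 ≤ (m₁ s - N * m s) ^ 2 := sq_nonneg _
  have h4 : 0 ≤ n * m s ^ 2 := by positivity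
  have h5 : m s ^ 2 ≤ 0 := by nlinarith
  exact pow_eq_zero_iff (two_ne_zero) |>.1 (le_antisymm h5 (sq_nonneg _))

lemma eq_zero_of_fourier {w : ℝ → ℝ} (hw : Continuous w)
    (hper : Function.Periodic w (2 * Real.pi))
    (hc : ∀ n : ℕ, ∫ θ in (0 : ℝ)..(2 * Real.pi), w θ * Real.cos (n * θ) = 0)
    (hs : ∀ n : ℕ, ∫ θ in (0 : ℝ)..(2 * Real.pi), w θ * Real.sin (n * θ) = 0) : ∀ θ, w θ = 0 := by
  have : Fact (0 < 2 * Real.pi) := ⟨Real.two_pi_pos⟩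
  have hper' : Function.Periodic (fun θ => (w θ : ℂ)) (2 * Real.pi) := fun θ => by
    simp [hper θ]
  let f : C(AddCircle (2 * Real.pi), ℂ) :=
    ⟨hper'.lift, continuous_coinduced_dom.2 (Complex.continuous_ofReal.comp hw)⟩
  have hf : ∀ θ : ℝ, f (θ : AddCircle (2 * Real.pi)) = (w θ : ℂ) := fun θ => hper'.lift_coe θ
  have hcos : ∀ k : ℤ, ∫ θ in (0 : ℝ)..(2 * Real.pi), w θ * Real.cos (k * θ) = 0 := by
    intro k
    obtain ⟨n, rfl | rfl⟩ := k.eq_nat_or_neg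
    · simpa using hc n
    · simpa using hc n
  have hsin : ∀ k : ℤ, ∫ θ in (0 : ℝ)..(2 * Real.pi), w θ * Real.sin (k * θ) = 0 := by
    intro k
    obtain ⟨n, rfl | rfl⟩ := k.eq_nat_or_neg
    · simpa using hs n
    · simpa using hs n
  have hcoef : ∀ k : ℤ, fourierCoeff f k = 0 := by
    intro k
    rw [fourierCoeff_eq_intervalIntegral f k 0, zero_add]
    have : ∀ θ : ℝ, (fourier (-k) (θ : AddCircle (2 * Real.pi))) • f θ
        = ((w θ * Real.cos (k * θ) : ℝ) : ℂ) - Complex.I * ((w θ * Real.sin (k * θ) : ℝ) : ℂ) := by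
      intro θ
      rw [fourier_coe_apply, hf, smul_eq_mul]
      have : (2 * Real.pi * Complex.I * ((-k : ℤ) : ℂ) * θ / ((2 * Real.pi : ℝ) : ℂ))
          = ((-(k * θ) : ℝ) : ℂ) * Complex.I := by
        have : (Real.pi : ℂ) ≠ 0 := by exact_mod_cast Real.pi_ne_zero
        push_cast; field_simp
      rw [this, Complex.exp_mul_I, ← Complex.ofReal_cos, ← Complex.ofReal_sin, Real.cos_neg,
        Real.sin_neg]
      push_cast; ring
    simp_rw [this]
    rw [intervalIntegral.integral_sub, intervalIntegral.integral_const_mul,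
      intervalIntegral.integral_ofReal, intervalIntegral.integral_ofReal, hcos, hsin]
    · simp
    · exact Continuous.intervalIntegrable (by fun_prop) _ _
    · exact Continuous.intervalIntegrable (by fun_prop) _ _
  have hsum : Summable (fourierCoeff f) := by
    rw [show fourierCoeff f = fun _ => 0 from funext hcoef]; exact summable_zero
  have h1 := hasSum_fourier_series_of_summable hsum
  have h2 : f = 0 := h1.unique (by simp [hcoef, hasSum_zero])
  intro θ
  have := hf θ
  rw [h2] at this
  simpa using this.symm

lemma integral_mode_eq_zero {W Ws Wss Wt Wtt : ℝ → ℝ → ℝ} {b c c₁ : ℝ → ℝ} {C s₁ n : ℝ}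
    (hn : 0 ≤ n) (hc : ∀ θ, HasDerivAt c (c₁ θ) θ) (hc₁ : ∀ θ, HasDerivAt c₁ (-n ^ 2 * c θ) θ)
    (hcp : c (2 * Real.pi) = c 0) (hcp₁ : c₁ (2 * Real.pi) = c₁ 0) (hcb : ∀ θ, |c θ| ≤ 1)
    (hWs : ∀ s < s₁, ∀ θ, HasDerivAt (fun s => W s θ) (Ws s θ) s)
    (hWss : ∀ s < s₁, ∀ θ, HasDerivAt (fun s => Ws s θ) (Wss s θ) s)
    (hWt : ∀ s < s₁, ∀ θ, HasDerivAt (W s) (Wt s θ) θ)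
    (hWtt : ∀ s < s₁, ∀ θ, HasDerivAt (Wt s) (Wtt s θ) θ)
    (cWs : ContinuousOn (Function.uncurry Ws) (Iio s₁ ×ˢ univ))
    (cWss : ContinuousOn (Function.uncurry Wss) (Iio s₁ ×ˢ univ))
    (cWtt : ∀ s < s₁, Continuous (Wtt s))
    (pW : ∀ s < s₁, W s (2 * Real.pi) = W s 0) (pWt : ∀ s < s₁, Wt s (2 * Real.pi) = Wt s 0)
    (pde : ∀ s < s₁, ∀ θ, Wss s θ + Wtt s θ = -b s * W s θ)
    (hb : ∀ s < s₁, 0 ≤ b s ∧ b s ≤ C)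
    (hdecay : ∀ K : ℕ, ∃ M, ∀ᶠ s in atBot, ∀ θ,
      |W s θ| ≤ M * Real.exp (K * s) ∧ |Ws s θ| ≤ M * Real.exp (K * s)) :
    ∀ s < s₁, ∫ θ in (0 : ℝ)..(2 * Real.pi), W s θ * c θ = 0 := by
  have cc : Continuous c := continuous_iff_continuousAt.2 fun θ => (hc θ).continuousAt
  have cc₁ : Continuous c₁ := continuous_iff_continuousAt.2 fun θ => (hc₁ θ).continuousAt
  have cW : ∀ s < s₁, Continuous (W s) := fun s hs =>
    continuous_iff_continuousAt.2 fun θ => (hWt s hs θ).continuousAt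
  have cWt : ∀ s < s₁, Continuous (Wt s) := fun s hs =>
    continuous_iff_continuousAt.2 fun θ => (hWtt s hs θ).continuousAt
  have slice : ∀ {H : ℝ → ℝ → ℝ}, ContinuousOn (Function.uncurry H) (Iio s₁ ×ˢ univ) →
      ∀ s < s₁, Continuous (H s) := by
    intro H hH s hs
    have : ContinuousOn (fun θ => Function.uncurry H (s, θ)) univ :=
      hH.comp (by fun_prop) fun θ _ => ⟨hs, trivial⟩
    exact continuousOn_univ.1 this
  have cc2 : ContinuousOn (fun x : ℝ × ℝ => c x.2) (Iio s₁ ×ˢ univ) := by fun_prop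
  refine eq_zero_of_superexp_decay (m₁ := fun s => ∫ θ in (0 : ℝ)..(2 * Real.pi), Ws s θ * c θ)
    (b := b) (C := C) hn ?_ ?_ hb ?_
  · intro s hs
    exact hasDerivAt_integral_param (F := fun s θ => W s θ * c θ) (F' := fun s θ => Ws s θ * c θ)
      hs _ _ (fun s hs => (cW s hs).mul cc) (cWs.mul cc2) fun s hs θ => (hWs s hs θ).mul_const _
  · intro s hs
    have h1 := hasDerivAt_integral_param (F := fun s θ => Ws s θ * c θ)
      (F' := fun s θ => Wss s θ * c θ)
      hs 0 (2 * Real.pi) (fun s hs => (slice cWs s hs).mul cc) (cWss.mul cc2)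
      fun s hs θ => (hWss s hs θ).mul_const _
    refine h1.congr_deriv ?_
    have i1 : ∫ θ in (0 : ℝ)..(2 * Real.pi), c θ * Wtt s θ
        = - ∫ θ in (0 : ℝ)..(2 * Real.pi), c₁ θ * Wt s θ := by
      rw [intervalIntegral.integral_mul_deriv_eq_deriv_mul (u := c) (v := Wt s)
        (fun θ _ => hc θ) (fun θ _ => hWtt s hs θ)
        (cc₁.intervalIntegrable _ _) ((cWtt s hs).intervalIntegrable _ _), hcp, pWt s hs]
      ring
    have i2 : ∫ θ in (0 : ℝ)..(2 * Real.pi), c₁ θ * Wt s θ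
        = - ∫ θ in (0 : ℝ)..(2 * Real.pi), (-n ^ 2 * c θ) * W s θ := by
      rw [intervalIntegral.integral_mul_deriv_eq_deriv_mul (u := c₁) (v := W s)
        (fun θ _ => hc₁ θ) (fun θ _ => hWt s hs θ)
        ((cc.const_mul _).intervalIntegrable _ _) ((cWt s hs).intervalIntegrable _ _), hcp₁,
        pW s hs]
      ring
    have i3 : ∫ θ in (0 : ℝ)..(2 * Real.pi), (-n ^ 2 * c θ) * W s θ
        = -n ^ 2 * ∫ θ in (0 : ℝ)..(2 * Real.pi), W s θ * c θ := by
      rw [← intervalIntegral.integral_const_mul]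
      exact intervalIntegral.integral_congr fun θ _ => by ring
    have i4 : ∫ θ in (0 : ℝ)..(2 * Real.pi), Wss s θ * c θ
        = (-b s) * (∫ θ in (0 : ℝ)..(2 * Real.pi), W s θ * c θ)
          - ∫ θ in (0 : ℝ)..(2 * Real.pi), c θ * Wtt s θ := by
      rw [← intervalIntegral.integral_const_mul, ← intervalIntegral.integral_sub]
      · refine intervalIntegral.integral_congr fun θ _ => ?_
        have := pde s hs θ
        linear_combination c θ * this
      · exact (((cW s hs).mul cc).const_mul _).intervalIntegrable _ _
      · exact (cc.mul (cWtt s hs)).intervalIntegrable _ _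
    rw [i4, i1, i2, i3]; ring
  · intro K
    obtain ⟨M, hM⟩ := hdecay K
    refine ⟨M * (2 * Real.pi), ?_⟩
    filter_upwards [hM] with s hs
    have bound : ∀ {H : ℝ → ℝ}, (∀ θ, |H θ| ≤ M * Real.exp (K * s)) →
        |∫ θ in (0 : ℝ)..(2 * Real.pi), H θ * c θ| ≤ M * (2 * Real.pi) * Real.exp (K * s) := by
      intro H hH
      have := intervalIntegral.norm_integral_le_of_norm_le_const (a := 0) (b := 2 * Real.pi)
        (f := fun θ => H θ * c θ) (C := M * Real.exp (K * s)) fun θ _ => by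
          rw [Real.norm_eq_abs, abs_mul]
          calc _ ≤ M * Real.exp (K * s) * 1 := by
                gcongr
                · exact (abs_nonneg _).trans (hH θ)
                · exact hH θ
                · exact hcb θ
            _ = _ := mul_one _
      rw [sub_zero, abs_of_pos Real.two_pi_pos] at this
      calc _ ≤ _ := this
        _ = _ := by ring
    exact ⟨bound fun θ => (hs θ).1, bound fun θ => (hs θ).2⟩

/-- Strong unique continuation for a rotationally symmetric equation in logarithmic polar
coordinates. -/
lemma eq_zero_of_polar {W Ws Wss Wt Wtt : ℝ → ℝ → ℝ} {b : ℝ → ℝ} {C s₁ : ℝ}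
    (hWs : ∀ s < s₁, ∀ θ, HasDerivAt (fun s => W s θ) (Ws s θ) s)
    (hWss : ∀ s < s₁, ∀ θ, HasDerivAt (fun s => Ws s θ) (Wss s θ) s)
    (hWt : ∀ s < s₁, ∀ θ, HasDerivAt (W s) (Wt s θ) θ)
    (hWtt : ∀ s < s₁, ∀ θ, HasDerivAt (Wt s) (Wtt s θ) θ)
    (cWs : ContinuousOn (Function.uncurry Ws) (Iio s₁ ×ˢ univ))
    (cWss : ContinuousOn (Function.uncurry Wss) (Iio s₁ ×ˢ univ))
    (cWtt : ∀ s < s₁, Continuous (Wtt s))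
    (pW : ∀ s < s₁, Function.Periodic (W s) (2 * Real.pi))
    (pWt : ∀ s < s₁, Wt s (2 * Real.pi) = Wt s 0)
    (pde : ∀ s < s₁, ∀ θ, Wss s θ + Wtt s θ = -b s * W s θ)
    (hb : ∀ s < s₁, 0 ≤ b s ∧ b s ≤ C)
    (hdecay : ∀ K : ℕ, ∃ M, ∀ᶠ s in atBot, ∀ θ,
      |W s θ| ≤ M * Real.exp (K * s) ∧ |Ws s θ| ≤ M * Real.exp (K * s)) :
    ∀ s < s₁, ∀ θ, W s θ = 0 := by
  intro s hs
  have pW0 : ∀ s < s₁, W s (2 * Real.pi) = W s 0 := fun s hs => by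
    simpa using pW s hs 0
  have dcos : ∀ (n : ℕ) (θ : ℝ), HasDerivAt (fun θ : ℝ => Real.cos (n * θ))
      (-(n * Real.sin (n * θ))) θ := fun n θ => by
    refine (((hasDerivAt_id θ).const_mul (n : ℝ)).cos).congr_deriv ?_
    simp only [id]; ring
  have dsin : ∀ (n : ℕ) (θ : ℝ), HasDerivAt (fun θ : ℝ => Real.sin (n * θ))
      (n * Real.cos (n * θ)) θ := fun n θ => by
    refine (((hasDerivAt_id θ).const_mul (n : ℝ)).sin).congr_deriv ?_
    simp only [id]; ring
  have c2 : ∀ n : ℕ, Real.cos (n * (2 * Real.pi)) = 1 := fun n => Real.cos_nat_mul_two_pi n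
  have s2 : ∀ n : ℕ, Real.sin (n * (2 * Real.pi)) = 0 := fun n => by
    rw [← mul_assoc]; exact_mod_cast Real.sin_nat_mul_pi (n * 2)
  refine eq_zero_of_fourier
    (continuous_iff_continuousAt.2 fun θ => (hWt s hs θ).continuousAt) (pW s hs) ?_ ?_
  · intro n
    refine integral_mode_eq_zero (n := n) (c₁ := fun θ => -(n * Real.sin (n * θ)))
      n.cast_nonneg (dcos n) (fun θ => ?_) ?_ ?_ (fun θ => Real.abs_cos_le_one _) hWs hWss hWt
      hWtt cWs cWss cWtt pW0 pWt pde hb hdecay s hs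
    · exact (((dsin n θ).const_mul (n : ℝ)).neg).congr_deriv (by ring)
    · simp [c2]
    · simp [s2]
  · intro n
    refine integral_mode_eq_zero (n := n) (c₁ := fun θ => n * Real.cos (n * θ))
      n.cast_nonneg (dsin n) (fun θ => ?_) ?_ ?_ (fun θ => Real.abs_sin_le_one _) hWs hWss hWt
      hWtt cWs cWss cWtt pW0 pWt pde hb hdecay s hs
    · exact ((dcos n θ).const_mul (n : ℝ)).congr_deriv (by ring)
    · simp [s2]
    · simp [c2]

/-- Logarithmic geodesic polar coordinates around `(x₀, y₀)`. -/
def polarMap (x₀ y₀ : ℝ) (ξ : ℂ) : ℂ :=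
  x₀ + Complex.I * y₀ * ((1 + Complex.exp ξ) / (1 - Complex.exp ξ))

def polarMap₁ (y₀ : ℝ) (ξ : ℂ) : ℂ :=
  2 * Complex.I * y₀ * (Complex.exp ξ / (1 - Complex.exp ξ) ^ 2)

def polarMap₂ (y₀ : ℝ) (ξ : ℂ) : ℂ :=
  2 * Complex.I * y₀ * (Complex.exp ξ * (1 + Complex.exp ξ) / (1 - Complex.exp ξ) ^ 3)

lemma norm_exp_lt_one {ξ : ℂ} (h : ξ.re < 0) : ‖Complex.exp ξ‖ < 1 := by
  rw [Complex.norm_exp]; exact Real.exp_lt_one_iff.2 h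

lemma one_sub_exp_ne_zero {ξ : ℂ} (h : ξ.re < 0) : 1 - Complex.exp ξ ≠ 0 := by
  intro h0
  have := norm_exp_lt_one h
  rw [← sub_eq_zero.1 h0] at this
  simp at this

lemma hasDerivAt_polarMap (x₀ y₀ : ℝ) {ξ : ℂ} (h : ξ.re < 0) :
    HasDerivAt (polarMap x₀ y₀) (polarMap₁ y₀ ξ) ξ := by
  have h0 := one_sub_exp_ne_zero h
  have := ((((Complex.hasDerivAt_exp ξ).const_add 1).div
    ((Complex.hasDerivAt_exp ξ).const_sub 1) h0).const_mul (Complex.I * y₀)).const_add (x₀ : ℂ)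
  refine this.congr_deriv ?_
  unfold polarMap₁
  field_simp
  ring

lemma hasDerivAt_polarMap₁ (y₀ : ℝ) {ξ : ℂ} (h : ξ.re < 0) :
    HasDerivAt (polarMap₁ y₀) (polarMap₂ y₀ ξ) ξ := by
  have h0 := one_sub_exp_ne_zero h
  have := ((Complex.hasDerivAt_exp ξ).div
    (((Complex.hasDerivAt_exp ξ).const_sub 1).pow 2) (pow_ne_zero 2 h0)).const_mul
      (2 * Complex.I * y₀)
  refine this.congr_deriv ?_
  unfold polarMap₂
  simp only [Pi.pow_apply]
  field_simp
  ring

lemma polarMap_im (x₀ y₀ : ℝ) (ξ : ℂ) :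
    (polarMap x₀ y₀ ξ).im =
      y₀ * (1 - Complex.normSq (Complex.exp ξ)) / Complex.normSq (1 - Complex.exp ξ) := by
  unfold polarMap
  set e := Complex.exp ξ
  have : ((1 + e) / (1 - e)).re = (1 - Complex.normSq e) / Complex.normSq (1 - e) := by
    rw [Complex.div_re, Complex.normSq_apply e]
    simp
    ring
  simp only [Complex.add_im, Complex.ofReal_im, Complex.mul_im, Complex.mul_re, Complex.I_re,
    Complex.I_im, Complex.ofReal_re, this]
  ring

lemma polarMap_im_pos {x₀ y₀ : ℝ} (hy : 0 < y₀) {ξ : ℂ} (h : ξ.re < 0) :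
    0 < (polarMap x₀ y₀ ξ).im := by
  rw [polarMap_im]
  have h1 := norm_exp_lt_one h
  have h2 : Complex.normSq (Complex.exp ξ) < 1 := by
    rw [Complex.normSq_eq_norm_sq]
    nlinarith [norm_nonneg (Complex.exp ξ)]
  have h3 : 0 < Complex.normSq (1 - Complex.exp ξ) :=
    Complex.normSq_pos.2 (one_sub_exp_ne_zero h)
  have : 0 < 1 - Complex.normSq (Complex.exp ξ) := by linarith
  positivity

lemma normSq_polarMap₁ {x₀ y₀ : ℝ} (hy : 0 < y₀) {ξ : ℂ} (h : ξ.re < 0) :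
    ((polarMap₁ y₀ ξ).re ^ 2 + (polarMap₁ y₀ ξ).im ^ 2) / (polarMap x₀ y₀ ξ).im ^ 2 =
      4 * Real.exp ξ.re ^ 2 / (1 - Real.exp ξ.re ^ 2) ^ 2 := by
  have h1 : (polarMap₁ y₀ ξ).re ^ 2 + (polarMap₁ y₀ ξ).im ^ 2
      = Complex.normSq (polarMap₁ y₀ ξ) := by rw [Complex.normSq_apply]; ring
  have h3 : 0 < Complex.normSq (1 - Complex.exp ξ) :=
    Complex.normSq_pos.2 (one_sub_exp_ne_zero h)
  rw [h1, polarMap_im, Complex.normSq_eq_norm_sq (Complex.exp ξ), Complex.norm_exp]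
  unfold polarMap₁
  have h4 : Real.exp ξ.re < 1 := Real.exp_lt_one_iff.2 h
  have h5 := Real.exp_pos ξ.re
  have h6 : 1 - Real.exp ξ.re ^ 2 ≠ 0 := by nlinarith
  simp only [map_mul, map_div₀, map_pow, Complex.normSq_I, Complex.normSq_ofReal,
    Complex.normSq_ofNat, Complex.normSq_eq_norm_sq (Complex.exp ξ), Complex.norm_exp]
  field_simp
  ring

lemma norm_polarMap_sub_le {x₀ y₀ : ℝ} (hy : 0 < y₀) {ξ : ℂ} (h : Real.exp ξ.re ≤ 1 / 2) :
    ‖polarMap x₀ y₀ ξ - (x₀ + Complex.I * y₀)‖ ≤ 4 * y₀ * Real.exp ξ.re ∧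
      ‖polarMap₁ y₀ ξ‖ ≤ 8 * y₀ * Real.exp ξ.re := by
  have hn : ‖Complex.exp ξ‖ = Real.exp ξ.re := Complex.norm_exp ξ
  have h1 : 1 / 2 ≤ ‖1 - Complex.exp ξ‖ := by
    have := norm_sub_norm_le (1 : ℂ) (Complex.exp ξ)
    rw [norm_one, hn] at this
    linarith
  have h0 : 1 - Complex.exp ξ ≠ 0 := by
    intro h0; rw [h0, norm_zero] at h1; linarith
  have e1 : polarMap x₀ y₀ ξ - (x₀ + Complex.I * y₀)
      = 2 * Complex.I * y₀ * (Complex.exp ξ / (1 - Complex.exp ξ)) := by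
    unfold polarMap; field_simp; ring
  have hy' : ‖(y₀ : ℂ)‖ = y₀ := by rw [Complex.norm_real, Real.norm_eq_abs, abs_of_pos hy]
  constructor
  · rw [e1, norm_mul, norm_mul, norm_mul, norm_div, hn, Complex.norm_I, hy', Complex.norm_ofNat]
    have : Real.exp ξ.re / ‖1 - Complex.exp ξ‖ ≤ Real.exp ξ.re / (1 / 2) := by gcongr
    calc _ ≤ 2 * 1 * y₀ * (Real.exp ξ.re / (1 / 2)) := by gcongr
      _ = _ := by ring
  · unfold polarMap₁
    rw [norm_mul, norm_mul, norm_mul, norm_div, norm_pow, hn, Complex.norm_I, hy',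
      Complex.norm_ofNat]
    have : Real.exp ξ.re / ‖1 - Complex.exp ξ‖ ^ 2 ≤ Real.exp ξ.re / (1 / 2) ^ 2 := by gcongr
    calc _ ≤ 2 * 1 * y₀ * (Real.exp ξ.re / (1 / 2) ^ 2) := by gcongr
      _ = _ := by ring

lemma ContDiffOn.fderiv_apply_of_isOpen {U : Set (ℝ × ℝ)} {v : ℝ × ℝ → ℝ} (hU : IsOpen U)
    (hv : ContDiffOn ℝ (⊤ : ℕ∞) v U) (e : ℝ × ℝ) :
    ContDiffOn ℝ (⊤ : ℕ∞) (fun z => fderiv ℝ v z e) U :=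
  fun _ hz => (ContDiffAt.fderiv_apply_const (hv.contDiffAt (hU.mem_nhds hz)) e).contDiffWithinAt

/-- Composition of a planar function with a differentiable complex curve. -/
lemma HasFDerivAt.comp_complex {g : ℝ × ℝ → ℝ} {γ : ℝ → ℂ} {γ' : ℂ} {t : ℝ}
    (hg : DifferentiableAt ℝ g ((γ t).re, (γ t).im)) (hγ : HasDerivAt γ γ' t) :
    HasDerivAt (fun t => g ((γ t).re, (γ t).im))
      (γ'.re * pdx g ((γ t).re, (γ t).im) + γ'.im * pdy g ((γ t).re, (γ t).im)) t := by
  have h1 : HasDerivAt (fun t => ((γ t).re, (γ t).im)) (γ'.re, γ'.im) t :=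
    (Complex.reCLM.hasFDerivAt.comp_hasDerivAt t hγ).prodMk
      (Complex.imCLM.hasFDerivAt.comp_hasDerivAt t hγ)
  refine (hg.hasFDerivAt.comp_hasDerivAt t h1).congr_deriv ?_
  rw [fderiv_apply_eq]

lemma eq_zero_of_flat {U : Set (ℝ × ℝ)} {v : ℝ × ℝ → ℝ} {μ : ℝ} {p : ℝ × ℝ} (hμ : 0 ≤ μ)
    (hU : IsOpen U) (hpU : p ∈ U) (hp : 0 < p.2)
    (hv : ContDiffOn ℝ (⊤ : ℕ∞) v U)
    (heq : ∀ z ∈ U, pdx (pdx v) z + pdy (pdy v) z = -(μ / z.2 ^ 2) * v z)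
    (hflat : ∀ m : ℕ, v =O[𝓝 p] (fun z => ‖z - p‖ ^ m) ∧
      fderiv ℝ v =O[𝓝 p] (fun z => ‖z - p‖ ^ m)) :
    ∀ᶠ z in 𝓝 p, v z = 0 := by
  obtain ⟨x₀, y₀⟩ := p
  simp only at hp
  obtain ⟨r, hr, hball⟩ := Metric.isOpen_iff.1 hU _ hpU
  have hdiff : ∀ {g : ℝ × ℝ → ℝ}, ContDiffOn ℝ (⊤ : ℕ∞) g U → ∀ z ∈ U, DifferentiableAt ℝ g z :=
    fun hg z hz => (hg.contDiffAt (hU.mem_nhds hz)).differentiableAt (by simp)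
  have hvx : ContDiffOn ℝ (⊤ : ℕ∞) (pdx v) U := ContDiffOn.fderiv_apply_of_isOpen hU hv _
  have hvy : ContDiffOn ℝ (⊤ : ℕ∞) (pdy v) U := ContDiffOn.fderiv_apply_of_isOpen hU hv _
  have hvxx : ContDiffOn ℝ (⊤ : ℕ∞) (pdx (pdx v)) U := ContDiffOn.fderiv_apply_of_isOpen hU hvx _
  have hvxy : ContDiffOn ℝ (⊤ : ℕ∞) (pdy (pdx v)) U := ContDiffOn.fderiv_apply_of_isOpen hU hvx _
  have hvyx : ContDiffOn ℝ (⊤ : ℕ∞) (pdx (pdy v)) U := ContDiffOn.fderiv_apply_of_isOpen hU hvy _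
  have hvyy : ContDiffOn ℝ (⊤ : ℕ∞) (pdy (pdy v)) U := ContDiffOn.fderiv_apply_of_isOpen hU hvy _
  set ρ := min (1 / 2) (r / (4 * y₀)) with hρ
  have hρ0 : 0 < ρ := by positivity
  have hexp : ∀ s < Real.log ρ, Real.exp s < ρ := fun s hs => (Real.lt_log_iff_exp_lt hρ0).1 hs
  have hlog0 : Real.log ρ < 0 :=
    Real.log_neg hρ0 (lt_of_le_of_lt (min_le_left _ _) (by norm_num))
  set ξ : ℝ → ℝ → ℂ := fun s θ => s + θ * Complex.I with hξ
  have ξre : ∀ s θ, (ξ s θ).re = s := fun s θ => by simp [hξ]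
  have ξneg : ∀ s < Real.log ρ, ∀ θ, (ξ s θ).re < 0 := fun s hs θ => by
    rw [ξre]; linarith
  have ξs : ∀ s θ, HasDerivAt (fun s => ξ s θ) 1 s := fun s θ => by
    exact ((Complex.ofRealCLM.hasDerivAt (x := s)).add_const (θ * Complex.I : ℂ)).congr_deriv
      (by simp)
  have ξθ : ∀ s θ, HasDerivAt (ξ s) Complex.I θ := fun s θ => by
    exact (((Complex.ofRealCLM.hasDerivAt (x := θ)).mul_const Complex.I).const_add
      (s : ℂ)).congr_deriv (by simp)
  set P : ℝ → ℝ → ℝ × ℝ :=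
    fun s θ => ((polarMap x₀ y₀ (ξ s θ)).re, (polarMap x₀ y₀ (ξ s θ)).im) with hP
  have hPle : ∀ s < Real.log ρ, ∀ θ, ‖P s θ - (x₀, y₀)‖ ≤ 4 * y₀ * Real.exp s := by
    intro s hs θ
    have h1 := (norm_polarMap_sub_le (x₀ := x₀) hp (ξ := ξ s θ) (by
      rw [ξre]; exact (hexp s hs).le.trans (min_le_left _ _))).1
    rw [ξre] at h1
    refine le_trans ?_ h1
    have a1 := Complex.abs_re_le_norm (polarMap x₀ y₀ (ξ s θ) - (x₀ + Complex.I * y₀))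
    have a2 := Complex.abs_im_le_norm (polarMap x₀ y₀ (ξ s θ) - (x₀ + Complex.I * y₀))
    simp at a1 a2
    exact max_le a1 a2
  have hPU : ∀ s < Real.log ρ, ∀ θ, P s θ ∈ U := by
    intro s hs θ
    refine hball ?_
    rw [mem_ball_iff_norm]
    refine (hPle s hs θ).trans_lt ?_
    calc 4 * y₀ * Real.exp s < 4 * y₀ * (r / (4 * y₀)) := by
          gcongr; exact (hexp s hs).trans_le (min_le_right _ _)
      _ = r := by field_simp
  have dZs : ∀ s < Real.log ρ, ∀ θ, HasDerivAt (fun s => polarMap x₀ y₀ (ξ s θ))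
      (polarMap₁ y₀ (ξ s θ)) s := fun s hs θ => by
    exact ((hasDerivAt_polarMap x₀ y₀ (ξneg s hs θ)).comp s (ξs s θ)).congr_deriv (mul_one _)
  have dZθ : ∀ s < Real.log ρ, ∀ θ, HasDerivAt (fun θ => polarMap x₀ y₀ (ξ s θ))
      (polarMap₁ y₀ (ξ s θ) * Complex.I) θ := fun s hs θ =>
    (hasDerivAt_polarMap x₀ y₀ (ξneg s hs θ)).comp θ (ξθ s θ)
  have dZ1s : ∀ s < Real.log ρ, ∀ θ, HasDerivAt (fun s => polarMap₁ y₀ (ξ s θ))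
      (polarMap₂ y₀ (ξ s θ)) s := fun s hs θ => by
    exact ((hasDerivAt_polarMap₁ y₀ (ξneg s hs θ)).comp s (ξs s θ)).congr_deriv (mul_one _)
  have dZ1θ : ∀ s < Real.log ρ, ∀ θ, HasDerivAt (fun θ => polarMap₁ y₀ (ξ s θ))
      (polarMap₂ y₀ (ξ s θ) * Complex.I) θ := fun s hs θ =>
    (hasDerivAt_polarMap₁ y₀ (ξneg s hs θ)).comp θ (ξθ s θ)
  have dgs : ∀ {g : ℝ × ℝ → ℝ}, ContDiffOn ℝ (⊤ : ℕ∞) g U → ∀ s < Real.log ρ, ∀ θ,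
      HasDerivAt (fun s => g (P s θ)) ((polarMap₁ y₀ (ξ s θ)).re * pdx g (P s θ) +
        (polarMap₁ y₀ (ξ s θ)).im * pdy g (P s θ)) s := fun hg s hs θ =>
    HasFDerivAt.comp_complex (hdiff hg _ (hPU s hs θ)) (dZs s hs θ)
  have dgθ : ∀ {g : ℝ × ℝ → ℝ}, ContDiffOn ℝ (⊤ : ℕ∞) g U → ∀ s < Real.log ρ, ∀ θ,
      HasDerivAt (fun θ => g (P s θ)) ((polarMap₁ y₀ (ξ s θ)).re * pdy g (P s θ) -
        (polarMap₁ y₀ (ξ s θ)).im * pdx g (P s θ)) θ := fun hg s hs θ => by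
    refine (HasFDerivAt.comp_complex (γ := fun θ => polarMap x₀ y₀ (ξ s θ))
      (hdiff hg _ (hPU s hs θ)) (dZθ s hs θ)).congr_deriv ?_
    simp only [Complex.mul_re, Complex.mul_im, Complex.I_re, Complex.I_im]
    ring
  have dre : ∀ {γ : ℝ → ℂ} {γ' : ℂ} {t : ℝ}, HasDerivAt γ γ' t →
      HasDerivAt (fun t => (γ t).re) γ'.re t := fun h =>
    Complex.reCLM.hasFDerivAt.comp_hasDerivAt _ h
  have dim : ∀ {γ : ℝ → ℂ} {γ' : ℂ} {t : ℝ}, HasDerivAt γ γ' t →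
      HasDerivAt (fun t => (γ t).im) γ'.im t := fun h =>
    Complex.imCLM.hasFDerivAt.comp_hasDerivAt _ h
  have cξ : Continuous (fun x : ℝ × ℝ => ξ x.1 x.2) := by simp only [hξ]; fun_prop
  have cexp : Continuous (fun x : ℝ × ℝ => Complex.exp (ξ x.1 x.2)) := Complex.continuous_exp.comp cξ
  have hne : ∀ x ∈ Iio (Real.log ρ) ×ˢ (univ : Set ℝ), 1 - Complex.exp (ξ x.1 x.2) ≠ 0 :=
    fun x hx => one_sub_exp_ne_zero (ξneg _ hx.1 _)
  have cZ1 : ContinuousOn (fun x : ℝ × ℝ => polarMap₁ y₀ (ξ x.1 x.2))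
      (Iio (Real.log ρ) ×ˢ univ) := by
    unfold polarMap₁
    exact continuousOn_const.mul (cexp.continuousOn.div
      ((continuous_const.sub cexp).continuousOn.pow 2) fun x hx => pow_ne_zero _ (hne x hx))
  have cZ2 : ContinuousOn (fun x : ℝ × ℝ => polarMap₂ y₀ (ξ x.1 x.2))
      (Iio (Real.log ρ) ×ˢ univ) := by
    unfold polarMap₂
    exact continuousOn_const.mul ((cexp.mul (continuous_const.add cexp)).continuousOn.div
      ((continuous_const.sub cexp).continuousOn.pow 3) fun x hx => pow_ne_zero _ (hne x hx))
  have cZ : ContinuousOn (fun x : ℝ × ℝ => polarMap x₀ y₀ (ξ x.1 x.2))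
      (Iio (Real.log ρ) ×ˢ univ) := by
    unfold polarMap
    exact continuousOn_const.add (continuousOn_const.mul
      ((continuous_const.add cexp).continuousOn.div
      ((continuous_const.sub cexp).continuousOn) hne))
  have cP : ContinuousOn (fun x : ℝ × ℝ => P x.1 x.2) (Iio (Real.log ρ) ×ˢ univ) :=
    (Complex.continuous_re.comp_continuousOn cZ).prodMk (Complex.continuous_im.comp_continuousOn cZ)
  have cg : ∀ {g : ℝ × ℝ → ℝ}, ContDiffOn ℝ (⊤ : ℕ∞) g U →
      ContinuousOn (fun x : ℝ × ℝ => g (P x.1 x.2)) (Iio (Real.log ρ) ×ˢ univ) := fun hg =>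
    hg.continuousOn.comp cP fun x hx => hPU _ hx.1 _
  have cre : ∀ {γ : ℝ × ℝ → ℂ}, ContinuousOn γ (Iio (Real.log ρ) ×ˢ univ) →
      ContinuousOn (fun x => (γ x).re) (Iio (Real.log ρ) ×ˢ univ) := fun h =>
    Complex.continuous_re.comp_continuousOn h
  have cim : ∀ {γ : ℝ × ℝ → ℂ}, ContinuousOn γ (Iio (Real.log ρ) ×ˢ univ) →
      ContinuousOn (fun x => (γ x).im) (Iio (Real.log ρ) ×ˢ univ) := fun h =>
    Complex.continuous_im.comp_continuousOn h
  have hper : ∀ s θ, Complex.exp (ξ s (θ + 2 * Real.pi)) = Complex.exp (ξ s θ) := by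
    intro s θ
    have : ξ s (θ + 2 * Real.pi) = ξ s θ + 2 * Real.pi * Complex.I := by
      simp only [hξ]; push_cast; ring
    rw [this, Complex.exp_add, Complex.exp_two_pi_mul_I, mul_one]
  have hperP : ∀ s θ, P s (θ + 2 * Real.pi) = P s θ := fun s θ => by
    simp only [hP, polarMap, hper]
  have hper1 : ∀ s θ, polarMap₁ y₀ (ξ s (θ + 2 * Real.pi)) = polarMap₁ y₀ (ξ s θ) := fun s θ => by
    simp only [polarMap₁, hper]
  have key : ∀ s < Real.log ρ, ∀ θ, v (P s θ) = 0 := by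
    refine eq_zero_of_polar (W := fun s θ => v (P s θ))
      (b := fun s => μ * (4 * Real.exp s ^ 2 / (1 - Real.exp s ^ 2) ^ 2))
      (C := μ * (4 * 1 ^ 2 / (1 / 2) ^ 2))
      (Ws := fun s θ => (polarMap₁ y₀ (ξ s θ)).re * pdx v (P s θ) +
        (polarMap₁ y₀ (ξ s θ)).im * pdy v (P s θ))
      (Wt := fun s θ => (polarMap₁ y₀ (ξ s θ)).re * pdy v (P s θ) -
        (polarMap₁ y₀ (ξ s θ)).im * pdx v (P s θ))
      (Wss := fun s θ => ((polarMap₂ y₀ (ξ s θ)).re * pdx v (P s θ) +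
        (polarMap₁ y₀ (ξ s θ)).re * ((polarMap₁ y₀ (ξ s θ)).re * pdx (pdx v) (P s θ) +
          (polarMap₁ y₀ (ξ s θ)).im * pdy (pdx v) (P s θ))) +
        ((polarMap₂ y₀ (ξ s θ)).im * pdy v (P s θ) +
        (polarMap₁ y₀ (ξ s θ)).im * ((polarMap₁ y₀ (ξ s θ)).re * pdx (pdy v) (P s θ) +
          (polarMap₁ y₀ (ξ s θ)).im * pdy (pdy v) (P s θ))))
      (Wtt := fun s θ => ((polarMap₂ y₀ (ξ s θ) * Complex.I).re * pdy v (P s θ) +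
        (polarMap₁ y₀ (ξ s θ)).re * ((polarMap₁ y₀ (ξ s θ)).re * pdy (pdy v) (P s θ) -
          (polarMap₁ y₀ (ξ s θ)).im * pdx (pdy v) (P s θ))) -
        ((polarMap₂ y₀ (ξ s θ) * Complex.I).im * pdx v (P s θ) +
        (polarMap₁ y₀ (ξ s θ)).im * ((polarMap₁ y₀ (ξ s θ)).re * pdy (pdx v) (P s θ) -
          (polarMap₁ y₀ (ξ s θ)).im * pdx (pdx v) (P s θ))))
      ?_ ?_ ?_ ?_ ?_ ?_ ?_ ?_ ?_ ?_ ?_ ?_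
    · exact fun s hs θ => dgs hv s hs θ
    · exact fun s hs θ => ((dre (dZ1s s hs θ)).mul (dgs hvx s hs θ)).add
        ((dim (dZ1s s hs θ)).mul (dgs hvy s hs θ))
    · exact fun s hs θ => dgθ hv s hs θ
    · exact fun s hs θ => ((dre (dZ1θ s hs θ)).mul (dgθ hvy s hs θ)).sub
        ((dim (dZ1θ s hs θ)).mul (dgθ hvx s hs θ))
    · exact ((cre cZ1).mul (cg hvx)).add ((cim cZ1).mul (cg hvy))
    · exact (((cre cZ2).mul (cg hvx)).add ((cre cZ1).mul
        (((cre cZ1).mul (cg hvxx)).add ((cim cZ1).mul (cg hvxy))))).add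
        (((cim cZ2).mul (cg hvy)).add ((cim cZ1).mul
        (((cre cZ1).mul (cg hvyx)).add ((cim cZ1).mul (cg hvyy)))))
    · intro s hs
      have c1 : ContinuousOn (fun x : ℝ × ℝ => (polarMap₂ y₀ (ξ x.1 x.2) * Complex.I))
        (Iio (Real.log ρ) ×ˢ univ) := cZ2.mul continuousOn_const
      have c2 := (((cre c1).mul (cg hvy)).add ((cre cZ1).mul
        (((cre cZ1).mul (cg hvyy)).sub ((cim cZ1).mul (cg hvyx))))).sub
        (((cim c1).mul (cg hvx)).add ((cim cZ1).mul
        (((cre cZ1).mul (cg hvxy)).sub ((cim cZ1).mul (cg hvxx)))))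
      exact continuousOn_univ.1 (c2.comp (f := fun θ : ℝ => (s, θ)) (s := univ)
        (by fun_prop) fun θ _ => ⟨hs, trivial⟩)
    · exact fun s _ θ => by simp only [hperP]
    · intro s _
      have h1 := hperP s 0
      have h2 := hper1 s 0
      rw [zero_add] at h1 h2
      simp only [h1, h2]
    · intro s hs θ
      have h1 := heq _ (hPU s hs θ)
      have h2 := normSq_polarMap₁ (x₀ := x₀) hp (ξneg s hs θ)
      have h3 := polarMap_im_pos (x₀ := x₀) hp (ξneg s hs θ)
      rw [ξre] at h2
      rw [← h2]
      have h4 : (P s θ).2 = (polarMap x₀ y₀ (ξ s θ)).im := rfl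
      rw [h4] at h1
      simp only [Complex.mul_re, Complex.mul_im, Complex.I_re, Complex.I_im]
      have h5 : ((polarMap₁ y₀ (ξ s θ)).re ^ 2 + (polarMap₁ y₀ (ξ s θ)).im ^ 2) *
        (pdx (pdx v) (P s θ) + pdy (pdy v) (P s θ)) =
        ((polarMap₁ y₀ (ξ s θ)).re ^ 2 + (polarMap₁ y₀ (ξ s θ)).im ^ 2) *
        (-(μ / (polarMap x₀ y₀ (ξ s θ)).im ^ 2) * v (P s θ)) := by rw [h1]
      calc _ = ((polarMap₁ y₀ (ξ s θ)).re ^ 2 + (polarMap₁ y₀ (ξ s θ)).im ^ 2) *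
        (pdx (pdx v) (P s θ) + pdy (pdy v) (P s θ)) := by ring
        _ = _ := by rw [h5]; ring
    · intro s hs
      have h1 : Real.exp s ≤ 1 / 2 := (hexp s hs).le.trans (min_le_left _ _)
      have h2 := Real.exp_pos s
      refine ⟨by positivity, ?_⟩
      gcongr
      · linarith
      · nlinarith
    · intro K
      obtain ⟨hv1, hv2⟩ := hflat K
      obtain ⟨C₁, hC₁⟩ := hv1.bound
      obtain ⟨C₂, hC₂⟩ := hv2.bound
      obtain ⟨δ, hδ, hb⟩ := Metric.eventually_nhds_iff_ball.1 (hC₁.and hC₂)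
      set M := (|C₁| + |C₂| * (16 * y₀)) * (4 * y₀) ^ K with hM
      refine ⟨M, ?_⟩
      have hlim : Tendsto (fun s => 4 * y₀ * Real.exp s) atBot (𝓝 0) := by
        simpa using Real.tendsto_exp_atBot.const_mul (4 * y₀)
      filter_upwards [hlim.eventually (gt_mem_nhds hδ), eventually_lt_atBot (Real.log ρ)]
        with s hs1 hs θ
      have h1 : P s θ ∈ Metric.ball (x₀, y₀) δ := by
        rw [mem_ball_iff_norm]; exact (hPle s hs θ).trans_lt hs1
      obtain ⟨k1, k2⟩ := hb _ h1
      have k3 : ‖P s θ - (x₀, y₀)‖ ^ K ≤ (4 * y₀) ^ K * Real.exp (K * s) := by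
        rw [Real.exp_nat_mul, ← mul_pow]
        have := hPle s hs θ
        gcongr
      rw [norm_pow, norm_norm] at k1 k2
      rw [Real.norm_eq_abs] at k1
      have j1 : |v (P s θ)| ≤ |C₁| * ((4 * y₀) ^ K * Real.exp (K * s)) :=
        k1.trans (mul_le_mul (le_abs_self _) k3 (by positivity) (abs_nonneg _))
      have j2 : ‖fderiv ℝ v (P s θ)‖ ≤ |C₂| * ((4 * y₀) ^ K * Real.exp (K * s)) :=
        k2.trans (mul_le_mul (le_abs_self _) k3 (by positivity) (abs_nonneg _))
      have j3 : ∀ e : ℝ × ℝ, ‖e‖ ≤ 1 → |fderiv ℝ v (P s θ) e| ≤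
          |C₂| * ((4 * y₀) ^ K * Real.exp (K * s)) := fun e he =>
        ((fderiv ℝ v (P s θ)).unit_le_opNorm e he).trans j2
      have jx : |pdx v (P s θ)| ≤ _ := j3 (1, 0) (by simp [Prod.norm_def])
      have jy : |pdy v (P s θ)| ≤ _ := j3 (0, 1) (by simp [Prod.norm_def])
      have he1 : Real.exp s ≤ 1 / 2 := (hexp s hs).le.trans (min_le_left _ _)
      have hz := (norm_polarMap_sub_le (x₀ := x₀) hp (ξ := ξ s θ) (by rw [ξre]; exact he1)).2
      rw [ξre] at hz
      have hz' : ‖polarMap₁ y₀ (ξ s θ)‖ ≤ 8 * y₀ := by nlinarith [hz]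
      have hE : 0 ≤ (4 * y₀) ^ K * Real.exp (K * s) := by positivity
      set E := (4 * y₀) ^ K * Real.exp (K * s)
      have hME : M * Real.exp (K * s) = |C₁| * E + |C₂| * (16 * y₀) * E := by
        simp only [hM, E]; ring
      rw [hME]
      constructor
      · have : 0 ≤ |C₂| * (16 * y₀) * E := by positivity
        linarith
      · have h0 : 0 ≤ |C₁| * E := by positivity
        have r1 := (Complex.abs_re_le_norm (polarMap₁ y₀ (ξ s θ))).trans hz'
        have r2 := (Complex.abs_im_le_norm (polarMap₁ y₀ (ξ s θ))).trans hz'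
        calc _ ≤ |(polarMap₁ y₀ (ξ s θ)).re * pdx v (P s θ)| +
              |(polarMap₁ y₀ (ξ s θ)).im * pdy v (P s θ)| := abs_add_le _ _
          _ ≤ (8 * y₀) * (|C₂| * E) + (8 * y₀) * (|C₂| * E) := by
            rw [abs_mul, abs_mul]; gcongr
          _ ≤ _ := by linarith
  set w : ℝ × ℝ → ℂ := fun z => (z.1 - x₀ + (z.2 - y₀) * Complex.I) / (z.1 - x₀ + (z.2 + y₀) * Complex.I)
    with hw
  have hden : ∀ᶠ z : ℝ × ℝ in 𝓝 (x₀, y₀), 0 < z.2 :=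
    continuous_snd.continuousAt.eventually (lt_mem_nhds hp)
  have hden0 : ∀ z : ℝ × ℝ, 0 < z.2 → (z.1 - x₀ + (z.2 + y₀) * Complex.I : ℂ) ≠ 0 := by
    intro z hz h0
    have := congrArg Complex.im h0
    simp at this
    linarith
  have hwc : ContinuousAt w (x₀, y₀) := by
    refine ContinuousAt.div (by fun_prop) (by fun_prop) (hden0 _ hp)
  have hw0 : w (x₀, y₀) = 0 := by simp [hw]
  have hsmall : ∀ᶠ z in 𝓝 (x₀, y₀), ‖w z‖ < ρ := by
    exact hwc.norm.eventually (gt_mem_nhds (show ‖w (x₀, y₀)‖ < ρ by rwa [hw0, norm_zero]))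
  filter_upwards [hden, hsmall] with z hz hzρ
  by_cases hzp : w z = 0
  · have h1 : (z.1 - x₀ + (z.2 - y₀) * Complex.I : ℂ) = 0 :=
      (div_eq_zero_iff.1 hzp).resolve_right (hden0 z hz)
    have a1 := congrArg Complex.re h1
    have a2 := congrArg Complex.im h1
    simp at a1 a2
    have : z = (x₀, y₀) := Prod.ext (by linarith) (by linarith)
    rw [this]
    have := (hflat 1).1.bound
    obtain ⟨C₁, hC₁⟩ := this
    simpa using hC₁.self_of_nhds
  · have hs : Real.log ‖w z‖ < Real.log ρ := Real.log_lt_log (norm_pos_iff.2 hzp) hzρ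
    have h1 := key _ hs (Complex.arg (w z))
    have h2 : Complex.exp (ξ (Real.log ‖w z‖) (Complex.arg (w z))) = w z := by
      simp only [hξ]
      rw [← Complex.log]
      exact Complex.exp_log hzp
    have h3 : polarMap x₀ y₀ (ξ (Real.log ‖w z‖) (Complex.arg (w z))) = z.1 + z.2 * Complex.I := by
      unfold polarMap
      have h4 : 1 - w z ≠ 0 := by
        rw [← h2]; exact one_sub_exp_ne_zero (ξneg _ hs _)
      have h5 := hden0 z hz
      have h6 : (y₀ : ℂ) ≠ 0 := by exact_mod_cast hp.ne'
      have e1 : 1 - w z = 2 * y₀ * Complex.I / (z.1 - x₀ + (z.2 + y₀) * Complex.I) := by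
        rw [eq_div_iff h5, sub_mul, div_mul_cancel₀ _ h5]; ring
      have e2 : 1 + w z = 2 * (z.1 - x₀ + z.2 * Complex.I) /
          (z.1 - x₀ + (z.2 + y₀) * Complex.I) := by
        rw [eq_div_iff h5, add_mul, div_mul_cancel₀ _ h5]; ring
      rw [h2, e1, e2, div_div_div_cancel_right₀ h5]
      field_simp
      ring
    simp only [hP, h3] at h1
    simpa using h1

lemma contDiffAt_potential (μ : ℝ) {p : ℝ × ℝ} (hp : 0 < p.2) :
    ContDiffAt ℝ (⊤ : ℕ∞) (fun z : ℝ × ℝ => -(μ / z.2 ^ 2)) p :=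
  (contDiffAt_const.div (contDiffAt_snd.pow 2) (by positivity)).neg

/-- At a critical zero, an eigenfunction that does not vanish identically has a nontrivial
harmonic leading term. -/
lemma expansion_of_ne_zero {Ω : Set (ℝ × ℝ)} {v : ℝ × ℝ → ℝ} {μ : ℝ} {p : ℝ × ℝ} (hμ : 0 ≤ μ)
    (hΩ : Ω ⊆ H2) (hopen : IsOpen Ω) (hconn : IsPreconnected Ω)
    (hv : ContDiffOn ℝ (⊤ : ℕ∞) v Ω)
    (heq : ∀ z ∈ Ω, pdx (pdx v) z + pdy (pdy v) z = -(μ / z.2 ^ 2) * v z)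
    (hne : ∃ z ∈ Ω, v z ≠ 0) (hp : p ∈ Ω) (h0 : v p = 0) (h1 : fderiv ℝ v p = 0) :
    ∃ k : ℕ, 2 ≤ k ∧ ∃ c : ℂ, c ≠ 0 ∧
      (fun z => v z - (c * cplx p z ^ k).re) =O[𝓝 p] (fun z => ‖z - p‖ ^ (k + 1)) ∧
      ∀ᶠ z in 𝓝[≠] p, fderiv ℝ v z ≠ 0 := by
  have dich : ∀ q ∈ Ω, v q = 0 → fderiv ℝ v q = 0 → (∀ᶠ z in 𝓝 q, v z = 0) ∨
      ∃ k : ℕ, 2 ≤ k ∧ ∃ c : ℂ, c ≠ 0 ∧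
      (fun z => v z - (c * cplx q z ^ k).re) =O[𝓝 q] (fun z => ‖z - q‖ ^ (k + 1)) ∧
      ∀ᶠ z in 𝓝[≠] q, fderiv ℝ v z ≠ 0 := by
    intro q hq hq0 hq1
    have hm := hopen.mem_nhds hq
    rcases flat_or_expansion (hv.contDiffAt hm) (contDiffAt_potential μ (hΩ hq))
      (by filter_upwards [hm] with z hz using heq z hz) hq0 hq1 with h | h
    · exact Or.inl (eq_zero_of_flat hμ hopen hq (hΩ hq) hv heq h)
    · exact Or.inr h
  refine (dich p hp h0 h1).resolve_left fun hflat => ?_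
  obtain ⟨z, hz, hvz⟩ := hne
  set A : Set (ℝ × ℝ) := {z | ∀ᶠ z' in 𝓝 z, v z' = 0} with hA
  have hAo : IsOpen A := isOpen_setOfPred_eventually_nhds
  have hsub : Ω ⊆ A := by
    refine hconn.subset_of_closure_inter_subset hAo ⟨p, hp, hflat⟩ ?_
    rintro q ⟨hqA, hq⟩
    have hfr : ∃ᶠ z in 𝓝 q, z ∈ A := mem_closure_iff_frequently.1 hqA
    have hcv : ContinuousAt v q := hv.continuousOn.continuousAt (hopen.mem_nhds hq)
    have hcf : ContinuousAt (fderiv ℝ v) q :=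
      (hv.continuousOn_fderiv_of_isOpen hopen (by simp)).continuousAt (hopen.mem_nhds hq)
    have hA0 : ∀ z ∈ A, v z = 0 := fun z hz => hz.self_of_nhds
    have hA1 : ∀ z ∈ A, fderiv ℝ v z = 0 := fun z hz => by
      have h : v =ᶠ[𝓝 z] fun _ => 0 := hz
      rw [h.fderiv_eq]; simp
    have hq0 : v q = 0 := by
      by_contra h
      exact hfr ((hcv.eventually_ne h).mono fun z hz hzA => hz (hA0 z hzA))
    have hq1 : fderiv ℝ v q = 0 := by
      by_contra h
      exact hfr ((hcf.eventually_ne h).mono fun z hz hzA => hz (hA1 z hzA))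
    refine (dich q hq hq0 hq1).resolve_right ?_
    rintro ⟨k, -, c, -, -, h⟩
    by_cases hqq : q ∈ A
    · have h2 : ∀ᶠ z in 𝓝[≠] q, fderiv ℝ v z = 0 :=
        (eventually_nhdsWithin_of_eventually_nhds (hAo.mem_nhds hqq)).mono hA1
      obtain ⟨z, hz1, hz2⟩ := (h.and h2).exists
      exact hz1 hz2
    · rw [eventually_nhdsWithin_iff] at h
      exact hfr (h.mono fun z hz hzA => hz (fun hzq => hqq (hzq ▸ hzA)) (hA1 z hzA))
  exact hvz (hsub hz).self_of_nhds

lemma tendsto_ratio_cocompact (a b : ℂ) :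
    Tendsto (fun z : ℂ => (a - z) / (b - z)) (cocompact ℂ) (𝓝 1) := by
  have h1 : Tendsto (fun z : ℂ => b - z) (cocompact ℂ) (cocompact ℂ) :=
    (Homeomorph.subLeft b).isClosedEmbedding.tendsto_cocompact
  have h2 : Tendsto (fun z : ℂ => 1 + (a - b) * (b - z)⁻¹) (cocompact ℂ) (𝓝 (1 + (a - b) * 0)) := by
    rw [← Metric.cobounded_eq_cocompact] at h1 ⊢
    exact
    (((tendsto_inv₀_cobounded (α := ℂ)).comp
      h1).const_mul (a - b)).const_add 1
  simp only [mul_zero, add_zero] at h2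
  refine h2.congr' ?_
  filter_upwards [(isCompact_singleton (x := b)).compl_mem_cocompact] with z hz
  have : b - z ≠ 0 := sub_ne_zero.2 fun h => hz h.symm
  field_simp
  ring

lemma tendsto_log_ratio_cocompact (a b : ℂ) :
    Tendsto (fun z : ℂ => Complex.log ((a - z) / (b - z))) (cocompact ℂ) (𝓝 0) := by
  have := (tendsto_ratio_cocompact a b).clog (by simp)
  simpa using this

/-- A continuous branch of `log ((b - z) / (a - z))` exists off a compact subset of any
connected open set containing both `a` and `b`. -/
lemma exists_log_ratio {N : Set ℂ} (hN : IsOpen N) (hc : IsPreconnected N) {a b : ℂ}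
    (ha : a ∈ N) (hb : b ∈ N) :
    ∃ K ⊆ N, IsCompact K ∧ ∃ g : ℂ → ℂ, ContinuousOn g Kᶜ ∧
      (∀ z ∉ K, Complex.exp (g z) * (a - z) = b - z) ∧ Tendsto g (cocompact ℂ) (𝓝 0) := by
  refine hc.induction₂' (fun a b => ∃ K ⊆ N, IsCompact K ∧ ∃ g : ℂ → ℂ, ContinuousOn g Kᶜ ∧
      (∀ z ∉ K, Complex.exp (g z) * (a - z) = b - z) ∧ Tendsto g (cocompact ℂ) (𝓝 0)) ?_ ?_ ha hb
  · intro x hx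
    obtain ⟨ε, hε, hball⟩ := Metric.nhds_basis_closedBall.mem_iff.1 (hN.mem_nhds hx)
    refine eventually_nhdsWithin_of_eventually_nhds ?_
    filter_upwards [Metric.ball_mem_nhds x hε] with y hy
    have key : ∀ z ∉ Metric.closedBall x ε, x - z ≠ 0 ∧ y - z ≠ 0 ∧
        (y - z) / (x - z) ∈ Complex.slitPlane := by
      intro z hz
      rw [Metric.mem_closedBall, not_le, dist_comm, dist_eq_norm] at hz
      rw [Metric.mem_ball, dist_eq_norm] at hy
      have h1 : x - z ≠ 0 := norm_pos_iff.1 (hε.trans hz)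
      have h2 : ‖(y - x) / (x - z)‖ < 1 := by
        rw [norm_div, div_lt_one (norm_pos_iff.2 h1)]; exact hy.trans hz
      have h3 := Complex.mem_slitPlane_of_norm_lt_one h2
      rw [show 1 + (y - x) / (x - z) = (y - z) / (x - z) by field_simp; ring] at h3
      refine ⟨h1, fun h => ?_, h3⟩
      rw [h, zero_div] at h3
      exact Complex.slitPlane_ne_zero h3 rfl
    have hcont : ContinuousOn (fun z => Complex.log ((y - z) / (x - z)))
        (Metric.closedBall x ε)ᶜ := by
      refine ContinuousOn.clog (ContinuousOn.div (by fun_prop) (by fun_prop) ?_) ?_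
      · exact fun z hz => (key z hz).1
      · exact fun z hz => (key z hz).2.2
    refine ⟨⟨_, hball, isCompact_closedBall x ε, _, hcont, fun z hz => ?_,
      tendsto_log_ratio_cocompact y x⟩, ⟨_, hball, isCompact_closedBall x ε, fun z => -_, hcont.neg,
      fun z hz => ?_, neg_zero (G := ℂ) ▸ (tendsto_log_ratio_cocompact y x).neg⟩⟩
    · obtain ⟨h1, h2, h3⟩ := key z hz
      rw [Complex.exp_log (div_ne_zero h2 h1), div_mul_cancel₀ _ h1]
    · obtain ⟨h1, h2, h3⟩ := key z hz
      rw [Complex.exp_neg, Complex.exp_log (div_ne_zero h2 h1)]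
      field_simp
  · rintro x y z - - - ⟨K, hK, hKc, g, hg, hge, hgt⟩ ⟨K', hK', hKc', g', hg', hge', hgt'⟩
    refine ⟨K ∪ K', union_subset hK hK', hKc.union hKc', fun z => g' z + g z, ?_, ?_, ?_⟩
    · rw [compl_union]
      exact (hg'.mono inter_subset_right).add (hg.mono inter_subset_left)
    · intro w hw
      rw [mem_union, not_or] at hw
      rw [Complex.exp_add, mul_assoc, hge w hw.1, hge' w hw.2]
    · simpa using hgt'.add hgt

lemma ratio_mem_slitPlane {p a z : ℂ} (hz : z ∉ segment ℝ p a) :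
    p - z ≠ 0 ∧ a - z ≠ 0 ∧ (a - z) / (p - z) ∈ Complex.slitPlane := by
  have h1 : p - z ≠ 0 := fun h => hz (sub_eq_zero.1 h ▸ left_mem_segment ℝ p a)
  have h2 : a - z ≠ 0 := fun h => hz (sub_eq_zero.1 h ▸ right_mem_segment ℝ p a)
  refine ⟨h1, h2, ?_⟩
  by_contra hs
  rw [Complex.mem_slitPlane_iff, not_or, not_lt, not_not] at hs
  obtain ⟨hre, him⟩ := hs
  set r := -((a - z) / (p - z)).re with hr
  have hr0 : 0 ≤ r := by simp only [hr]; linarith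
  have h3 : (a - z) / (p - z) = -(r : ℂ) := by
    apply Complex.ext
    · simp [hr]
    · simpa using him
  rw [div_eq_iff h1] at h3
  refine hz ⟨r / (1 + r), 1 / (1 + r), by positivity, by positivity, by field_simp; ring, ?_⟩
  have h4 : (1 + r : ℂ) ≠ 0 := by
    have : (1 + r : ℝ) ≠ 0 := by positivity
    exact_mod_cast this
  rw [Complex.real_smul, Complex.real_smul]
  push_cast
  field_simp
  linear_combination h3

lemma frontier_connectedComponentIn_eq_zero {Ω : Set ℂ} {v : ℂ → ℝ} (hΩ : IsOpen Ω)
    (hv : ContinuousOn v Ω) {z₀ z : ℂ}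
    (hz : z ∈ frontier (connectedComponentIn {z | z ∈ Ω ∧ 0 < v z} z₀)) (hzΩ : z ∈ Ω)
    (hz₀ : z₀ ∈ Ω ∧ 0 < v z₀) : v z = 0 := by
  set P := connectedComponentIn {z | z ∈ Ω ∧ 0 < v z} z₀ with hP
  have hpos : IsOpen {z | z ∈ Ω ∧ 0 < v z} := hv.isOpen_inter_preimage hΩ isOpen_Ioi
  have hPo : IsOpen P := hpos.connectedComponentIn
  have hsub : P ⊆ {z | z ∈ Ω ∧ 0 < v z} := connectedComponentIn_subset _ _
  have hzP : z ∉ P := by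
    rw [hPo.frontier_eq] at hz; exact hz.2
  have hzc : z ∈ closure P := frontier_subset_closure hz
  refine le_antisymm (not_lt.1 fun hvz => hzP ?_) ?_
  · have h1 : IsPreconnected (insert z P) :=
      isPreconnected_connectedComponentIn.subset_closure (subset_insert _ _)
        (insert_subset hzc subset_closure)
    exact h1.subset_connectedComponentIn (mem_insert_of_mem _ (mem_connectedComponentIn hz₀))
      (insert_subset (show z ∈ {z | z ∈ Ω ∧ 0 < v z} from ⟨hzΩ, hvz⟩) hsub) (mem_insert _ _)
  · have hca : ContinuousAt v z := hv.continuousAt (hΩ.mem_nhds hzΩ)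
    by_contra hneg
    exact (mem_closure_iff_frequently.1 hzc) ((hca.eventually (gt_mem_nhds (not_le.1 hneg))).mono
      fun w hw hwP => absurd (hsub hwP).2 (not_lt.2 (le_of_lt hw)))

/-- The winding argument: if two negative rays emanating from the zero `p` are joined inside the
negative set, and positive rays alternate with them, some positive component is compactly
contained in `Ω`. -/
lemma exists_compact_positive_component {Ω N : Set ℂ} {v : ℂ → ℝ} {p : ℂ} {θ α t₀ : ℝ}
    (hΩ : IsOpen Ω)
    (hunb : ∀ q ∉ Ω, ∃ S ⊆ Ωᶜ, q ∈ S ∧ IsPreconnected S ∧ ¬ Bornology.IsBounded S)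
    (hv : ContinuousOn v Ω) (hp : p ∈ Ω) (hvp : v p = 0)
    (hN : IsOpen N) (hNc : IsPreconnected N) (hNs : ∀ z ∈ N, z ∈ Ω ∧ v z < 0)
    (hα : 0 < α) (hα' : α ≤ Real.pi / 2) (ht₀ : 0 < t₀)
    (hray : ∀ t, 0 < t → t ≤ t₀ → ∀ j : Fin 4,
      (p + t * Complex.exp ((θ + (j : ℕ) * α : ℝ) * Complex.I)) ∈ Ω ∧
      0 < (-1) ^ (j : ℕ) * v (p + t * Complex.exp ((θ + (j : ℕ) * α : ℝ) * Complex.I)))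
    (ha : p + t₀ * Complex.exp ((θ + (1 : ℕ) * α : ℝ) * Complex.I) ∈ N)
    (hb : p + t₀ * Complex.exp ((θ + (3 : ℕ) * α : ℝ) * Complex.I) ∈ N) :
    ∃ P : Set ℂ, IsOpen P ∧ P.Nonempty ∧ (∀ z ∈ P, 0 < v z) ∧ IsCompact (closure P) ∧
      closure P ⊆ Ω ∧ ∀ z ∈ frontier P, v z = 0 := by
  set e : ℕ → ℂ := fun j => Complex.exp ((θ + j * α : ℝ) * Complex.I) with he
  have he0 : ∀ j, e j ≠ 0 := fun j => Complex.exp_ne_zero _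
  set a := p + t₀ * e 1 with hadef
  set b := p + t₀ * e 3 with hbdef
  obtain ⟨K, hKN, hK, g, hg, hge, hgt⟩ := exists_log_ratio hN hNc ha hb
  have hseg : ∀ j : Fin 4, (-1 : ℝ) ^ (j : ℕ) = -1 →
      ∀ z ∈ segment ℝ p (p + t₀ * e j), z ∈ Ω ∧ v z ≤ 0 := by
    intro j hj z hz
    rw [segment_eq_image'] at hz
    obtain ⟨s, ⟨hs0, hs1⟩, rfl⟩ := hz
    rcases hs0.eq_or_lt with rfl | hs0
    · simpa using ⟨hp, hvp.le⟩
    · have h1 := hray (s * t₀) (by positivity) (by nlinarith) j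
      rw [hj] at h1
      have h2 : p + s • (p + t₀ * e j - p) =
          p + (s * t₀ : ℝ) * Complex.exp ((θ + (j : ℕ) * α : ℝ) * Complex.I) := by
        simp only [he, Complex.real_smul]; push_cast; ring
      show p + s • (p + t₀ * e j - p) ∈ Ω ∧ v (p + s • (p + t₀ * e j - p)) ≤ 0
      rw [h2]
      exact ⟨h1.1, by linarith [h1.2]⟩
  have hseg1 := hseg 1 (by norm_num)
  have hseg3 := hseg 3 (by simp; norm_num)
  set J := K ∪ (segment ℝ p a ∪ segment ℝ p b) with hJ
  have hsegc : ∀ w : ℂ, IsCompact (segment ℝ p w) := fun w => by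
    rw [segment_eq_image']
    exact isCompact_Icc.image (by fun_prop)
  have hJc : IsCompact J := hK.union ((hsegc a).union (hsegc b))
  have hJs : ∀ z ∈ J, z ∈ Ω ∧ v z ≤ 0 := by
    rintro z (hz | hz | hz)
    · exact ⟨(hNs z (hKN hz)).1, (hNs z (hKN hz)).2.le⟩
    · exact hseg1 z hz
    · exact hseg3 z hz
  set F : ℂ → ℂ := fun z =>
    g z + Complex.log ((a - z) / (p - z)) - Complex.log ((b - z) / (p - z)) with hF
  have hJm : ∀ z ∉ J, z ∉ K ∧ z ∉ segment ℝ p a ∧ z ∉ segment ℝ p b := by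
    intro z hz
    simpa only [hJ, mem_union, not_or] using hz
  have hFc : ContinuousOn F Jᶜ := by
    refine ((hg.mono ?_).add ?_).sub ?_
    · exact compl_subset_compl.2 subset_union_left
    · refine ContinuousOn.clog (ContinuousOn.div (by fun_prop) (by fun_prop) ?_) ?_
      · exact fun z hz => (ratio_mem_slitPlane (hJm z hz).2.1).1
      · exact fun z hz => (ratio_mem_slitPlane (hJm z hz).2.1).2.2
    · refine ContinuousOn.clog (ContinuousOn.div (by fun_prop) (by fun_prop) ?_) ?_
      · exact fun z hz => (ratio_mem_slitPlane (hJm z hz).2.2).1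
      · exact fun z hz => (ratio_mem_slitPlane (hJm z hz).2.2).2.2
  set n : ℂ → ℝ := fun z => (F z).im / (2 * Real.pi) with hn
  have hnc : ContinuousOn n Jᶜ := (Complex.continuous_im.comp_continuousOn hFc).div_const _
  have hnZ : MapsTo n Jᶜ (range ((↑) : ℤ → ℝ)) := by
    intro z hz
    obtain ⟨h1, h2, h3⟩ := hJm z hz
    obtain ⟨hp1, ha1, -⟩ := ratio_mem_slitPlane h2
    obtain ⟨-, hb1, -⟩ := ratio_mem_slitPlane h3
    have : Complex.exp (F z) = 1 := by
      simp only [hF]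
      rw [Complex.exp_sub, Complex.exp_add, Complex.exp_log (div_ne_zero ha1 hp1),
        Complex.exp_log (div_ne_zero hb1 hp1)]
      have := hge z h1
      field_simp
      exact this
    obtain ⟨m, hm⟩ := Complex.exp_eq_one_iff.1 this
    refine ⟨m, ?_⟩
    simp only [hn, hm]
    simp
  have hdisc : IsDiscrete (range ((↑) : ℤ → ℝ)) :=
    Int.isClosedEmbedding_coe_real.isInducing.isDiscrete_range
  have hconst : ∀ {S : Set ℂ}, IsPreconnected S → S ⊆ Jᶜ → ∀ {x y}, x ∈ S → y ∈ S → n x = n y :=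
    fun hS hSJ _ _ hx hy =>
      hS.constant_of_mapsTo hdisc (hnc.mono hSJ) (hnZ.mono_left hSJ) hx hy
  have hFt : Tendsto F (cocompact ℂ) (𝓝 0) := by
    have := (hgt.add (tendsto_log_ratio_cocompact a p)).sub (tendsto_log_ratio_cocompact b p)
    simpa [hF] using this
  have hev : ∀ᶠ z in cocompact ℂ, n z = 0 := by
    filter_upwards [hJc.compl_mem_cocompact, hFt.norm.eventually (gt_mem_nhds
      (show ‖(0 : ℂ)‖ < 1 by simp))] with z hz h1
    obtain ⟨m, hm⟩ := hnZ hz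
    have h2 : |n z| < 1 := by
      simp only [hn]
      rw [abs_div, abs_of_pos Real.two_pi_pos, div_lt_one Real.two_pi_pos]
      have := Complex.abs_im_le_norm (F z)
      linarith [Real.pi_gt_three]
    rw [← hm] at h2 ⊢
    have h3 : |m| < 1 := by exact_mod_cast h2
    rw [Int.abs_lt_one_iff] at h3
    exact_mod_cast h3
  obtain ⟨R, hR⟩ : ∃ R : ℝ, ∀ z : ℂ, R < ‖z‖ → n z = 0 := by
    rw [← Metric.cobounded_eq_cocompact, (Metric.hasBasis_cobounded_compl_closedBall (0:ℂ)).eventually_iff] at hev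
    obtain ⟨R, -, hR⟩ := hev
    exact ⟨R, fun z hz => hR (by simpa using hz)⟩
  have hout : ∀ q ∉ Ω, n q = 0 := by
    intro q hq
    obtain ⟨S, hSΩ, hqS, hSc, hSb⟩ := hunb q hq
    obtain ⟨z, hzS, hz⟩ : ∃ z ∈ S, R < ‖z‖ := by
      by_contra hcon
      push Not at hcon
      exact hSb (isBounded_iff_forall_norm_le.2 ⟨R, hcon⟩)
    rw [hconst hSc (fun w hw hwJ => hSΩ hw (hJs w hwJ).1) hqS hzS, hR z hz]
  have hposJ : ∀ z, z ∈ Ω ∧ 0 < v z → z ∉ J := fun z hz hzJ => absurd hz.2 (not_lt.2 (hJs z hzJ).2)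
  obtain ⟨z₀, hz₀, hn0⟩ : ∃ z₀, (z₀ ∈ Ω ∧ 0 < v z₀) ∧ n z₀ ≠ 0 := by
    by_contra hcon
    push Not at hcon
    have hlim : ∀ j : ℕ, (-(e 1 / e j)) ∈ Complex.slitPlane → (-(e 3 / e j)) ∈ Complex.slitPlane →
        Tendsto (fun t : ℝ => (F (p + t * e j)).im) (𝓝[>] 0)
          (𝓝 ((g p).im + (-(e 1 / e j)).arg - (-(e 3 / e j)).arg)) := by
      intro j h1 h3
      have hpK : p ∉ K := fun h => by linarith [(hNs p (hKN h)).2]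
      have hγ : Tendsto (fun t : ℝ => p + t * e j) (𝓝[>] 0) (𝓝 p) := by
        have : Continuous (fun t : ℝ => p + t * e j) := by fun_prop
        simpa using (this.tendsto 0).mono_left nhdsWithin_le_nhds
      have hg1 : Tendsto (fun t : ℝ => (g (p + t * e j)).im) (𝓝[>] 0) (𝓝 (g p).im) :=
        (Complex.continuous_im.tendsto _).comp
          (((hg.continuousAt (hK.isClosed.isOpen_compl.mem_nhds hpK)).tendsto).comp hγ)
      have harg : ∀ w : ℂ, -(w / e j) ∈ Complex.slitPlane →
          Tendsto (fun t : ℝ => (Complex.log ((p + t₀ * w - (p + t * e j)) / (p - (p + t * e j)))).im)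
            (𝓝[>] 0) (𝓝 (-(w / e j)).arg) := by
        intro w hw
        have h4 : Tendsto (fun t : ℝ => (-(w / e j) + (t / t₀ : ℝ) : ℂ)) (𝓝[>] 0)
            (𝓝 (-(w / e j))) := by
          have : Continuous (fun t : ℝ => (-(w / e j) + (t / t₀ : ℝ) : ℂ)) := by fun_prop
          simpa using (this.tendsto 0).mono_left nhdsWithin_le_nhds
        have h5 := ((Complex.continuousAt_arg hw).tendsto).comp h4
        refine h5.congr' ?_
        filter_upwards [self_mem_nhdsWithin] with t ht
        rw [mem_Ioi] at ht
        simp only [Function.comp, Complex.log_im]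
        have h6 : (p + t₀ * w - (p + t * e j)) / (p - (p + t * e j))
            = ((t₀ / t : ℝ) : ℂ) * (-(w / e j) + (t / t₀ : ℝ)) := by
          have := he0 j
          have h7 : (t : ℂ) ≠ 0 := by exact_mod_cast ht.ne'
          have h8 : (t₀ : ℂ) ≠ 0 := by exact_mod_cast ht₀.ne'
          rw [show p - (p + t * e j) = -(t * e j) by ring]
          push_cast
          field_simp
          ring
        rw [h6, Complex.arg_real_mul _ (by positivity)]
      have := (hg1.add (harg _ h1)).sub (harg _ h3)
      simpa only [hF, hadef, hbdef, Complex.add_im, Complex.sub_im] using this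
    have hzero : ∀ j : Fin 4, (-1 : ℝ) ^ (j : ℕ) = 1 →
        ∀ᶠ t : ℝ in 𝓝[>] 0, (F (p + t * e j)).im = 0 := by
      intro j hj
      filter_upwards [Ioc_mem_nhdsGT ht₀] with t ht
      have h1 := hray t ht.1 ht.2 j
      rw [hj, one_mul] at h1
      have h2 := hcon _ h1
      simp only [hn] at h2
      exact (div_eq_zero_iff.1 h2).resolve_right Real.two_pi_pos.ne'
    have hrat : ∀ i j : ℕ, -(e i / e j) = Complex.exp (((i - j : ℝ) * α - Real.pi : ℝ) * Complex.I) ∧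
        -(e i / e j) = Complex.exp (((i - j : ℝ) * α + Real.pi : ℝ) * Complex.I) := by
      intro i j
      have h1 : e i / e j = Complex.exp (((i - j : ℝ) * α : ℝ) * Complex.I) := by
        simp only [he]
        rw [← Complex.exp_sub]
        congr 1
        push_cast
        ring
      rw [h1]
      constructor
      · rw [Complex.ofReal_sub, sub_mul _ (Real.pi : ℂ), Complex.exp_sub, Complex.exp_pi_mul_I, div_neg, div_one]
      · rw [Complex.ofReal_add, add_mul, Complex.exp_add, Complex.exp_pi_mul_I, mul_neg, mul_one]
    have hargs : ∀ β : ℝ, -Real.pi < β → β < Real.pi →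
        Complex.exp (β * Complex.I) ∈ Complex.slitPlane ∧ (Complex.exp (β * Complex.I)).arg = β := by
      intro β h1 h2
      have h3 : (Complex.exp (β * Complex.I)).arg = β := by
        rw [Complex.arg_exp_mul_I, toIocMod_eq_self]
        exact ⟨h1, by linarith⟩
      exact ⟨Complex.mem_slitPlane_iff_arg.2 ⟨by rw [h3]; exact h2.ne, Complex.exp_ne_zero _⟩, h3⟩
    have hpi := Real.pi_pos
    have k10 := hargs ((((1 : ℕ) - (0 : ℕ) : ℝ)) * α - Real.pi) (by push_cast; linarith)
      (by push_cast; linarith)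
    have k30 := hargs ((((3 : ℕ) - (0 : ℕ) : ℝ)) * α - Real.pi) (by push_cast; linarith)
      (by push_cast; linarith)
    have k12 := hargs ((((1 : ℕ) - (2 : ℕ) : ℝ)) * α + Real.pi) (by push_cast; linarith)
      (by push_cast; linarith)
    have k32 := hargs ((((3 : ℕ) - (2 : ℕ) : ℝ)) * α - Real.pi) (by push_cast; linarith)
      (by push_cast; linarith)
    rw [← (hrat _ _).1] at k10 k30 k32
    rw [← (hrat _ _).2] at k12
    have l0 := tendsto_nhds_unique_of_eventuallyEq (hlim 0 k10.1 k30.1) tendsto_const_nhds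
      (hzero 0 (by simp))
    have l2 := tendsto_nhds_unique_of_eventuallyEq (hlim 2 k12.1 k32.1) tendsto_const_nhds
      (hzero 2 (by simp))
    rw [k10.2, k30.2] at l0
    rw [k12.2, k32.2] at l2
    push_cast at l0 l2
    linarith
  set P := connectedComponentIn {z | z ∈ Ω ∧ 0 < v z} z₀ with hP
  have hPsub : P ⊆ {z | z ∈ Ω ∧ 0 < v z} := connectedComponentIn_subset _ _
  have hz₀P : z₀ ∈ P := mem_connectedComponentIn hz₀
  have hclJ : ∀ z ∈ closure P, z ∉ J → n z ≠ 0 := by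
    intro z hz hzJ
    have h1 : IsPreconnected (insert z P) :=
      isPreconnected_connectedComponentIn.subset_closure (subset_insert _ _)
        (insert_subset hz subset_closure)
    rw [hconst h1 (insert_subset hzJ fun w hw => hposJ w (hPsub hw)) (mem_insert _ _)
      (mem_insert_of_mem _ hz₀P)]
    exact hn0
  have hclΩ : closure P ⊆ Ω := by
    intro z hz
    by_contra hzΩ
    exact hclJ z hz (fun h => hzΩ (hJs z h).1) (hout z hzΩ)
  have hbdd : Bornology.IsBounded P := by
    refine isBounded_iff_forall_norm_le.2 ⟨R, fun z hz => ?_⟩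
    by_contra h
    exact hclJ z (subset_closure hz) (hposJ z (hPsub hz)) (hR z (not_le.1 h))
  refine ⟨P, (hv.isOpen_inter_preimage hΩ isOpen_Ioi).connectedComponentIn, ⟨z₀, hz₀P⟩,
    fun z hz => (hPsub hz).2, hbdd.isCompact_closure, hclΩ, fun z hz => ?_⟩
  exact frontier_connectedComponentIn_eq_zero hΩ hv hz (hclΩ (frontier_subset_closure hz)) hz₀

lemma straighten_injOn : InjOn straighten H2 := fun a ha b hb h => by
  rw [← unstraighten_straighten ha, h, unstraighten_straighten hb]

lemma eq_zero_of_forall_mul_le {d B : ℝ} (h : ∀ t : ℝ, 1 ≤ t → |t * d| ≤ B) : d = 0 := by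
  by_contra hd
  have hd' : 0 < |d| := abs_pos.2 hd
  have h1 := h (max 1 (B / |d| + 1)) (le_max_left _ _)
  rw [abs_mul, abs_of_pos (lt_of_lt_of_le one_pos (le_max_left _ _))] at h1
  have h2 : (B / |d| + 1) * |d| ≤ B :=
    (mul_le_mul_of_nonneg_right (le_max_right _ _) hd'.le).trans h1
  rw [add_mul, div_mul_cancel₀ _ hd'.ne'] at h2
  linarith

/-- The complement of a geodesically convex domain has only unbounded components. -/
lemma exists_unbounded_preconnected_compl {Ω : Set (ℝ × ℝ)} (hΩ : Ω ⊆ H2)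
    (hconv : Convex ℝ (straighten '' Ω)) {p q : ℝ × ℝ} (hp : p ∈ Ω) (hq : q ∉ Ω) :
    ∃ S ⊆ Ωᶜ, q ∈ S ∧ IsPreconnected S ∧ ¬ Bornology.IsBounded S := by
  set L : Set (ℝ × ℝ) := {z | z.2 ≤ 0} with hL
  have hLΩ : L ⊆ Ωᶜ := fun z hz hzΩ => absurd (show z.2 ≤ 0 from hz) (not_le.2 (hΩ hzΩ))
  have hLc : IsPreconnected L := by
    have : Convex ℝ L := convex_halfSpace_le (LinearMap.snd ℝ ℝ ℝ).isLinear 0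
    exact this.isPreconnected
  have hLb : ¬ Bornology.IsBounded L := by
    intro h
    obtain ⟨R, hR⟩ := isBounded_iff_forall_norm_le.1 h
    have h1 := hR (|R| + 1, 0) (show (0 : ℝ) ≤ 0 from le_rfl)
    have h2 := (norm_fst_le ((|R| + 1, 0) : ℝ × ℝ)).trans h1
    rw [Real.norm_of_nonneg (by positivity)] at h2
    linarith [le_abs_self R]
  by_cases hq2 : q.2 ≤ 0
  · exact ⟨L, hLΩ, hq2, hLc, hLb⟩
  have hqH : q ∈ H2 := not_le.1 hq2
  set w : ℝ → ℝ × ℝ := fun t => straighten p + t • (straighten q - straighten p) with hw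
  set z : ℝ → ℝ × ℝ := fun t => unstraighten (w t) with hz
  have hzc : Continuous z := continuous_unstraighten.comp (by fun_prop)
  set T := z '' Ici 1 with hT
  have hTc : IsPreconnected T := isPreconnected_Ici.image _ hzc.continuousOn
  have hqT : q ∈ T := ⟨1, self_mem_Ici, by simp [hz, hw, unstraighten_straighten hqH]⟩
  have hTΩ : T ⊆ Ωᶜ := by
    rintro _ ⟨t, ht, rfl⟩ hzΩ
    have ht' : (1 : ℝ) ≤ t := ht
    have h1 : (w t).1 ^ 2 < (w t).2 := by
      have : 0 < Real.sqrt ((w t).2 - (w t).1 ^ 2) := hΩ hzΩ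
      linarith [Real.sqrt_pos.1 this]
    have h2 : w t ∈ straighten '' Ω := ⟨_, hzΩ, straighten_unstraighten h1.le⟩
    have h3 := hconv (mem_image_of_mem _ hp) h2 (a := 1 - 1 / t) (b := 1 / t)
      (by rw [sub_nonneg, div_le_one (by linarith)]; exact ht') (by positivity) (by ring)
    have h4 : (1 - 1 / t) • straighten p + (1 / t) • w t = straighten q := by
      have : (1 / t) * t = 1 := by field_simp
      simp only [hw, smul_add, smul_smul, this]
      module
    rw [h4] at h3
    obtain ⟨q', hq', hqq⟩ := h3
    exact hq (straighten_injOn (hΩ hq') hqH hqq ▸ hq')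
  by_cases hex : ∃ t, 1 ≤ t ∧ (w t).2 ≤ (w t).1 ^ 2
  · obtain ⟨t, ht, hwt⟩ := hex
    refine ⟨T ∪ L, union_subset hTΩ hLΩ, Or.inl hqT, ?_, fun h => hLb (h.subset subset_union_right)⟩
    refine IsPreconnected.union (z t) ⟨t, ht, rfl⟩ ?_ hTc hLc
    show Real.sqrt ((w t).2 - (w t).1 ^ 2) ≤ 0
    rw [Real.sqrt_eq_zero_of_nonpos (by linarith)]
  · push Not at hex
    refine ⟨T, hTΩ, hqT, hTc, fun hb => hq ?_⟩
    obtain ⟨R, hR⟩ := isBounded_iff_forall_norm_le.1 hb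
    have hR' : ∀ t, 1 ≤ t → |(w t).1| ≤ R ∧ |(w t).2| ≤ 2 * R ^ 2 := by
      intro t ht
      have h1 := hR (z t) ⟨t, ht, rfl⟩
      have h2 := (norm_fst_le _).trans h1
      have h3 := (norm_snd_le _).trans h1
      simp only [hz, unstraighten, Real.norm_eq_abs] at h2 h3
      have h4 := hex t ht
      have h5 : Real.sqrt ((w t).2 - (w t).1 ^ 2) ^ 2 ≤ R ^ 2 := by
        rw [← sq_abs]; exact pow_le_pow_left₀ (abs_nonneg _) h3 2
      have h6 : (w t).1 ^ 2 ≤ R ^ 2 := by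
        rw [← sq_abs]; exact pow_le_pow_left₀ (abs_nonneg _) h2 2
      rw [Real.sq_sqrt (by linarith)] at h5
      refine ⟨h2, ?_⟩
      rw [abs_of_nonneg (by nlinarith [sq_nonneg (w t).1])]
      linarith
    have e1 : (straighten q - straighten p).1 = 0 := by
      refine eq_zero_of_forall_mul_le (B := R + |(straighten p).1|) fun t ht => ?_
      have h1 := (hR' t ht).1
      have h2 : t * (straighten q - straighten p).1 = (w t).1 - (straighten p).1 := by
        simp [hw]
      rw [h2]
      exact (abs_sub _ _).trans (by linarith)
    have e2 : (straighten q - straighten p).2 = 0 := by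
      refine eq_zero_of_forall_mul_le (B := 2 * R ^ 2 + |(straighten p).2|) fun t ht => ?_
      have h1 := (hR' t ht).2
      have h2 : t * (straighten q - straighten p).2 = (w t).2 - (straighten p).2 := by
        simp [hw]
      rw [h2]
      exact (abs_sub _ _).trans (by linarith)
    have h3 : straighten q = straighten p := sub_eq_zero.1 (Prod.ext e1 e2)
    exact straighten_injOn hqH (hΩ hp) h3 ▸ hp

lemma cplx_eq (p z : ℝ × ℝ) :
    cplx p z = Complex.equivRealProdCLM.symm z - Complex.equivRealProdCLM.symm p := by
  apply Complex.ext <;> rfl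

lemma norm_equivRealProdCLM_sub_le (a b : ℂ) :
    ‖Complex.equivRealProdCLM a - Complex.equivRealProdCLM b‖ ≤ ‖a - b‖ := by
  rw [← map_sub]
  exact max_le (Complex.abs_re_le_norm (a - b)) (Complex.abs_im_le_norm (a - b))

/-- Along suitable rays a function with leading term `Re (c zᵏ)` alternates in sign. -/
lemma exists_alternating_rays {v : ℝ × ℝ → ℝ} {p : ℝ × ℝ} {k : ℕ} (hk : 2 ≤ k) {c : ℂ}
    (hc : c ≠ 0)
    (hexp : (fun z => v z - (c * cplx p z ^ k).re) =O[𝓝 p] (fun z => ‖z - p‖ ^ (k + 1))) :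
    ∃ θ : ℝ, ∃ t₀ : ℝ, 0 < t₀ ∧ ∀ t : ℝ, 0 < t → t ≤ t₀ → ∀ j : ℕ,
      0 < (-1) ^ j * v (Complex.equivRealProdCLM (Complex.equivRealProdCLM.symm p +
        t * Complex.exp ((θ + j * (Real.pi / k) : ℝ) * Complex.I))) := by
  set φ := Complex.equivRealProdCLM with hφ
  obtain ⟨C, hC⟩ := hexp.bound
  obtain ⟨δ, hδ, hball⟩ := Metric.eventually_nhds_iff.1 hC
  have hcpos : 0 < ‖c‖ := norm_pos_iff.2 hc
  have hk0 : (k : ℝ) ≠ 0 := by positivity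
  refine ⟨-c.arg / k, min (δ / 2) (‖c‖ / (2 * (|C| + 1))), by positivity, fun t ht ht' j => ?_⟩
  set E := Complex.exp ((-c.arg / k + j * (Real.pi / k) : ℝ) * Complex.I) with hE
  set z := φ (φ.symm p + t * E) with hz
  have hEn : ‖E‖ = 1 := Complex.norm_exp_ofReal_mul_I _
  have hcz : cplx p z = t * E := by rw [cplx_eq, hz, ← hφ, φ.symm_apply_apply, add_sub_cancel_left]
  have hzp : ‖z - p‖ ≤ t := by
    refine (norm_sub_le_norm_cplx z).trans ?_
    rw [hcz, norm_mul, hEn, mul_one, Complex.norm_real, Real.norm_of_nonneg ht.le]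
  have hEk : c * E ^ k = ‖c‖ * (-1) ^ j := by
    conv_lhs => rw [← Complex.norm_mul_exp_arg_mul_I c]
    rw [hE, ← Complex.exp_nat_mul, mul_assoc, ← Complex.exp_add, ← Complex.exp_pi_mul_I,
      ← Complex.exp_nat_mul]
    congr 2
    have : (k : ℂ) ≠ 0 := by exact_mod_cast hk0
    push_cast
    field_simp
    ring
  have hre : (c * cplx p z ^ k).re = (-1) ^ j * (‖c‖ * t ^ k) := by
    rw [hcz, mul_pow, show c * ((t : ℂ) ^ k * E ^ k) = t ^ k * (c * E ^ k) by ring, hEk]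
    rw [show (t : ℂ) ^ k * (‖c‖ * (-1) ^ j) = (((-1) ^ j * (‖c‖ * t ^ k) : ℝ) : ℂ) by
      push_cast; ring, Complex.ofReal_re]
  have h1 := hball (y := z) (by
    rw [dist_eq_norm]
    have := ht'.trans (min_le_left _ _)
    linarith)
  rw [hre, Real.norm_eq_abs, Real.norm_of_nonneg (by positivity)] at h1
  have h2 : |v z - (-1) ^ j * (‖c‖ * t ^ k)| < ‖c‖ * t ^ k := by
    refine h1.trans_lt ?_
    have h3 : C * ‖z - p‖ ^ (k + 1) ≤ |C| * t ^ (k + 1) :=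
      mul_le_mul (le_abs_self C) (pow_le_pow_left₀ (norm_nonneg _) hzp _) (by positivity)
        (abs_nonneg _)
    have h4 : t * (2 * (|C| + 1)) ≤ ‖c‖ := by
      have := ht'.trans (min_le_right _ _)
      rwa [le_div_iff₀ (by positivity)] at this
    have h5 : |C| * t < ‖c‖ := by nlinarith [abs_nonneg C]
    have h6 : 0 < t ^ k := by positivity
    calc _ ≤ _ := h3
      _ = (|C| * t) * t ^ k := by ring
      _ < _ := mul_lt_mul_of_pos_right h5 h6
  rw [abs_lt] at h2
  rcases neg_one_pow_eq_or ℝ j with h | h <;> rw [h] at h2 ⊢ <;> linarith [h2.1, h2.2]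

/-- Near a saddle zero, either two different components of the negative set touch `p`, or some
positive component is compactly contained in `Ω`. -/
lemma exists_two_negative_components {Ω : Set (ℝ × ℝ)} {v : ℝ × ℝ → ℝ} {p : ℝ × ℝ} {k : ℕ}
    {c : ℂ} (hΩ : Ω ⊆ H2) (hopen : IsOpen Ω) (hconv : Convex ℝ (straighten '' Ω))
    (hv : ContinuousOn v Ω) (hp : p ∈ Ω) (hvp : v p = 0) (hk : 2 ≤ k) (hc : c ≠ 0)
    (hexp : (fun z => v z - (c * cplx p z ^ k).re) =O[𝓝 p] (fun z => ‖z - p‖ ^ (k + 1)))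
    (hno : ∀ P : Set (ℝ × ℝ), IsOpen P → P.Nonempty → (∀ z ∈ P, 0 < v z) →
      IsCompact (closure P) → closure P ⊆ Ω → (∀ z ∈ frontier P, v z = 0) → False) :
    ∃ a b, (a ∈ Ω ∧ v a < 0) ∧ (b ∈ Ω ∧ v b < 0) ∧
      p ∈ closure (connectedComponentIn {z | z ∈ Ω ∧ v z < 0} a) ∧
      p ∈ closure (connectedComponentIn {z | z ∈ Ω ∧ v z < 0} b) ∧
      b ∉ connectedComponentIn {z | z ∈ Ω ∧ v z < 0} a := by
  set φ := Complex.equivRealProdCLM with hφ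
  obtain ⟨θ, t₁, ht₁, hray⟩ := exists_alternating_rays hk hc hexp
  set α : ℝ := Real.pi / k with hα
  have hk0 : (0 : ℝ) < k := by positivity
  have hα0 : 0 < α := by positivity
  have hα2 : α ≤ Real.pi / 2 := by
    have : (2 : ℝ) ≤ k := by exact_mod_cast hk
    exact div_le_div_of_nonneg_left Real.pi_pos.le (by norm_num) this
  set r : ℕ → ℝ → ℂ := fun j t =>
    φ.symm p + t * Complex.exp ((θ + j * α : ℝ) * Complex.I) with hr
  obtain ⟨δ, hδ, hball⟩ := Metric.isOpen_iff.1 hopen p hp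
  have hmem : ∀ j t, 0 ≤ t → t < δ → φ (r j t) ∈ Ω := by
    intro j t ht htδ
    apply hball
    rw [Metric.mem_ball, dist_eq_norm]
    have := norm_equivRealProdCLM_sub_le (r j t) (φ.symm p)
    rw [← hφ, φ.apply_symm_apply] at this
    refine this.trans_lt ?_
    simp only [hr, add_sub_cancel_left, norm_mul, Complex.norm_exp_ofReal_mul_I, mul_one,
      Complex.norm_real, Real.norm_of_nonneg ht]
    exact htδ
  set t₀ := min t₁ (δ / 2) with ht₀
  have ht₀p : 0 < t₀ := by positivity
  have hlt : t₀ < δ := (min_le_right _ _).trans_lt (by linarith)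
  have hneg : ∀ j : ℕ, (-1 : ℝ) ^ j = -1 → ∀ t, 0 < t → t ≤ t₀ →
      φ (r j t) ∈ Ω ∧ v (φ (r j t)) < 0 := by
    intro j hj t ht ht'
    have := hray t ht (ht'.trans (min_le_left _ _)) j
    rw [hj] at this
    exact ⟨hmem j t ht.le (ht'.trans_lt hlt), by simp only [hr]; linarith⟩
  have hcl : ∀ j : ℕ, (-1 : ℝ) ^ j = -1 →
      p ∈ closure (connectedComponentIn {z | z ∈ Ω ∧ v z < 0} (φ (r j t₀))) := by
    intro j hj
    have hcont : Continuous fun t => φ (r j t) := by simp only [hr]; fun_prop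
    have hsub : (fun t => φ (r j t)) '' Ioc 0 t₀ ⊆
        connectedComponentIn {z | z ∈ Ω ∧ v z < 0} (φ (r j t₀)) := by
      refine (isPreconnected_Ioc.image _ hcont.continuousOn).subset_connectedComponentIn
        ⟨t₀, right_mem_Ioc.2 ht₀p, rfl⟩ ?_
      rintro _ ⟨t, ht, rfl⟩
      exact hneg j hj t ht.1 ht.2
    have h0 : Tendsto (fun t => φ (r j t)) (𝓝[>] 0) (𝓝 p) := by
      have := (hcont.tendsto 0).mono_left (nhdsWithin_le_nhds (s := Ioi 0))
      simpa [hr] using this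
    refine mem_closure_of_tendsto h0 ?_
    filter_upwards [Ioc_mem_nhdsGT ht₀p] with t ht using hsub ⟨t, ht, rfl⟩
  have m1 : (-1 : ℝ) ^ 1 = -1 := by norm_num
  have m3 : (-1 : ℝ) ^ 3 = -1 := by norm_num
  have hNo : IsOpen {z | z ∈ Ω ∧ v z < 0} := hv.isOpen_inter_preimage hopen isOpen_Iio
  refine ⟨φ (r 1 t₀), φ (r 3 t₀), hneg 1 m1 t₀ ht₀p le_rfl, hneg 3 m3 t₀ ht₀p le_rfl,
    hcl 1 m1, hcl 3 m3, fun hb => ?_⟩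
  set D := connectedComponentIn {z | z ∈ Ω ∧ v z < 0} (φ (r 1 t₀)) with hD
  have hDsub : D ⊆ {z | z ∈ Ω ∧ v z < 0} := connectedComponentIn_subset _ _
  set H : ℂ ≃ₜ ℝ × ℝ := φ.toHomeomorph with hH
  have hHe : ∀ z, H z = φ z := fun _ => rfl
  obtain ⟨P, hPo, hPn, hPpos, hPc, hPΩ, hPf⟩ := exists_compact_positive_component
    (Ω := H ⁻¹' Ω) (N := H ⁻¹' D) (v := v ∘ H) (p := φ.symm p) (θ := θ) (α := α) (t₀ := t₀)
    (hopen.preimage H.continuous) (fun q hq => by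
      obtain ⟨S, hS, hqS, hSc, hSb⟩ := exists_unbounded_preconnected_compl hΩ hconv hp hq
      refine ⟨H ⁻¹' S, fun z hz => hS hz, hqS, ?_, fun hb => hSb ?_⟩
      · rw [← H.image_symm]
        exact hSc.image _ H.symm.continuous.continuousOn
      · have h1 := (φ : ℂ →L[ℝ] ℝ × ℝ).lipschitz.isBounded_image hb
        have h2 : (φ : ℂ →L[ℝ] ℝ × ℝ) '' (H ⁻¹' S) = S := H.toEquiv.image_preimage S
        rwa [h2] at h1)
    (hv.comp H.continuous.continuousOn fun z hz => hz)
    (by show φ (φ.symm p) ∈ Ω; rwa [φ.apply_symm_apply])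
    (by show v (φ (φ.symm p)) = 0; rwa [φ.apply_symm_apply])
    (hNo.connectedComponentIn.preimage H.continuous)
    (by
      rw [← H.image_symm]
      exact isPreconnected_connectedComponentIn.image _ H.symm.continuous.continuousOn)
    (fun z hz => hDsub hz) hα0 hα2 ht₀p
    (fun t ht ht' j => ⟨hmem j t ht.le (ht'.trans_lt hlt),
      hray t ht (ht'.trans (min_le_left _ _)) j⟩)
    (mem_connectedComponentIn (hneg 1 m1 t₀ ht₀p le_rfl)) hb
  have hcls : closure (H.symm ⁻¹' P) = H.symm ⁻¹' closure P := (H.symm.preimage_closure P).symm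
  have hfr : frontier (H.symm ⁻¹' P) = H.symm ⁻¹' frontier P := (H.symm.preimage_frontier P).symm
  refine hno (H.symm ⁻¹' P) (hPo.preimage H.symm.continuous) ?_ ?_ ?_ ?_ ?_
  · obtain ⟨z, hz⟩ := hPn
    exact ⟨H z, by simpa using hz⟩
  · intro z hz
    simpa using hPpos _ hz
  · rw [hcls]
    exact H.symm.isCompact_preimage.2 hPc
  · rw [hcls]
    intro z hz
    simpa using hPΩ hz
  · rw [hfr]
    intro z hz
    simpa using hPf _ hz

lemma second_deriv_nonpos_of_isLocalMax {g g' : ℝ → ℝ} {g2 t : ℝ}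
    (hg : ∀ᶠ s in 𝓝 t, HasDerivAt g (g' s) s) (hg' : HasDerivAt g' g2 t)
    (hmax : IsLocalMax g t) : g2 ≤ 0 := by
  by_contra hpos
  have h1 : deriv g =ᶠ[𝓝 t] g' := by filter_upwards [hg] with s hs using hs.deriv
  have h2 : deriv (deriv g) t = g2 := by rw [h1.deriv_eq, hg'.deriv]
  have hmin := isLocalMin_of_deriv_deriv_pos (f := g) (x₀ := t) (by rw [h2]; linarith)
    hmax.deriv_eq_zero hg.self_of_nhds.continuousAt
  have h3 : g =ᶠ[𝓝 t] fun _ => g t := by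
    filter_upwards [hmax, hmin] with s h4 h5 using le_antisymm h4 h5
  have h4 : deriv g =ᶠ[𝓝 t] fun _ => 0 := by
    filter_upwards [h3.eventually_nhds] with s hs
    rw [EventuallyEq.deriv_eq hs, deriv_const]
  rw [h4.deriv_eq, deriv_const] at h2
  linarith

lemma second_fderiv_le_of_isLocalMax {v : ℝ × ℝ → ℝ} {z₀ e : ℝ × ℝ} {h h' : ℝ → ℝ} {h2 : ℝ}
    (hv : ContDiffAt ℝ (⊤ : ℕ∞) v z₀) (hh : ∀ᶠ s in 𝓝 0, HasDerivAt h (h' s) s)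
    (hh' : HasDerivAt h' h2 0) (hmax : IsLocalMax (fun t : ℝ => v (z₀ + t • e) - h t) 0) :
    fderiv ℝ (fun z => fderiv ℝ v z e) z₀ e ≤ h2 := by
  have hline : ∀ t : ℝ, HasDerivAt (fun t : ℝ => z₀ + t • e) e t := fun t =>
    (((hasDerivAt_id t).smul_const e).const_add z₀).congr_deriv (by simp)
  have hcont : Tendsto (fun t : ℝ => z₀ + t • e) (𝓝 0) (𝓝 z₀) := by
    have := (hline 0).continuousAt.tendsto
    simpa using this
  have h1 : ∀ᶠ t in 𝓝 (0 : ℝ),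
      HasDerivAt (fun t : ℝ => v (z₀ + t • e) - h t) (fderiv ℝ v (z₀ + t • e) e - h' t) t := by
    filter_upwards [hcont.eventually hv.eventually_differentiableAt, hh] with t ht hht
    exact (ht.hasFDerivAt.comp_hasDerivAt t (hline t)).sub hht
  have h3 : DifferentiableAt ℝ (fun z => fderiv ℝ v z e) (z₀ + (0 : ℝ) • e) := by
    simpa using (hv.fderiv_apply_const e).differentiableAt (by simp)
  have h4 := (h3.hasFDerivAt.comp_hasDerivAt 0 (hline 0)).sub hh'
  have := second_deriv_nonpos_of_isLocalMax h1 h4 hmax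
  simp only [zero_smul, add_zero] at this
  linarith

/-- A positive eigenfunction with eigenvalue at most `1/4` cannot vanish on the boundary of a
relatively compact open set. -/
lemma false_of_positive_on_compact {Ω P : Set (ℝ × ℝ)} {v : ℝ × ℝ → ℝ} {μ : ℝ}
    (hμ : μ ≤ 1 / 4) (hΩ : Ω ⊆ H2) (hopen : IsOpen Ω) (hv : ContDiffOn ℝ (⊤ : ℕ∞) v Ω)
    (heq : ∀ z ∈ Ω, pdx (pdx v) z + pdy (pdy v) z = -(μ / z.2 ^ 2) * v z)
    (hPo : IsOpen P) (hPn : P.Nonempty) (hpos : ∀ z ∈ P, 0 < v z)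
    (hPc : IsCompact (closure P)) (hPΩ : closure P ⊆ Ω) (hfr : ∀ z ∈ frontier P, v z = 0) :
    False := by
  obtain ⟨R, hR⟩ := isBounded_iff_forall_norm_le.1 hPc.isBounded
  set M := R ^ 2 + 1 with hM
  have hMx : ∀ z ∈ closure P, z.1 ^ 2 < M := by
    intro z hz
    have h1 := (norm_fst_le z).trans (hR z hz)
    rw [Real.norm_eq_abs] at h1
    have : z.1 ^ 2 ≤ R ^ 2 := by
      rw [← sq_abs]; exact pow_le_pow_left₀ (abs_nonneg _) h1 2
    linarith
  set G : ℝ × ℝ → ℝ := fun z => Real.sqrt z.2 * (M - z.1 ^ 2) with hG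
  have hGpos : ∀ z ∈ closure P, 0 < G z := fun z hz =>
    mul_pos (Real.sqrt_pos.2 (hΩ (hPΩ hz))) (sub_pos.2 (hMx z hz))
  have hGc : Continuous G := by simp only [hG]; fun_prop
  obtain ⟨z₁, hz₁⟩ := hPn
  obtain ⟨z₀, hz₀, hmax⟩ := hPc.exists_isMaxOn ⟨z₁, subset_closure hz₁⟩
    (f := fun z => v z / G z)
    ((hv.continuousOn.mono hPΩ).div hGc.continuousOn fun z hz => (hGpos z hz).ne')
  set l := v z₀ / G z₀ with hl
  have hl0 : 0 < l :=
    (div_pos (hpos z₁ hz₁) (hGpos z₁ (subset_closure hz₁))).trans_le (hmax (subset_closure hz₁))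
  have hz₀P : z₀ ∈ P := by
    by_contra hnot
    have : v z₀ = 0 := hfr z₀ ⟨hz₀, by rwa [hPo.interior_eq]⟩
    rw [hl, this, zero_div] at hl0
    exact lt_irrefl _ hl0
  have hy : 0 < z₀.2 := hΩ (hPΩ hz₀)
  have hv0 : v z₀ = l * G z₀ := by rw [hl, div_mul_cancel₀ _ (hGpos z₀ hz₀).ne']
  have hlm : ∀ e : ℝ × ℝ, ∀ᶠ t in 𝓝 (0 : ℝ), v (z₀ + t • e) - l * G (z₀ + t • e) ≤ 0 := by
    intro e
    have hcont : Tendsto (fun t : ℝ => z₀ + t • e) (𝓝 0) (𝓝 z₀) := by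
      have : Continuous (fun t : ℝ => z₀ + t • e) := by fun_prop
      simpa using this.tendsto 0
    filter_upwards [hcont.eventually (hPo.mem_nhds hz₀P)] with t ht
    have h1 : v (z₀ + t • e) / G (z₀ + t • e) ≤ l := hmax (subset_closure ht)
    rw [div_le_iff₀ (hGpos _ (subset_closure ht))] at h1
    linarith
  have hvs : ContDiffAt ℝ (⊤ : ℕ∞) v z₀ := hv.contDiffAt (hopen.mem_nhds (hPΩ hz₀))
  have hx : pdx (pdx v) z₀ ≤ l * (Real.sqrt z₀.2 * (-2)) := by
    refine second_fderiv_le_of_isLocalMax (e := ((1, 0) : ℝ × ℝ)) hvs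
      (h := fun t => l * (Real.sqrt z₀.2 * (M - (z₀.1 + t) ^ 2)))
      (h' := fun t => l * (Real.sqrt z₀.2 * (-2 * (z₀.1 + t)))) (Eventually.of_forall fun t => ?_) ?_ ?_
    · exact ((((((hasDerivAt_id t).const_add z₀.1).pow 2).const_sub M).const_mul _).const_mul
        l).congr_deriv (by simp)
    · exact ((((hasDerivAt_id (0 : ℝ)).const_add z₀.1).const_mul (-2)).const_mul _).const_mul
        l |>.congr_deriv (by simp)
    · filter_upwards [hlm (1, 0)] with t ht
      simp only [hG, Prod.fst_add, Prod.snd_add, Prod.smul_fst, Prod.smul_snd, smul_eq_mul, mul_one,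
        mul_zero, add_zero] at ht ⊢
      rw [zero_smul, add_zero]
      simp only [hG] at hv0
      linarith
  have hy' : pdy (pdy v) z₀ ≤ l * ((M - z₀.1 ^ 2) * (-(1 / (4 * z₀.2 * Real.sqrt z₀.2)))) := by
    refine second_fderiv_le_of_isLocalMax (e := ((0, 1) : ℝ × ℝ)) hvs
      (h := fun t => l * ((M - z₀.1 ^ 2) * Real.sqrt (z₀.2 + t)))
      (h' := fun t => l * ((M - z₀.1 ^ 2) * (1 / (2 * Real.sqrt (z₀.2 + t))))) ?_ ?_ ?_
    · filter_upwards [Ioi_mem_nhds (show -z₀.2 < 0 by linarith)] with t ht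
      have ht' : 0 < z₀.2 + t := by linarith [mem_Ioi.1 ht]
      exact ((((hasDerivAt_id t).const_add z₀.2).sqrt ht'.ne').const_mul _).const_mul l
    · have h1 : HasDerivAt (fun t => Real.sqrt (z₀.2 + t)) (1 / (2 * Real.sqrt (z₀.2 + 0))) 0 :=
        ((hasDerivAt_id (0 : ℝ)).const_add z₀.2).sqrt (by simpa using hy.ne')
      have h2 : 2 * Real.sqrt (z₀.2 + 0) ≠ 0 := by
        have := Real.sqrt_pos.2 hy
        simp [this.ne']
      have h3 := (((hasDerivAt_const (0 : ℝ) (1 : ℝ)).div (h1.const_mul 2) h2).const_mul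
        (M - z₀.1 ^ 2)).const_mul l
      refine h3.congr_deriv ?_
      simp only [add_zero]
      have h4 := Real.sqrt_pos.2 hy
      have h5 := Real.sq_sqrt hy.le
      congr 2
      field_simp
      rw [h5]
      ring
    · filter_upwards [hlm (0, 1)] with t ht
      simp only [hG, Prod.fst_add, Prod.snd_add, Prod.smul_fst, Prod.smul_snd, smul_eq_mul, mul_one,
        mul_zero, add_zero] at ht ⊢
      rw [zero_smul, add_zero]
      simp only [hG] at hv0
      linarith
  have h1 := heq z₀ (hPΩ hz₀)
  have hs := Real.sqrt_pos.2 hy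
  have hs2 := Real.sq_sqrt hy.le
  have hA : 0 < M - z₀.1 ^ 2 := sub_pos.2 (hMx z₀ hz₀)
  have h2 : (pdx (pdx v) z₀ + pdy (pdy v) z₀) * z₀.2 ^ 2 = -μ * v z₀ := by
    rw [h1]; field_simp
  have h3 : (l * ((M - z₀.1 ^ 2) * (-(1 / (4 * z₀.2 * Real.sqrt z₀.2))))) * z₀.2 ^ 2 =
      -(1 / 4) * v z₀ := by
    rw [hv0, hG]
    field_simp
    rw [hs2]
  have h4 : 0 < v z₀ := hpos z₀ hz₀P
  have h5 : 0 < l * Real.sqrt z₀.2 * z₀.2 ^ 2 := by positivity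
  have h6 : (pdx (pdx v) z₀ + pdy (pdy v) z₀) * z₀.2 ^ 2 ≤
      (l * (Real.sqrt z₀.2 * (-2)) +
        l * ((M - z₀.1 ^ 2) * (-(1 / (4 * z₀.2 * Real.sqrt z₀.2))))) * z₀.2 ^ 2 :=
    mul_le_mul_of_nonneg_right (add_le_add hx hy') (by positivity)
  rw [h2, add_mul, h3] at h6
  nlinarith

open scoped NNReal Manifold in
lemma exists_smooth_cutoff {K U : Set (ℝ × ℝ)} (hK : IsCompact K) (hU : IsOpen U) (hKU : K ⊆ U) :
    ∃ B : ℝ × ℝ → ℝ, ContDiff ℝ (⊤ : ℕ∞) B ∧ HasCompactSupport B ∧ tsupport B ⊆ U ∧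
      (∀ᶠ z in 𝓝ˢ K, B z = 1) ∧ ∀ z, B z ∈ Icc (0 : ℝ) 1 := by
  obtain ⟨L, hL, hKL, hLU⟩ := exists_compact_between hK hU hKU
  obtain ⟨f, hf1, hf0, hf⟩ := exists_contMDiffMap_one_nhds_of_subset_interior
    (n := (⊤ : ℕ∞)) 𝓘(ℝ, ℝ × ℝ) hK.isClosed hKL
  have hsupp : tsupport f ⊆ L := closure_minimal
    (fun z hz => by_contra fun h => hz (hf0 z h)) hL.isClosed
  exact ⟨f, f.contMDiff.contDiff, hL.of_isClosed_subset (isClosed_tsupport _) hsupp,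
    hsupp.trans hLU, hf1, hf⟩

open scoped NNReal in
lemma LipschitzWith.mul_of_bounded {g h : ℝ × ℝ → ℝ} {C D : ℝ≥0} (hg : LipschitzWith C g)
    (hh : LipschitzWith D h) (hg1 : ∀ z, |g z| ≤ 1) (hh1 : ∀ z, |h z| ≤ 1) :
    LipschitzWith (C + D) (fun z => g z * h z) := by
  refine LipschitzWith.of_dist_le_mul fun x y => ?_
  have h1 := hg.dist_le_mul x y
  have h2 := hh.dist_le_mul x y
  rw [Real.dist_eq] at h1 h2 ⊢
  calc |g x * h x - g y * h y| = |(g x - g y) * h x + g y * (h x - h y)| := by ring_nf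
    _ ≤ |g x - g y| * |h x| + |g y| * |h x - h y| := by
        rw [← abs_mul, ← abs_mul]; exact abs_add_le _ _
    _ ≤ C * dist x y * 1 + 1 * (D * dist x y) := by
        gcongr
        · exact hh1 x
        · exact hg1 y
    _ = _ := by push_cast; ring

lemma ContDiffOn.contDiff_mul_cutoff {n : WithTop ℕ∞} {Ω : Set (ℝ × ℝ)} {F B : ℝ × ℝ → ℝ} (hopen : IsOpen Ω)
    (hF : ContDiffOn ℝ n F Ω) (hB : ContDiff ℝ n B)
    (hBΩ : tsupport B ⊆ Ω) : ContDiff ℝ n (fun z => B z * F z) := by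
  rw [contDiff_iff_contDiffAt]
  intro z
  by_cases hz : z ∈ Ω
  · exact hB.contDiffAt.mul (hF.contDiffAt (hopen.mem_nhds hz))
  · have : (fun z => B z * F z) =ᶠ[𝓝 z] fun _ => 0 := by
      filter_upwards [notMem_tsupport_iff_eventuallyEq.1 fun h => hz (hBΩ h)] with w hw
      rw [hw, Pi.zero_apply, zero_mul]
    exact contDiffAt_const.congr_of_eventuallyEq this

open scoped NNReal in
/-- Integration by parts of a smooth function on `Ω` against a Lipschitz function compactly
supported in `Ω`. -/
lemma integral_fderiv_mul_of_lipschitz {Ω : Set (ℝ × ℝ)} {F g : ℝ × ℝ → ℝ} {D : ℝ≥0}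
    (hopen : IsOpen Ω) (hF : ContDiffOn ℝ (⊤ : ℕ∞) F Ω) (hg : LipschitzWith D g)
    (hgc : HasCompactSupport g) (hgΩ : tsupport g ⊆ Ω) (e : ℝ × ℝ) :
    ∫ z in Ω, fderiv ℝ F z e * g z = -∫ z in Ω, F z * lineDeriv ℝ g z e := by
  obtain ⟨B, hB, hBc, hBΩ, hB1, -⟩ := exists_smooth_cutoff hgc hopen hgΩ
  have hf := hF.contDiff_mul_cutoff hopen hB hBΩ
  have hfc : HasCompactSupport (fun z => B z * F z) := hBc.mul_right
  obtain ⟨C, hC⟩ : ∃ C, LipschitzWith C (fun z => B z * F z) :=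
    hf.lipschitzWith_of_hasCompactSupport hfc (by simp)
  have hline0 : ∀ z ∉ tsupport g, lineDeriv ℝ g z e = 0 := by
    intro z hz
    have h : g =ᶠ[𝓝 z] 0 := notMem_tsupport_iff_eventuallyEq.1 hz
    rw [h.lineDeriv_eq]
    simp [lineDeriv]
  have hnear : ∀ z ∈ tsupport g, (fun z => B z * F z) =ᶠ[𝓝 z] F := by
    intro z hz
    filter_upwards [eventually_nhdsSet_iff_forall.1 hB1 z hz] with w hw
    rw [hw, one_mul]
  have h1 := LipschitzWith.integral_lineDeriv_mul_eq (μ := volume) hC hg hgc e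
  have h2 : ∫ z in Ω, fderiv ℝ F z e * g z =
      ∫ z, lineDeriv ℝ (fun z => B z * F z) z e * g z := by
    rw [← setIntegral_eq_integral_of_forall_compl_eq_zero (s := Ω)
      (f := fun z => lineDeriv ℝ (fun z => B z * F z) z e * g z)]
    · refine setIntegral_congr_fun hopen.measurableSet fun z hz => ?_
      by_cases hzg : z ∈ tsupport g
      · have h4 : DifferentiableAt ℝ F z :=
          (hF.contDiffAt (hopen.mem_nhds hz)).differentiableAt (by simp)
        rw [(hnear z hzg).lineDeriv_eq, h4.lineDeriv_eq_fderiv]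
      · simp [image_eq_zero_of_notMem_tsupport hzg]
    · intro z hz
      rw [image_eq_zero_of_notMem_tsupport fun h => hz (hgΩ h), mul_zero]
  have h3 : ∫ z in Ω, F z * lineDeriv ℝ g z e =
      ∫ z, lineDeriv ℝ g z e * (B z * F z) := by
    rw [← setIntegral_eq_integral_of_forall_compl_eq_zero (s := Ω)
      (f := fun z => lineDeriv ℝ g z e * (B z * F z))]
    · refine setIntegral_congr_fun hopen.measurableSet fun z hz => ?_
      by_cases hzg : z ∈ tsupport g
      · rw [show B z * F z = F z from (hnear z hzg).self_of_nhds, mul_comm]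
      · simp [hline0 z hzg]
    · intro z hz
      rw [hline0 z fun h => hz (hgΩ h), zero_mul]
  rw [h2, h3, h1, ← integral_neg]
  congr 1
  ext z
  rw [lineDeriv_neg, neg_mul]

/-- The straightened domain, translated so that `p` is the origin. -/
def domainBody (Ω : Set (ℝ × ℝ)) (p : ℝ × ℝ) : Set (ℝ × ℝ) :=
  {w | w + straighten p ∈ straighten '' Ω}

/-- The Minkowski gauge of the straightened domain, in the original coordinates. -/
def domainGauge (Ω : Set (ℝ × ℝ)) (p z : ℝ × ℝ) : ℝ :=
  gauge (domainBody Ω p) (straighten z - straighten p)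

lemma fderiv_straighten (z h : ℝ × ℝ) :
    fderiv ℝ straighten z h = (h.1, 2 * z.1 * h.1 + 2 * z.2 * h.2) := by
  have h1 : HasFDerivAt (fun z : ℝ × ℝ => z.1) (ContinuousLinearMap.fst ℝ ℝ ℝ) z := hasFDerivAt_fst
  have h2 : HasFDerivAt (fun z : ℝ × ℝ => z.2) (ContinuousLinearMap.snd ℝ ℝ ℝ) z := hasFDerivAt_snd
  have h3 : HasFDerivAt straighten _ z := h1.prodMk ((h1.pow 2).add (h2.pow 2))
  rw [h3.fderiv]
  ext <;> simp

lemma differentiableAt_unstraighten {w : ℝ × ℝ} (hw : w.1 ^ 2 < w.2) :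
    DifferentiableAt ℝ unstraighten w := by
  refine differentiableAt_fst.prodMk (DifferentiableAt.sqrt (by fun_prop) ?_)
  linarith

lemma surjective_fderiv_unstraighten {z : ℝ × ℝ} (hz : z ∈ H2) :
    Function.Surjective (fderiv ℝ unstraighten (straighten z)) := by
  have h1 := (differentiableAt_unstraighten (lt_straighten hz)).hasFDerivAt.comp z
    (contDiff_straighten.differentiable (by simp) z).hasFDerivAt
  have h2 : unstraighten ∘ straighten =ᶠ[𝓝 z] id := by
    have : H2 ∈ 𝓝 z := (isOpen_lt continuous_const continuous_snd).mem_nhds hz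
    filter_upwards [this] with y hy using unstraighten_straighten hy
  have h3 := h1.unique ((hasFDerivAt_id z).congr_of_eventuallyEq h2)
  intro y
  exact ⟨fderiv ℝ straighten z y, by simpa using congrArg (fun L => L y) h3⟩

lemma H2_mem_nhds {z : ℝ × ℝ} (hz : z ∈ H2) : H2 ∈ 𝓝 z :=
  (isOpen_lt continuous_const continuous_snd).mem_nhds hz

lemma uniqueDiffOn_closure_inter {Ω : Set (ℝ × ℝ)} (hΩ : Ω ⊆ H2) (hopen : IsOpen Ω)
    (hne : Ω.Nonempty) (hconv : Convex ℝ (straighten '' Ω)) :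
    UniqueDiffOn ℝ (closure Ω ∩ H2) := by
  intro z hz
  set s : Set (ℝ × ℝ) := closure (straighten '' Ω) ∩ {w | w.1 ^ 2 < w.2} with hs
  have hso : IsOpen {w : ℝ × ℝ | w.1 ^ 2 < w.2} := isOpen_lt (by fun_prop) (by fun_prop)
  have h_int : (interior (closure (straighten '' Ω))).Nonempty :=
    ((hne.image _).mono (isOpen_image_straighten hΩ hopen).subset_interior_closure)
  have hus : UniqueDiffOn ℝ s := (uniqueDiffOn_convex hconv.closure h_int).inter hso
  have hmaps : unstraighten '' s ⊆ closure Ω ∩ H2 := by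
    rintro _ ⟨w, ⟨hw, hw2⟩, rfl⟩
    refine ⟨?_, unstraighten_mem hw2⟩
    have h1 := (image_closure_subset_closure_image continuous_unstraighten)
      (mem_image_of_mem unstraighten hw)
    have h2 : unstraighten '' (straighten '' Ω) = Ω := by
      rw [image_image]
      exact (image_congr fun a ha => unstraighten_straighten (hΩ ha)).trans (image_id' _)
    rwa [h2] at h1
  have hzs : straighten z ∈ s :=
    ⟨image_closure_subset_closure_image continuous_straighten (mem_image_of_mem _ hz.1),
      lt_straighten hz.2⟩
  have h1 := (differentiableAt_unstraighten (lt_straighten hz.2)).hasFDerivAt.hasFDerivWithinAt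
    (s := s) |>.uniqueDiffWithinAt (hus _ hzs) (surjective_fderiv_unstraighten hz.2).denseRange
  rw [unstraighten_straighten hz.2] at h1
  exact h1.mono hmaps

section Gauge

variable {Ω : Set (ℝ × ℝ)} {p : ℝ × ℝ}

lemma convex_domainBody (hconv : Convex ℝ (straighten '' Ω)) : Convex ℝ (domainBody Ω p) :=
  hconv.translate_preimage_left (straighten p)

lemma isOpen_domainBody (hΩ : Ω ⊆ H2) (hopen : IsOpen Ω) : IsOpen (domainBody Ω p) :=
  (isOpen_image_straighten hΩ hopen).preimage (by fun_prop)

lemma zero_mem_domainBody (hp : p ∈ Ω) : (0 : ℝ × ℝ) ∈ domainBody Ω p := by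
  simpa [domainBody] using mem_image_of_mem straighten hp

lemma exists_lipschitz_gauge_domainBody (hΩ : Ω ⊆ H2) (hopen : IsOpen Ω)
    (hconv : Convex ℝ (straighten '' Ω)) (hp : p ∈ Ω) :
    ∃ D, LipschitzWith D (gauge (domainBody Ω p)) :=
  (convex_domainBody hconv).lipschitz_gauge
    ((isOpen_domainBody hΩ hopen).mem_nhds (zero_mem_domainBody hp))

lemma continuous_domainGauge (hΩ : Ω ⊆ H2) (hopen : IsOpen Ω)
    (hconv : Convex ℝ (straighten '' Ω)) (hp : p ∈ Ω) : Continuous (domainGauge Ω p) := by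
  obtain ⟨D, hD⟩ := exists_lipschitz_gauge_domainBody hΩ hopen hconv hp
  exact hD.continuous.comp (continuous_straighten.sub continuous_const)

lemma gauge_domainBody_lt_one (hΩ : Ω ⊆ H2) (hopen : IsOpen Ω)
    (hconv : Convex ℝ (straighten '' Ω)) (hp : p ∈ Ω) {w : ℝ × ℝ} :
    gauge (domainBody Ω p) w < 1 ↔ w ∈ domainBody Ω p := by
  have := setOfPred_gauge_lt_one_eq_self_of_isOpen (convex_domainBody hconv)
    (zero_mem_domainBody hp) (isOpen_domainBody hΩ hopen)
  exact Set.ext_iff.1 this w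

lemma domainGauge_lt_one (hΩ : Ω ⊆ H2) (hopen : IsOpen Ω)
    (hconv : Convex ℝ (straighten '' Ω)) (hp : p ∈ Ω) {z : ℝ × ℝ} (hz : z ∈ H2) :
    domainGauge Ω p z < 1 ↔ z ∈ Ω := by
  rw [domainGauge, gauge_domainBody_lt_one hΩ hopen hconv hp, domainBody, mem_ofPred_eq,
    sub_add_cancel]
  exact ⟨fun ⟨y, hy, h⟩ => straighten_injOn (hΩ hy) hz h ▸ hy, mem_image_of_mem _⟩

lemma domainGauge_eq_one (hΩ : Ω ⊆ H2) (hopen : IsOpen Ω)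
    (hconv : Convex ℝ (straighten '' Ω)) (hp : p ∈ Ω) {z : ℝ × ℝ}
    (hz : z ∈ frontier Ω ∩ H2) : domainGauge Ω p z = 1 := by
  refine le_antisymm ?_ (not_lt.1 fun h => ?_)
  · have hc := continuous_domainGauge hΩ hopen hconv hp
    exact closure_minimal (fun y hy => ((domainGauge_lt_one hΩ hopen hconv hp (hΩ hy)).2 hy).le)
      (isClosed_le hc continuous_const) (frontier_subset_closure hz.1)
  · have h1 := (domainGauge_lt_one hΩ hopen hconv hp hz.2).1 h
    have h2 := hz.1.2
    rw [hopen.interior_eq] at h2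
    exact h2 h1

lemma domainGauge_nonneg (z : ℝ × ℝ) : 0 ≤ domainGauge Ω p z := gauge_nonneg _

lemma hasFDerivAt_domainGauge {z : ℝ × ℝ} {l : ℝ × ℝ →L[ℝ] ℝ}
    (h : HasFDerivAt (gauge (domainBody Ω p)) l (straighten z - straighten p)) :
    HasFDerivAt (domainGauge Ω p) (l.comp (fderiv ℝ straighten z)) z :=
  h.comp z ((contDiff_straighten.differentiable (by simp) z).hasFDerivAt.sub_const _)

lemma differentiableAt_gauge_of_domainGauge {z : ℝ × ℝ} (hz : z ∈ H2)
    (h : DifferentiableAt ℝ (domainGauge Ω p) z) :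
    DifferentiableAt ℝ (gauge (domainBody Ω p)) (straighten z - straighten p) := by
  have h1 : DifferentiableAt ℝ (fun w => unstraighten (w + straighten p))
      (straighten z - straighten p) := by
    refine DifferentiableAt.comp (straighten z - straighten p) (g := unstraighten)
      (f := fun w => w + straighten p) ?_ (by fun_prop)
    rw [sub_add_cancel]
    exact differentiableAt_unstraighten (lt_straighten hz)
  have h2 : DifferentiableAt ℝ (fun w => domainGauge Ω p (unstraighten (w + straighten p)))
      (straighten z - straighten p) := by
    refine DifferentiableAt.comp (straighten z - straighten p) (g := domainGauge Ω p)
      (f := fun w => unstraighten (w + straighten p)) ?_ h1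
    rwa [sub_add_cancel, unstraighten_straighten hz]
  refine h2.congr_of_eventuallyEq ?_
  have h3 : Continuous fun w : ℝ × ℝ => w + straighten p := by fun_prop
  have h4 : {w : ℝ × ℝ | w.1 ^ 2 < w.2} ∈ 𝓝 (straighten z - straighten p + straighten p) := by
    rw [sub_add_cancel]
    exact (isOpen_lt (by fun_prop) (by fun_prop)).mem_nhds (lt_straighten hz)
  filter_upwards [h3.tendsto _ h4] with w hw
  rw [domainGauge, straighten_unstraighten (le_of_lt hw), add_sub_cancel_right]

/-- Euler's identity for the gauge. -/
lemma fderiv_gauge_self {C : Set (ℝ × ℝ)} {w : ℝ × ℝ} {l : ℝ × ℝ →L[ℝ] ℝ}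
    (h : HasFDerivAt (gauge C) l w) : l w = gauge C w := by
  have h1 : HasDerivAt (fun t : ℝ => t • w) w 1 :=
    ((hasDerivAt_id (1 : ℝ)).smul_const w).congr_deriv (by simp)
  have h2 : HasDerivAt (fun t : ℝ => gauge C (t • w)) (l w) 1 := by
    have h0 : HasFDerivAt (gauge C) l ((1 : ℝ) • w) := by rwa [one_smul]
    exact h0.comp_hasDerivAt (1 : ℝ) h1
  have h3 : HasDerivAt (fun t : ℝ => gauge C (t • w)) (gauge C w) 1 := by
    refine (((hasDerivAt_id (1 : ℝ)).mul_const (gauge C w)).congr_deriv (by simp)).congr_of_eventuallyEq ?_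
    filter_upwards [Ioi_mem_nhds (zero_lt_one' ℝ)] with t ht
    rw [gauge_smul_of_nonneg (le_of_lt ht), smul_eq_mul, id]
  exact h2.unique h3

/-- The derivative of the gauge is constant along rays. -/
lemma hasFDerivAt_gauge_smul {C : Set (ℝ × ℝ)} {w : ℝ × ℝ} {l : ℝ × ℝ →L[ℝ] ℝ}
    (h : HasFDerivAt (gauge C) l w) {s : ℝ} (hs : 0 < s) : HasFDerivAt (gauge C) l (s • w) := by
  have h1 : HasFDerivAt (fun x : ℝ × ℝ => s⁻¹ • x) (s⁻¹ • ContinuousLinearMap.id ℝ (ℝ × ℝ))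
      (s • w) := (hasFDerivAt_id _).const_smul s⁻¹
  have h2 : HasFDerivAt (fun x : ℝ × ℝ => gauge C (s⁻¹ • x))
      (l.comp (s⁻¹ • ContinuousLinearMap.id ℝ (ℝ × ℝ))) (s • w) := by
    have h0 : HasFDerivAt (gauge C) l (s⁻¹ • s • w) := by
      rwa [smul_smul, inv_mul_cancel₀ hs.ne', one_smul]
    exact h0.comp (s • w) h1
  have h3 : gauge C = fun x : ℝ × ℝ => s • gauge C (s⁻¹ • x) := by
    ext x
    rw [← gauge_smul_of_nonneg hs.le, smul_smul, mul_inv_cancel₀ hs.ne', one_smul]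
  rw [h3]
  refine (h2.const_smul s).congr_fderiv ?_
  ext <;> simp [hs.ne']

end Gauge

/-- The Euclidean inner product of two gradients. -/
def gradDot (f g : ℝ × ℝ → ℝ) (z : ℝ × ℝ) : ℝ := pdx f z * pdx g z + pdy f z * pdy g z

lemma pdx_domainGauge {Ω : Set (ℝ × ℝ)} {p z : ℝ × ℝ} {l : ℝ × ℝ →L[ℝ] ℝ}
    (h : HasFDerivAt (gauge (domainBody Ω p)) l (straighten z - straighten p)) :
    pdx (domainGauge Ω p) z = l (1, 2 * z.1) ∧ pdy (domainGauge Ω p) z = l (0, 2 * z.2) := by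
  rw [pdx, pdy, (hasFDerivAt_domainGauge h).fderiv]
  simp [fderiv_straighten]

section

variable {Ω : Set (ℝ × ℝ)} {p : ℝ × ℝ}

lemma mem_frontier_of_domainGauge_eq_one (hΩ : Ω ⊆ H2) (hopen : IsOpen Ω)
    (hconv : Convex ℝ (straighten '' Ω)) (hp : p ∈ Ω) {z : ℝ × ℝ} (hz : z ∈ H2)
    (h : domainGauge Ω p z = 1) : z ∈ frontier Ω := by
  refine ⟨?_, ?_⟩
  · have hc : Continuous fun t : ℝ =>
        unstraighten (t • (straighten z - straighten p) + straighten p) :=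
      continuous_unstraighten.comp (by fun_prop)
    have h1 := (hc.tendsto 1).mono_left (nhdsWithin_le_nhds (s := Iio 1))
    rw [one_smul, sub_add_cancel, unstraighten_straighten hz] at h1
    refine mem_closure_of_tendsto h1 ?_
    filter_upwards [Ioo_mem_nhdsLT (zero_lt_one' ℝ)] with t ht
    have h2 : t • (straighten z - straighten p) ∈ domainBody Ω p := by
      rw [← gauge_domainBody_lt_one hΩ hopen hconv hp, gauge_smul_of_nonneg ht.1.le]
      rw [domainGauge] at h
      rw [h]
      simpa using ht.2
    obtain ⟨y, hy, hy'⟩ := h2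
    rw [← hy', unstraighten_straighten (hΩ hy)]
    exact hy
  · rw [hopen.interior_eq]
    intro hzΩ
    exact h.not_lt ((domainGauge_lt_one hΩ hopen hconv hp hz).2 hzΩ)

/-- The gradient of the gauge never vanishes. -/
lemma grad_gauge_ne_zero {q : ℝ × ℝ} (hq : q ∈ H2) {l : ℝ × ℝ →L[ℝ] ℝ}
    (h : HasFDerivAt (gauge (domainBody Ω p)) l (straighten q - straighten p))
    (h1 : domainGauge Ω p q = 1) : 0 < l (1, 2 * q.1) ^ 2 + l (0, 2 * q.2) ^ 2 := by
  have hq' : (0 : ℝ) < q.2 := hq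
  rcases eq_or_ne (l (1, 2 * q.1)) 0 with hx | hx
  · rcases eq_or_ne (l (0, 2 * q.2)) 0 with hy | hy
    · exfalso
      have h2 : l (straighten q - straighten p) = 1 := by rw [fderiv_gauge_self h]; exact h1
      set w := straighten q - straighten p
      have h3 : w = w.1 • ((1, 2 * q.1) : ℝ × ℝ) +
          ((w.2 - w.1 * (2 * q.1)) / (2 * q.2)) • ((0, 2 * q.2) : ℝ × ℝ) := by
        ext
        · simp
        · simp; field_simp; ring
      rw [h3, map_add, map_smul, map_smul, hx, hy] at h2
      simp at h2
    · positivity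
  · positivity

lemma isOutwardNormalAt_of_hasFDerivAt (hΩ : Ω ⊆ H2) (hopen : IsOpen Ω)
    (hconv : Convex ℝ (straighten '' Ω)) (hp : p ∈ Ω) {q : ℝ × ℝ} (hq : q ∈ frontier Ω ∩ H2)
    {l : ℝ × ℝ →L[ℝ] ℝ}
    (h : HasFDerivAt (gauge (domainBody Ω p)) l (straighten q - straighten p)) :
    IsOutwardNormalAt Ω q ((Real.sqrt (l (1, 2 * q.1) ^ 2 + l (0, 2 * q.2) ^ 2))⁻¹ •
      (l (1, 2 * q.1), l (0, 2 * q.2))) := by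
  have h1 := domainGauge_eq_one hΩ hopen hconv hp hq
  have hN := grad_gauge_ne_zero hq.2 h h1
  set A := l (1, 2 * q.1)
  set B := l (0, 2 * q.2)
  set N := Real.sqrt (A ^ 2 + B ^ 2) with hNdef
  have hN0 : 0 < N := Real.sqrt_pos.2 hN
  have hN2 : N ^ 2 = A ^ 2 + B ^ 2 := Real.sq_sqrt hN.le
  have hL := hasFDerivAt_domainGauge h
  have hLe : ∀ w : ℝ × ℝ, (l.comp (fderiv ℝ straighten q)) w = w.1 * A + w.2 * B := by
    intro w
    rw [ContinuousLinearMap.comp_apply, fderiv_straighten,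
      show (w.1, 2 * q.1 * w.1 + 2 * q.2 * w.2) =
        w.1 • ((1, 2 * q.1) : ℝ × ℝ) + w.2 • ((0, 2 * q.2) : ℝ × ℝ) by ext <;> simp; ring,
      map_add, map_smul, map_smul, smul_eq_mul, smul_eq_mul]
  refine ⟨?_, ?_, ?_⟩
  · simp only [Prod.smul_fst, Prod.smul_snd, smul_eq_mul]
    field_simp
    rw [hN2]
  · have hlit := hL.isLittleO
    rw [Metric.tendsto_nhds]
    intro ε hε
    have h2 := hlit.def (show 0 < ε / 2 * N by positivity)
    have h3 : ∀ᶠ x in 𝓝 q, x ∈ H2 := H2_mem_nhds hq.2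
    filter_upwards [self_mem_nhdsWithin, nhdsWithin_le_nhds h2, nhdsWithin_le_nhds h3]
      with x hx hx2 hx3
    rw [domainGauge_eq_one hΩ hopen hconv hp ⟨hx.1, hx3⟩, h1, sub_self, zero_sub, norm_neg, hLe,
      Real.norm_eq_abs] at hx2
    have hne : 0 < ‖x - q‖ := norm_pos_iff.2 (sub_ne_zero.2 hx.2)
    have h4 : ‖x - q‖ ≤ Real.sqrt ((x.1 - q.1) ^ 2 + (x.2 - q.2) ^ 2) :=
      max_le (Real.abs_le_sqrt (by simp; positivity)) (Real.abs_le_sqrt (by simp; positivity))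
    simp only [Prod.smul_fst, Prod.smul_snd, smul_eq_mul, dist_zero_right, Real.norm_eq_abs]
    rw [abs_div, abs_abs, abs_of_nonneg (Real.sqrt_nonneg _), div_lt_iff₀ (hne.trans_le h4)]
    have h5 : (x.1 - q.1) * (N⁻¹ * A) + (x.2 - q.2) * (N⁻¹ * B) =
        N⁻¹ * ((x - q).1 * A + (x - q).2 * B) := by
      simp only [Prod.fst_sub, Prod.snd_sub]; ring
    rw [h5, abs_mul, abs_of_pos (inv_pos.2 hN0), inv_mul_lt_iff₀ hN0]
    nlinarith [mul_pos hε hN0, mul_le_mul_of_nonneg_left h4 (mul_pos hε hN0).le]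
  · have h2 : HasDerivAt (fun t : ℝ => domainGauge Ω p (q + t • (N⁻¹ • (A, B)))) N 0 := by
      have h3 : HasDerivAt (fun t : ℝ => q + t • (N⁻¹ • (A, B))) (N⁻¹ • (A, B)) 0 :=
        (((hasDerivAt_id (0 : ℝ)).smul_const _).const_add q).congr_deriv (by simp)
      have h0 : HasFDerivAt (domainGauge Ω p) (l.comp (fderiv ℝ straighten q))
          (q + (0 : ℝ) • (N⁻¹ • (A, B))) := by rwa [zero_smul, add_zero]
      refine (h0.comp_hasDerivAt (0 : ℝ) h3).congr_deriv ?_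
      rw [hLe]
      simp only [Prod.smul_fst, Prod.smul_snd, smul_eq_mul]
      field_simp
      rw [hN2]
    have h3 := (hasDerivAt_iff_tendsto_slope_zero.1 h2).mono_left
      (nhdsWithin_mono (0 : ℝ) (show Ioi (0 : ℝ) ⊆ {0}ᶜ from fun t ht => ne_of_gt ht))
    filter_upwards [h3.eventually (lt_mem_nhds hN0), self_mem_nhdsWithin] with t ht ht0 hmem
    have ht0' : (0 : ℝ) < t := ht0
    have h4 := (domainGauge_lt_one hΩ hopen hconv hp (hΩ hmem)).2 hmem
    simp only [zero_add, zero_smul, add_zero, smul_eq_mul, h1] at ht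
    have := (mul_pos_iff_of_pos_left (inv_pos.2 ht0')).1 ht
    linarith

end

section

variable {Ω : Set (ℝ × ℝ)} {p : ℝ × ℝ} {u : ℝ × ℝ → ℝ}

lemma fderivWithin_grad_gauge_eq_zero (hΩ : Ω ⊆ H2) (hopen : IsOpen Ω)
    (hconv : Convex ℝ (straighten '' Ω)) (hp : p ∈ Ω)
    (hneumann : ∀ q ∈ frontier Ω ∩ H2, ∀ ν, IsOutwardNormalAt Ω q ν →
      fderivWithin ℝ u (closure Ω ∩ H2) q ν = 0)
    {q : ℝ × ℝ} (hq : q ∈ frontier Ω ∩ H2) {l : ℝ × ℝ →L[ℝ] ℝ}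
    (h : HasFDerivAt (gauge (domainBody Ω p)) l (straighten q - straighten p)) :
    fderivWithin ℝ u (closure Ω ∩ H2) q (l (1, 2 * q.1), l (0, 2 * q.2)) = 0 := by
  have h1 := hneumann q hq _ (isOutwardNormalAt_of_hasFDerivAt hΩ hopen hconv hp hq h)
  have h2 := grad_gauge_ne_zero hq.2 h (domainGauge_eq_one hΩ hopen hconv hp hq)
  rw [map_smul, smul_eq_mul] at h1
  exact (mul_eq_zero.1 h1).resolve_left (inv_ne_zero (Real.sqrt_pos.2 h2).ne')

/-- The radial projection of a point of the domain to the boundary. -/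
def boundaryProj (Ω : Set (ℝ × ℝ)) (p z : ℝ × ℝ) : ℝ × ℝ :=
  unstraighten ((domainGauge Ω p z)⁻¹ • (straighten z - straighten p) + straighten p)

/-- The Neumann condition forces the derivative of `u` along the gradient of the gauge to be
uniformly small near the boundary, locally in the half-plane. -/
lemma exists_abs_gradDot_domainGauge_le (hΩ : Ω ⊆ H2) (hopen : IsOpen Ω)
    (hconv : Convex ℝ (straighten '' Ω)) (hp : p ∈ Ω)
    (hC1 : ContDiffOn ℝ 1 u (closure Ω ∩ H2))
    (hneumann : ∀ q ∈ frontier Ω ∩ H2, ∀ ν, IsOutwardNormalAt Ω q ν →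
      fderivWithin ℝ u (closure Ω ∩ H2) q ν = 0)
    {K : Set (ℝ × ℝ)} (hK : IsCompact K) (hKH : K ⊆ H2) {ε : ℝ} (hε : 0 < ε) :
    ∃ δ : ℝ, 0 < δ ∧ ∀ z ∈ Ω ∩ K, DifferentiableAt ℝ (domainGauge Ω p) z →
      1 - δ < domainGauge Ω p z → |gradDot u (domainGauge Ω p) z| ≤ ε := by
  by_contra! hcon
  have hn : ∀ n : ℕ, (0 : ℝ) < 1 / ((n : ℝ) + 1) := fun n => Nat.one_div_pos_of_nat
  choose z hzK hzd hzG hzε using fun n : ℕ => hcon _ (hn n)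
  obtain ⟨D, hD⟩ := exists_lipschitz_gauge_domainBody hΩ hopen hconv hp
  set l : ℕ → (ℝ × ℝ →L[ℝ] ℝ) := fun n =>
    fderiv ℝ (gauge (domainBody Ω p)) (straighten (z n) - straighten p) with hl
  have hld : ∀ n, HasFDerivAt (gauge (domainBody Ω p)) (l n) (straighten (z n) - straighten p) :=
    fun n => (differentiableAt_gauge_of_domainGauge (hKH (hzK n).2) (hzd n)).hasFDerivAt
  have := FiniteDimensional.proper ℝ (ℝ × ℝ →L[ℝ] ℝ)
  have hlD : ∀ n, l n ∈ Metric.closedBall (0 : ℝ × ℝ →L[ℝ] ℝ) D := fun n => by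
    rw [mem_closedBall_zero_iff]
    exact (hld n).le_of_lipschitz hD
  obtain ⟨⟨zb, lb⟩, hb, φ, hφ, hlim⟩ :=
    (hK.prod (isCompact_closedBall (0 : ℝ × ℝ →L[ℝ] ℝ) D)).tendsto_subseq
      (x := fun n => (z n, l n)) fun n => ⟨(hzK n).2, hlD n⟩
  have hzb : zb ∈ H2 := hKH hb.1
  have hz : Tendsto (fun n => z (φ n)) atTop (𝓝 zb) := (continuous_fst.tendsto _).comp hlim
  have hlb : Tendsto (fun n => l (φ n)) atTop (𝓝 lb) := (continuous_snd.tendsto _).comp hlim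
  set S := closure Ω ∩ H2
  have hG1 : Tendsto (fun n => domainGauge Ω p (z (φ n))) atTop (𝓝 1) := by
    refine tendsto_of_tendsto_of_tendsto_of_le_of_le (g := fun n => 1 - 1 / ((φ n : ℝ) + 1))
      (h := fun _ => 1) ?_ tendsto_const_nhds (fun n => (hzG (φ n)).le) fun n =>
      ((domainGauge_lt_one hΩ hopen hconv hp (hKH (hzK (φ n)).2)).2 (hzK (φ n)).1).le
    simpa using (tendsto_one_div_add_atTop_nhds_zero_nat (𝕜 := ℝ)).comp hφ.tendsto_atTop
      |>.const_sub 1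
  have hw : Tendsto (fun n => (domainGauge Ω p (z (φ n)))⁻¹ •
      (straighten (z (φ n)) - straighten p) + straighten p) atTop (𝓝 (straighten zb)) := by
    have := ((hG1.inv₀ one_ne_zero).smul
      (((continuous_straighten.tendsto zb).comp hz).sub_const (straighten p))).add_const
      (straighten p)
    simpa using this
  have hs : Tendsto (fun n => boundaryProj Ω p (z (φ n))) atTop (𝓝 zb) := by
    have := (continuous_unstraighten.tendsto (straighten zb)).comp hw
    rwa [unstraighten_straighten hzb] at this
  have hev : ∀ᶠ n in atTop, boundaryProj Ω p (z (φ n)) ∈ frontier Ω ∩ H2 ∧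
      HasFDerivAt (gauge (domainBody Ω p)) (l (φ n))
        (straighten (boundaryProj Ω p (z (φ n))) - straighten p) := by
    have ho : IsOpen {w : ℝ × ℝ | w.1 ^ 2 < w.2} := isOpen_lt (by fun_prop) (by fun_prop)
    filter_upwards [hw.eventually (ho.mem_nhds (lt_straighten hzb)),
      hs.eventually (H2_mem_nhds hzb), hG1.eventually (lt_mem_nhds zero_lt_one)] with n h1 h2 h3
    have h4 : straighten (boundaryProj Ω p (z (φ n))) - straighten p =
        (domainGauge Ω p (z (φ n)))⁻¹ • (straighten (z (φ n)) - straighten p) := by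
      rw [boundaryProj, straighten_unstraighten (le_of_lt h1), add_sub_cancel_right]
    refine ⟨⟨mem_frontier_of_domainGauge_eq_one hΩ hopen hconv hp h2 ?_, h2⟩, ?_⟩
    · rw [domainGauge, h4, gauge_smul_of_nonneg (inv_nonneg.2 h3.le)]
      exact inv_mul_cancel₀ h3.ne'
    · rw [h4]
      exact hasFDerivAt_gauge_smul (hld _) (inv_pos.2 h3)
  have hzbS : zb ∈ S :=
    ⟨mem_closure_of_tendsto hz (Eventually.of_forall fun n => (hzK _).1), hzb⟩
  have hA : ContinuousWithinAt (fderivWithin ℝ u S) S zb :=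
    hC1.continuousOn_fderivWithin (uniqueDiffOn_closure_inter hΩ hopen ⟨p, hp⟩ hconv) le_rfl zb hzbS
  have hcomb : ∀ ζ : ℕ → ℝ × ℝ, Tendsto ζ atTop (𝓝 zb) → (∀ᶠ n in atTop, ζ n ∈ S) →
      Tendsto (fun n => fderivWithin ℝ u S (ζ n)
        (l (φ n) (1, 2 * (ζ n).1), l (φ n) (0, 2 * (ζ n).2))) atTop
        (𝓝 (fderivWithin ℝ u S zb (lb (1, 2 * zb.1), lb (0, 2 * zb.2)))) := by
    intro ζ hζ hζS
    have h1 : Tendsto (fun n => fderivWithin ℝ u S (ζ n)) atTop (𝓝 (fderivWithin ℝ u S zb)) :=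
      hA.tendsto.comp (tendsto_nhdsWithin_iff.2 ⟨hζ, hζS⟩)
    have h2 : Tendsto (fun n => (ζ n).1) atTop (𝓝 zb.1) := (continuous_fst.tendsto _).comp hζ
    have h3 : Tendsto (fun n => (ζ n).2) atTop (𝓝 zb.2) := (continuous_snd.tendsto _).comp hζ
    have happ : ∀ {A : ℕ → (ℝ × ℝ →L[ℝ] ℝ)} {B : ℝ × ℝ →L[ℝ] ℝ} {x : ℕ → ℝ × ℝ} {y : ℝ × ℝ},
        Tendsto A atTop (𝓝 B) → Tendsto x atTop (𝓝 y) →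
        Tendsto (fun n => A n (x n)) atTop (𝓝 (B y)) := fun {A B x y} hAB hxy =>
      (isBoundedBilinearMap_apply.continuous.tendsto (B, y)).comp (hAB.prodMk_nhds hxy)
    exact happ h1 ((happ hlb (tendsto_const_nhds.prodMk_nhds (h2.const_mul 2))).prodMk_nhds
      (happ hlb (tendsto_const_nhds.prodMk_nhds (h3.const_mul 2))))
  have hzero := hcomb _ hs (hev.mono fun n h => ⟨frontier_subset_closure h.1.1, h.1.2⟩)
  have hz0 : fderivWithin ℝ u S zb (lb (1, 2 * zb.1), lb (0, 2 * zb.2)) = 0 := by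
    refine tendsto_nhds_unique hzero (tendsto_const_nhds.congr' ?_)
    filter_upwards [hev] with n h
    exact (fderivWithin_grad_gauge_eq_zero hΩ hopen hconv hp hneumann h.1 h.2).symm
  have hlast := hcomb _ hz (Eventually.of_forall fun n =>
    ⟨subset_closure (hzK _).1, hKH (hzK _).2⟩)
  rw [hz0] at hlast
  obtain ⟨n, hn⟩ := ((Metric.tendsto_nhds.1 hlast) ε hε).exists
  refine lt_asymm (hzε (φ n)) ?_
  have hn' := hn
  have hSn : S ∈ 𝓝 (z (φ n)) := mem_of_superset (hopen.mem_nhds (hzK _).1)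
    fun y hy => ⟨subset_closure hy, hΩ hy⟩
  rw [fderivWithin_of_mem_nhds hSn, fderiv_apply_eq, dist_zero_right, Real.norm_eq_abs] at hn'
  obtain ⟨hx, hy⟩ := pdx_domainGauge (hld (φ n))
  rw [gradDot, hx, hy]
  rw [mul_comm, mul_comm (pdy u _)]
  exact hn'

end

section

open scoped NNReal

lemma deriv_smoothTransition_eq_zero {t : ℝ} (ht : t ∉ Icc (0 : ℝ) 1) :
    deriv Real.smoothTransition t = 0 := by
  rw [mem_Icc, not_and_or, not_le, not_le] at ht
  rcases ht with ht | ht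
  · have : Real.smoothTransition =ᶠ[𝓝 t] fun _ => 0 := by
      filter_upwards [gt_mem_nhds ht] with x hx using Real.smoothTransition.zero_of_nonpos hx.le
    rw [this.deriv_eq, deriv_const]
  · have : Real.smoothTransition =ᶠ[𝓝 t] fun _ => 1 := by
      filter_upwards [lt_mem_nhds ht] with x hx using Real.smoothTransition.one_of_one_le hx.le
    rw [this.deriv_eq, deriv_const]

lemma differentiable_smoothTransition : Differentiable ℝ Real.smoothTransition :=
  (Real.smoothTransition.contDiff (n := 1)).differentiable (by simp)

lemma exists_lipschitz_smoothTransition : ∃ C, LipschitzWith C Real.smoothTransition := by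
  have hc : Continuous (deriv Real.smoothTransition) :=
    (Real.smoothTransition.contDiff (n := 1)).continuous_deriv (by simp)
  obtain ⟨C, hC⟩ := (isCompact_Icc (a := (0 : ℝ)) (b := 1)).exists_bound_of_continuousOn
    hc.continuousOn
  refine ⟨C.toNNReal, lipschitzWith_of_nnnorm_deriv_le differentiable_smoothTransition fun x => ?_⟩
  by_cases hx : x ∈ Icc (0 : ℝ) 1
  · rw [← NNReal.coe_le_coe, coe_nnnorm]
    exact (hC x hx).trans (Real.le_coe_toNNReal C)
  · simp [deriv_smoothTransition_eq_zero hx]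

lemma deriv_smoothTransition_nonneg (t : ℝ) : 0 ≤ deriv Real.smoothTransition t :=
  Real.smoothTransition.monotone.deriv_nonneg

lemma integrableOn_mul_lineDeriv_of_lipschitz {Ω : Set (ℝ × ℝ)} {F g : ℝ × ℝ → ℝ} {D : ℝ≥0}
    (hopen : IsOpen Ω) (hF : ContinuousOn F Ω) (hg : LipschitzWith D g)
    (hgc : HasCompactSupport g) (hgΩ : tsupport g ⊆ Ω) (e : ℝ × ℝ) :
    IntegrableOn (fun z => F z * lineDeriv ℝ g z e) Ω := by
  have hK : IsCompact (tsupport g) := hgc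
  have h0 : ∀ z ∉ tsupport g, lineDeriv ℝ g z e = 0 := by
    intro z hz
    rw [(notMem_tsupport_iff_eventuallyEq.1 hz).lineDeriv_eq]
    simp [lineDeriv]
  have h1 : IntegrableOn (fun z => F z * lineDeriv ℝ g z e) (tsupport g) := by
    refine ((hF.mono hgΩ).integrableOn_compact hK).mul_bdd (c := D * ‖e‖)
      (measurable_lineDeriv hg.continuous).aestronglyMeasurable ?_
    exact Eventually.of_forall fun z => norm_lineDeriv_le_of_lipschitz ℝ hg
  refine h1.of_forall_sdiff_eq_zero hopen.measurableSet fun z hz => ?_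
  rw [h0 z hz.2, mul_zero]

lemma integrableOn_mul_of_tsupport {Ω : Set (ℝ × ℝ)} {F g : ℝ × ℝ → ℝ}
    (hopen : IsOpen Ω) (hF : ContinuousOn F Ω) (hg : Continuous g)
    (hgc : HasCompactSupport g) (hgΩ : tsupport g ⊆ Ω) :
    IntegrableOn (fun z => F z * g z) Ω := by
  have hK : IsCompact (tsupport g) := hgc
  have h1 : IntegrableOn (fun z => F z * g z) (tsupport g) :=
    ((hF.mono hgΩ).mul hg.continuousOn).integrableOn_compact hK
  refine h1.of_forall_sdiff_eq_zero hopen.measurableSet fun z hz => ?_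
  rw [image_eq_zero_of_notMem_tsupport hz.2, mul_zero]

/-- The Euclidean Laplacian. -/
def eucLap (w : ℝ × ℝ → ℝ) (z : ℝ × ℝ) : ℝ := pdx (pdx w) z + pdy (pdy w) z

/-- The density `div (κ ψ ∇w) - …` obtained by testing with `κ ψ`. -/
def fluxDensity (w ψ κ : ℝ × ℝ → ℝ) (z : ℝ × ℝ) : ℝ :=
  (gradDot w ψ z + eucLap w z * ψ z) * κ z + ψ z * gradDot w κ z

lemma integral_div_mul_of_lipschitz {Ω : Set (ℝ × ℝ)} {w ψ g : ℝ × ℝ → ℝ} {D : ℝ≥0}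
    (hopen : IsOpen Ω) (hw : ContDiffOn ℝ (⊤ : ℕ∞) w Ω) (hψ : ContDiffOn ℝ (⊤ : ℕ∞) ψ Ω)
    (hg : LipschitzWith D g) (hgc : HasCompactSupport g) (hgΩ : tsupport g ⊆ Ω) :
    ∫ z in Ω, (gradDot w ψ z + eucLap w z * ψ z) * g z =
      -∫ z in Ω, ψ z * (pdx w z * lineDeriv ℝ g z (1, 0) + pdy w z * lineDeriv ℝ g z (0, 1)) := by
  have hwx : ContDiffOn ℝ (⊤ : ℕ∞) (pdx w) Ω := hw.fderiv_apply_of_isOpen hopen (1, 0)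
  have hwy : ContDiffOn ℝ (⊤ : ℕ∞) (pdy w) Ω := hw.fderiv_apply_of_isOpen hopen (0, 1)
  have hFx := hψ.mul hwx
  have hFy := hψ.mul hwy
  have hx := integral_fderiv_mul_of_lipschitz hopen hFx hg hgc hgΩ (1, 0)
  have hy := integral_fderiv_mul_of_lipschitz hopen hFy hg hgc hgΩ (0, 1)
  have ix := integrableOn_mul_lineDeriv_of_lipschitz hopen hFx.continuousOn hg hgc hgΩ (1, 0)
  have iy := integrableOn_mul_lineDeriv_of_lipschitz hopen hFy.continuousOn hg hgc hgΩ (0, 1)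
  have jx := integrableOn_mul_of_tsupport hopen
    (hFx.fderiv_apply_of_isOpen hopen (1, 0)).continuousOn hg.continuous hgc hgΩ
  have jy := integrableOn_mul_of_tsupport hopen
    (hFy.fderiv_apply_of_isOpen hopen (0, 1)).continuousOn hg.continuous hgc hgΩ
  have key : ∀ z ∈ Ω, (gradDot w ψ z + eucLap w z * ψ z) * g z =
      fderiv ℝ (fun z => ψ z * pdx w z) z (1, 0) * g z +
        fderiv ℝ (fun z => ψ z * pdy w z) z (0, 1) * g z := by
    intro z hz
    have d1 := (hψ.contDiffAt (hopen.mem_nhds hz)).differentiableAt (by simp)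
    have d2 := (hwx.contDiffAt (hopen.mem_nhds hz)).differentiableAt (by simp)
    have d3 := (hwy.contDiffAt (hopen.mem_nhds hz)).differentiableAt (by simp)
    rw [fderiv_fun_mul d1 d2, fderiv_fun_mul d1 d3]
    simp only [gradDot, eucLap, add_apply, smul_apply, smul_eq_mul]
    change _ = (ψ z * pdx (pdx w) z + pdx w z * pdx ψ z) * g z +
      (ψ z * pdy (pdy w) z + pdy w z * pdy ψ z) * g z
    ring
  rw [setIntegral_congr_fun hopen.measurableSet key, integral_add jx jy, hx, hy, ← neg_add,
    ← integral_add ix iy]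
  congr 2
  ext z
  ring

/-- A cutoff that vanishes near the boundary of the domain. -/
def boundaryCutoff (Ω : Set (ℝ × ℝ)) (p : ℝ × ℝ) (δ : ℝ) (z : ℝ × ℝ) : ℝ :=
  Real.smoothTransition ((1 - domainGauge Ω p z) / δ - 1)

section

variable {Ω : Set (ℝ × ℝ)} {p : ℝ × ℝ}

lemma continuous_boundaryCutoff (hΩ : Ω ⊆ H2) (hopen : IsOpen Ω)
    (hconv : Convex ℝ (straighten '' Ω)) (hp : p ∈ Ω) (δ : ℝ) :
    Continuous (boundaryCutoff Ω p δ) :=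
  Real.smoothTransition.continuous.comp
    (((continuous_const.sub (continuous_domainGauge hΩ hopen hconv hp)).div_const δ).sub
      continuous_const)

lemma boundaryCutoff_eq_zero {δ : ℝ} (hδ : 0 < δ) {z : ℝ × ℝ} (hz : 1 - δ < domainGauge Ω p z) :
    boundaryCutoff Ω p δ z = 0 := by
  refine Real.smoothTransition.zero_of_nonpos ?_
  have : (1 - domainGauge Ω p z) / δ ≤ 1 := by
    rw [div_le_one hδ]; linarith
  linarith

lemma inter_domainGauge_le_subset (hΩ : Ω ⊆ H2) (hopen : IsOpen Ω)
    (hconv : Convex ℝ (straighten '' Ω)) (hp : p ∈ Ω) {K : Set (ℝ × ℝ)} (hK : K ⊆ H2)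
    {δ : ℝ} (hδ : 0 < δ) : K ∩ {z | domainGauge Ω p z ≤ 1 - δ} ⊆ Ω := by
  intro z hz
  rw [← domainGauge_lt_one hΩ hopen hconv hp (hK hz.1)]
  exact lt_of_le_of_lt hz.2 (by linarith)

lemma tsupport_mul_boundaryCutoff_subset (hΩ : Ω ⊆ H2) (hopen : IsOpen Ω)
    (hconv : Convex ℝ (straighten '' Ω)) (hp : p ∈ Ω) {κ : ℝ × ℝ → ℝ} (hκH : tsupport κ ⊆ H2)
    {δ : ℝ} (hδ : 0 < δ) :
    tsupport (fun z => κ z * boundaryCutoff Ω p δ z) ⊆ Ω := by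
  have hG := continuous_domainGauge hΩ hopen hconv hp
  refine Subset.trans ?_ (inter_domainGauge_le_subset hΩ hopen hconv hp hκH hδ)
  refine closure_minimal (fun z hz => ?_)
    ((isClosed_tsupport κ).inter (isClosed_le hG continuous_const))
  have hz' : κ z * boundaryCutoff Ω p δ z ≠ 0 := hz
  refine ⟨subset_tsupport _ (left_ne_zero_of_mul hz'), ?_⟩
  by_contra hlt
  exact right_ne_zero_of_mul hz' (boundaryCutoff_eq_zero hδ (not_le.1 hlt))

lemma exists_lipschitz_domainGauge_eqOn (hΩ : Ω ⊆ H2) (hopen : IsOpen Ω)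
    (hconv : Convex ℝ (straighten '' Ω)) (hp : p ∈ Ω) {K : Set (ℝ × ℝ)} (hK : IsCompact K) :
    ∃ (D : ℝ≥0) (H : ℝ × ℝ → ℝ), LipschitzWith D H ∧ ∀ᶠ z in 𝓝ˢ K, H z = domainGauge Ω p z := by
  obtain ⟨B, hB, hBc, -, hB1, -⟩ := exists_smooth_cutoff hK isOpen_univ (subset_univ K)
  obtain ⟨D, hD⟩ := exists_lipschitz_gauge_domainBody hΩ hopen hconv hp
  have hf : ContDiff ℝ 1 (fun z => B z • (straighten z - straighten p)) :=
    (hB.of_le (by simp)).smul ((contDiff_straighten.of_le (by simp)).sub contDiff_const)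
  obtain ⟨C, hC⟩ := hf.lipschitzWith_of_hasCompactSupport hBc.smul_right (by simp)
  refine ⟨_, _, hD.comp hC, ?_⟩
  filter_upwards [hB1] with z hz
  change gauge _ (B z • (straighten z - straighten p)) = _
  rw [hz, one_smul]
  rfl

lemma exists_lipschitz_mul_boundaryCutoff (hΩ : Ω ⊆ H2) (hopen : IsOpen Ω)
    (hconv : Convex ℝ (straighten '' Ω)) (hp : p ∈ Ω) {κ : ℝ × ℝ → ℝ}
    (hκ : ContDiff ℝ (⊤ : ℕ∞) κ) (hκc : HasCompactSupport κ) (hκ1 : ∀ z, κ z ∈ Icc (0 : ℝ) 1)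
    (δ : ℝ) : ∃ D, LipschitzWith D (fun z => κ z * boundaryCutoff Ω p δ z) := by
  obtain ⟨C, hC⟩ := hκ.lipschitzWith_of_hasCompactSupport hκc (by simp)
  obtain ⟨D, H, hD, hH⟩ := exists_lipschitz_domainGauge_eqOn hΩ hopen hconv hp hκc
  obtain ⟨E, hE⟩ := exists_lipschitz_smoothTransition
  have hl : LipschitzWith (‖δ⁻¹‖₊) (fun t : ℝ => (1 - t) / δ - 1) := by
    refine LipschitzWith.of_dist_le_mul fun x y => ?_
    rw [Real.dist_eq, Real.dist_eq, coe_nnnorm, Real.norm_eq_abs, ← abs_mul, ← abs_neg]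
    exact (congrArg _ (by ring)).le
  have h1 := LipschitzWith.mul_of_bounded hC (hE.comp (hl.comp hD))
    (fun z => by rw [abs_of_nonneg (hκ1 z).1]; exact (hκ1 z).2)
    (fun z => by
      rw [Function.comp_apply, abs_of_nonneg (Real.smoothTransition.nonneg _)]
      exact Real.smoothTransition.le_one _)
  refine ⟨C + E * (‖δ⁻¹‖₊ * D), ?_⟩
  convert h1 using 2 with z
  by_cases hz : z ∈ tsupport κ
  · simp only [boundaryCutoff, Function.comp_apply]
    rw [(eventually_nhdsSet_iff_forall.1 hH z hz).self_of_nhds]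
  · rw [image_eq_zero_of_notMem_tsupport hz, zero_mul, zero_mul]

lemma ae_differentiableAt_domainGauge (hΩ : Ω ⊆ H2) (hopen : IsOpen Ω)
    (hconv : Convex ℝ (straighten '' Ω)) (hp : p ∈ Ω) {K : Set (ℝ × ℝ)} (hK : IsCompact K) :
    ∀ᵐ z, z ∈ K → DifferentiableAt ℝ (domainGauge Ω p) z := by
  obtain ⟨D, H, hD, hH⟩ := exists_lipschitz_domainGauge_eqOn hΩ hopen hconv hp hK
  filter_upwards [hD.ae_differentiableAt] with z hz hzK
  exact hz.congr_of_eventuallyEq ((eventually_nhdsSet_iff_forall.1 hH z hzK).mono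
    fun _ h => h.symm)

lemma lineDeriv_mul_boundaryCutoff {κ : ℝ × ℝ → ℝ} (hκ : ContDiff ℝ (⊤ : ℕ∞) κ) {δ : ℝ}
    {z : ℝ × ℝ} (hz : DifferentiableAt ℝ (domainGauge Ω p) z) (e : ℝ × ℝ) :
    lineDeriv ℝ (fun z => κ z * boundaryCutoff Ω p δ z) z e =
      boundaryCutoff Ω p δ z * fderiv ℝ κ z e -
      κ z * (deriv Real.smoothTransition ((1 - domainGauge Ω p z) / δ - 1) / δ) *
        fderiv ℝ (domainGauge Ω p) z e := by
  have h1 : HasFDerivAt (fun y => (1 - domainGauge Ω p y) / δ - 1)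
      (-(δ⁻¹ • fderiv ℝ (domainGauge Ω p) z)) z := by
    have := ((hz.hasFDerivAt.const_sub 1).mul_const δ⁻¹).sub_const 1
    simpa only [div_eq_mul_inv, smul_neg] using this
  have h2 := (differentiable_smoothTransition
    ((1 - domainGauge Ω p z) / δ - 1)).hasDerivAt.comp_hasFDerivAt z h1
  have h3 : HasFDerivAt κ (fderiv ℝ κ z) z := (hκ.differentiable (by simp) z).hasFDerivAt
  have h4 := h3.mul h2
  have h5 : HasFDerivAt (fun z => κ z * boundaryCutoff Ω p δ z) _ z := h4
  rw [h5.differentiableAt.lineDeriv_eq_fderiv, h5.fderiv]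
  simp only [add_apply, smul_apply, neg_apply, smul_eq_mul, boundaryCutoff, Function.comp_apply]
  ring

/-- The flux of `w` through the boundary, tested against a nonnegative function, has a sign when
the derivative of `w` along the gradient of the gauge is nonnegative near the boundary. -/
lemma integral_fluxDensity_mul_nonneg (hΩ : Ω ⊆ H2) (hopen : IsOpen Ω)
    (hconv : Convex ℝ (straighten '' Ω)) (hp : p ∈ Ω) {w ψ κ : ℝ × ℝ → ℝ}
    (hw : ContDiffOn ℝ (⊤ : ℕ∞) w Ω) (hψ : ContDiffOn ℝ (⊤ : ℕ∞) ψ Ω) (hψ0 : ∀ z ∈ Ω, 0 ≤ ψ z)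
    (hκ : ContDiff ℝ (⊤ : ℕ∞) κ) (hκc : HasCompactSupport κ) (hκH : tsupport κ ⊆ H2)
    (hκ1 : ∀ z, κ z ∈ Icc (0 : ℝ) 1) {δ : ℝ} (hδ : 0 < δ)
    (hb : ∀ z ∈ Ω ∩ tsupport κ, DifferentiableAt ℝ (domainGauge Ω p) z →
      1 - 2 * δ ≤ domainGauge Ω p z → 0 ≤ gradDot w (domainGauge Ω p) z) :
    0 ≤ ∫ z in Ω, fluxDensity w ψ κ z * boundaryCutoff Ω p δ z := by
  obtain ⟨D, hD⟩ := exists_lipschitz_mul_boundaryCutoff hΩ hopen hconv hp hκ hκc hκ1 δ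
  set g : ℝ × ℝ → ℝ := fun z => κ z * boundaryCutoff Ω p δ z with hg
  have hgs := tsupport_mul_boundaryCutoff_subset hΩ hopen hconv hp hκH hδ
  have hgΩ : tsupport g ⊆ Ω := hgs
  have hgc : HasCompactSupport g := hκc.mul_right
  have hwx : ContDiffOn ℝ (⊤ : ℕ∞) (pdx w) Ω := hw.fderiv_apply_of_isOpen hopen (1, 0)
  have hwy : ContDiffOn ℝ (⊤ : ℕ∞) (pdy w) Ω := hw.fderiv_apply_of_isOpen hopen (0, 1)
  have hwxx : ContDiffOn ℝ (⊤ : ℕ∞) (pdx (pdx w)) Ω := hwx.fderiv_apply_of_isOpen hopen (1, 0)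
  have hwyy : ContDiffOn ℝ (⊤ : ℕ∞) (pdy (pdy w)) Ω := hwy.fderiv_apply_of_isOpen hopen (0, 1)
  have hψx : ContDiffOn ℝ (⊤ : ℕ∞) (pdx ψ) Ω := hψ.fderiv_apply_of_isOpen hopen (1, 0)
  have hψy : ContDiffOn ℝ (⊤ : ℕ∞) (pdy ψ) Ω := hψ.fderiv_apply_of_isOpen hopen (0, 1)
  have i1 : IntegrableOn (fun z => (gradDot w ψ z + eucLap w z * ψ z) * g z) Ω :=
    integrableOn_mul_of_tsupport hopen
      ((((hwx.mul hψx).add (hwy.mul hψy)).add ((hwxx.add hwyy).mul hψ)).continuousOn)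
      hD.continuous hgc hgΩ
  have i2 : IntegrableOn (fun z => ψ z * (pdx w z * lineDeriv ℝ g z (1, 0) +
      pdy w z * lineDeriv ℝ g z (0, 1))) Ω := by
    refine ((integrableOn_mul_lineDeriv_of_lipschitz hopen (hψ.mul hwx).continuousOn hD hgc hgΩ
      (1, 0)).add (integrableOn_mul_lineDeriv_of_lipschitz hopen (hψ.mul hwy).continuousOn hD hgc
      hgΩ (0, 1))).congr_fun (fun z _ => ?_) hopen.measurableSet
    simp only [Pi.add_apply]
    ring
  have hkx : Continuous (pdx κ) := (hκ.continuous_fderiv (by simp)).clm_apply continuous_const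
  have hky : Continuous (pdy κ) := (hκ.continuous_fderiv (by simp)).clm_apply continuous_const
  have hκ0 : ∀ z ∉ tsupport κ, fderiv ℝ κ z = 0 := fun z hz => by
    rw [(notMem_tsupport_iff_eventuallyEq.1 hz).fderiv_eq]; simp
  have i3 : IntegrableOn (fun z => fluxDensity w ψ κ z * boundaryCutoff Ω p δ z) Ω := by
    have hc : ContinuousOn (fun z => fluxDensity w ψ κ z * boundaryCutoff Ω p δ z) Ω :=
      (((((hwx.mul hψx).add (hwy.mul hψy)).add ((hwxx.add hwyy).mul hψ)).continuousOn.mul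
        hκ.continuous.continuousOn).add
        (hψ.continuousOn.mul ((hwx.continuousOn.mul hkx.continuousOn).add
        (hwy.continuousOn.mul hky.continuousOn)))).mul
        (continuous_boundaryCutoff hΩ hopen hconv hp δ).continuousOn
    have hK := inter_domainGauge_le_subset hΩ hopen hconv hp hκH hδ
    have hKc : IsCompact (tsupport κ ∩ {z | domainGauge Ω p z ≤ 1 - δ}) :=
      IsCompact.inter_right hκc
        (isClosed_le (continuous_domainGauge hΩ hopen hconv hp) continuous_const)
    refine ((hc.mono hK).integrableOn_compact hKc).of_forall_sdiff_eq_zero hopen.measurableSet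
      fun z hz => ?_
    rcases not_and_or.1 hz.2 with h | h
    · simp [fluxDensity, gradDot, pdx, pdy, hκ0 z h, image_eq_zero_of_notMem_tsupport h]
    · rw [boundaryCutoff_eq_zero hδ (not_le.1 h), mul_zero]
  have h0 := integral_div_mul_of_lipschitz hopen hw hψ hD hgc hgΩ
  rw [eq_neg_iff_add_eq_zero, ← integral_add i1 i2] at h0
  rw [← h0]
  refine setIntegral_mono_ae_restrict (i1.add i2) i3 ?_
  rw [EventuallyLE, ae_restrict_iff' hopen.measurableSet]
  filter_upwards [ae_differentiableAt_domainGauge hΩ hopen hconv hp hκc] with z hzd hz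
  have hmain : pdx w z * lineDeriv ℝ g z (1, 0) + pdy w z * lineDeriv ℝ g z (0, 1) ≤
      gradDot w κ z * boundaryCutoff Ω p δ z := by
    by_cases hzκ : z ∈ tsupport κ
    · rw [lineDeriv_mul_boundaryCutoff hκ (hzd hzκ), lineDeriv_mul_boundaryCutoff hκ (hzd hzκ)]
      set t := (1 - domainGauge Ω p z) / δ - 1 with ht
      have hnn : 0 ≤ κ z * (deriv Real.smoothTransition t / δ) * gradDot w (domainGauge Ω p) z := by
        by_cases htm : t ∈ Icc (0 : ℝ) 1
        · refine mul_nonneg (mul_nonneg (hκ1 z).1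
            (div_nonneg (deriv_smoothTransition_nonneg t) hδ.le)) (hb z ⟨hz, hzκ⟩ (hzd hzκ) ?_)
          have h1 : (1 - domainGauge Ω p z) / δ ≤ 2 := by linarith [htm.2]
          rw [div_le_iff₀ hδ] at h1
          linarith
        · rw [deriv_smoothTransition_eq_zero htm]; simp
      rw [gradDot] at hnn ⊢
      change pdx w z * (boundaryCutoff Ω p δ z * pdx κ z - κ z * (_ / δ) * pdx _ z) +
        pdy w z * (boundaryCutoff Ω p δ z * pdy κ z - κ z * (_ / δ) * pdy _ z) ≤ _
      linarith
    · have hg0 : ∀ e, lineDeriv ℝ g z e = 0 := by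
        intro e
        have : g =ᶠ[𝓝 z] 0 := by
          filter_upwards [notMem_tsupport_iff_eventuallyEq.1 hzκ] with y hy
          simp [hg, hy]
        rw [this.lineDeriv_eq]
        simp [lineDeriv]
      simp [hg0, gradDot, pdx, pdy, hκ0 z hzκ]
  have := mul_le_mul_of_nonneg_left hmain (hψ0 z hz)
  simp only [fluxDensity, hg]
  linarith

end

/-- The squared hyperbolic sine of half the hyperbolic distance to `p`. -/
def radial (p z : ℝ × ℝ) : ℝ := ((z.1 - p.1) ^ 2 + (z.2 - p.2) ^ 2) / (4 * z.2 * p.2)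

section

variable {p z : ℝ × ℝ}

lemma HasFDerivAt.real_div {f g : ℝ × ℝ → ℝ} {f' g' : ℝ × ℝ →L[ℝ] ℝ} (hf : HasFDerivAt f f' z)
    (hg : HasFDerivAt g g' z) (h0 : g z ≠ 0) :
    HasFDerivAt (fun y => f y / g y) (f z • (-(g z ^ 2)⁻¹ • g') + (g z)⁻¹ • f') z := by
  have h := hf.mul ((hasDerivAt_inv h0).comp_hasFDerivAt z hg)
  simp only [div_eq_mul_inv]
  exact h

lemma contDiffOn_radial (hp : p ∈ H2) : ContDiffOn ℝ (⊤ : ℕ∞) (radial p) H2 := by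
  have hp' : (0 : ℝ) < p.2 := hp
  refine ContDiffOn.div (by fun_prop) (by fun_prop) fun z hz => ?_
  have hz' : (0 : ℝ) < z.2 := hz
  positivity

lemma isOpen_H2 : IsOpen H2 := isOpen_lt continuous_const continuous_snd

lemma radial_nonneg (hp : p ∈ H2) (hz : z ∈ H2) : 0 ≤ radial p z := by
  have hp' : (0 : ℝ) < p.2 := hp
  have hz' : (0 : ℝ) < z.2 := hz
  rw [radial]; positivity

lemma hasFDerivAt_radial (hp : p ∈ H2) (hz : z ∈ H2) :
    HasFDerivAt (radial p)
      (((z.1 - p.1) / (2 * z.2 * p.2)) • ContinuousLinearMap.fst ℝ ℝ ℝ +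
        ((z.2 ^ 2 - p.2 ^ 2 - (z.1 - p.1) ^ 2) / (4 * z.2 ^ 2 * p.2)) •
          ContinuousLinearMap.snd ℝ ℝ ℝ) z := by
  have hp' : (0 : ℝ) < p.2 := hp
  have hz' : (0 : ℝ) < z.2 := hz
  have h1 : HasFDerivAt (fun z : ℝ × ℝ => z.1 - p.1) (ContinuousLinearMap.fst ℝ ℝ ℝ) z :=
    hasFDerivAt_fst.sub_const _
  have h2 : HasFDerivAt (fun z : ℝ × ℝ => z.2 - p.2) (ContinuousLinearMap.snd ℝ ℝ ℝ) z :=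
    hasFDerivAt_snd.sub_const _
  have h3 : HasFDerivAt (fun z : ℝ × ℝ => z.2) (ContinuousLinearMap.snd ℝ ℝ ℝ) z :=
    hasFDerivAt_snd
  have h4 : HasFDerivAt (radial p) _ z :=
    ((h1.pow 2).add (h2.pow 2)).real_div ((h3.const_mul 4).mul_const p.2) (by positivity)
  refine h4.congr_fderiv ?_
  ext
  · simp
    field_simp
    ring
  · simp
    field_simp
    ring

lemma pdx_radial (hp : p ∈ H2) (hz : z ∈ H2) :
    pdx (radial p) z = (z.1 - p.1) / (2 * z.2 * p.2) := by
  rw [pdx, (hasFDerivAt_radial hp hz).fderiv]; simp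

lemma pdy_radial (hp : p ∈ H2) (hz : z ∈ H2) :
    pdy (radial p) z = (z.2 ^ 2 - p.2 ^ 2 - (z.1 - p.1) ^ 2) / (4 * z.2 ^ 2 * p.2) := by
  rw [pdy, (hasFDerivAt_radial hp hz).fderiv]; simp

lemma gradSq_radial (hp : p ∈ H2) (hz : z ∈ H2) :
    z.2 ^ 2 * gradSq (radial p) z = radial p z * (1 + radial p z) := by
  have hp' : (0 : ℝ) < p.2 := hp
  have hz' : (0 : ℝ) < z.2 := hz
  rw [gradSq, pdx_radial hp hz, pdy_radial hp hz, radial]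
  field_simp
  ring

lemma eucLap_radial (hp : p ∈ H2) (hz : z ∈ H2) :
    z.2 ^ 2 * eucLap (radial p) z = 1 + 2 * radial p z := by
  have hp' : (0 : ℝ) < p.2 := hp
  have hz' : (0 : ℝ) < z.2 := hz
  have h1 : HasFDerivAt (fun z : ℝ × ℝ => z.1 - p.1) (ContinuousLinearMap.fst ℝ ℝ ℝ) z :=
    hasFDerivAt_fst.sub_const _
  have h3 : HasFDerivAt (fun z : ℝ × ℝ => z.2) (ContinuousLinearMap.snd ℝ ℝ ℝ) z :=
    hasFDerivAt_snd
  have hx : pdx (radial p) =ᶠ[𝓝 z] fun z => (z.1 - p.1) / (2 * z.2 * p.2) := by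
    filter_upwards [H2_mem_nhds hz] with y hy using pdx_radial hp hy
  have hy : pdy (radial p) =ᶠ[𝓝 z]
      fun z => (z.2 ^ 2 - p.2 ^ 2 - (z.1 - p.1) ^ 2) / (4 * z.2 ^ 2 * p.2) := by
    filter_upwards [H2_mem_nhds hz] with y hy using pdy_radial hp hy
  have h5 : HasFDerivAt (fun z : ℝ × ℝ => (z.1 - p.1) / (2 * z.2 * p.2)) _ z :=
    h1.real_div ((h3.const_mul 2).mul_const p.2) (by positivity)
  have h6 : HasFDerivAt
      (fun z : ℝ × ℝ => (z.2 ^ 2 - p.2 ^ 2 - (z.1 - p.1) ^ 2) / (4 * z.2 ^ 2 * p.2)) _ z :=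
    (((h3.pow 2).sub_const (p.2 ^ 2)).sub (h1.pow 2)).real_div
      (((h3.pow 2).const_mul 4).mul_const p.2) (by positivity)
  rw [eucLap, pdx, hx.fderiv_eq, h5.fderiv, pdy, hy.fderiv_eq, h6.fderiv, radial]
  simp
  field_simp
  ring

lemma gradDot_radial_domainGauge {Ω : Set (ℝ × ℝ)} (hp : p ∈ H2) (hz : z ∈ H2)
    (hd : DifferentiableAt ℝ (domainGauge Ω p) z) :
    gradDot (radial p) (domainGauge Ω p) z = domainGauge Ω p z / (2 * z.2 * p.2) := by
  have hp' : (0 : ℝ) < p.2 := hp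
  have hz' : (0 : ℝ) < z.2 := hz
  have hl := (differentiableAt_gauge_of_domainGauge hz hd).hasFDerivAt
  obtain ⟨hx, hy⟩ := pdx_domainGauge hl
  set l := fderiv ℝ (gauge (domainBody Ω p)) (straighten z - straighten p)
  have h1 : domainGauge Ω p z = l (straighten z - straighten p) := (fderiv_gauge_self hl).symm
  have h2 : ((z.1 - p.1) / (2 * z.2 * p.2)) • ((1, 2 * z.1) : ℝ × ℝ) +
      ((z.2 ^ 2 - p.2 ^ 2 - (z.1 - p.1) ^ 2) / (4 * z.2 ^ 2 * p.2)) • ((0, 2 * z.2) : ℝ × ℝ) =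
      (1 / (2 * z.2 * p.2)) • (straighten z - straighten p) := by
    ext
    · simp [straighten]
      field_simp
    · simp [straighten]
      field_simp
      ring
  have h3 := congrArg l h2
  simp only [map_add, map_smul, smul_eq_mul] at h3
  rw [gradDot, hx, hy, h1, pdx_radial hp hz, pdy_radial hp hz, h3]
  ring

lemma isCompact_radial_le (hp : p ∈ H2) {M : ℝ} (hM : 0 ≤ M) :
    IsCompact {z : ℝ × ℝ | (z.1 - p.1) ^ 2 + (z.2 - p.2) ^ 2 ≤ 4 * z.2 * p.2 * M} ∧
      {z : ℝ × ℝ | (z.1 - p.1) ^ 2 + (z.2 - p.2) ^ 2 ≤ 4 * z.2 * p.2 * M} ⊆ H2 := by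
  have hp' : (0 : ℝ) < p.2 := hp
  have hsub : {z : ℝ × ℝ | (z.1 - p.1) ^ 2 + (z.2 - p.2) ^ 2 ≤ 4 * z.2 * p.2 * M} ⊆ H2 := by
    intro z hz
    rw [mem_ofPred_eq] at hz
    change 0 < z.2
    by_contra! h
    have : 4 * z.2 * p.2 * M ≤ 0 :=
      mul_nonpos_of_nonpos_of_nonneg (mul_nonpos_of_nonpos_of_nonneg (by linarith) hp'.le) hM
    nlinarith [sq_nonneg (z.1 - p.1)]
  refine ⟨?_, hsub⟩
  set Y := p.2 * (2 + 4 * M)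
  set W := 4 * Y * p.2 * M + 1
  have hYp : 0 < Y := by positivity
  refine (isCompact_Icc (a := p.1 - W) (b := p.1 + W) |>.prod
    (isCompact_Icc (a := 0) (b := Y))).of_isClosed_subset
    (isClosed_le (by fun_prop) (by fun_prop)) fun z hz => ?_
  have hz2 : 0 < z.2 := hsub hz
  rw [mem_ofPred_eq] at hz
  have hY : z.2 ≤ Y := by
    by_contra! h
    nlinarith [sq_nonneg (z.1 - p.1), mul_pos hz2 (sub_pos.2 h), sq_nonneg p.2]
  have h1 : 4 * z.2 * p.2 * M ≤ 4 * Y * p.2 * M := by gcongr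
  have h2 : (z.1 - p.1) ^ 2 ≤ W := by nlinarith [sq_nonneg (z.2 - p.2)]
  have hW : 1 ≤ W := by
    have : 0 ≤ 4 * Y * p.2 * M := by positivity
    linarith
  have h3 : |z.1 - p.1| ≤ W := abs_le_of_sq_le_sq (by nlinarith) (by linarith)
  rw [abs_le] at h3
  exact ⟨⟨by linarith [h3.1], by linarith [h3.2]⟩, hz2.le, hY⟩

end

end

open scoped NNReal Classical in
/-- A cutoff that vanishes outside a hyperbolic disc. -/
def radialCutoff (p : ℝ × ℝ) (n : ℕ) (z : ℝ × ℝ) : ℝ :=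
  if 0 < z.2 then Real.smoothTransition (2 - radial p z / (n + 1)) else 0

section

variable {p : ℝ × ℝ}

lemma radialCutoff_of_mem {z : ℝ × ℝ} (hz : z ∈ H2) (n : ℕ) :
    radialCutoff p n z = Real.smoothTransition (2 - radial p z / (n + 1)) := if_pos hz

lemma radialCutoff_mem_Icc (n : ℕ) (z : ℝ × ℝ) : radialCutoff p n z ∈ Icc (0 : ℝ) 1 := by
  rw [radialCutoff]
  split_ifs
  · exact ⟨Real.smoothTransition.nonneg _, Real.smoothTransition.le_one _⟩
  · simp

lemma radialCutoff_eq_zero (hp : p ∈ H2) {n : ℕ} {z : ℝ × ℝ}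
    (hz : ¬ (z.1 - p.1) ^ 2 + (z.2 - p.2) ^ 2 ≤ 4 * z.2 * p.2 * (2 * (n + 1))) :
    radialCutoff p n z = 0 := by
  have hp' : (0 : ℝ) < p.2 := hp
  rw [radialCutoff]
  split_ifs with h
  · refine Real.smoothTransition.zero_of_nonpos ?_
    have hn : (0 : ℝ) < n + 1 := by positivity
    have : 2 ≤ radial p z / (n + 1) := by
      rw [le_div_iff₀ hn, radial, le_div_iff₀ (by positivity)]
      linarith
    linarith
  · rfl

lemma tsupport_radialCutoff_subset (hp : p ∈ H2) (n : ℕ) :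
    tsupport (radialCutoff p n) ⊆
      {z | (z.1 - p.1) ^ 2 + (z.2 - p.2) ^ 2 ≤ 4 * z.2 * p.2 * (2 * (n + 1))} := by
  refine closure_minimal (fun z hz => ?_) (isClosed_le (by fun_prop) (by fun_prop))
  by_contra h
  exact hz (radialCutoff_eq_zero hp h)

lemma hasCompactSupport_radialCutoff (hp : p ∈ H2) (n : ℕ) :
    HasCompactSupport (radialCutoff p n) :=
  (isCompact_radial_le hp (M := 2 * (n + 1)) (by positivity)).1.of_isClosed_subset
    (isClosed_tsupport _) (tsupport_radialCutoff_subset hp n)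

lemma tsupport_radialCutoff_subset_H2 (hp : p ∈ H2) (n : ℕ) : tsupport (radialCutoff p n) ⊆ H2 :=
  (tsupport_radialCutoff_subset hp n).trans
    (isCompact_radial_le hp (M := 2 * (n + 1)) (by positivity)).2

lemma radialCutoff_eventuallyEq {z : ℝ × ℝ} (hz : z ∈ H2) (n : ℕ) :
    radialCutoff p n =ᶠ[𝓝 z] fun y => Real.smoothTransition (2 - radial p y / (n + 1)) := by
  filter_upwards [H2_mem_nhds hz] with y hy using radialCutoff_of_mem hy n

lemma contDiff_radialCutoff (hp : p ∈ H2) (n : ℕ) :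
    ContDiff ℝ (⊤ : ℕ∞) (radialCutoff p n) := by
  rw [contDiff_iff_contDiffAt]
  intro z
  by_cases hz : z ∈ H2
  · refine ContDiffAt.congr_of_eventuallyEq ?_ (radialCutoff_eventuallyEq hz n)
    exact Real.smoothTransition.contDiffAt.comp z (contDiffAt_const.sub
      (((contDiffOn_radial hp).contDiffAt (H2_mem_nhds hz)).div_const _))
  · have h : radialCutoff p n =ᶠ[𝓝 z] fun _ => 0 := notMem_tsupport_iff_eventuallyEq.1
      fun h => hz (tsupport_radialCutoff_subset_H2 hp n h)
    exact contDiffAt_const.congr_of_eventuallyEq h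

lemma radialCutoff_eventuallyEq_one (hp : p ∈ H2) {z : ℝ × ℝ} (hz : z ∈ H2) :
    ∀ᶠ n in atTop, radialCutoff p n =ᶠ[𝓝 z] fun _ => 1 := by
  obtain ⟨N, hN⟩ := exists_nat_gt (radial p z)
  filter_upwards [eventually_ge_atTop N] with n hn
  have hc : ContinuousAt (radial p) z :=
    (contDiffOn_radial hp).continuousOn.continuousAt (H2_mem_nhds hz)
  filter_upwards [hc.eventually (gt_mem_nhds hN), H2_mem_nhds hz] with y hy hyH
  rw [radialCutoff_of_mem hyH]
  refine Real.smoothTransition.one_of_one_le ?_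
  have hn' : (N : ℝ) ≤ n := by exact_mod_cast hn
  have : radial p y / (n + 1) ≤ 1 := by
    rw [div_le_one (by positivity)]; linarith
  linarith

lemma exists_gradSq_radialCutoff_le (hp : p ∈ H2) :
    ∃ C, 0 ≤ C ∧ ∀ n, ∀ z ∈ H2, z.2 ^ 2 * gradSq (radialCutoff p n) z ≤ C := by
  obtain ⟨C, hC⟩ := exists_lipschitz_smoothTransition
  refine ⟨9 * C ^ 2, by positivity, fun n z hz => ?_⟩
  set N : ℝ := n + 1 with hN
  have hN0 : 1 ≤ N := by simp [hN]
  set t := 2 - radial p z / N with ht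
  have h1 : HasFDerivAt (fun y => 2 - radial p y / N) (-(N⁻¹ • fderiv ℝ (radial p) z)) z := by
    have := ((hasFDerivAt_radial hp hz).differentiableAt.hasFDerivAt.mul_const N⁻¹).const_sub 2
    simpa only [div_eq_mul_inv] using this
  have h2 := (differentiable_smoothTransition t).hasDerivAt.comp_hasFDerivAt z h1
  have h3 : fderiv ℝ (radialCutoff p n) z =
      deriv Real.smoothTransition t • -(N⁻¹ • fderiv ℝ (radial p) z) := by
    rw [(radialCutoff_eventuallyEq hz n).fderiv_eq]
    exact h2.fderiv
  have h4 : gradSq (radialCutoff p n) z =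
      (deriv Real.smoothTransition t) ^ 2 / N ^ 2 * gradSq (radial p) z := by
    rw [gradSq, pdx, pdy, h3, gradSq, pdx, pdy]
    simp only [smul_apply, neg_apply, smul_eq_mul]
    field_simp
  have h5 : |deriv Real.smoothTransition t| ≤ C := by
    have := norm_deriv_le_of_lipschitz (x₀ := t) hC
    simpa using this
  have h6 : (deriv Real.smoothTransition t) ^ 2 ≤ (C : ℝ) ^ 2 := sq_le_sq' (abs_le.1 h5).1 (abs_le.1 h5).2
  have hX := radial_nonneg hp hz
  have h7 : z.2 ^ 2 * gradSq (radialCutoff p n) z =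
      (deriv Real.smoothTransition t) ^ 2 * (radial p z * (1 + radial p z) / N ^ 2) := by
    rw [← gradSq_radial hp hz, h4]
    ring
  rw [h7]
  by_cases htm : t ∈ Icc (0 : ℝ) 1
  · have h8 : radial p z ≤ 2 * N := by
      have := htm.1
      rw [ht, sub_nonneg, div_le_iff₀ (by linarith)] at this
      exact this
    have h9 : radial p z * (1 + radial p z) / N ^ 2 ≤ 9 := by
      rw [div_le_iff₀ (by positivity)]
      nlinarith
    have h10 : 0 ≤ radial p z * (1 + radial p z) / N ^ 2 := by positivity
    calc _ ≤ (C : ℝ) ^ 2 * 9 := mul_le_mul h6 h9 h10 (by positivity)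
      _ = _ := by ring
  · rw [deriv_smoothTransition_eq_zero htm]
    simp

end

lemma sq_gradDot_le (f g : ℝ × ℝ → ℝ) (z : ℝ × ℝ) : gradDot f g z ^ 2 ≤ gradSq f z * gradSq g z := by
  rw [gradDot, gradSq, gradSq]
  nlinarith [sq_nonneg (pdx f z * pdy g z - pdy f z * pdx g z)]

lemma gradSq_nonneg (f : ℝ × ℝ → ℝ) (z : ℝ × ℝ) : 0 ≤ gradSq f z := by
  rw [gradSq]; positivity

lemma abs_gradDot_le (f g : ℝ × ℝ → ℝ) (z : ℝ × ℝ) :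
    |gradDot f g z| ≤ gradSq f z + gradSq g z := by
  refine abs_le_of_sq_le_sq ((sq_gradDot_le f g z).trans ?_)
    (add_nonneg (gradSq_nonneg _ _) (gradSq_nonneg _ _))
  nlinarith [gradSq_nonneg f z, gradSq_nonneg g z]

lemma abs_mul_le_weighted {a b y : ℝ} (hy : 0 < y) : |a * b| ≤ y ^ 2 * a ^ 2 + b ^ 2 / y ^ 2 := by
  have h : a * b = (y * a) * (b / y) := by field_simp
  rw [h, ← div_pow, ← mul_pow]
  set s := y * a
  set t := b / y
  rw [abs_le]
  constructor <;> nlinarith [sq_nonneg (s - t), sq_nonneg (s + t)]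

lemma abs_fluxDensity_le {w ψ κ : ℝ × ℝ → ℝ} {z : ℝ × ℝ} (hz : z ∈ H2)
    (hκ : κ z ∈ Icc (0 : ℝ) 1) {C : ℝ} (hC : z.2 ^ 2 * gradSq κ z ≤ C) :
    |fluxDensity w ψ κ z| ≤ (1 + C) * (gradSq w z + z.2 ^ 2 * eucLap w z ^ 2) + gradSq ψ z +
      2 * (ψ z ^ 2 / z.2 ^ 2) := by
  have hz' : (0 : ℝ) < z.2 := hz
  have h1 := abs_gradDot_le w ψ z
  have h2 := abs_mul_le_weighted (a := eucLap w z) (b := ψ z) hz'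
  have h3 := abs_mul_le_weighted (a := gradDot w κ z) (b := ψ z) hz'
  have h4 : z.2 ^ 2 * gradDot w κ z ^ 2 ≤ C * gradSq w z := by
    calc _ ≤ z.2 ^ 2 * (gradSq w z * gradSq κ z) := by gcongr; exact sq_gradDot_le _ _ _
      _ = (z.2 ^ 2 * gradSq κ z) * gradSq w z := by ring
      _ ≤ _ := by gcongr; exact gradSq_nonneg _ _
  have hC0 : 0 ≤ C := le_trans (mul_nonneg (sq_nonneg _) (gradSq_nonneg _ _)) hC
  have h5 : |(gradDot w ψ z + eucLap w z * ψ z) * κ z| ≤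
      |gradDot w ψ z| + |eucLap w z * ψ z| := by
    rw [abs_mul, abs_of_nonneg hκ.1]
    exact (mul_le_of_le_one_right (abs_nonneg _) hκ.2).trans (abs_add_le _ _)
  have h6 := abs_add_le ((gradDot w ψ z + eucLap w z * ψ z) * κ z) (ψ z * gradDot w κ z)
  rw [fluxDensity]
  rw [mul_comm (ψ z)] at h6 ⊢
  have h7 : 0 ≤ C * (z.2 ^ 2 * eucLap w z ^ 2) := by positivity
  nlinarith

section

variable {Ω : Set (ℝ × ℝ)} {w ψ κ : ℝ × ℝ → ℝ}

lemma continuousOn_gradDot (hopen : IsOpen Ω) (hw : ContDiffOn ℝ (⊤ : ℕ∞) w Ω)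
    (hψ : ContDiffOn ℝ (⊤ : ℕ∞) ψ Ω) : ContinuousOn (gradDot w ψ) Ω :=
  ((hw.fderiv_apply_of_isOpen hopen (1, 0)).continuousOn.mul
    (hψ.fderiv_apply_of_isOpen hopen (1, 0)).continuousOn).add
  ((hw.fderiv_apply_of_isOpen hopen (0, 1)).continuousOn.mul
    (hψ.fderiv_apply_of_isOpen hopen (0, 1)).continuousOn)

lemma continuousOn_gradSq (hopen : IsOpen Ω) (hw : ContDiffOn ℝ (⊤ : ℕ∞) w Ω) :
    ContinuousOn (gradSq w) Ω :=
  ((hw.fderiv_apply_of_isOpen hopen (1, 0)).continuousOn.pow 2).add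
    ((hw.fderiv_apply_of_isOpen hopen (0, 1)).continuousOn.pow 2)

lemma continuousOn_eucLap (hopen : IsOpen Ω) (hw : ContDiffOn ℝ (⊤ : ℕ∞) w Ω) :
    ContinuousOn (eucLap w) Ω :=
  ((hw.fderiv_apply_of_isOpen hopen (1, 0)).fderiv_apply_of_isOpen hopen (1, 0)).continuousOn.add
    ((hw.fderiv_apply_of_isOpen hopen (0, 1)).fderiv_apply_of_isOpen hopen (0, 1)).continuousOn

lemma continuousOn_fluxDensity (hopen : IsOpen Ω) (hw : ContDiffOn ℝ (⊤ : ℕ∞) w Ω)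
    (hψ : ContDiffOn ℝ (⊤ : ℕ∞) ψ Ω) (hκ : ContDiffOn ℝ (⊤ : ℕ∞) κ Ω) :
    ContinuousOn (fluxDensity w ψ κ) Ω :=
  (((continuousOn_gradDot hopen hw hψ).add ((continuousOn_eucLap hopen hw).mul
    hψ.continuousOn)).mul hκ.continuousOn).add
    (hψ.continuousOn.mul (continuousOn_gradDot hopen hw hκ))

lemma fluxDensity_eq_zero {z : ℝ × ℝ} (hz : z ∉ tsupport κ) : fluxDensity w ψ κ z = 0 := by
  have : fderiv ℝ κ z = 0 := by
    rw [(notMem_tsupport_iff_eventuallyEq.1 hz).fderiv_eq]; simp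
  simp [fluxDensity, gradDot, pdx, pdy, this, image_eq_zero_of_notMem_tsupport hz]

lemma integrableOn_fluxDensity (hΩ : Ω ⊆ H2) (hopen : IsOpen Ω)
    (hw : ContDiffOn ℝ (⊤ : ℕ∞) w Ω)
    (hψ : ContDiffOn ℝ (⊤ : ℕ∞) ψ Ω) (hκ : ContDiff ℝ (⊤ : ℕ∞) κ)
    (hκ1 : ∀ z, κ z ∈ Icc (0 : ℝ) 1) {C : ℝ} (hC : ∀ z ∈ H2, z.2 ^ 2 * gradSq κ z ≤ C)
    (hwi : IntegrableOn (fun z => gradSq w z + z.2 ^ 2 * eucLap w z ^ 2) (Ω ∩ tsupport κ))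
    (hψ2 : IntegrableOn (fun z => ψ z ^ 2 / z.2 ^ 2) Ω) (hψe : IntegrableOn (gradSq ψ) Ω) :
    IntegrableOn (fluxDensity w ψ κ) Ω := by
  have hm : MeasurableSet (Ω ∩ tsupport κ) :=
    hopen.measurableSet.inter (isClosed_tsupport κ).measurableSet
  have h : IntegrableOn (fluxDensity w ψ κ) (Ω ∩ tsupport κ) := by
    refine Integrable.mono' (((hwi.const_mul (1 + C)).add (hψe.mono_set inter_subset_left)).add
      ((hψ2.mono_set inter_subset_left).const_mul 2))
      (((continuousOn_fluxDensity hopen hw hψ hκ.contDiffOn).mono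
        inter_subset_left).aestronglyMeasurable hm) ?_
    filter_upwards [ae_restrict_mem hm] with z hz
    exact abs_fluxDensity_le (hΩ hz.1) (hκ1 z) (hC z (hΩ hz.1))
  refine h.of_forall_sdiff_eq_zero hopen.measurableSet fun z hz => ?_
  exact fluxDensity_eq_zero fun hzκ => hz.2 ⟨hz.1, hzκ⟩

variable {p : ℝ × ℝ}

lemma tendsto_boundaryCutoff (hΩ : Ω ⊆ H2) (hopen : IsOpen Ω)
    (hconv : Convex ℝ (straighten '' Ω)) (hp : p ∈ Ω) {z : ℝ × ℝ} (hz : z ∈ Ω) :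
    ∀ᶠ n : ℕ in atTop, boundaryCutoff Ω p (1 / ((n : ℝ) + 1)) z = 1 := by
  have hG := (domainGauge_lt_one hΩ hopen hconv hp (hΩ hz)).2 hz
  obtain ⟨N, hN⟩ := exists_nat_gt (2 / (1 - domainGauge Ω p z))
  filter_upwards [eventually_ge_atTop N] with n hn
  refine Real.smoothTransition.one_of_one_le ?_
  have hn' : (N : ℝ) ≤ n := by exact_mod_cast hn
  rw [div_lt_iff₀ (by linarith)] at hN
  rw [div_div_eq_mul_div, div_one]
  nlinarith

/-- Removing the boundary cutoff in `integral_fluxDensity_mul_nonneg`. -/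
lemma integral_fluxDensity_nonneg (hΩ : Ω ⊆ H2) (hopen : IsOpen Ω)
    (hconv : Convex ℝ (straighten '' Ω)) (hp : p ∈ Ω)
    (hw : ContDiffOn ℝ (⊤ : ℕ∞) w Ω) (hψ : ContDiffOn ℝ (⊤ : ℕ∞) ψ Ω) (hψ0 : ∀ z ∈ Ω, 0 ≤ ψ z)
    (hκ : ContDiff ℝ (⊤ : ℕ∞) κ) (hκc : HasCompactSupport κ) (hκH : tsupport κ ⊆ H2)
    (hκ1 : ∀ z, κ z ∈ Icc (0 : ℝ) 1) (hi : IntegrableOn (fluxDensity w ψ κ) Ω)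
    {δ₀ : ℝ} (hδ₀ : 0 < δ₀)
    (hb : ∀ z ∈ Ω ∩ tsupport κ, DifferentiableAt ℝ (domainGauge Ω p) z →
      1 - δ₀ < domainGauge Ω p z → 0 ≤ gradDot w (domainGauge Ω p) z) :
    0 ≤ ∫ z in Ω, fluxDensity w ψ κ z := by
  have hlim : Tendsto (fun n : ℕ => ∫ z in Ω, fluxDensity w ψ κ z *
      boundaryCutoff Ω p (1 / ((n : ℝ) + 1)) z) atTop (𝓝 (∫ z in Ω, fluxDensity w ψ κ z)) := by
    refine tendsto_integral_of_dominated_convergence (fun z => |fluxDensity w ψ κ z|)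
      (fun n => ?_) hi.abs (fun n => ?_) ?_
    · exact hi.aestronglyMeasurable.mul
        (continuous_boundaryCutoff hΩ hopen hconv hp _).aestronglyMeasurable
    · refine Eventually.of_forall fun z => ?_
      rw [norm_mul, Real.norm_eq_abs, Real.norm_eq_abs, boundaryCutoff,
        abs_of_nonneg (Real.smoothTransition.nonneg _)]
      exact mul_le_of_le_one_right (abs_nonneg _) (Real.smoothTransition.le_one _)
    · filter_upwards [ae_restrict_mem hopen.measurableSet] with z hz
      refine tendsto_const_nhds.congr' ?_
      filter_upwards [tendsto_boundaryCutoff hΩ hopen hconv hp hz] with n hn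
      rw [hn, mul_one]
  refine ge_of_tendsto hlim ?_
  have hev := (tendsto_one_div_add_atTop_nhds_zero_nat (𝕜 := ℝ)).eventually
    (gt_mem_nhds (half_pos hδ₀))
  filter_upwards [hev] with n hn
  refine integral_fluxDensity_mul_nonneg hΩ hopen hconv hp hw hψ hψ0 hκ hκc hκH hκ1
    Nat.one_div_pos_of_nat fun z hz hd hG => hb z hz hd ?_
  linarith

lemma eucLap_add_mul (hopen : IsOpen Ω) {v X : ℝ × ℝ → ℝ} (hv : ContDiffOn ℝ (⊤ : ℕ∞) v Ω)
    (hX : ContDiffOn ℝ (⊤ : ℕ∞) X Ω) (ε : ℝ) {z : ℝ × ℝ} (hz : z ∈ Ω) :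
    eucLap (fun y => v y + ε * X y) z = eucLap v z + ε * eucLap X z := by
  have hd : ∀ y ∈ Ω, ∀ e, fderiv ℝ (fun y => v y + ε * X y) y e =
      fderiv ℝ v y e + ε * fderiv ℝ X y e := by
    intro y hy e
    have h1 := (hv.contDiffAt (hopen.mem_nhds hy)).differentiableAt (by simp)
    have h2 := (hX.contDiffAt (hopen.mem_nhds hy)).differentiableAt (by simp)
    rw [fderiv_fun_add h1 (h2.const_mul ε), fderiv_const_mul h2]
    simp
  have hd2 : ∀ e, fderiv ℝ (fun y => fderiv ℝ (fun y => v y + ε * X y) y e) z e =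
      fderiv ℝ (fun y => fderiv ℝ v y e) z e + ε * fderiv ℝ (fun y => fderiv ℝ X y e) z e := by
    intro e
    have he : (fun y => fderiv ℝ (fun y => v y + ε * X y) y e) =ᶠ[𝓝 z]
        fun y => fderiv ℝ v y e + ε * fderiv ℝ X y e := by
      filter_upwards [hopen.mem_nhds hz] with y hy using hd y hy e
    have h1 := ((hv.fderiv_apply_of_isOpen hopen e).contDiffAt
      (hopen.mem_nhds hz)).differentiableAt (by simp)
    have h2 := ((hX.fderiv_apply_of_isOpen hopen e).contDiffAt
      (hopen.mem_nhds hz)).differentiableAt (by simp)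
    rw [he.fderiv_eq, fderiv_fun_add h1 (h2.const_mul ε), fderiv_const_mul h2]
    simp
  have hx := hd2 (1, 0)
  have hy := hd2 (0, 1)
  change eucLap (fun y => v y + ε * X y) z =
    (fderiv ℝ (fun y => fderiv ℝ v y (1, 0)) z (1, 0) +
      fderiv ℝ (fun y => fderiv ℝ v y (0, 1)) z (0, 1)) +
    ε * (fderiv ℝ (fun y => fderiv ℝ X y (1, 0)) z (1, 0) +
      fderiv ℝ (fun y => fderiv ℝ X y (0, 1)) z (0, 1))
  rw [show eucLap (fun y => v y + ε * X y) z =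
    fderiv ℝ (fun y => fderiv ℝ (fun y => v y + ε * X y) y (1, 0)) z (1, 0) +
      fderiv ℝ (fun y => fderiv ℝ (fun y => v y + ε * X y) y (0, 1)) z (0, 1) from rfl, hx, hy]
  ring

lemma gradDot_add_mul {v X f : ℝ × ℝ → ℝ} {z : ℝ × ℝ} (hv : DifferentiableAt ℝ v z)
    (hX : DifferentiableAt ℝ X z) (ε : ℝ) :
    gradDot (fun y => v y + ε * X y) f z = gradDot v f z + ε * gradDot X f z := by
  rw [gradDot, pdx, pdy, fderiv_fun_add hv (hX.const_mul ε), fderiv_const_mul hX]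
  simp only [gradDot, pdx, pdy, add_apply, smul_apply, smul_eq_mul]
  ring

lemma fluxDensity_add_mul (hopen : IsOpen Ω) {v X : ℝ × ℝ → ℝ} (hv : ContDiffOn ℝ (⊤ : ℕ∞) v Ω)
    (hX : ContDiffOn ℝ (⊤ : ℕ∞) X Ω) (ε : ℝ) {z : ℝ × ℝ} (hz : z ∈ Ω) :
    fluxDensity (fun y => v y + ε * X y) ψ κ z =
      fluxDensity v ψ κ z + ε * fluxDensity X ψ κ z := by
  have h1 := (hv.contDiffAt (hopen.mem_nhds hz)).differentiableAt (by simp)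
  have h2 := (hX.contDiffAt (hopen.mem_nhds hz)).differentiableAt (by simp)
  rw [fluxDensity, gradDot_add_mul h1 h2, gradDot_add_mul h1 h2, eucLap_add_mul hopen hv hX ε hz,
    fluxDensity, fluxDensity]
  ring

end

/-- The derivative of `v` along the gradient of the gauge is asymptotically nonnegative at the
boundary, locally uniformly in the half-plane. -/
def BoundaryFluxNonneg (Ω : Set (ℝ × ℝ)) (p : ℝ × ℝ) (v : ℝ × ℝ → ℝ) : Prop :=
  ∀ K : Set (ℝ × ℝ), IsCompact K → K ⊆ H2 → ∀ ε : ℝ, 0 < ε → ∃ δ : ℝ, 0 < δ ∧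
    ∀ z ∈ Ω ∩ K, DifferentiableAt ℝ (domainGauge Ω p) z → 1 - δ < domainGauge Ω p z →
      -ε ≤ gradDot v (domainGauge Ω p) z

section

variable {Ω : Set (ℝ × ℝ)} {p : ℝ × ℝ} {v ψ : ℝ × ℝ → ℝ} {μ : ℝ}

lemma integrableOn_gradSq_add_eucLap (hΩ : Ω ⊆ H2) (hopen : IsOpen Ω)
    (heq : ∀ z ∈ Ω, eucLap v z = -(μ / z.2 ^ 2) * v z)
    (hv2 : IntegrableOn (fun z => v z ^ 2 / z.2 ^ 2) Ω) (hve : IntegrableOn (gradSq v) Ω) :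
    IntegrableOn (fun z => gradSq v z + z.2 ^ 2 * eucLap v z ^ 2) Ω := by
  refine (hve.add (hv2.const_mul (μ ^ 2))).congr_fun (fun z hz => ?_) hopen.measurableSet
  have hz' : z.2 ≠ 0 := (show (0 : ℝ) < z.2 from hΩ hz).ne'
  simp only [Pi.add_apply]
  rw [heq z hz]
  field_simp

lemma integrableOn_fluxDensity_radial (hΩ : Ω ⊆ H2) (hopen : IsOpen Ω) (hp : p ∈ H2)
    (hψ : ContDiffOn ℝ (⊤ : ℕ∞) ψ Ω)
    (hψ2 : IntegrableOn (fun z => ψ z ^ 2 / z.2 ^ 2) Ω) (hψe : IntegrableOn (gradSq ψ) Ω) (n : ℕ) :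
    IntegrableOn (fluxDensity (radial p) ψ (radialCutoff p n)) Ω := by
  obtain ⟨C, -, hC⟩ := exists_gradSq_radialCutoff_le hp
  have hX := contDiffOn_radial hp
  have hc : ContinuousOn (fun z => gradSq (radial p) z + z.2 ^ 2 * eucLap (radial p) z ^ 2) H2 :=
    (continuousOn_gradSq isOpen_H2 hX).add
      ((continuous_snd.pow 2).continuousOn.mul ((continuousOn_eucLap isOpen_H2 hX).pow 2))
  refine integrableOn_fluxDensity hΩ hopen (hX.mono hΩ) hψ (contDiff_radialCutoff hp n)
    (radialCutoff_mem_Icc n) (hC n) ?_ hψ2 hψe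
  exact ((hc.mono (tsupport_radialCutoff_subset_H2 hp n)).integrableOn_compact
    (hasCompactSupport_radialCutoff hp n)).mono_set inter_subset_right

lemma integral_fluxDensity_radialCutoff_nonneg (hΩ : Ω ⊆ H2) (hopen : IsOpen Ω)
    (hconv : Convex ℝ (straighten '' Ω)) (hp : p ∈ Ω)
    (hv : ContDiffOn ℝ (⊤ : ℕ∞) v Ω) (heq : ∀ z ∈ Ω, eucLap v z = -(μ / z.2 ^ 2) * v z)
    (hv2 : IntegrableOn (fun z => v z ^ 2 / z.2 ^ 2) Ω) (hve : IntegrableOn (gradSq v) Ω)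
    (hbd : BoundaryFluxNonneg Ω p v)
    (hψ : ContDiffOn ℝ (⊤ : ℕ∞) ψ Ω) (hψ0 : ∀ z ∈ Ω, 0 ≤ ψ z)
    (hψ2 : IntegrableOn (fun z => ψ z ^ 2 / z.2 ^ 2) Ω) (hψe : IntegrableOn (gradSq ψ) Ω) (n : ℕ) :
    0 ≤ ∫ z in Ω, fluxDensity v ψ (radialCutoff p n) z := by
  have hpH := hΩ hp
  have hp' : (0 : ℝ) < p.2 := hpH
  obtain ⟨C, -, hC⟩ := exists_gradSq_radialCutoff_le hpH
  have hX := (contDiffOn_radial hpH).mono hΩ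
  set κ := radialCutoff p n
  have hκc : HasCompactSupport κ := hasCompactSupport_radialCutoff hpH n
  have hκH : tsupport κ ⊆ H2 := tsupport_radialCutoff_subset_H2 hpH n
  have i1 : IntegrableOn (fluxDensity v ψ κ) Ω :=
    integrableOn_fluxDensity hΩ hopen hv hψ (contDiff_radialCutoff hpH n)
    (radialCutoff_mem_Icc n) (hC n)
    ((integrableOn_gradSq_add_eucLap hΩ hopen heq hv2 hve).mono_set inter_subset_left) hψ2 hψe
  have i2 : IntegrableOn (fluxDensity (radial p) ψ κ) Ω :=
    integrableOn_fluxDensity_radial hΩ hopen hpH hψ hψ2 hψe n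
  obtain ⟨Y, hY⟩ := (IsCompact.image hκc continuous_snd).bddAbove
  set I := ∫ z in Ω, fluxDensity v ψ κ z
  set J := ∫ z in Ω, fluxDensity (radial p) ψ κ z
  have key : ∀ ε : ℝ, 0 < ε → 0 ≤ I + ε * J := by
    intro ε hε
    obtain ⟨δ, hδ, hb⟩ := hbd (tsupport κ) hκc hκH (ε / (4 * (|Y| + 1) * p.2)) (by positivity)
    have hfd : ∀ z ∈ Ω, fluxDensity v ψ κ z + ε * fluxDensity (radial p) ψ κ z =
        fluxDensity (fun y => v y + ε * radial p y) ψ κ z :=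
      fun z hz => (fluxDensity_add_mul hopen hv hX ε hz).symm
    have i3 := (i1.add (i2.const_mul ε)).congr_fun hfd hopen.measurableSet
    have := integral_fluxDensity_nonneg hΩ hopen hconv hp (hv.add (contDiffOn_const.mul hX)) hψ hψ0
      (contDiff_radialCutoff hpH n) hκc hκH (radialCutoff_mem_Icc n) i3
      (δ₀ := min δ (1 / 2)) (by positivity) ?_
    · rwa [← setIntegral_congr_fun hopen.measurableSet hfd, integral_add i1 (i2.const_mul ε),
        integral_const_mul] at this
    · intro z hz hd hG
      have hzH : (0 : ℝ) < z.2 := hΩ hz.1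
      have h1 := hb z hz hd (lt_of_le_of_lt (by linarith [min_le_left δ (1 / 2)]) hG)
      have h2 : 1 / 2 < domainGauge Ω p z :=
        lt_of_le_of_lt (by linarith [min_le_right δ (1 / 2)]) hG
      rw [gradDot_add_mul ((hv.contDiffAt (hopen.mem_nhds hz.1)).differentiableAt (by simp))
        ((hX.contDiffAt (hopen.mem_nhds hz.1)).differentiableAt (by simp)),
        gradDot_radial_domainGauge hpH (hΩ hz.1) hd]
      have hzY : z.2 ≤ |Y| + 1 := by
        have := hY (mem_image_of_mem _ hz.2)
        linarith [le_abs_self Y]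
      have h3 : 1 / (4 * (|Y| + 1) * p.2) ≤ domainGauge Ω p z / (2 * z.2 * p.2) := by
        rw [div_le_div_iff₀ (by positivity) (by positivity)]
        nlinarith [mul_le_mul_of_nonneg_right hzY hp'.le,
          mul_pos (show (0 : ℝ) < |Y| + 1 by positivity) hp']
      have h4 := mul_le_mul_of_nonneg_left h3 hε.le
      rw [mul_one_div] at h4
      linarith
  have hlim : Tendsto (fun ε : ℝ => I + ε * J) (𝓝[>] 0) (𝓝 (I + 0 * J)) :=
    ((continuous_const.add (continuous_id.mul continuous_const)).tendsto _).mono_left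
      nhdsWithin_le_nhds
  rw [zero_mul, add_zero] at hlim
  exact ge_of_tendsto hlim (eventually_mem_nhdsWithin.mono fun ε hε => key ε hε)

/-- If the flux of a solution through the boundary is nonnegative in the weak sense, then it is a
weak Neumann supersolution. -/
theorem integral_gradDot_ge (hΩ : Ω ⊆ H2) (hopen : IsOpen Ω)
    (hconv : Convex ℝ (straighten '' Ω)) (hp : p ∈ Ω)
    (hv : ContDiffOn ℝ (⊤ : ℕ∞) v Ω) (heq : ∀ z ∈ Ω, eucLap v z = -(μ / z.2 ^ 2) * v z)
    (hv2 : IntegrableOn (fun z => v z ^ 2 / z.2 ^ 2) Ω) (hve : IntegrableOn (gradSq v) Ω)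
    (hbd : BoundaryFluxNonneg Ω p v)
    (hψ : ContDiffOn ℝ (⊤ : ℕ∞) ψ Ω) (hψ0 : ∀ z ∈ Ω, 0 ≤ ψ z)
    (hψ2 : IntegrableOn (fun z => ψ z ^ 2 / z.2 ^ 2) Ω) (hψe : IntegrableOn (gradSq ψ) Ω) :
    μ * ∫ z in Ω, v z * ψ z / z.2 ^ 2 ≤ ∫ z in Ω, gradDot v ψ z := by
  have hpH := hΩ hp
  obtain ⟨C, -, hC⟩ := exists_gradSq_radialCutoff_le hpH
  have hi := integrableOn_gradSq_add_eucLap hΩ hopen heq hv2 hve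
  have hm := hopen.measurableSet
  have hlim : Tendsto (fun n : ℕ => ∫ z in Ω, fluxDensity v ψ (radialCutoff p n) z) atTop
      (𝓝 (∫ z in Ω, (gradDot v ψ z + eucLap v z * ψ z))) := by
    refine tendsto_integral_of_dominated_convergence
      (fun z => (1 + C) * (gradSq v z + z.2 ^ 2 * eucLap v z ^ 2) + gradSq ψ z +
        2 * (ψ z ^ 2 / z.2 ^ 2)) (fun n => ?_)
      (((hi.const_mul (1 + C)).add hψe).add (hψ2.const_mul 2)) (fun n => ?_) ?_
    · exact (continuousOn_fluxDensity hopen hv hψ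
        (contDiff_radialCutoff hpH n).contDiffOn).aestronglyMeasurable hm
    · filter_upwards [ae_restrict_mem hm] with z hz
      exact abs_fluxDensity_le (hΩ hz) (radialCutoff_mem_Icc n z) (hC n z (hΩ hz))
    · filter_upwards [ae_restrict_mem hm] with z hz
      refine tendsto_const_nhds.congr' ?_
      filter_upwards [radialCutoff_eventuallyEq_one hpH (hΩ hz)] with n hn
      have h0 : fderiv ℝ (radialCutoff p n) z = 0 := by rw [hn.fderiv_eq]; simp
      have h1 : radialCutoff p n z = 1 := hn.self_of_nhds
      simp [fluxDensity, gradDot, pdx, pdy, h0, h1]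
  have h0 := ge_of_tendsto' hlim fun n => integral_fluxDensity_radialCutoff_nonneg hΩ hopen hconv hp
    hv heq hv2 hve hbd hψ hψ0 hψ2 hψe n
  have hg : IntegrableOn (gradDot v ψ) Ω := by
    refine Integrable.mono' (hve.add hψe)
      ((continuousOn_gradDot hopen hv hψ).aestronglyMeasurable hm) (Eventually.of_forall fun z => ?_)
    exact abs_gradDot_le v ψ z
  have hvψ : IntegrableOn (fun z => v z * ψ z / z.2 ^ 2) Ω := by
    refine Integrable.mono' (hv2.add hψ2) ?_ ?_
    · refine ((hv.continuousOn.mul hψ.continuousOn).div (continuous_snd.pow 2).continuousOn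
        fun z hz => ?_).aestronglyMeasurable hm
      exact pow_ne_zero 2 (show (0 : ℝ) < z.2 from hΩ hz).ne'
    · filter_upwards with z
      rw [Real.norm_eq_abs, abs_div, abs_of_nonneg (sq_nonneg z.2), Pi.add_apply, ← add_div]
      refine div_le_div_of_nonneg_right ?_ (sq_nonneg _)
      rw [abs_le]
      constructor <;> nlinarith [sq_nonneg (v z + ψ z), sq_nonneg (v z - ψ z)]
  have h1 : ∫ z in Ω, (gradDot v ψ z + eucLap v z * ψ z) =
      ∫ z in Ω, (gradDot v ψ z - μ * (v z * ψ z / z.2 ^ 2)) := by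
    refine setIntegral_congr_fun hm fun z hz => ?_
    simp only [heq z hz]
    ring
  rw [h1, integral_sub hg (hvψ.const_mul μ), integral_const_mul] at h0
  linarith

end

section

variable {U : Set (ℝ × ℝ)} {I : Set ℝ} {X : ℝ × ℝ → ℝ} {f : ℝ → ℝ} {z : ℝ × ℝ}

lemma fderiv_comp_of_contDiffOn (hX : ContDiffOn ℝ (⊤ : ℕ∞) X U) (hU : IsOpen U)
    (hf : ContDiffOn ℝ (⊤ : ℕ∞) f I) (hI : IsOpen I) (hz : z ∈ U) (hXz : X z ∈ I) :
    fderiv ℝ (fun y => f (X y)) z = deriv f (X z) • fderiv ℝ X z := by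
  have h1 : HasDerivAt f (deriv f (X z)) (X z) :=
    ((hf.contDiffAt (hI.mem_nhds hXz)).differentiableAt (by simp)).hasDerivAt
  exact (h1.comp_hasFDerivAt z
    ((hX.contDiffAt (hU.mem_nhds hz)).differentiableAt (by simp)).hasFDerivAt).fderiv

lemma eucLap_comp (hX : ContDiffOn ℝ (⊤ : ℕ∞) X U) (hU : IsOpen U)
    (hf : ContDiffOn ℝ (⊤ : ℕ∞) f I) (hI : IsOpen I) (hXI : ∀ z ∈ U, X z ∈ I) (hz : z ∈ U) :
    eucLap (fun y => f (X y)) z =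
      deriv (deriv f) (X z) * gradSq X z + deriv f (X z) * eucLap X z := by
  have hf' : ContDiffOn ℝ (⊤ : ℕ∞) (deriv f) I := ((contDiffOn_infty_iff_deriv_of_isOpen hI).1 hf).2
  have key : ∀ e, fderiv ℝ (fun y => fderiv ℝ (fun y => f (X y)) y e) z e =
      deriv (deriv f) (X z) * fderiv ℝ X z e ^ 2 +
        deriv f (X z) * fderiv ℝ (fun y => fderiv ℝ X y e) z e := by
    intro e
    have he : (fun y => fderiv ℝ (fun y => f (X y)) y e) =ᶠ[𝓝 z]
        fun y => deriv f (X y) * fderiv ℝ X y e := by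
      filter_upwards [hU.mem_nhds hz] with y hy
      rw [fderiv_comp_of_contDiffOn hX hU hf hI hy (hXI y hy)]
      rfl
    have h1 : DifferentiableAt ℝ (fun y => deriv f (X y)) z :=
      ((hf'.contDiffAt (hI.mem_nhds (hXI z hz))).differentiableAt (by simp)).comp z
        ((hX.contDiffAt (hU.mem_nhds hz)).differentiableAt (by simp))
    have h2 : DifferentiableAt ℝ (fun y => fderiv ℝ X y e) z :=
      ((hX.fderiv_apply_of_isOpen hU e).contDiffAt (hU.mem_nhds hz)).differentiableAt (by simp)
    rw [he.fderiv_eq, fderiv_fun_mul h1 h2, fderiv_comp_of_contDiffOn hX hU hf' hI hz (hXI z hz)]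
    simp only [add_apply, smul_apply, smul_eq_mul]
    ring
  have hx := key (1, 0)
  have hy := key (0, 1)
  rw [show eucLap (fun y => f (X y)) z =
    fderiv ℝ (fun y => fderiv ℝ (fun y => f (X y)) y (1, 0)) z (1, 0) +
      fderiv ℝ (fun y => fderiv ℝ (fun y => f (X y)) y (0, 1)) z (0, 1) from rfl, hx, hy,
    show eucLap X z = fderiv ℝ (fun y => fderiv ℝ X y (1, 0)) z (1, 0) +
      fderiv ℝ (fun y => fderiv ℝ X y (0, 1)) z (0, 1) from rfl, gradSq, pdx, pdy]
  ring

end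

lemma gradSq_eq_of_fderiv_eq {f g : ℝ × ℝ → ℝ} {a : ℝ} {z : ℝ × ℝ}
    (h : fderiv ℝ f z = a • fderiv ℝ g z) : gradSq f z = a ^ 2 * gradSq g z := by
  rw [gradSq, gradSq, pdx, pdy, h]
  simp only [smul_apply, smul_eq_mul, pdx, pdy]
  ring

/-- A positive radially decreasing eigenfunction on the hyperbolic plane. -/
theorem exists_radial_eigenfunction {μ : ℝ} (hμ : 0 < μ) (hμ' : μ ≤ 1 / 4) {p : ℝ × ℝ}
    (hp : p ∈ H2) : ∃ φ : ℝ × ℝ → ℝ, ContDiffOn ℝ (⊤ : ℕ∞) φ H2 ∧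
      (∀ z ∈ H2, eucLap φ z = -(μ / z.2 ^ 2) * φ z) ∧ (∀ z ∈ H2, 0 < φ z ∧ φ z ≤ φ p) ∧
      fderiv ℝ φ p = 0 ∧ (∃ C : ℝ, ∀ z ∈ H2, gradSq φ z ≤ C / z.2 ^ 2) ∧
      ∀ z ∈ H2, ∃ a ≤ (0 : ℝ), fderiv ℝ φ z = a • fderiv ℝ (radial p) z := by
  obtain ⟨f, hf, hode, hpos, C, hC, hfC⟩ := exists_radial_solution hμ hμ'
  have hXp : radial p p = 0 := by simp [radial]
  have hX0 : ∀ z ∈ H2, 0 ≤ radial p z := fun z hz => radial_nonneg hp hz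
  have hXI : ∀ z ∈ H2, radial p z ∈ Ioi (-1 : ℝ) := fun z hz =>
    lt_of_lt_of_le (by norm_num) (hX0 z hz)
  have hd : ∀ z ∈ H2, fderiv ℝ (fun y => f (radial p y)) z =
      deriv f (radial p z) • fderiv ℝ (radial p) z := fun z hz =>
    fderiv_comp_of_contDiffOn (contDiffOn_radial hp) isOpen_H2 hf isOpen_Ioi hz (hXI z hz)
  refine ⟨fun z => f (radial p z), ?_, ?_, ?_, ?_, ⟨C ^ 2, ?_⟩, ?_⟩
  · exact hf.comp (contDiffOn_radial hp) hXI
  · intro z hz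
    have hz' : z.2 ≠ 0 := (show (0 : ℝ) < z.2 from hz).ne'
    have h1 := gradSq_radial hp hz
    have h2 := eucLap_radial hp hz
    have h3 := hode (radial p z) (hXI z hz)
    rw [eucLap_comp (contDiffOn_radial hp) isOpen_H2 hf isOpen_Ioi hXI hz]
    rw [← h1, ← h2] at h3
    field_simp
    linarith
  · intro z hz
    change 0 < f (radial p z) ∧ f (radial p z) ≤ f (radial p p)
    rw [hXp]
    exact ⟨(hpos _ (hX0 z hz)).1, (hpos _ (hX0 z hz)).2.1⟩
  · rw [hd p hp]
    have h1 := gradSq_radial hp hp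
    rw [hXp, zero_mul] at h1
    have h2 : gradSq (radial p) p = 0 :=
      (mul_eq_zero.1 h1).resolve_left (pow_ne_zero 2 (show (0 : ℝ) < p.2 from hp).ne')
    rw [gradSq] at h2
    have hx : pdx (radial p) p = 0 := by
      nlinarith [sq_nonneg (pdx (radial p) p), sq_nonneg (pdy (radial p) p)]
    have hy : pdy (radial p) p = 0 := by
      nlinarith [sq_nonneg (pdx (radial p) p), sq_nonneg (pdy (radial p) p)]
    ext
    · simp [show fderiv ℝ (radial p) p (1, 0) = 0 from hx]
    · simp [show fderiv ℝ (radial p) p (0, 1) = 0 from hy]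
  · intro z hz
    have hz' : (0 : ℝ) < z.2 := hz
    have hX := hX0 z hz
    rw [gradSq_eq_of_fderiv_eq (hd z hz), le_div_iff₀ (by positivity), mul_assoc,
      mul_comm (gradSq _ _), gradSq_radial hp hz]
    have h1 := hfC _ hX
    rw [le_div_iff₀ (by linarith)] at h1
    calc _ ≤ deriv f (radial p z) ^ 2 * (1 + radial p z) ^ 2 := by gcongr; nlinarith
      _ = (|deriv f (radial p z)| * (1 + radial p z)) ^ 2 := by rw [mul_pow, sq_abs]
      _ ≤ C ^ 2 := by gcongr
  · exact fun z hz => ⟨_, (hpos _ (hX0 z hz)).2.2, hd z hz⟩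

section

variable {Ω : Set (ℝ × ℝ)} {p : ℝ × ℝ} {u φ : ℝ × ℝ → ℝ} {μ : ℝ}

lemma gradSq_add_mul {X : ℝ × ℝ → ℝ} {z : ℝ × ℝ} (hu : DifferentiableAt ℝ u z)
    (hX : DifferentiableAt ℝ X z) (ε : ℝ) :
    gradSq (fun y => u y + ε * X y) z =
      gradSq u z + 2 * ε * gradDot u X z + ε ^ 2 * gradSq X z := by
  rw [gradSq, pdx, pdy, fderiv_fun_add hu (hX.const_mul ε), fderiv_const_mul hX]
  simp only [gradSq, gradDot, pdx, pdy, add_apply, smul_apply, smul_eq_mul]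
  ring

lemma gradSq_add_mul_le {X : ℝ × ℝ → ℝ} {z : ℝ × ℝ} (hu : DifferentiableAt ℝ u z)
    (hX : DifferentiableAt ℝ X z) (ε : ℝ) :
    gradSq (fun y => u y + ε * X y) z ≤ 2 * gradSq u z + 2 * ε ^ 2 * gradSq X z := by
  have h := gradSq_nonneg (fun y => u y + -ε * X y) z
  rw [gradSq_add_mul hu hX] at h ⊢
  linarith

lemma integrableOn_div_sq (hΩ : Ω ⊆ H2) (hopen : IsOpen Ω) (hu : ContDiffOn ℝ (⊤ : ℕ∞) u Ω)
    (harea : IntegrableOn (fun z : ℝ × ℝ => 1 / z.2 ^ 2) Ω)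
    (hu2 : IntegrableOn (fun z => u z ^ 2 / z.2 ^ 2) Ω) :
    IntegrableOn (fun z => u z / z.2 ^ 2) Ω := by
  refine Integrable.mono' (harea.add hu2) ?_ (Eventually.of_forall fun z => ?_)
  · refine (hu.continuousOn.div (continuous_snd.pow 2).continuousOn
      fun z hz => ?_).aestronglyMeasurable hopen.measurableSet
    exact pow_ne_zero 2 (show (0 : ℝ) < z.2 from hΩ hz).ne'
  · rw [Real.norm_eq_abs, abs_div, abs_of_nonneg (sq_nonneg z.2), Pi.add_apply, ← add_div]
    refine div_le_div_of_nonneg_right ?_ (sq_nonneg _)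
    rw [abs_le]
    constructor <;> nlinarith [sq_nonneg (u z + 1), sq_nonneg (u z - 1)]

lemma not_forall_pos (hΩ : Ω ⊆ H2) (hopen : IsOpen Ω)
    (hconv : Convex ℝ (straighten '' Ω)) (hp : p ∈ Ω) (hμ : 0 < μ)
    (harea : IntegrableOn (fun z : ℝ × ℝ => 1 / z.2 ^ 2) Ω)
    (hu : ContDiffOn ℝ (⊤ : ℕ∞) u Ω) (heq : ∀ z ∈ Ω, eucLap u z = -(μ / z.2 ^ 2) * u z)
    (hu2 : IntegrableOn (fun z => u z ^ 2 / z.2 ^ 2) Ω) (hue : IntegrableOn (gradSq u) Ω)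
    (hbd : BoundaryFluxNonneg Ω p u) : ¬ ∀ z ∈ Ω, 0 < u z := by
  intro hpos
  have h := integral_gradDot_ge hΩ hopen hconv hp hu heq hu2 hue hbd (ψ := fun _ => 1)
    contDiffOn_const (fun _ _ => zero_le_one) (by simpa using harea)
    (by
      have : gradSq (fun _ : ℝ × ℝ => (1 : ℝ)) = fun _ => 0 := by
        ext z; simp [gradSq, pdx, pdy]
      rw [this]; exact integrableOn_zero)
  have h0 : ∀ z, gradDot u (fun _ => 1) z = 0 := fun z => by simp [gradDot, pdx, pdy]
  simp only [h0, integral_zero, mul_one] at h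
  have hi := integrableOn_div_sq hΩ hopen hu harea hu2
  have hpos' : ∀ z ∈ Ω, 0 < u z / z.2 ^ 2 := fun z hz =>
    div_pos (hpos z hz) (pow_pos (show (0 : ℝ) < z.2 from hΩ hz) 2)
  have : 0 < ∫ z in Ω, u z / z.2 ^ 2 := by
    rw [setIntegral_pos_iff_support_of_nonneg_ae _ hi]
    · refine lt_of_lt_of_le (hopen.measure_pos volume ⟨p, hp⟩) (measure_mono fun z hz => ?_)
      exact ⟨(hpos' z hz).ne', hz⟩
    · filter_upwards [ae_restrict_mem hopen.measurableSet] with z hz using (hpos' z hz).le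
  nlinarith

/-- Subtracting a multiple of a radially decreasing function keeps the boundary flux
nonnegative. -/
lemma BoundaryFluxNonneg.add_neg_mul (hΩ : Ω ⊆ H2) (hopen : IsOpen Ω) (hp : p ∈ H2)
    (hu : ContDiffOn ℝ (⊤ : ℕ∞) u Ω) (hφ : ContDiffOn ℝ (⊤ : ℕ∞) φ H2)
    (hφr : ∀ z ∈ H2, ∃ a ≤ (0 : ℝ), fderiv ℝ φ z = a • fderiv ℝ (radial p) z)
    (h : BoundaryFluxNonneg Ω p u) {c : ℝ} (hc : 0 ≤ c) :
    BoundaryFluxNonneg Ω p (fun z => u z + -c * φ z) := by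
  intro K hK hKH ε hε
  obtain ⟨δ, hδ, hb⟩ := h K hK hKH ε hε
  refine ⟨δ, hδ, fun z hz hd hG => ?_⟩
  have h1 := hb z hz hd hG
  have hzH := hΩ hz.1
  have hz' : (0 : ℝ) < z.2 := hzH
  have hp' : (0 : ℝ) < p.2 := hp
  rw [gradDot_add_mul ((hu.contDiffAt (hopen.mem_nhds hz.1)).differentiableAt (by simp))
    ((hφ.contDiffAt (H2_mem_nhds hzH)).differentiableAt (by simp))]
  obtain ⟨a, ha, hφa⟩ := hφr z hzH
  have h2 : gradDot φ (domainGauge Ω p) z = a * gradDot (radial p) (domainGauge Ω p) z := by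
    rw [gradDot, gradDot, pdx, pdy, hφa]
    simp only [smul_apply, smul_eq_mul, pdx, pdy]
    ring
  have h3 : 0 ≤ gradDot (radial p) (domainGauge Ω p) z := by
    rw [gradDot_radial_domainGauge hp hzH hd]
    exact div_nonneg (domainGauge_nonneg z) (by positivity)
  rw [h2]
  nlinarith [mul_nonneg hc (mul_nonneg (neg_nonneg.2 ha) h3)]

/-- A Neumann eigenfunction with a critical point `p` can be corrected by a radial eigenfunction
to a nontrivial supersolution vanishing to second order at `p`. -/
theorem exists_supersolution (hΩ : Ω ⊆ H2) (hopen : IsOpen Ω)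
    (hconv : Convex ℝ (straighten '' Ω)) (hp : p ∈ Ω) (hμ : 0 < μ) (hμ' : μ ≤ 1 / 4)
    (harea : IntegrableOn (fun z : ℝ × ℝ => 1 / z.2 ^ 2) Ω)
    (hnc : ∃ z ∈ Ω, u z ≠ 0)
    (hu : ContDiffOn ℝ (⊤ : ℕ∞) u Ω) (heq : ∀ z ∈ Ω, eucLap u z = -(μ / z.2 ^ 2) * u z)
    (hu2 : IntegrableOn (fun z => u z ^ 2 / z.2 ^ 2) Ω) (hue : IntegrableOn (gradSq u) Ω)
    (hbd : BoundaryFluxNonneg Ω p u) (hup : 0 ≤ u p) (hcrit : fderiv ℝ u p = 0) :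
    ∃ v : ℝ × ℝ → ℝ, ContDiffOn ℝ (⊤ : ℕ∞) v Ω ∧
      (∀ z ∈ Ω, eucLap v z = -(μ / z.2 ^ 2) * v z) ∧
      IntegrableOn (fun z => v z ^ 2 / z.2 ^ 2) Ω ∧ IntegrableOn (gradSq v) Ω ∧
      BoundaryFluxNonneg Ω p v ∧ v p = 0 ∧ fderiv ℝ v p = 0 ∧ ∃ z ∈ Ω, v z ≠ 0 := by
  have hpH := hΩ hp
  have hm := hopen.measurableSet
  obtain ⟨φ, hφ, hφe, hφb, hφp, ⟨C, hC⟩, hφr⟩ := exists_radial_eigenfunction hμ hμ' hpH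
  have hφΩ := hφ.mono hΩ
  have hφp0 := (hφb p hpH).1
  set c := u p / φ p with hc
  have hc0 : 0 ≤ c := div_nonneg hup hφp0.le
  have hvs : ContDiffOn ℝ (⊤ : ℕ∞) (fun z => u z + -c * φ z) Ω := hu.add (contDiffOn_const.mul hφΩ)
  have hdu : ∀ z ∈ Ω, DifferentiableAt ℝ u z := fun z hz =>
    (hu.contDiffAt (hopen.mem_nhds hz)).differentiableAt (by simp)
  have hdφ : ∀ z ∈ Ω, DifferentiableAt ℝ φ z := fun z hz =>
    (hφΩ.contDiffAt (hopen.mem_nhds hz)).differentiableAt (by simp)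
  refine ⟨fun z => u z + -c * φ z, hvs, ?_, ?_, ?_,
    hbd.add_neg_mul hΩ hopen hpH hu hφ hφr hc0, ?_, ?_, ?_⟩
  · intro z hz
    rw [eucLap_add_mul hopen hu hφΩ _ hz, heq z hz, hφe z (hΩ hz)]
    ring
  · refine Integrable.mono' ((hu2.const_mul 2).add (harea.const_mul (2 * c ^ 2 * φ p ^ 2))) ?_ ?_
    · refine ((hvs.continuousOn.pow 2).div (continuous_snd.pow 2).continuousOn
        fun z hz => ?_).aestronglyMeasurable hm
      exact pow_ne_zero 2 (show (0 : ℝ) < z.2 from hΩ hz).ne'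
    · filter_upwards [ae_restrict_mem hm] with z hz
      have hb := hφb z (hΩ hz)
      have h1 : φ z ^ 2 ≤ φ p ^ 2 := pow_le_pow_left₀ hb.1.le hb.2 2
      rw [Real.norm_of_nonneg (by positivity), Pi.add_apply, ← mul_div_assoc, ← mul_div_assoc,
        ← add_div]
      refine div_le_div_of_nonneg_right ?_ (sq_nonneg _)
      nlinarith [sq_nonneg (u z + c * φ z), mul_le_mul_of_nonneg_left h1 (sq_nonneg c)]
  · refine Integrable.mono' ((hue.const_mul 2).add (harea.const_mul (2 * c ^ 2 * C)))
      ((continuousOn_gradSq hopen hvs).aestronglyMeasurable hm) ?_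
    filter_upwards [ae_restrict_mem hm] with z hz
    rw [Real.norm_of_nonneg (gradSq_nonneg _ _)]
    refine (gradSq_add_mul_le (hdu z hz) (hdφ z hz) (-c)).trans ?_
    have h1 := mul_le_mul_of_nonneg_left (hC z (hΩ hz)) (show 0 ≤ 2 * c ^ 2 by positivity)
    rw [neg_sq, Pi.add_apply]
    refine (add_le_add_right h1 _).trans (le_of_eq ?_)
    ring
  · change u p + -c * φ p = 0
    rw [hc]; field_simp; ring
  · rw [fderiv_fun_add (hdu p hp) ((hdφ p hp).const_mul _), fderiv_const_mul (hdφ p hp), hcrit, hφp]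
    simp
  · by_contra hv
    push Not at hv
    have huφ : ∀ z ∈ Ω, u z = c * φ z := fun z hz => by linarith [hv z hz]
    obtain ⟨z₀, hz₀, hne⟩ := hnc
    have hcpos : 0 < c := lt_of_le_of_ne hc0 fun h => hne (by rw [huφ z₀ hz₀, ← h, zero_mul])
    exact not_forall_pos hΩ hopen hconv hp hμ harea hu heq hu2 hue hbd fun z hz => by
      rw [huφ z hz]; exact mul_pos hcpos (hφb z (hΩ hz)).1

end

/-- A smooth approximation of the positive part whose derivative is the `k`-th power of a
transition function at scale `ε`. -/
def posApprox (k : ℕ) (ε t : ℝ) : ℝ := ∫ τ in (0 : ℝ)..t, Real.smoothTransition (τ / ε - 1) ^ k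

section

variable {k : ℕ} {ε : ℝ}

lemma continuous_posApprox_integrand :
    Continuous (fun τ => Real.smoothTransition (τ / ε - 1) ^ k) :=
  (Real.smoothTransition.continuous.comp
    ((continuous_id.div_const ε).sub continuous_const)).pow k

lemma hasDerivAt_posApprox (t : ℝ) :
    HasDerivAt (posApprox k ε) (Real.smoothTransition (t / ε - 1) ^ k) t :=
  intervalIntegral.integral_hasDerivAt_right (continuous_posApprox_integrand.intervalIntegrable _ _)
    continuous_posApprox_integrand.stronglyMeasurable.stronglyMeasurableAtFilter
    continuous_posApprox_integrand.continuousAt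

lemma contDiff_posApprox : ContDiff ℝ (⊤ : ℕ∞) (posApprox k ε) := by
  rw [contDiff_infty_iff_deriv]
  refine ⟨fun t => (hasDerivAt_posApprox t).differentiableAt, ?_⟩
  rw [show deriv (posApprox k ε) = fun t => Real.smoothTransition (t / ε - 1) ^ k from
    funext fun t => (hasDerivAt_posApprox t).deriv]
  exact ((Real.smoothTransition.contDiff (n := (⊤ : ℕ∞))).comp
    ((contDiff_id.div_const ε).sub contDiff_const)).pow k

lemma posApprox_of_le (hk : k ≠ 0) (hε : 0 < ε) {t : ℝ} (ht : t ≤ ε) : posApprox k ε t = 0 := by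
  rw [posApprox, intervalIntegral.integral_congr (g := fun _ => 0),
    intervalIntegral.integral_zero]
  intro τ hτ
  have h1 : τ ≤ ε := hτ.2.trans (max_le hε.le ht)
  have h2 : τ / ε - 1 ≤ 0 := by
    rw [sub_nonpos, div_le_one hε]; exact h1
  simp only [Real.smoothTransition.zero_of_nonpos h2, zero_pow hk]

lemma posApprox_mem_Icc {t : ℝ} (ht : 0 ≤ t) : posApprox k ε t ∈ Icc 0 t := by
  constructor
  · exact intervalIntegral.integral_nonneg ht fun τ _ => pow_nonneg (Real.smoothTransition.nonneg _) k
  · calc posApprox k ε t ≤ ∫ _ in (0 : ℝ)..t, (1 : ℝ) := by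
          refine intervalIntegral.integral_mono_on ht
            (continuous_posApprox_integrand.intervalIntegrable _ _) (by simp) fun τ _ => ?_
          exact pow_le_one₀ (Real.smoothTransition.nonneg _) (Real.smoothTransition.le_one _)
      _ = t := by simp

lemma le_posApprox (hε : 0 < ε) {t : ℝ} (ht : 0 ≤ t) : t - 2 * ε ≤ posApprox k ε t := by
  rcases le_total t (2 * ε) with h | h
  · exact (sub_nonpos.2 h).trans (posApprox_mem_Icc ht).1
  · have h1 : ∫ τ in (2 * ε)..t, Real.smoothTransition (τ / ε - 1) ^ k = t - 2 * ε := by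
      rw [intervalIntegral.integral_congr (g := fun _ => (1 : ℝ))]
      · simp
      · intro τ hτ
        rw [uIcc_of_le h] at hτ
        have : 1 ≤ τ / ε - 1 := by
          rw [le_sub_iff_add_le, le_div_iff₀ hε]; linarith [hτ.1]
        simp only [Real.smoothTransition.one_of_one_le this, one_pow]
    rw [posApprox, ← intervalIntegral.integral_add_adjacent_intervals
      (continuous_posApprox_integrand.intervalIntegrable 0 (2 * ε))
      (continuous_posApprox_integrand.intervalIntegrable _ _), h1, le_add_iff_nonneg_left]
    exact (posApprox_mem_Icc (k := k) (ε := ε) (by positivity : (0 : ℝ) ≤ 2 * ε)).1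

lemma tendsto_posApprox {t : ℝ} (ht : 0 ≤ t) :
    Tendsto (fun n : ℕ => posApprox k (1 / ((n : ℝ) + 1)) t) atTop (𝓝 t) := by
  have h : Tendsto (fun n : ℕ => t - 2 * (1 / ((n : ℝ) + 1))) atTop (𝓝 (t - 2 * 0)) :=
    tendsto_const_nhds.sub (tendsto_one_div_add_atTop_nhds_zero_nat.const_mul 2)
  rw [mul_zero, sub_zero] at h
  exact tendsto_of_tendsto_of_tendsto_of_le_of_le h tendsto_const_nhds
    (fun n => le_posApprox Nat.one_div_pos_of_nat ht) (fun n => (posApprox_mem_Icc ht).2)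

end

/-- A set that is a union of components of the negativity set of `v` in `Ω`. -/
structure IsNegativeRegion (Ω : Set (ℝ × ℝ)) (v : ℝ × ℝ → ℝ) (D : Set (ℝ × ℝ)) : Prop where
  isOpen : IsOpen D
  subset : D ⊆ Ω
  neg : ∀ z ∈ D, v z < 0
  isOpen_diff : IsOpen ({z | z ∈ Ω ∧ v z < 0} \ D)

open scoped Classical in
/-- The function `H (-v)` restricted to `D`. -/
def restrictNeg (D : Set (ℝ × ℝ)) (H : ℝ → ℝ) (v : ℝ × ℝ → ℝ) (z : ℝ × ℝ) : ℝ :=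
  if z ∈ D then H (-v z) else 0

section

variable {Ω D : Set (ℝ × ℝ)} {v : ℝ × ℝ → ℝ} {H : ℝ → ℝ} {z : ℝ × ℝ}

lemma restrictNeg_of_mem (hz : z ∈ D) : restrictNeg D H v z = H (-v z) := if_pos hz

lemma restrictNeg_of_notMem (hz : z ∉ D) : restrictNeg D H v z = 0 := if_neg hz

lemma restrictNeg_eventuallyEq_of_mem (hD : IsOpen D) (hz : z ∈ D) :
    restrictNeg D H v =ᶠ[𝓝 z] fun y => H (-v y) := by
  filter_upwards [hD.mem_nhds hz] with y hy using restrictNeg_of_mem hy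

lemma restrictNeg_eventuallyEq_of_notMem (hD : IsNegativeRegion Ω v D) (hopen : IsOpen Ω)
    (hv : ContinuousOn v Ω) {ε : ℝ} (hε : 0 < ε) (hH : ∀ t ≤ ε, H t = 0) (hz : z ∈ Ω)
    (hzD : z ∉ D) : restrictNeg D H v =ᶠ[𝓝 z] fun _ => 0 := by
  by_cases hneg : v z < 0
  · filter_upwards [hD.isOpen_diff.mem_nhds ⟨⟨hz, hneg⟩, hzD⟩] with y hy
    exact restrictNeg_of_notMem hy.2
  · have h1 : -ε < v z := by linarith
    filter_upwards [(hv.continuousAt (hopen.mem_nhds hz)).eventually (lt_mem_nhds h1)] with y hy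
    rw [restrictNeg]
    split_ifs
    · exact hH _ (by linarith)
    · rfl

lemma contDiffOn_restrictNeg (hD : IsNegativeRegion Ω v D) (hopen : IsOpen Ω)
    (hv : ContDiffOn ℝ (⊤ : ℕ∞) v Ω) {ε : ℝ} (hε : 0 < ε) (hH : ∀ t ≤ ε, H t = 0)
    (hHs : ContDiff ℝ (⊤ : ℕ∞) H) : ContDiffOn ℝ (⊤ : ℕ∞) (restrictNeg D H v) Ω := by
  intro z hz
  refine ContDiffAt.contDiffWithinAt ?_
  by_cases hzD : z ∈ D
  · refine ContDiffAt.congr_of_eventuallyEq ?_ (restrictNeg_eventuallyEq_of_mem hD.isOpen hzD)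
    exact hHs.contDiffAt.comp z (hv.contDiffAt (hopen.mem_nhds hz)).neg
  · exact contDiffAt_const.congr_of_eventuallyEq
      (restrictNeg_eventuallyEq_of_notMem hD hopen hv.continuousOn hε hH hz hzD)

lemma fderiv_restrictNeg_of_mem (hD : IsOpen D) (hv : DifferentiableAt ℝ v z)
    (hH : DifferentiableAt ℝ H (-v z)) (hzD : z ∈ D) :
    fderiv ℝ (restrictNeg D H v) z = (-deriv H (-v z)) • fderiv ℝ v z := by
  rw [(restrictNeg_eventuallyEq_of_mem hD hzD).fderiv_eq]
  have := (hH.hasDerivAt.comp_hasFDerivAt z hv.hasFDerivAt.neg).fderiv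
  refine this.trans ?_
  ext <;> simp

lemma fderiv_restrictNeg_of_notMem (hD : IsNegativeRegion Ω v D) (hopen : IsOpen Ω)
    (hv : ContinuousOn v Ω) {ε : ℝ} (hε : 0 < ε) (hH : ∀ t ≤ ε, H t = 0) (hz : z ∈ Ω)
    (hzD : z ∉ D) : fderiv ℝ (restrictNeg D H v) z = 0 := by
  rw [(restrictNeg_eventuallyEq_of_notMem hD hopen hv hε hH hz hzD).fderiv_eq]
  simp

end

section

variable {Ω D : Set (ℝ × ℝ)} {v : ℝ × ℝ → ℝ} {k : ℕ} {ε : ℝ}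

lemma restrictNeg_posApprox_mem_Icc (hD : IsNegativeRegion Ω v D) (z : ℝ × ℝ) :
    restrictNeg D (posApprox k ε) v z ∈ Icc 0 (restrictNeg D id v z) := by
  by_cases hz : z ∈ D
  · rw [restrictNeg_of_mem hz, restrictNeg_of_mem hz]
    exact posApprox_mem_Icc (t := -v z) (by linarith [hD.neg z hz])
  · simp [restrictNeg_of_notMem hz]

lemma restrictNeg_id_mem_Icc (hD : IsNegativeRegion Ω v D) (z : ℝ × ℝ) :
    restrictNeg D id v z ∈ Icc 0 |v z| := by
  by_cases hz : z ∈ D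
  · rw [restrictNeg_of_mem hz, abs_of_neg (hD.neg z hz)]
    exact ⟨(neg_pos.2 (hD.neg z hz)).le, le_rfl⟩
  · simp [restrictNeg_of_notMem hz]

lemma contDiffOn_restrictNeg_posApprox (hD : IsNegativeRegion Ω v D) (hopen : IsOpen Ω)
    (hv : ContDiffOn ℝ (⊤ : ℕ∞) v Ω) (hk : k ≠ 0) (hε : 0 < ε) :
    ContDiffOn ℝ (⊤ : ℕ∞) (restrictNeg D (posApprox k ε) v) Ω :=
  contDiffOn_restrictNeg hD hopen hv hε (fun _ => posApprox_of_le hk hε) contDiff_posApprox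

open scoped Classical in
lemma fderiv_restrictNeg_posApprox (hD : IsNegativeRegion Ω v D) (hopen : IsOpen Ω)
    (hv : ContDiffOn ℝ (⊤ : ℕ∞) v Ω) (hk : k ≠ 0) (hε : 0 < ε) {z : ℝ × ℝ} (hz : z ∈ Ω) :
    fderiv ℝ (restrictNeg D (posApprox k ε) v) z =
      (if z ∈ D then -Real.smoothTransition (-v z / ε - 1) ^ k else 0) • fderiv ℝ v z := by
  split_ifs with hzD
  · rw [fderiv_restrictNeg_of_mem hD.isOpen
      ((hv.contDiffAt (hopen.mem_nhds hz)).differentiableAt (by simp))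
      (hasDerivAt_posApprox _).differentiableAt hzD, (hasDerivAt_posApprox _).deriv]
  · rw [fderiv_restrictNeg_of_notMem hD hopen hv.continuousOn hε
      (fun _ => posApprox_of_le hk hε) hz hzD, zero_smul]

lemma gradSq_restrictNeg_posApprox_le (hD : IsNegativeRegion Ω v D) (hopen : IsOpen Ω)
    (hv : ContDiffOn ℝ (⊤ : ℕ∞) v Ω) (hk : k ≠ 0) (hε : 0 < ε) {z : ℝ × ℝ} (hz : z ∈ Ω) :
    gradSq (restrictNeg D (posApprox k ε) v) z ≤ gradSq v z := by
  rw [gradSq_eq_of_fderiv_eq (fderiv_restrictNeg_posApprox hD hopen hv hk hε hz)]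
  refine mul_le_of_le_one_left (gradSq_nonneg _ _) ?_
  split_ifs
  · rw [neg_sq]
    exact pow_le_one₀ (pow_nonneg (Real.smoothTransition.nonneg _) _)
      (pow_le_one₀ (Real.smoothTransition.nonneg _) (Real.smoothTransition.le_one _))
  · simp

lemma gradDot_eq_of_fderiv_eq {f g X : ℝ × ℝ → ℝ} {a b : ℝ} {z : ℝ × ℝ}
    (hf : fderiv ℝ f z = a • fderiv ℝ X z) (hg : fderiv ℝ g z = b • fderiv ℝ X z) :
    gradDot f g z = a * b * gradSq X z := by
  rw [gradDot, gradSq, pdx, pdy, pdx, pdy, hf, hg]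
  simp only [smul_apply, smul_eq_mul, pdx, pdy]
  ring

lemma gradSq_restrictNeg_posApprox_one (hD : IsNegativeRegion Ω v D) (hopen : IsOpen Ω)
    (hv : ContDiffOn ℝ (⊤ : ℕ∞) v Ω) (hε : 0 < ε) {z : ℝ × ℝ} (hz : z ∈ Ω) :
    gradSq (restrictNeg D (posApprox 1 ε) v) z =
      -gradDot v (restrictNeg D (posApprox 2 ε) v) z := by
  rw [gradSq_eq_of_fderiv_eq (fderiv_restrictNeg_posApprox hD hopen hv one_ne_zero hε hz),
    gradDot_eq_of_fderiv_eq (one_smul ℝ _).symm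
      (fderiv_restrictNeg_posApprox hD hopen hv two_ne_zero hε hz)]
  split_ifs <;> ring

lemma integrableOn_sq_of_abs_le (hΩ : Ω ⊆ H2) (hopen : IsOpen Ω) {w : ℝ × ℝ → ℝ}
    (hw : ContinuousOn w Ω) (hwv : ∀ z ∈ Ω, |w z| ≤ |v z|)
    (hv2 : IntegrableOn (fun z => v z ^ 2 / z.2 ^ 2) Ω) :
    IntegrableOn (fun z => w z ^ 2 / z.2 ^ 2) Ω := by
  refine Integrable.mono' hv2 ?_ ?_
  · refine ((hw.pow 2).div (continuous_snd.pow 2).continuousOn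
      fun z hz => ?_).aestronglyMeasurable hopen.measurableSet
    exact pow_ne_zero 2 (show (0 : ℝ) < z.2 from hΩ hz).ne'
  · filter_upwards [ae_restrict_mem hopen.measurableSet] with z hz
    rw [Real.norm_of_nonneg (by positivity)]
    exact div_le_div_of_nonneg_right (sq_le_sq.2 (hwv z hz)) (sq_nonneg _)

lemma abs_restrictNeg_posApprox_le (hD : IsNegativeRegion Ω v D) (z : ℝ × ℝ) :
    |restrictNeg D (posApprox k ε) v z| ≤ |v z| := by
  have h := restrictNeg_posApprox_mem_Icc (k := k) (ε := ε) hD z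
  rw [abs_of_nonneg h.1]
  exact h.2.trans (restrictNeg_id_mem_Icc hD z).2

lemma integrableOn_gradSq_restrictNeg (hD : IsNegativeRegion Ω v D) (hopen : IsOpen Ω)
    (hv : ContDiffOn ℝ (⊤ : ℕ∞) v Ω) (hve : IntegrableOn (gradSq v) Ω) (hk : k ≠ 0) (hε : 0 < ε) :
    IntegrableOn (gradSq (restrictNeg D (posApprox k ε) v)) Ω := by
  refine Integrable.mono' hve ((continuousOn_gradSq hopen
    (contDiffOn_restrictNeg_posApprox hD hopen hv hk hε)).aestronglyMeasurable
    hopen.measurableSet) ?_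
  filter_upwards [ae_restrict_mem hopen.measurableSet] with z hz
  rw [Real.norm_of_nonneg (gradSq_nonneg _ _)]
  exact gradSq_restrictNeg_posApprox_le hD hopen hv hk hε hz

lemma continuousOn_restrictNeg_id (hD : IsNegativeRegion Ω v D) (hopen : IsOpen Ω)
    (hv : ContinuousOn v Ω) : ContinuousOn (restrictNeg D id v) Ω := by
  refine fun z hz => ContinuousAt.continuousWithinAt ?_
  by_cases hzD : z ∈ D
  · refine ContinuousAt.congr ?_ (restrictNeg_eventuallyEq_of_mem hD.isOpen hzD).symm
    exact (hv.continuousAt (hopen.mem_nhds hz)).neg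
  · by_cases hneg : v z < 0
    · have : restrictNeg D id v =ᶠ[𝓝 z] fun _ => 0 := by
        filter_upwards [hD.isOpen_diff.mem_nhds ⟨⟨hz, hneg⟩, hzD⟩] with y hy
        exact restrictNeg_of_notMem hy.2
      exact continuousAt_const.congr this.symm
    · have h0 : restrictNeg D id v z = 0 := restrictNeg_of_notMem hzD
      rw [ContinuousAt, h0]
      have h1 : Tendsto (fun y => max (-v y) 0) (𝓝 z) (𝓝 (max (-v z) 0)) :=
        (hv.continuousAt (hopen.mem_nhds hz)).neg.max continuousAt_const
      rw [max_eq_right (by linarith [not_lt.1 hneg])] at h1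
      refine tendsto_of_tendsto_of_tendsto_of_le_of_le tendsto_const_nhds h1
        (fun y => (restrictNeg_id_mem_Icc hD y).1) fun y => ?_
      by_cases hy : y ∈ D
      · rw [restrictNeg_of_mem hy]; exact le_max_left _ _
      · rw [restrictNeg_of_notMem hy]; exact le_max_right _ _

lemma tendsto_integral_restrictNeg (hD : IsNegativeRegion Ω v D) (hopen : IsOpen Ω)
    (hv : ContDiffOn ℝ (⊤ : ℕ∞) v Ω) (hk : k ≠ 0) (m : ℕ) {F : ℝ × ℝ → ℝ}
    (hF : ContinuousOn F Ω) (hi : IntegrableOn (fun z => restrictNeg D id v z ^ m * F z) Ω) :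
    Tendsto (fun n : ℕ => ∫ z in Ω, restrictNeg D (posApprox k (1 / ((n : ℝ) + 1))) v z ^ m * F z)
      atTop (𝓝 (∫ z in Ω, restrictNeg D id v z ^ m * F z)) := by
  have hm := hopen.measurableSet
  refine tendsto_integral_of_dominated_convergence
    (fun z => |restrictNeg D id v z ^ m * F z|) (fun n => ?_) hi.abs (fun n => ?_) ?_
  · exact ((((contDiffOn_restrictNeg_posApprox hD hopen hv hk
      Nat.one_div_pos_of_nat).continuousOn.pow m).mul hF).aestronglyMeasurable hm)
  · refine Eventually.of_forall fun z => ?_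
    have h := restrictNeg_posApprox_mem_Icc (k := k) (ε := 1 / ((n : ℝ) + 1)) hD z
    rw [Real.norm_eq_abs, abs_mul, abs_mul, abs_of_nonneg (pow_nonneg h.1 m),
      abs_of_nonneg (pow_nonneg (h.1.trans h.2) m)]
    exact mul_le_mul_of_nonneg_right (pow_le_pow_left₀ h.1 h.2 m) (abs_nonneg _)
  · refine Eventually.of_forall fun z => ?_
    refine Tendsto.mul_const _ (Tendsto.pow ?_ m)
    by_cases hz : z ∈ D
    · simp only [restrictNeg_of_mem hz]
      exact tendsto_posApprox (by linarith [hD.neg z hz])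
    · simp only [restrictNeg_of_notMem hz]
      exact tendsto_const_nhds

/-- The truncations of a weak supersolution have controlled energy. -/
lemma integral_gradSq_restrictNeg_le {μ : ℝ} (hμ : 0 ≤ μ) (hΩ : Ω ⊆ H2)
    (hD : IsNegativeRegion Ω v D) (hopen : IsOpen Ω)
    (hv : ContDiffOn ℝ (⊤ : ℕ∞) v Ω) (hv2 : IntegrableOn (fun z => v z ^ 2 / z.2 ^ 2) Ω)
    (hve : IntegrableOn (gradSq v) Ω)
    (hweak : ∀ ψ : ℝ × ℝ → ℝ, ContDiffOn ℝ (⊤ : ℕ∞) ψ Ω → (∀ z ∈ Ω, 0 ≤ ψ z) →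
      IntegrableOn (fun z => ψ z ^ 2 / z.2 ^ 2) Ω → IntegrableOn (gradSq ψ) Ω →
      μ * ∫ z in Ω, v z * ψ z / z.2 ^ 2 ≤ ∫ z in Ω, gradDot v ψ z) (hε : 0 < ε) :
    ∫ z in Ω, gradSq (restrictNeg D (posApprox 1 ε) v) z ≤
      μ * ∫ z in Ω, restrictNeg D id v z ^ 2 / z.2 ^ 2 := by
  have hm := hopen.measurableSet
  set ψ := restrictNeg D (posApprox 2 ε) v with hψ
  have hψs : ContDiffOn ℝ (⊤ : ℕ∞) ψ Ω := contDiffOn_restrictNeg_posApprox hD hopen hv two_ne_zero hε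
  have hψ2 := integrableOn_sq_of_abs_le hΩ hopen hψs.continuousOn
    (fun z _ => abs_restrictNeg_posApprox_le (k := 2) (ε := ε) hD z) hv2
  have h1 := hweak ψ hψs (fun z _ => (restrictNeg_posApprox_mem_Icc hD z).1) hψ2
    (integrableOn_gradSq_restrictNeg hD hopen hv hve two_ne_zero hε)
  have hh2 : IntegrableOn (fun z => restrictNeg D id v z ^ 2 / z.2 ^ 2) Ω :=
    integrableOn_sq_of_abs_le hΩ hopen (continuousOn_restrictNeg_id hD hopen hv.continuousOn)
      (fun z _ => by
        have h := restrictNeg_id_mem_Icc hD z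
        rw [abs_of_nonneg h.1]; exact h.2) hv2
  rw [setIntegral_congr_fun hm fun z hz => gradSq_restrictNeg_posApprox_one hD hopen hv hε hz,
    integral_neg]
  have h2 : -∫ z in Ω, v z * ψ z / z.2 ^ 2 ≤ ∫ z in Ω, restrictNeg D id v z ^ 2 / z.2 ^ 2 := by
    rw [← integral_neg]
    refine integral_mono_of_nonneg (Eventually.of_forall fun z => ?_) hh2
      (Eventually.of_forall fun z => ?_)
    all_goals
      simp only [Pi.zero_apply]
      rw [← neg_div]
    · refine div_nonneg ?_ (sq_nonneg _)
      by_cases hz : z ∈ D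
      · have := (restrictNeg_posApprox_mem_Icc (k := 2) (ε := ε) hD z).1
        nlinarith [hD.neg z hz]
      · simp [hψ, restrictNeg_of_notMem hz]
    · refine div_le_div_of_nonneg_right ?_ (sq_nonneg _)
      by_cases hz : z ∈ D
      · have := (restrictNeg_posApprox_mem_Icc (k := 2) (ε := ε) hD z).2
        rw [restrictNeg_of_mem (H := id) hz, id] at this ⊢
        nlinarith [mul_le_mul_of_nonneg_left this (neg_nonneg.2 (hD.neg z hz).le)]
      · simp [hψ, restrictNeg_of_notMem hz]
  have h3 := mul_le_mul_of_nonneg_left h2 hμ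
  linarith

end

section

variable {Ω : Set (ℝ × ℝ)} {μ : ℝ} {w ψ : ℝ × ℝ → ℝ}

lemma HasCompactSupport.fderiv_apply_const (hψc : HasCompactSupport ψ) (e : ℝ × ℝ) :
    HasCompactSupport (fun z => fderiv ℝ ψ z e) :=
  (hψc.fderiv (𝕜 := ℝ)).comp_left (g := fun l : ℝ × ℝ →L[ℝ] ℝ => l e) rfl

lemma tsupport_fderiv_apply_subset_of_subset (hψΩ : tsupport ψ ⊆ Ω) (e : ℝ × ℝ) :
    tsupport (fun z => fderiv ℝ ψ z e) ⊆ Ω :=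
  (tsupport_fderiv_apply_subset ℝ e).trans hψΩ

lemma contDiff_fderiv_apply_const (hψ : ContDiff ℝ (⊤ : ℕ∞) ψ) (e : ℝ × ℝ) :
    ContDiff ℝ (⊤ : ℕ∞) (fun z => fderiv ℝ ψ z e) :=
  (hψ.fderiv_right (by simp)).clm_apply contDiff_const

lemma integral_fderiv_mul_fderiv (hopen : IsOpen Ω) (hw : ContDiffOn ℝ (⊤ : ℕ∞) w Ω)
    (hψ : ContDiff ℝ (⊤ : ℕ∞) ψ) (hψc : HasCompactSupport ψ) (hψΩ : tsupport ψ ⊆ Ω) (e : ℝ × ℝ) :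
    ∫ z in Ω, fderiv ℝ w z e * fderiv ℝ ψ z e =
      -∫ z in Ω, w z * fderiv ℝ (fun y => fderiv ℝ ψ y e) z e := by
  have hd := contDiff_fderiv_apply_const hψ e
  obtain ⟨C, hC⟩ := hd.lipschitzWith_of_hasCompactSupport (hψc.fderiv_apply_const e) (by simp)
  rw [integral_fderiv_mul_of_lipschitz hopen hw hC (hψc.fderiv_apply_const e)
    (tsupport_fderiv_apply_subset_of_subset hψΩ e) e]
  congr 2 with z
  rw [(hd.differentiable (by simp) z).lineDeriv_eq_fderiv]

lemma integrableOn_fderiv_mul_fderiv (hopen : IsOpen Ω) (hw : ContDiffOn ℝ (⊤ : ℕ∞) w Ω)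
    (hψ : ContDiff ℝ (⊤ : ℕ∞) ψ) (hψc : HasCompactSupport ψ) (hψΩ : tsupport ψ ⊆ Ω) (e : ℝ × ℝ) :
    IntegrableOn (fun z => fderiv ℝ w z e * fderiv ℝ ψ z e) Ω :=
  integrableOn_mul_of_tsupport hopen (hw.fderiv_apply_of_isOpen hopen e).continuousOn
    (contDiff_fderiv_apply_const hψ e).continuous (hψc.fderiv_apply_const e)
    (tsupport_fderiv_apply_subset_of_subset hψΩ e)

lemma integrableOn_mul_fderiv_fderiv (hopen : IsOpen Ω) (hw : ContinuousOn w Ω)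
    (hψ : ContDiff ℝ (⊤ : ℕ∞) ψ) (hψc : HasCompactSupport ψ) (hψΩ : tsupport ψ ⊆ Ω) (e : ℝ × ℝ) :
    IntegrableOn (fun z => w z * fderiv ℝ (fun y => fderiv ℝ ψ y e) z e) Ω :=
  integrableOn_mul_of_tsupport hopen hw
    (contDiff_fderiv_apply_const (contDiff_fderiv_apply_const hψ e) e).continuous
    ((hψc.fderiv_apply_const e).fderiv_apply_const e)
    (tsupport_fderiv_apply_subset_of_subset (tsupport_fderiv_apply_subset_of_subset hψΩ e) e)

lemma integrableOn_mul_eucLap (hopen : IsOpen Ω) (hw : ContinuousOn w Ω)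
    (hψ : ContDiff ℝ (⊤ : ℕ∞) ψ) (hψc : HasCompactSupport ψ) (hψΩ : tsupport ψ ⊆ Ω) :
    IntegrableOn (fun z => w z * eucLap ψ z) Ω := by
  refine ((integrableOn_mul_fderiv_fderiv hopen hw hψ hψc hψΩ (1, 0)).add
    (integrableOn_mul_fderiv_fderiv hopen hw hψ hψc hψΩ (0, 1))).congr_fun (fun z _ => ?_)
    hopen.measurableSet
  exact (mul_add _ _ _).symm

lemma integrableOn_mul_div_sq (hΩ : Ω ⊆ H2) (hopen : IsOpen Ω) (hw : ContinuousOn w Ω)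
    (hψ : ContDiff ℝ (⊤ : ℕ∞) ψ) (hψc : HasCompactSupport ψ) (hψΩ : tsupport ψ ⊆ Ω) :
    IntegrableOn (fun z => w z * (ψ z / z.2 ^ 2)) Ω := by
  have hc : ContinuousOn (fun z => w z / z.2 ^ 2) Ω :=
    hw.div (continuous_snd.pow 2).continuousOn
      fun z hz => pow_ne_zero 2 (show (0 : ℝ) < z.2 from hΩ hz).ne'
  refine (integrableOn_mul_of_tsupport hopen hc hψ.continuous hψc hψΩ).congr_fun (fun z _ => ?_)
    hopen.measurableSet
  simp only
  ring

lemma integral_gradDot_eq_neg (hopen : IsOpen Ω) (hw : ContDiffOn ℝ (⊤ : ℕ∞) w Ω)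
    (hψ : ContDiff ℝ (⊤ : ℕ∞) ψ) (hψc : HasCompactSupport ψ) (hψΩ : tsupport ψ ⊆ Ω) :
    ∫ z in Ω, gradDot w ψ z = -∫ z in Ω, w z * eucLap ψ z := by
  have h1 : ∫ z in Ω, gradDot w ψ z = ∫ z in Ω, (fderiv ℝ w z (1, 0) * fderiv ℝ ψ z (1, 0) +
    fderiv ℝ w z (0, 1) * fderiv ℝ ψ z (0, 1)) := rfl
  have h2 : ∫ z in Ω, w z * eucLap ψ z = ∫ z in Ω,
      (w z * fderiv ℝ (fun y => fderiv ℝ ψ y (1, 0)) z (1, 0) +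
      w z * fderiv ℝ (fun y => fderiv ℝ ψ y (0, 1)) z (0, 1)) := by
    congr 1 with z
    exact mul_add _ _ _
  rw [h1, h2, integral_add (integrableOn_fderiv_mul_fderiv hopen hw hψ hψc hψΩ _)
    (integrableOn_fderiv_mul_fderiv hopen hw hψ hψc hψΩ _),
    integral_add (integrableOn_mul_fderiv_fderiv hopen hw.continuousOn hψ hψc hψΩ _)
    (integrableOn_mul_fderiv_fderiv hopen hw.continuousOn hψ hψc hψΩ _),
    integral_fderiv_mul_fderiv hopen hw hψ hψc hψΩ, integral_fderiv_mul_fderiv hopen hw hψ hψc hψΩ]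
  ring

/-- The spectral gap inequality on mean-zero functions of finite energy. -/
def SpectralGap (Ω : Set (ℝ × ℝ)) (μ : ℝ) : Prop :=
  ∀ w : ℝ × ℝ → ℝ, ContDiffOn ℝ (⊤ : ℕ∞) w Ω → (∫ p in Ω, w p / p.2 ^ 2) = 0 →
    IntegrableOn (fun p : ℝ × ℝ => w p ^ 2 / p.2 ^ 2) Ω volume → IntegrableOn (gradSq w) Ω volume →
    μ * ∫ p in Ω, w p ^ 2 / p.2 ^ 2 ≤ ∫ p in Ω, gradSq w p

/-- The first variation of the spectral gap inequality. -/
lemma SpectralGap.first_variation (hμ : 0 ≤ μ) (h : SpectralGap Ω μ) (hΩ : Ω ⊆ H2)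
    (hopen : IsOpen Ω) (hne : Ω.Nonempty) (harea : IntegrableOn (fun z : ℝ × ℝ => 1 / z.2 ^ 2) Ω)
    (hw : ContDiffOn ℝ (⊤ : ℕ∞) w Ω) (hw0 : ∫ z in Ω, w z / z.2 ^ 2 = 0)
    (hw2 : IntegrableOn (fun z => w z ^ 2 / z.2 ^ 2) Ω) (hwe : IntegrableOn (gradSq w) Ω)
    (hψ : ContDiff ℝ (⊤ : ℕ∞) ψ) (hψc : HasCompactSupport ψ) (hψΩ : tsupport ψ ⊆ Ω) (t : ℝ) :
    μ * (∫ z in Ω, w z ^ 2 / z.2 ^ 2) +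
        2 * t * ((∫ z in Ω, w z * eucLap ψ z) + μ * ∫ z in Ω, w z * (ψ z / z.2 ^ 2)) ≤
      (∫ z in Ω, gradSq w z) + t ^ 2 * ∫ z in Ω, gradSq ψ z := by
  have hm := hopen.measurableSet
  set A := ∫ z in Ω, 1 / z.2 ^ 2 with hA
  have hApos : 0 < A := by
    have hpos : ∀ z ∈ Ω, (0 : ℝ) < 1 / z.2 ^ 2 := fun z hz =>
      div_pos one_pos (pow_pos (show (0 : ℝ) < z.2 from hΩ hz) 2)
    rw [hA, setIntegral_pos_iff_support_of_nonneg_ae _ harea]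
    · exact lt_of_lt_of_le (hopen.measure_pos volume hne)
        (measure_mono fun z hz => ⟨(hpos z hz).ne', hz⟩)
    · filter_upwards [ae_restrict_mem hm] with z hz using (hpos z hz).le
  have iw := integrableOn_div_sq hΩ hopen hw harea hw2
  have iψ : IntegrableOn (fun z => ψ z / z.2 ^ 2) Ω := by
    simpa using integrableOn_mul_div_sq hΩ hopen (w := fun _ => 1) continuousOn_const hψ hψc hψΩ
  have iwψ := integrableOn_mul_div_sq hΩ hopen hw.continuousOn hψ hψc hψΩ
  have iψψ := integrableOn_mul_div_sq hΩ hopen hψ.continuous.continuousOn hψ hψc hψΩ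
  set m := (∫ z in Ω, ψ z / z.2 ^ 2) / A with hmdef
  have hmA : m * A = ∫ z in Ω, ψ z / z.2 ^ 2 := div_mul_cancel₀ _ hApos.ne'
  have hF : ContDiffOn ℝ (⊤ : ℕ∞) (fun z => w z + t * (ψ z - m)) Ω :=
    hw.add (contDiffOn_const.mul (hψ.contDiffOn.sub contDiffOn_const))
  have e1 : ∀ z, (w z + t * (ψ z - m)) / z.2 ^ 2 =
      w z / z.2 ^ 2 + t * (ψ z / z.2 ^ 2 - m * (1 / z.2 ^ 2)) := fun z => by ring
  have hF0 : ∫ z in Ω, (w z + t * (ψ z - m)) / z.2 ^ 2 = 0 := by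
    have i0 : IntegrableOn (fun z => ψ z / z.2 ^ 2 - m * (1 / z.2 ^ 2)) Ω :=
      iψ.sub (harea.const_mul m)
    simp only [e1]
    rw [integral_add iw (i0.const_mul t), integral_const_mul,
      integral_sub iψ (harea.const_mul m), integral_const_mul, hw0, hmA]
    ring
  have iS : IntegrableOn (fun z => ψ z * (ψ z / z.2 ^ 2) - 2 * m * (ψ z / z.2 ^ 2) +
      m ^ 2 * (1 / z.2 ^ 2)) Ω := (iψψ.sub (iψ.const_mul _)).add (harea.const_mul _)
  have e2 : ∀ z, (w z + t * (ψ z - m)) ^ 2 / z.2 ^ 2 =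
      (w z ^ 2 / z.2 ^ 2 + 2 * t * (w z * (ψ z / z.2 ^ 2)) - 2 * t * m * (w z / z.2 ^ 2)) +
      t ^ 2 * (ψ z * (ψ z / z.2 ^ 2) - 2 * m * (ψ z / z.2 ^ 2) + m ^ 2 * (1 / z.2 ^ 2)) :=
    fun z => by ring
  have i1 : IntegrableOn (fun z => w z ^ 2 / z.2 ^ 2 + 2 * t * (w z * (ψ z / z.2 ^ 2))) Ω :=
    hw2.add (iwψ.const_mul _)
  have i2 : IntegrableOn (fun z => w z ^ 2 / z.2 ^ 2 + 2 * t * (w z * (ψ z / z.2 ^ 2)) -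
    2 * t * m * (w z / z.2 ^ 2)) Ω := i1.sub (iw.const_mul _)
  have hF2 : IntegrableOn (fun z => (w z + t * (ψ z - m)) ^ 2 / z.2 ^ 2) Ω := by
    simp only [e2]
    exact i2.add (iS.const_mul _)
  have hS0 : 0 ≤ ∫ z in Ω, (ψ z * (ψ z / z.2 ^ 2) - 2 * m * (ψ z / z.2 ^ 2) +
      m ^ 2 * (1 / z.2 ^ 2)) := by
    refine integral_nonneg fun z => ?_
    have : ψ z * (ψ z / z.2 ^ 2) - 2 * m * (ψ z / z.2 ^ 2) + m ^ 2 * (1 / z.2 ^ 2) =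
      (ψ z - m) ^ 2 / z.2 ^ 2 := by ring
    simp only [Pi.zero_apply, this]
    positivity
  have e3 : ∀ z ∈ Ω, gradSq (fun z => w z + t * (ψ z - m)) z =
      gradSq w z + 2 * t * gradDot w ψ z + t ^ 2 * gradSq ψ z := by
    intro z hz
    rw [gradSq_add_mul ((hw.contDiffAt (hopen.mem_nhds hz)).differentiableAt (by simp))
      ((hψ.differentiable (by simp) z).sub_const m)]
    simp only [gradSq, gradDot, pdx, pdy, fderiv_sub_const]
  have ig : IntegrableOn (gradDot w ψ) Ω :=
    (integrableOn_fderiv_mul_fderiv hopen hw hψ hψc hψΩ (1, 0)).add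
      (integrableOn_fderiv_mul_fderiv hopen hw hψ hψc hψΩ (0, 1))
  have igψ : IntegrableOn (gradSq ψ) Ω := by
    refine ((integrableOn_fderiv_mul_fderiv hopen hψ.contDiffOn hψ hψc hψΩ (1, 0)).add
      (integrableOn_fderiv_mul_fderiv hopen hψ.contDiffOn hψ hψc hψΩ (0, 1))).congr_fun
      (fun z _ => ?_) hm
    simp only [Pi.add_apply, gradSq, pdx, pdy]
    ring
  have i3 : IntegrableOn (fun z => gradSq w z + 2 * t * gradDot w ψ z) Ω := hwe.add (ig.const_mul _)
  have hFe := (i3.add (igψ.const_mul (t ^ 2))).congr_fun (fun z hz => (e3 z hz).symm) hm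
  have hmain := h _ hF hF0 hF2 hFe
  rw [setIntegral_congr_fun hm e3, integral_add i3 (igψ.const_mul _),
    integral_add hwe (ig.const_mul _), integral_const_mul, integral_const_mul,
    integral_gradDot_eq_neg hopen hw hψ hψc hψΩ] at hmain
  simp only [e2] at hmain
  rw [integral_add i2 (iS.const_mul _), integral_sub i1 (iw.const_mul _),
    integral_add hw2 (iwψ.const_mul _), integral_const_mul, integral_const_mul, integral_const_mul,
    hw0] at hmain
  have := mul_nonneg hμ (mul_nonneg (sq_nonneg t) hS0)
  linarith

end

section

variable {Ω D₁ D₂ : Set (ℝ × ℝ)} {μ : ℝ} {v : ℝ × ℝ → ℝ} {ε : ℝ}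

lemma restrictNeg_mul_restrictNeg (hdis : Disjoint D₁ D₂) (H : ℝ → ℝ) (z : ℝ × ℝ) :
    restrictNeg D₁ H v z * restrictNeg D₂ H v z = 0 := by
  by_cases hz : z ∈ D₁
  · rw [restrictNeg_of_notMem (disjoint_left.1 hdis hz), mul_zero]
  · rw [restrictNeg_of_notMem hz, zero_mul]

lemma gradSq_restrictNeg_combination (hD₁ : IsNegativeRegion Ω v D₁)
    (hD₂ : IsNegativeRegion Ω v D₂) (hdis : Disjoint D₁ D₂) (hopen : IsOpen Ω)
    (hv : ContDiffOn ℝ (⊤ : ℕ∞) v Ω) (hε : 0 < ε) (a b : ℝ) {z : ℝ × ℝ} (hz : z ∈ Ω) :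
    gradSq (fun y => a * restrictNeg D₁ (posApprox 1 ε) v y -
        b * restrictNeg D₂ (posApprox 1 ε) v y) z =
      a ^ 2 * gradSq (restrictNeg D₁ (posApprox 1 ε) v) z +
        b ^ 2 * gradSq (restrictNeg D₂ (posApprox 1 ε) v) z := by
  have d₁ := ((contDiffOn_restrictNeg_posApprox hD₁ hopen hv one_ne_zero hε).contDiffAt
    (hopen.mem_nhds hz)).differentiableAt (by simp)
  have d₂ := ((contDiffOn_restrictNeg_posApprox hD₂ hopen hv one_ne_zero hε).contDiffAt
    (hopen.mem_nhds hz)).differentiableAt (by simp)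
  have h₁ := fderiv_restrictNeg_posApprox hD₁ hopen hv one_ne_zero hε hz
  have h₂ := fderiv_restrictNeg_posApprox hD₂ hopen hv one_ne_zero hε hz
  have h : fderiv ℝ (fun y => a * restrictNeg D₁ (posApprox 1 ε) v y -
      b * restrictNeg D₂ (posApprox 1 ε) v y) z =
      a • fderiv ℝ (restrictNeg D₁ (posApprox 1 ε) v) z -
        b • fderiv ℝ (restrictNeg D₂ (posApprox 1 ε) v) z :=
    ((d₁.hasFDerivAt.const_mul a).sub (d₂.hasFDerivAt.const_mul b)).fderiv
  have hp : fderiv ℝ (restrictNeg D₁ (posApprox 1 ε) v) z = 0 ∨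
      fderiv ℝ (restrictNeg D₂ (posApprox 1 ε) v) z = 0 := by
    by_cases hzD : z ∈ D₁
    · right; rw [h₂, if_neg (disjoint_left.1 hdis hzD), zero_smul]
    · left; rw [h₁, if_neg hzD, zero_smul]
  simp only [gradSq, pdx, pdy]
  rcases hp with hp | hp <;> rw [h, hp] <;> simp <;> ring

/-- Testing the spectral gap against the balanced combination of two disjoint truncations. -/
lemma SpectralGap.combination_le (hμ : 0 ≤ μ) (h : SpectralGap Ω μ) (hΩ : Ω ⊆ H2)
    (hopen : IsOpen Ω) (hne : Ω.Nonempty) (harea : IntegrableOn (fun z : ℝ × ℝ => 1 / z.2 ^ 2) Ω)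
    (hD₁ : IsNegativeRegion Ω v D₁) (hD₂ : IsNegativeRegion Ω v D₂) (hdis : Disjoint D₁ D₂)
    (hv : ContDiffOn ℝ (⊤ : ℕ∞) v Ω) (hv2 : IntegrableOn (fun z => v z ^ 2 / z.2 ^ 2) Ω)
    (hve : IntegrableOn (gradSq v) Ω) (hε : 0 < ε) {w₁ w₂ : ℝ × ℝ → ℝ}
    (hw₁ : w₁ = restrictNeg D₁ (posApprox 1 ε) v) (hw₂ : w₂ = restrictNeg D₂ (posApprox 1 ε) v)
    {a b : ℝ} (hab : a * ∫ z in Ω, w₁ z / z.2 ^ 2 = b * ∫ z in Ω, w₂ z / z.2 ^ 2)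
    {ψ : ℝ × ℝ → ℝ} (hψ : ContDiff ℝ (⊤ : ℕ∞) ψ) (hψc : HasCompactSupport ψ)
    (hψΩ : tsupport ψ ⊆ Ω) (t : ℝ) :
    μ * (a ^ 2 * (∫ z in Ω, w₁ z ^ 2 / z.2 ^ 2) + b ^ 2 * ∫ z in Ω, w₂ z ^ 2 / z.2 ^ 2) +
        2 * t * (a * ((∫ z in Ω, w₁ z * eucLap ψ z) + μ * ∫ z in Ω, w₁ z * (ψ z / z.2 ^ 2)) -
          b * ((∫ z in Ω, w₂ z * eucLap ψ z) + μ * ∫ z in Ω, w₂ z * (ψ z / z.2 ^ 2))) ≤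
      a ^ 2 * (∫ z in Ω, gradSq w₁ z) + b ^ 2 * (∫ z in Ω, gradSq w₂ z) +
        t ^ 2 * ∫ z in Ω, gradSq ψ z := by
  have hm := hopen.measurableSet
  have c₁ : ContDiffOn ℝ (⊤ : ℕ∞) w₁ Ω :=
    hw₁ ▸ contDiffOn_restrictNeg_posApprox hD₁ hopen hv one_ne_zero hε
  have c₂ : ContDiffOn ℝ (⊤ : ℕ∞) w₂ Ω :=
    hw₂ ▸ contDiffOn_restrictNeg_posApprox hD₂ hopen hv one_ne_zero hε
  have s₁ : IntegrableOn (fun z => w₁ z ^ 2 / z.2 ^ 2) Ω :=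
    integrableOn_sq_of_abs_le hΩ hopen c₁.continuousOn
      (fun z _ => hw₁ ▸ abs_restrictNeg_posApprox_le hD₁ z) hv2
  have s₂ : IntegrableOn (fun z => w₂ z ^ 2 / z.2 ^ 2) Ω :=
    integrableOn_sq_of_abs_le hΩ hopen c₂.continuousOn
      (fun z _ => hw₂ ▸ abs_restrictNeg_posApprox_le hD₂ z) hv2
  have g₁ : IntegrableOn (gradSq w₁) Ω :=
    hw₁ ▸ integrableOn_gradSq_restrictNeg hD₁ hopen hv hve one_ne_zero hε
  have g₂ : IntegrableOn (gradSq w₂) Ω :=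
    hw₂ ▸ integrableOn_gradSq_restrictNeg hD₂ hopen hv hve one_ne_zero hε
  have l₁ := integrableOn_div_sq hΩ hopen c₁ harea s₁
  have l₂ := integrableOn_div_sq hΩ hopen c₂ harea s₂
  have e2 : ∀ z, (a * w₁ z - b * w₂ z) ^ 2 / z.2 ^ 2 =
      a ^ 2 * (w₁ z ^ 2 / z.2 ^ 2) + b ^ 2 * (w₂ z ^ 2 / z.2 ^ 2) := by
    intro z
    have : w₁ z * w₂ z = 0 := by rw [hw₁, hw₂]; exact restrictNeg_mul_restrictNeg hdis _ z
    linear_combination (-(2 * a * b) / z.2 ^ 2) * this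
  have e3 : ∀ z ∈ Ω, gradSq (fun y => a * w₁ y - b * w₂ y) z =
      a ^ 2 * gradSq w₁ z + b ^ 2 * gradSq w₂ z := by
    intro z hz
    subst hw₁ hw₂
    exact gradSq_restrictNeg_combination hD₁ hD₂ hdis hopen hv hε a b hz
  have e4 : ∀ F : ℝ × ℝ → ℝ, ∀ z, (a * w₁ z - b * w₂ z) * F z =
      a * (w₁ z * F z) - b * (w₂ z * F z) := fun F z => by ring
  have W0 : ∫ z in Ω, (a * w₁ z - b * w₂ z) / z.2 ^ 2 = 0 := by
    simp only [div_eq_mul_inv] at hab l₁ l₂ ⊢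
    simp only [e4 fun z => (z.2 ^ 2)⁻¹]
    rw [integral_sub (l₁.const_mul a) (l₂.const_mul b), integral_const_mul, integral_const_mul,
      hab, sub_self]
  have W2 : IntegrableOn (fun z => (a * w₁ z - b * w₂ z) ^ 2 / z.2 ^ 2) Ω := by
    simp only [e2]
    exact (s₁.const_mul _).add (s₂.const_mul _)
  have We : IntegrableOn (gradSq fun y => a * w₁ y - b * w₂ y) Ω :=
    IntegrableOn.congr_fun ((g₁.const_mul (a ^ 2)).add (g₂.const_mul (b ^ 2)))
      (fun z hz => (e3 z hz).symm) hm
  have main := h.first_variation hμ hΩ hopen hne harea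
    ((contDiffOn_const.mul c₁).sub (contDiffOn_const.mul c₂)) W0 W2 We hψ hψc hψΩ t
  rw [setIntegral_congr_fun hm e3, integral_add (g₁.const_mul _) (g₂.const_mul _),
    integral_const_mul, integral_const_mul] at main
  simp only [e2, e4 (eucLap ψ), e4 fun z => ψ z / z.2 ^ 2] at main
  rw [integral_add (s₁.const_mul _) (s₂.const_mul _),
    integral_sub ((integrableOn_mul_eucLap hopen c₁.continuousOn hψ hψc hψΩ).const_mul a)
      ((integrableOn_mul_eucLap hopen c₂.continuousOn hψ hψc hψΩ).const_mul b),
    integral_sub ((integrableOn_mul_div_sq hΩ hopen c₁.continuousOn hψ hψc hψΩ).const_mul a)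
      ((integrableOn_mul_div_sq hΩ hopen c₂.continuousOn hψ hψc hψΩ).const_mul b)] at main
  simp only [integral_const_mul] at main
  linarith

end

section

variable {Ω D₁ D₂ : Set (ℝ × ℝ)} {μ : ℝ} {v : ℝ × ℝ → ℝ}

lemma integrableOn_restrictNeg_id_div_sq (hΩ : Ω ⊆ H2) (hopen : IsOpen Ω) {D : Set (ℝ × ℝ)}
    (harea : IntegrableOn (fun z : ℝ × ℝ => 1 / z.2 ^ 2) Ω) (hD : IsNegativeRegion Ω v D)
    (hv : ContDiffOn ℝ (⊤ : ℕ∞) v Ω) (hv2 : IntegrableOn (fun z => v z ^ 2 / z.2 ^ 2) Ω) :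
    IntegrableOn (fun z => restrictNeg D id v z / z.2 ^ 2) Ω := by
  refine Integrable.mono (integrableOn_div_sq hΩ hopen hv harea hv2) ?_ ?_
  · refine ((continuousOn_restrictNeg_id hD hopen hv.continuousOn).div
      (continuous_snd.pow 2).continuousOn fun z hz => ?_).aestronglyMeasurable hopen.measurableSet
    exact pow_ne_zero 2 (show (0 : ℝ) < z.2 from hΩ hz).ne'
  · refine Eventually.of_forall fun z => ?_
    have h := restrictNeg_id_mem_Icc hD z
    rw [norm_div, norm_div, Real.norm_of_nonneg h.1, Real.norm_eq_abs]
    exact div_le_div_of_nonneg_right h.2 (abs_nonneg _)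

lemma integral_restrictNeg_id_pos (hΩ : Ω ⊆ H2) {D : Set (ℝ × ℝ)}
    (hD : IsNegativeRegion Ω v D) (hne : D.Nonempty)
    (hi : IntegrableOn (fun z => restrictNeg D id v z / z.2 ^ 2) Ω) :
    0 < ∫ z in Ω, restrictNeg D id v z / z.2 ^ 2 := by
  rw [setIntegral_pos_iff_support_of_nonneg_ae _ hi]
  · refine lt_of_lt_of_le (hD.isOpen.measure_pos volume hne)
      (measure_mono fun z hz => ⟨?_, hD.subset hz⟩)
    have h1 := pow_pos (show (0 : ℝ) < z.2 from hΩ (hD.subset hz)) 2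
    rw [Function.mem_support, restrictNeg_of_mem hz]
    exact (div_pos (neg_pos.2 (hD.neg z hz)) h1).ne'
  · exact Eventually.of_forall fun z =>
      div_nonneg (restrictNeg_id_mem_Icc hD z).1 (sq_nonneg _)

lemma eq_zero_of_forall_two_mul_le {L Q : ℝ} (h : ∀ t : ℝ, 2 * t * L ≤ t ^ 2 * Q) : L = 0 := by
  by_contra hL
  have hQ : 0 < |Q| + 1 := by positivity
  have h1 := h (L / (|Q| + 1))
  have h2 : 0 < L ^ 2 / (|Q| + 1) := by positivity
  have h3 : (L / (|Q| + 1)) ^ 2 * Q ≤ L ^ 2 / (|Q| + 1) := by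
    calc (L / (|Q| + 1)) ^ 2 * Q ≤ (L / (|Q| + 1)) ^ 2 * (|Q| + 1) :=
          mul_le_mul_of_nonneg_left (by linarith [le_abs_self Q]) (sq_nonneg _)
      _ = _ := by field_simp
  have h4 : 2 * (L / (|Q| + 1)) * L = 2 * (L ^ 2 / (|Q| + 1)) := by ring
  linarith

/-- A balanced combination of two disjoint negative parts of a weak supersolution is a weak
solution. -/
lemma SpectralGap.exists_combination (hμ : 0 ≤ μ) (h : SpectralGap Ω μ) (hΩ : Ω ⊆ H2)
    (hopen : IsOpen Ω) (harea : IntegrableOn (fun z : ℝ × ℝ => 1 / z.2 ^ 2) Ω)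
    (hD₁ : IsNegativeRegion Ω v D₁) (hD₂ : IsNegativeRegion Ω v D₂) (hdis : Disjoint D₁ D₂)
    (hne₁ : D₁.Nonempty) (hne₂ : D₂.Nonempty)
    (hv : ContDiffOn ℝ (⊤ : ℕ∞) v Ω) (hv2 : IntegrableOn (fun z => v z ^ 2 / z.2 ^ 2) Ω)
    (hve : IntegrableOn (gradSq v) Ω)
    (hweak : ∀ ψ : ℝ × ℝ → ℝ, ContDiffOn ℝ (⊤ : ℕ∞) ψ Ω → (∀ z ∈ Ω, 0 ≤ ψ z) →
      IntegrableOn (fun z => ψ z ^ 2 / z.2 ^ 2) Ω → IntegrableOn (gradSq ψ) Ω →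
      μ * ∫ z in Ω, v z * ψ z / z.2 ^ 2 ≤ ∫ z in Ω, gradDot v ψ z) :
    ∃ a b : ℝ, 0 < a ∧ 0 < b ∧ ∀ ψ : ℝ × ℝ → ℝ, ContDiff ℝ (⊤ : ℕ∞) ψ → HasCompactSupport ψ →
      tsupport ψ ⊆ Ω →
      a * ((∫ z in Ω, restrictNeg D₁ id v z * eucLap ψ z) +
          μ * ∫ z in Ω, restrictNeg D₁ id v z * (ψ z / z.2 ^ 2)) =
        b * ((∫ z in Ω, restrictNeg D₂ id v z * eucLap ψ z) +
          μ * ∫ z in Ω, restrictNeg D₂ id v z * (ψ z / z.2 ^ 2)) := by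
  have l₁ := integrableOn_restrictNeg_id_div_sq hΩ hopen harea hD₁ hv hv2
  have l₂ := integrableOn_restrictNeg_id_div_sq hΩ hopen harea hD₂ hv hv2
  refine ⟨_, _, integral_restrictNeg_id_pos hΩ hD₂ hne₂ l₂,
    integral_restrictNeg_id_pos hΩ hD₁ hne₁ l₁, fun ψ hψ hψc hψΩ => ?_⟩
  rw [← sub_eq_zero]
  refine eq_zero_of_forall_two_mul_le (Q := ∫ z in Ω, gradSq ψ z) fun t => ?_
  have hy : ContinuousOn (fun z : ℝ × ℝ => (z.2 ^ 2)⁻¹) Ω :=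
    (continuous_snd.pow 2).continuousOn.inv₀
      fun z hz => pow_ne_zero 2 (show (0 : ℝ) < z.2 from hΩ hz).ne'
  have key : ∀ D, IsNegativeRegion Ω v D →
      (Tendsto (fun n : ℕ => ∫ z in Ω, restrictNeg D (posApprox 1 (1 / ((n : ℝ) + 1))) v z / z.2 ^ 2)
        atTop (𝓝 (∫ z in Ω, restrictNeg D id v z / z.2 ^ 2))) ∧
      (Tendsto (fun n : ℕ => ∫ z in Ω,
        restrictNeg D (posApprox 1 (1 / ((n : ℝ) + 1))) v z ^ 2 / z.2 ^ 2)
        atTop (𝓝 (∫ z in Ω, restrictNeg D id v z ^ 2 / z.2 ^ 2))) ∧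
      Tendsto (fun n : ℕ =>
        (∫ z in Ω, restrictNeg D (posApprox 1 (1 / ((n : ℝ) + 1))) v z * eucLap ψ z) +
          μ * ∫ z in Ω, restrictNeg D (posApprox 1 (1 / ((n : ℝ) + 1))) v z * (ψ z / z.2 ^ 2))
        atTop (𝓝 ((∫ z in Ω, restrictNeg D id v z * eucLap ψ z) +
          μ * ∫ z in Ω, restrictNeg D id v z * (ψ z / z.2 ^ 2))) := by
    intro D hD
    have hc := continuousOn_restrictNeg_id hD hopen hv.continuousOn
    have habs : ∀ z, |restrictNeg D id v z| ≤ |v z| := fun z =>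
      (abs_of_nonneg (restrictNeg_id_mem_Icc hD z).1).trans_le (restrictNeg_id_mem_Icc hD z).2
    have t1 := tendsto_integral_restrictNeg hD hopen hv one_ne_zero 1 hy
      (by simpa only [pow_one, ← div_eq_mul_inv] using
        integrableOn_restrictNeg_id_div_sq hΩ hopen harea hD hv hv2)
    have t2 := tendsto_integral_restrictNeg hD hopen hv one_ne_zero 2 hy
      (by simpa only [← div_eq_mul_inv] using
        integrableOn_sq_of_abs_le hΩ hopen hc (fun z _ => habs z) hv2)
    have t3 := tendsto_integral_restrictNeg hD hopen hv one_ne_zero 1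
      (F := eucLap ψ) (Continuous.continuousOn ((contDiff_fderiv_apply_const
        (contDiff_fderiv_apply_const hψ (1, 0)) (1, 0)).continuous.add
        (contDiff_fderiv_apply_const (contDiff_fderiv_apply_const hψ (0, 1)) (0, 1)).continuous))
      (by simpa only [pow_one] using integrableOn_mul_eucLap hopen hc hψ hψc hψΩ)
    have t4 := tendsto_integral_restrictNeg hD hopen hv one_ne_zero 1
      (F := fun z => ψ z / z.2 ^ 2) (hψ.continuous.continuousOn.mul hy)
      (by simpa only [pow_one] using integrableOn_mul_div_sq hΩ hopen hc hψ hψc hψΩ)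
    simp only [pow_one, ← div_eq_mul_inv] at t1 t2 t3 t4
    exact ⟨t1, t2, t3.add (t4.const_mul μ)⟩
  obtain ⟨A₁, S₁, J₁⟩ := key D₁ hD₁
  obtain ⟨A₂, S₂, J₂⟩ := key D₂ hD₂
  have lhs := ((((A₂.pow 2).mul S₁).add ((A₁.pow 2).mul S₂)).const_mul μ).add
    (((A₂.mul J₁).sub (A₁.mul J₂)).const_mul (2 * t))
  have rhs := ((((A₂.pow 2).mul_const (∫ z in Ω, restrictNeg D₁ id v z ^ 2 / z.2 ^ 2)).add
    ((A₁.pow 2).mul_const (∫ z in Ω, restrictNeg D₂ id v z ^ 2 / z.2 ^ 2))).const_mul μ).add_const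
    (t ^ 2 * ∫ z in Ω, gradSq ψ z)
  have hlim := le_of_tendsto_of_tendsto' lhs rhs fun n => by
    have hε : (0 : ℝ) < 1 / ((n : ℝ) + 1) := Nat.one_div_pos_of_nat
    have hle := h.combination_le hμ hΩ hopen (hne₁.mono hD₁.subset) harea hD₁ hD₂ hdis hv hv2 hve hε
      rfl rfl (a := ∫ z in Ω, restrictNeg D₂ (posApprox 1 (1 / ((n : ℝ) + 1))) v z / z.2 ^ 2)
      (mul_comm _ _) hψ hψc hψΩ t
    have E₁ := mul_le_mul_of_nonneg_left
      (integral_gradSq_restrictNeg_le hμ hΩ hD₁ hopen hv hv2 hve hweak hε)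
      (sq_nonneg (∫ z in Ω, restrictNeg D₂ (posApprox 1 (1 / ((n : ℝ) + 1))) v z / z.2 ^ 2))
    have E₂ := mul_le_mul_of_nonneg_left
      (integral_gradSq_restrictNeg_le hμ hΩ hD₂ hopen hv hv2 hve hweak hε)
      (sq_nonneg (∫ z in Ω, restrictNeg D₁ (posApprox 1 (1 / ((n : ℝ) + 1))) v z / z.2 ^ 2))
    refine hle.trans ?_
    linarith
  linarith

end

section

variable {Ω : Set (ℝ × ℝ)} {v : ℝ × ℝ → ℝ} {a p q : ℝ × ℝ}

lemma isOpen_negSet (hopen : IsOpen Ω) (hv : ContinuousOn v Ω) :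
    IsOpen {z | z ∈ Ω ∧ v z < 0} :=
  hv.isOpen_inter_preimage hopen isOpen_Iio

lemma isOpen_diff_connectedComponentIn {N : Set (ℝ × ℝ)} (hN : IsOpen N) (a : ℝ × ℝ) :
    IsOpen (N \ connectedComponentIn N a) := by
  rw [isOpen_iff_mem_nhds]
  intro x hx
  refine mem_of_superset (hN.connectedComponentIn.mem_nhds (mem_connectedComponentIn hx.1))
    fun y hy => ⟨connectedComponentIn_subset _ _ hy, fun hya => hx.2 ?_⟩
  rw [connectedComponentIn_eq hya, ← connectedComponentIn_eq hy]
  exact mem_connectedComponentIn hx.1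

lemma isNegativeRegion_connectedComponentIn (hopen : IsOpen Ω) (hv : ContinuousOn v Ω)
    (a : ℝ × ℝ) : IsNegativeRegion Ω v (connectedComponentIn {z | z ∈ Ω ∧ v z < 0} a) where
  isOpen := (isOpen_negSet hopen hv).connectedComponentIn
  subset _ hz := (connectedComponentIn_subset _ _ hz).1
  neg _ hz := (connectedComponentIn_subset _ _ hz).2
  isOpen_diff := isOpen_diff_connectedComponentIn (isOpen_negSet hopen hv) a

lemma IsNegativeRegion.diff {D : Set (ℝ × ℝ)} (hD : IsNegativeRegion Ω v D) :
    IsNegativeRegion Ω v ({z | z ∈ Ω ∧ v z < 0} \ D) where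
  isOpen := hD.isOpen_diff
  subset _ hz := hz.1.1
  neg _ hz := hz.1.2
  isOpen_diff := by
    have h : D ⊆ {z | z ∈ Ω ∧ v z < 0} := fun z hz => ⟨hD.subset hz, hD.neg z hz⟩
    rw [sdiff_sdiff_right_self, inter_eq_self_of_subset_right h]
    exact hD.isOpen

lemma IsNegativeRegion.eq_zero_of_mem_frontier {D : Set (ℝ × ℝ)} (hD : IsNegativeRegion Ω v D)
    (hopen : IsOpen Ω) (hv : ContinuousOn v Ω) (hq : q ∈ Ω) (hqD : q ∈ frontier D) : v q = 0 := by
  rw [hD.isOpen.frontier_eq] at hqD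
  refine le_antisymm ?_ (not_lt.1 fun hneg => ?_)
  · by_contra! hpos
    obtain ⟨z, hz, hzD⟩ := mem_closure_iff_nhds.1 hqD.1 _
      ((hv.continuousAt (hopen.mem_nhds hq)).eventually (lt_mem_nhds hpos))
    exact lt_asymm hz (hD.neg z hzD)
  · obtain ⟨z, hz, hzD⟩ := mem_closure_iff_nhds.1 hqD.1 _
      (hD.isOpen_diff.mem_nhds ⟨⟨hq, hneg⟩, hqD.2⟩)
    exact hz.2 hzD

lemma isPreconnected_ball_diff_singleton (p : ℝ × ℝ) {r : ℝ} (hr : 0 < r) :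
    IsPreconnected (Metric.ball p r \ {p}) := by
  have h1 : IsPreconnected ({0}ᶜ : Set (ℝ × ℝ)) := by
    refine (isConnected_compl_singleton_of_one_lt_rank ?_ _).isPreconnected
    rw [rank_prod', Module.rank_self]
    norm_num
  have h2 := h1.image (OpenPartialHomeomorph.univBall p r)
    (OpenPartialHomeomorph.continuous_univBall p r).continuousOn
  convert h2 using 1
  ext z
  constructor
  · rintro ⟨hz, hzp⟩
    rw [← OpenPartialHomeomorph.univBall_target p hr] at hz
    refine ⟨(OpenPartialHomeomorph.univBall p r).symm z, fun h0 => hzp ?_,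
      (OpenPartialHomeomorph.univBall p r).right_inv hz⟩
    rw [mem_singleton_iff] at h0
    rw [mem_singleton_iff, ← (OpenPartialHomeomorph.univBall p r).right_inv hz, h0,
      OpenPartialHomeomorph.univBall_apply_zero]
  · rintro ⟨x, hx, rfl⟩
    have hs : ∀ x, x ∈ (OpenPartialHomeomorph.univBall p r).source := fun x => by
      rw [OpenPartialHomeomorph.univBall_source]; trivial
    refine ⟨?_, fun h0 => hx ?_⟩
    · rw [← OpenPartialHomeomorph.univBall_target p hr]
      exact (OpenPartialHomeomorph.univBall p r).map_source (hs x)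
    · exact (OpenPartialHomeomorph.univBall p r).injOn (hs x) (hs 0)
        ((mem_singleton_iff.1 h0).trans (OpenPartialHomeomorph.univBall_apply_zero p r).symm)

lemma IsPreconnected.exists_mem_frontier {A D E : Set (ℝ × ℝ)} (hA : IsPreconnected A)
    (hD : IsOpen D) (hE : IsOpen E) (hdis : Disjoint D E) (hAD : (A ∩ D).Nonempty)
    (hAE : (A ∩ E).Nonempty) : ∃ q ∈ A, q ∈ frontier D := by
  by_contra! h
  have hE' : E ⊆ (closure D)ᶜ := fun z hz hzD => by
    obtain ⟨y, hyE, hyD⟩ := mem_closure_iff.1 hzD E hE hz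
    exact disjoint_left.1 hdis hyD hyE
  obtain ⟨y, -, hyD, hyE⟩ := hA D (closure D)ᶜ hD isClosed_closure.isOpen_compl
    (fun z hz => by
      by_contra hc
      rw [mem_union, not_or, mem_compl_iff, not_not] at hc
      exact h z hz (hD.frontier_eq ▸ ⟨hc.2, hc.1⟩)) hAD (hAE.mono (inter_subset_inter_right A hE'))
  exact hyE (subset_closure hyD)

/-- Near a regular boundary point of a component of the negativity set, the negativity set
coincides with the component. -/
lemma exists_ball_subset_component (hopen : IsOpen Ω) (hv : ContDiffOn ℝ (⊤ : ℕ∞) v Ω)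
    (hq : q ∈ Ω) (hvq : v q = 0) (hdq : fderiv ℝ v q ≠ 0)
    (hqD : q ∈ closure (connectedComponentIn {z | z ∈ Ω ∧ v z < 0} a)) :
    ∃ ρ : ℝ, 0 < ρ ∧ Metric.ball q ρ ⊆ Ω ∧ ∀ z ∈ Metric.ball q ρ, v z < 0 →
      z ∈ connectedComponentIn {z | z ∈ Ω ∧ v z < 0} a := by
  obtain ⟨e, he⟩ : ∃ e, 0 < fderiv ℝ v q e := by
    by_contra! h
    refine hdq (ContinuousLinearMap.ext fun e => le_antisymm (h e) ?_)
    have := h (-e)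
    rw [map_neg] at this
    simpa using this
  have hcont : ContinuousAt (fun z => fderiv ℝ v z e) q :=
    (hv.fderiv_apply_of_isOpen hopen e).continuousOn.continuousAt (hopen.mem_nhds hq)
  obtain ⟨R, hR, hball⟩ := Metric.mem_nhds_iff.1
    (inter_mem (hcont.eventually (lt_mem_nhds he)) (hopen.mem_nhds hq))
  have hdiff : ∀ z ∈ Metric.ball q R, HasFDerivWithinAt v (fderiv ℝ v z) (Metric.ball q R) z :=
    fun z hz => ((hv.contDiffAt (hopen.mem_nhds (hball hz).2)).differentiableAt
      (by simp)).hasFDerivAt.hasFDerivWithinAt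
  have hlt : ∀ x ∈ Metric.ball q R, ∀ τ : ℝ, 0 < τ → x - τ • e ∈ Metric.ball q R →
      v (x - τ • e) < v x := by
    intro x hx τ hτ hxτ
    obtain ⟨z, hz, hzv⟩ := domain_mvt hdiff (convex_ball q R) hxτ hx
    rw [sub_sub_cancel, map_smul, smul_eq_mul] at hzv
    have := mul_pos hτ (hball ((convex_ball q R).segment_subset hxτ hx hz)).1
    linarith
  obtain ⟨s, hs, hsR⟩ : ∃ s : ℝ, 0 < s ∧ q - s • e ∈ Metric.ball q R := by
    have hc : ContinuousAt (fun s : ℝ => q - s • e) 0 := by fun_prop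
    have h1 : ∀ᶠ s in 𝓝 (0 : ℝ), q - s • e ∈ Metric.ball q R :=
      hc.preimage_mem_nhds (by simpa using Metric.ball_mem_nhds q hR)
    obtain ⟨s, h2, h3⟩ := ((h1.filter_mono nhdsWithin_le_nhds).and
      (self_mem_nhdsWithin (s := Ioi (0 : ℝ)))).exists
    exact ⟨s, h3, h2⟩
  have hneg : v (q - s • e) < 0 := hvq ▸ hlt q (Metric.mem_ball_self hR) s hs hsR
  obtain ⟨ρ, hρ, hρs⟩ := Metric.mem_nhds_iff.1 (inter_mem (Metric.isOpen_ball.mem_nhds hsR)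
    ((isOpen_negSet hopen hv.continuousOn).mem_nhds ⟨(hball hsR).2, hneg⟩))
  have hsub : ∀ z ∈ Metric.ball q (min ρ R), z - s • e ∈ Metric.ball (q - s • e) ρ := by
    intro z hz
    rw [Metric.mem_ball, dist_sub_right]
    exact (Metric.mem_ball.1 hz).trans_le (min_le_left _ _)
  set N := {z | z ∈ Ω ∧ v z < 0}
  have hconn : ∀ z ∈ Metric.ball q (min ρ R), v z < 0 →
      IsPreconnected (segment ℝ (z - s • e) z ∪ Metric.ball (q - s • e) ρ) ∧
        segment ℝ (z - s • e) z ∪ Metric.ball (q - s • e) ρ ⊆ N := by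
    intro z hz hvz
    have hzR : z ∈ Metric.ball q R := Metric.ball_subset_ball (min_le_right _ _) hz
    have hz2 := hsub z hz
    refine ⟨IsPreconnected.union (z - s • e) (left_mem_segment ℝ _ _) hz2
      (convex_segment _ _).isPreconnected (convex_ball _ _).isPreconnected,
      union_subset ?_ fun y hy => (hρs hy).2⟩
    intro y hy
    have hyR := (convex_ball q R).segment_subset (hρs hz2).1 hzR hy
    refine ⟨(hball hyR).2, ?_⟩
    obtain ⟨θ, hθ, rfl⟩ := segment_eq_image' ℝ (z - s • e) z ▸ hy
    have hy' : z - s • e + θ • (z - (z - s • e)) = z - ((1 - θ) * s) • e := by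
      rw [sub_sub_cancel, mul_smul, sub_smul, one_smul]; abel
    simp only [hy'] at hyR ⊢
    rcases hθ.2.lt_or_eq with h1 | h1
    · exact (hlt z hzR _ (mul_pos (sub_pos.2 h1) hs) hyR).trans hvz
    · simpa [h1] using hvz
  refine ⟨min ρ R, lt_min hρ hR, fun z hz =>
    (hball (Metric.ball_subset_ball (min_le_right _ _) hz)).2, fun z hz hvz => ?_⟩
  obtain ⟨y, hy, hyD⟩ := mem_closure_iff.1 hqD _ Metric.isOpen_ball
    (Metric.mem_ball_self (lt_min hρ hR))
  obtain ⟨hy1, hy2⟩ := hconn y hy (connectedComponentIn_subset _ _ hyD).2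
  obtain ⟨hz1, hz2⟩ := hconn z hz hvz
  have hcy := connectedComponentIn_eq hyD
  have hc : q - s • e ∈ connectedComponentIn N a := by
    rw [hcy]
    exact hy1.subset_connectedComponentIn (Or.inl (right_mem_segment ℝ _ _)) hy2
      (Or.inr (Metric.mem_ball_self hρ))
  rw [connectedComponentIn_eq hc]
  exact hz1.subset_connectedComponentIn (Or.inr (Metric.mem_ball_self hρ)) hz2
    (Or.inl (right_mem_segment ℝ _ _))

end

/-- A smooth bump on `[δ, 2 * r]`, equal to one on `[2 * δ, r]`. -/
def ringBump (δ r t : ℝ) : ℝ := Real.smoothTransition (t / δ - 1) - Real.smoothTransition (t / r - 1)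

/-- The truncated logarithmic potential whose derivative is `-ringBump δ r t / t`. -/
def ringPotential (δ r t : ℝ) : ℝ := -∫ τ in (2 * r)..t, ringBump δ r τ / τ

section

variable {δ r t : ℝ}

lemma ringBump_of_le (hδ : 0 < δ) (hr : δ ≤ r) (ht : t ≤ δ) : ringBump δ r t = 0 := by
  rw [ringBump, Real.smoothTransition.zero_of_nonpos, Real.smoothTransition.zero_of_nonpos, sub_zero]
  · rw [sub_nonpos, div_le_one (hδ.trans_le hr)]; linarith
  · rwa [sub_nonpos, div_le_one hδ]

lemma ringBump_of_ge (hδ : 0 < δ) (hr : δ ≤ r) (ht : 2 * r ≤ t) : ringBump δ r t = 0 := by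
  rw [ringBump, Real.smoothTransition.one_of_one_le, Real.smoothTransition.one_of_one_le, sub_self]
  · rw [le_sub_iff_add_le, le_div_iff₀ (hδ.trans_le hr)]; linarith
  · rw [le_sub_iff_add_le, le_div_iff₀ hδ]; linarith

lemma ringBump_nonneg (hδ : 0 < δ) (hr : δ ≤ r) (t : ℝ) : 0 ≤ ringBump δ r t := by
  rcases le_total t δ with ht | ht
  · exact (ringBump_of_le hδ hr ht).ge
  · refine sub_nonneg.2 (Real.smoothTransition.monotone ?_)
    have := div_le_div_of_nonneg_left (hδ.le.trans ht) hδ hr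
    linarith

lemma contDiff_smoothTransition_div_sub (r : ℝ) :
    ContDiff ℝ (⊤ : ℕ∞) fun t => Real.smoothTransition (t / r - 1) :=
  Real.smoothTransition.contDiff.comp ((contDiff_id.div_const r).sub contDiff_const)

lemma hasDerivAt_smoothTransition_div_sub (r t : ℝ) :
    HasDerivAt (fun t => Real.smoothTransition (t / r - 1))
      (deriv Real.smoothTransition (t / r - 1) / r) t := by
  have h1 : HasDerivAt (fun t : ℝ => t / r - 1) (1 / r) t := ((hasDerivAt_id t).div_const r).sub_const 1
  refine ((differentiable_smoothTransition (t / r - 1)).hasDerivAt.comp t h1).congr_deriv ?_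
  ring

lemma hasDerivAt_ringBump (δ r t : ℝ) : HasDerivAt (ringBump δ r)
    (deriv Real.smoothTransition (t / δ - 1) / δ - deriv Real.smoothTransition (t / r - 1) / r) t :=
  (hasDerivAt_smoothTransition_div_sub δ t).sub (hasDerivAt_smoothTransition_div_sub r t)

lemma contDiff_ringBump_div (hδ : 0 < δ) (hr : δ ≤ r) :
    ContDiff ℝ (⊤ : ℕ∞) fun t => ringBump δ r t / t := by
  rw [contDiff_iff_contDiffAt]
  intro t
  rcases eq_or_ne t 0 with rfl | ht
  · refine contDiffAt_const (c := 0) |>.congr_of_eventuallyEq ?_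
    filter_upwards [gt_mem_nhds hδ] with τ hτ
    rw [ringBump_of_le hδ hr hτ.le, zero_div]
  · exact ((contDiff_smoothTransition_div_sub δ).sub
      (contDiff_smoothTransition_div_sub r)).contDiffAt.div contDiffAt_id ht

lemma hasDerivAt_ringPotential (hδ : 0 < δ) (hr : δ ≤ r) (t : ℝ) :
    HasDerivAt (ringPotential δ r) (-(ringBump δ r t / t)) t := by
  have hc := (contDiff_ringBump_div hδ hr).continuous
  exact (intervalIntegral.integral_hasDerivAt_right (hc.intervalIntegrable _ _)
    hc.stronglyMeasurable.stronglyMeasurableAtFilter hc.continuousAt).neg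

lemma deriv_ringPotential (hδ : 0 < δ) (hr : δ ≤ r) :
    deriv (ringPotential δ r) = fun t => -(ringBump δ r t / t) :=
  funext fun t => (hasDerivAt_ringPotential hδ hr t).deriv

lemma contDiff_ringPotential (hδ : 0 < δ) (hr : δ ≤ r) :
    ContDiff ℝ (⊤ : ℕ∞) (ringPotential δ r) := by
  rw [contDiff_infty_iff_deriv, deriv_ringPotential hδ hr]
  exact ⟨fun t => (hasDerivAt_ringPotential hδ hr t).differentiableAt,
    (contDiff_ringBump_div hδ hr).neg⟩

lemma deriv_deriv_ringPotential (hδ : 0 < δ) (hr : δ ≤ r) (t : ℝ) :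
    deriv (deriv (ringPotential δ r)) t * t + deriv (ringPotential δ r) t =
      deriv Real.smoothTransition (t / r - 1) / r - deriv Real.smoothTransition (t / δ - 1) / δ := by
  have h1 : HasDerivAt (fun t => ringBump δ r t / t) (deriv (fun t => ringBump δ r t / t) t) t :=
    ((contDiff_ringBump_div hδ hr).differentiable (by simp) t).hasDerivAt
  have h2 : (fun t => ringBump δ r t / t * t) = ringBump δ r := by
    funext t
    rcases eq_or_ne t 0 with rfl | ht
    · rw [mul_zero, ringBump_of_le hδ hr hδ.le]
    · exact div_mul_cancel₀ _ ht
  have h3 : HasDerivAt (fun t => ringBump δ r t / t * t) _ t := h1.mul (hasDerivAt_id' t)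
  rw [h2] at h3
  have h4 := h3.unique (hasDerivAt_ringBump δ r t)
  rw [deriv_ringPotential hδ hr, (h1.fun_neg).deriv]
  linarith

lemma ringPotential_of_ge (hδ : 0 < δ) (hr : δ ≤ r) (ht : 2 * r ≤ t) : ringPotential δ r t = 0 := by
  rw [ringPotential, intervalIntegral.integral_congr (g := fun _ => 0),
    intervalIntegral.integral_zero, neg_zero]
  intro τ hτ
  rw [uIcc_of_le ht] at hτ
  simp only [ringBump_of_ge hδ hr hτ.1, zero_div]

lemma ringPotential_nonneg (hδ : 0 < δ) (hr : δ ≤ r) (ht : 0 ≤ t) : 0 ≤ ringPotential δ r t := by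
  rcases le_total (2 * r) t with h | h
  · exact (ringPotential_of_ge hδ hr h).ge
  · rw [ringPotential, ← intervalIntegral.integral_symm]
    exact intervalIntegral.integral_nonneg h fun τ hτ =>
      div_nonneg (ringBump_nonneg hδ hr τ) (ht.trans hτ.1)

end

/-- The squared Euclidean distance to `q`. -/
def sqDist (q z : ℝ × ℝ) : ℝ := (z.1 - q.1) ^ 2 + (z.2 - q.2) ^ 2

section

variable {q z : ℝ × ℝ} {δ r : ℝ}

lemma contDiff_sqDist (q : ℝ × ℝ) : ContDiff ℝ (⊤ : ℕ∞) (sqDist q) := by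
  unfold sqDist
  fun_prop

lemma sqDist_nonneg (q z : ℝ × ℝ) : 0 ≤ sqDist q z := add_nonneg (sq_nonneg _) (sq_nonneg _)

lemma hasFDerivAt_sqDist (q z : ℝ × ℝ) : HasFDerivAt (sqDist q)
    ((2 * (z.1 - q.1)) • ContinuousLinearMap.fst ℝ ℝ ℝ +
      (2 * (z.2 - q.2)) • ContinuousLinearMap.snd ℝ ℝ ℝ) z := by
  have h := ((hasFDerivAt_fst (𝕜 := ℝ) (p := z)).sub_const q.1 |>.pow 2).add
    ((hasFDerivAt_snd (𝕜 := ℝ) (p := z)).sub_const q.2 |>.pow 2)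
  refine h.congr_fderiv ?_
  ext <;> simp

lemma pdx_sqDist (q : ℝ × ℝ) : pdx (sqDist q) = fun z => 2 * (z.1 - q.1) := by
  funext z
  simp [pdx, (hasFDerivAt_sqDist q z).fderiv]

lemma pdy_sqDist (q : ℝ × ℝ) : pdy (sqDist q) = fun z => 2 * (z.2 - q.2) := by
  funext z
  simp [pdy, (hasFDerivAt_sqDist q z).fderiv]

lemma gradSq_sqDist (q z : ℝ × ℝ) : gradSq (sqDist q) z = 4 * sqDist q z := by
  rw [gradSq, pdx_sqDist, pdy_sqDist, sqDist]
  ring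

lemma eucLap_sqDist (q z : ℝ × ℝ) : eucLap (sqDist q) z = 4 := by
  have h1 : HasFDerivAt (fun z : ℝ × ℝ => 2 * (z.1 - q.1))
    ((2 : ℝ) • ContinuousLinearMap.fst ℝ ℝ ℝ) z := (hasFDerivAt_fst.sub_const q.1).const_mul 2
  have h2 : HasFDerivAt (fun z : ℝ × ℝ => 2 * (z.2 - q.2))
    ((2 : ℝ) • ContinuousLinearMap.snd ℝ ℝ ℝ) z := (hasFDerivAt_snd.sub_const q.2).const_mul 2
  rw [eucLap, pdx_sqDist, pdy_sqDist, pdx, pdy, h1.fderiv, h2.fderiv]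
  norm_num

lemma eucLap_ringPotential_sqDist (hδ : 0 < δ) (hr : δ ≤ r) (q z : ℝ × ℝ) :
    eucLap (fun y => ringPotential δ r (sqDist q y)) z =
      4 * (deriv Real.smoothTransition (sqDist q z / r - 1) / r -
        deriv Real.smoothTransition (sqDist q z / δ - 1) / δ) := by
  rw [eucLap_comp (contDiff_sqDist q).contDiffOn isOpen_univ
    (contDiff_ringPotential hδ hr).contDiffOn isOpen_univ (fun _ _ => mem_univ _) (mem_univ z),
    gradSq_sqDist, eucLap_sqDist, ← deriv_deriv_ringPotential hδ hr]
  ring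

lemma dist_le_sqrt_sqDist (q z : ℝ × ℝ) : dist z q ≤ √(sqDist q z) := by
  rw [Prod.dist_eq, Real.dist_eq, Real.dist_eq]
  exact max_le (Real.abs_le_sqrt (le_add_of_nonneg_right (sq_nonneg _)))
    (Real.abs_le_sqrt (le_add_of_nonneg_left (sq_nonneg _)))

lemma sqDist_le_subset_closedBall (q : ℝ × ℝ) (t : ℝ) :
    {z | sqDist q z ≤ t} ⊆ Metric.closedBall q √t :=
  fun z hz => (dist_le_sqrt_sqDist q z).trans (Real.sqrt_le_sqrt hz)

lemma hasCompactSupport_comp_sqDist {f : ℝ → ℝ} {t : ℝ} (hf : ∀ s, t < s → f s = 0) (q : ℝ × ℝ) :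
    HasCompactSupport (fun z => f (sqDist q z)) ∧
      tsupport (fun z => f (sqDist q z)) ⊆ Metric.closedBall q √t := by
  have h : Function.support (fun z => f (sqDist q z)) ⊆ Metric.closedBall q √t := fun z hz =>
    sqDist_le_subset_closedBall q t (not_lt.1 fun h => hz (hf _ h))
  exact ⟨HasCompactSupport.of_support_subset_isCompact (isCompact_closedBall _ _) h,
    closure_minimal h Metric.isClosed_closedBall⟩

end

section

variable {Ω : Set (ℝ × ℝ)} {μ ρ δ r : ℝ} {h : ℝ × ℝ → ℝ} {q : ℝ × ℝ}

lemma deriv_smoothTransition_div_sub_eq_zero (hr : 0 < r) {t : ℝ} (ht : 2 * r < t) :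
    deriv Real.smoothTransition (t / r - 1) / r = 0 := by
  rw [deriv_smoothTransition_eq_zero, zero_div]
  intro h
  have := h.2
  rw [sub_le_iff_le_add, div_le_iff₀ hr] at this
  linarith

lemma continuous_deriv_smoothTransition : Continuous (deriv Real.smoothTransition) :=
  (Real.smoothTransition.contDiff (n := 1)).continuous_deriv (by simp)

lemma continuous_ringMean_integrand (q : ℝ × ℝ) (r : ℝ) :
    Continuous fun z => deriv Real.smoothTransition (sqDist q z / r - 1) / r :=
  (continuous_deriv_smoothTransition.comp
    (((contDiff_sqDist q).continuous.div_const r).sub continuous_const)).div_const r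

lemma sqrt_lt_of_lt_sq (hρ : 0 < ρ) (hr : 2 * r < ρ ^ 2) : √(2 * r) < ρ :=
  (Real.sqrt_lt' hρ).2 hr

lemma integrableOn_ringMean (hopen : IsOpen Ω) (hh : ContinuousOn h Ω) (hρ : 0 < ρ)
    (hball : Metric.ball q ρ ⊆ Ω) (hr0 : 0 < r) (hr : 2 * r < ρ ^ 2) :
    IntegrableOn (fun z => h z * (deriv Real.smoothTransition (sqDist q z / r - 1) / r)) Ω := by
  obtain ⟨h1, h2⟩ := hasCompactSupport_comp_sqDist
    (f := fun t => deriv Real.smoothTransition (t / r - 1) / r)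
    (fun _ ht => deriv_smoothTransition_div_sub_eq_zero hr0 ht) q
  exact integrableOn_mul_of_tsupport hopen hh (continuous_ringMean_integrand q r) h1
    (h2.trans ((Metric.closedBall_subset_ball (sqrt_lt_of_lt_sq hρ hr)).trans hball))

/-- Smoothed circular means of a weakly superharmonic function are monotone. -/
lemma ringMean_le_ringMean (hopen : IsOpen Ω) (hμ : 0 ≤ μ) (hh : ContinuousOn h Ω)
    (h0 : ∀ z, 0 ≤ h z) (hρ : 0 < ρ) (hball : Metric.ball q ρ ⊆ Ω)
    (hweak : ∀ ψ : ℝ × ℝ → ℝ, ContDiff ℝ (⊤ : ℕ∞) ψ → HasCompactSupport ψ →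
      tsupport ψ ⊆ Metric.ball q ρ →
      (∫ z in Ω, h z * eucLap ψ z) + μ * ∫ z in Ω, h z * (ψ z / z.2 ^ 2) = 0)
    (hδ : 0 < δ) (hδr : δ ≤ r) (hr : 2 * r < ρ ^ 2) :
    ∫ z in Ω, h z * (deriv Real.smoothTransition (sqDist q z / r - 1) / r) ≤
      ∫ z in Ω, h z * (deriv Real.smoothTransition (sqDist q z / δ - 1) / δ) := by
  obtain ⟨h1, h2⟩ := hasCompactSupport_comp_sqDist (f := ringPotential δ r)
    (fun _ ht => ringPotential_of_ge hδ hδr ht.le) q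
  have key := hweak _ ((contDiff_ringPotential hδ hδr).comp (contDiff_sqDist q)) h1
    (h2.trans (Metric.closedBall_subset_ball (sqrt_lt_of_lt_sq hρ hr)))
  have hnn : 0 ≤ ∫ z in Ω, h z * (ringPotential δ r (sqDist q z) / z.2 ^ 2) :=
    integral_nonneg fun z => mul_nonneg (h0 z)
      (div_nonneg (ringPotential_nonneg hδ hδr (sqDist_nonneg q z)) (sq_nonneg _))
  have e : ∀ z, h z * eucLap (fun y => ringPotential δ r (sqDist q y)) z =
      4 * (h z * (deriv Real.smoothTransition (sqDist q z / r - 1) / r) -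
        h z * (deriv Real.smoothTransition (sqDist q z / δ - 1) / δ)) := fun z => by
    rw [eucLap_ringPotential_sqDist hδ hδr]; ring
  simp only [Function.comp_def, e] at key
  rw [integral_const_mul, integral_sub
    (integrableOn_ringMean hopen hh hρ hball (hδ.trans_le hδr) hr)
    (integrableOn_ringMean hopen hh hρ hball hδ (by linarith))] at key
  have := mul_nonneg hμ hnn
  linarith

lemma volume_real_closedBall_prod {t : ℝ} (ht : 0 ≤ t) (q : ℝ × ℝ) :
    volume.real (Metric.closedBall q t) = 4 * t ^ 2 := by
  have : Metric.closedBall q t = Metric.closedBall q.1 t ×ˢ Metric.closedBall q.2 t :=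
    (closedBall_prod_same q.1 q.2 t).symm
  rw [this, Measure.volume_eq_prod, measureReal_prod_prod, Real.volume_real_closedBall ht,
    Real.volume_real_closedBall ht]
  ring

lemma ringMean_le {η L : ℝ} (hopen : IsOpen Ω) (h0 : ∀ z, 0 ≤ h z)
    (hL : ∀ t, |deriv Real.smoothTransition t| ≤ L) (hδ : 0 < δ)
    (hball : Metric.closedBall q √(2 * δ) ⊆ Ω)
    (hη : ∀ z ∈ Metric.closedBall q √(2 * δ), h z ≤ η) :
    ∫ z in Ω, h z * (deriv Real.smoothTransition (sqDist q z / δ - 1) / δ) ≤ 8 * (η * L) := by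
  rw [setIntegral_eq_of_subset_of_forall_sdiff_eq_zero hopen.measurableSet hball]
  · have h1 : ∀ z ∈ Metric.closedBall q √(2 * δ),
        ‖h z * (deriv Real.smoothTransition (sqDist q z / δ - 1) / δ)‖ ≤ η * (L / δ) := by
      intro z hz
      rw [norm_mul, norm_div, Real.norm_of_nonneg (h0 z), Real.norm_of_nonneg hδ.le]
      exact mul_le_mul (hη z hz) (div_le_div_of_nonneg_right (hL _) hδ.le)
        (div_nonneg (norm_nonneg _) hδ.le) ((h0 z).trans (hη z hz))
    have h2 := norm_setIntegral_le_of_norm_le_const (μ := volume)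
      (isCompact_closedBall q √(2 * δ)).measure_lt_top h1
    rw [volume_real_closedBall_prod (Real.sqrt_nonneg _), Real.sq_sqrt (by positivity)] at h2
    refine (le_abs_self _).trans (h2.trans_eq ?_)
    field_simp
    ring
  · intro z hz
    rw [deriv_smoothTransition_div_sub_eq_zero hδ, mul_zero]
    by_contra! hle
    exact hz.2 (sqDist_le_subset_closedBall q _ hle)

lemma exists_bound_deriv_smoothTransition : ∃ L, ∀ t, |deriv Real.smoothTransition t| ≤ L := by
  obtain ⟨C, hC⟩ := exists_lipschitz_smoothTransition
  exact ⟨C, fun t => norm_deriv_le_of_lipschitz hC⟩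

lemma exists_deriv_smoothTransition_eq_one :
    ∃ τ ∈ Ioo (0 : ℝ) 1, deriv Real.smoothTransition τ = 1 := by
  obtain ⟨τ, hτ, h⟩ := exists_deriv_eq_slope Real.smoothTransition zero_lt_one
    differentiable_smoothTransition.continuous.continuousOn
    differentiable_smoothTransition.differentiableOn
  refine ⟨τ, hτ, h.trans ?_⟩
  rw [Real.smoothTransition.one_of_one_le le_rfl, Real.smoothTransition.zero_of_nonpos le_rfl]
  norm_num

/-- A weak strong-maximum principle: a nonnegative continuous weak solution vanishing at a point
vanishes near it. -/
theorem eventually_eq_zero_of_weak_solution (hopen : IsOpen Ω) (hμ : 0 ≤ μ)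
    (hh : ContinuousOn h Ω) (h0 : ∀ z, 0 ≤ h z) (hq : h q = 0) (hρ : 0 < ρ)
    (hball : Metric.ball q ρ ⊆ Ω)
    (hweak : ∀ ψ : ℝ × ℝ → ℝ, ContDiff ℝ (⊤ : ℕ∞) ψ → HasCompactSupport ψ →
      tsupport ψ ⊆ Metric.ball q ρ →
      (∫ z in Ω, h z * eucLap ψ z) + μ * ∫ z in Ω, h z * (ψ z / z.2 ^ 2) = 0) :
    ∀ᶠ z in 𝓝 q, h z = 0 := by
  have hqΩ : q ∈ Ω := hball (Metric.mem_ball_self hρ)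
  obtain ⟨L, hL⟩ := exists_bound_deriv_smoothTransition
  have hL0 : 0 ≤ L := (abs_nonneg _).trans (hL 0)
  have hM : ∀ r, 0 < r → 2 * r < ρ ^ 2 →
      ∫ z in Ω, h z * (deriv Real.smoothTransition (sqDist q z / r - 1) / r) ≤ 0 := by
    intro r hr0 hr
    refine le_of_forall_pos_le_add fun ε hε => ?_
    obtain ⟨η, hη, hηε⟩ : ∃ η : ℝ, 0 < η ∧ 8 * (η * L) ≤ ε := by
      refine ⟨ε / (8 * (L + 1)), by positivity, ?_⟩
      rw [show 8 * (ε / (8 * (L + 1)) * L) = ε * (L / (L + 1)) by field_simp]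
      exact mul_le_of_le_one_right hε.le ((div_le_one (by positivity)).2 (by linarith))
    have hc := (hh.continuousAt (hopen.mem_nhds hqΩ)).eventually (gt_mem_nhds (hq.trans_lt hη))
    obtain ⟨R, hR, hRη⟩ := Metric.mem_nhds_iff.1 hc
    have hδ : 0 < min r (R ^ 2 / 4) := lt_min hr0 (by positivity)
    have hδr : min r (R ^ 2 / 4) ≤ r := min_le_left _ _
    have hδR : 2 * min r (R ^ 2 / 4) < R ^ 2 := by
      have := min_le_right r (R ^ 2 / 4)
      have := sq_pos_of_pos hR
      linarith
    refine (ringMean_le_ringMean hopen hμ hh h0 hρ hball hweak hδ hδr hr).trans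
      ((ringMean_le (η := η) hopen h0 hL hδ ?_ ?_).trans (by linarith))
    · exact (Metric.closedBall_subset_ball (sqrt_lt_of_lt_sq hρ (by linarith))).trans hball
    · exact fun z hz => (hRη (Metric.closedBall_subset_ball (sqrt_lt_of_lt_sq hR hδR) hz)).le
  obtain ⟨τ, hτ, hτ1⟩ := exists_deriv_smoothTransition_eq_one
  have hX : ∀ᶠ z in 𝓝 q, sqDist q z < ρ ^ 2 / 2 := by
    refine (contDiff_sqDist q).continuous.continuousAt.eventually (gt_mem_nhds ?_)
    have : 0 < ρ ^ 2 / 2 := by positivity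
    simpa [sqDist] using this
  filter_upwards [hX, hopen.mem_nhds hqΩ] with z hz hzΩ
  rcases (sqDist_nonneg q z).eq_or_lt with hz0 | hz0
  · have : z = q := by
      have h1 : sqDist q z = 0 := hz0.symm
      rw [sqDist] at h1
      have h2 := pow_eq_zero_iff two_ne_zero |>.1 (le_antisymm (by nlinarith [sq_nonneg (z.2 - q.2)])
        (sq_nonneg (z.1 - q.1)))
      have h3 := pow_eq_zero_iff two_ne_zero |>.1 (le_antisymm (by nlinarith [sq_nonneg (z.1 - q.1)])
        (sq_nonneg (z.2 - q.2)))
      exact Prod.ext (sub_eq_zero.1 h2) (sub_eq_zero.1 h3)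
    rw [this, hq]
  · have hτ0 : 0 < 1 + τ := by linarith [hτ.1]
    set r := sqDist q z / (1 + τ) with hrdef
    have hr0 : 0 < r := div_pos hz0 hτ0
    have hr : 2 * r < ρ ^ 2 := by
      have : r ≤ sqDist q z := div_le_self hz0.le (by linarith [hτ.1])
      linarith
    have hval : sqDist q z / r - 1 = τ := by
      rw [hrdef]; field_simp; ring
    by_contra hne
    have hpos : 0 < h z := lt_of_le_of_ne (h0 z) (Ne.symm hne)
    have hc : ContinuousOn (fun z => h z * (deriv Real.smoothTransition (sqDist q z / r - 1) / r)) Ω :=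
      hh.mul (continuous_ringMean_integrand q r).continuousOn
    have hnn : ∀ z, 0 ≤ h z * (deriv Real.smoothTransition (sqDist q z / r - 1) / r) := fun z =>
      mul_nonneg (h0 z) (div_nonneg (deriv_smoothTransition_nonneg _) hr0.le)
    refine (hM r hr0 hr).not_gt ?_
    rw [setIntegral_pos_iff_support_of_nonneg_ae (Eventually.of_forall hnn)
      (integrableOn_ringMean hopen hh hρ hball hr0 hr)]
    have hopen' := hc.isOpen_inter_preimage hopen (isOpen_Ioi (a := (0 : ℝ)))
    refine lt_of_lt_of_le (hopen'.measure_pos volume ⟨z, hzΩ, ?_⟩)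
      (measure_mono fun y hy => ⟨(mem_Ioi.1 hy.2).ne', hy.1⟩)
    simp only [mem_preimage, hval, hτ1, mem_Ioi]
    positivity

end

section

variable {Ω : Set (ℝ × ℝ)} {μ : ℝ} {u v : ℝ × ℝ → ℝ} {p : ℝ × ℝ}

/-- If a combination of two restrictions of `v` is a weak solution, then the negative set of `v`
has no regular boundary point `q` on its component through `a`. -/
lemma false_of_combination {a q : ℝ × ℝ} {D : Set (ℝ × ℝ)} {s t : ℝ} (hμ : 0 ≤ μ)
    (hopen : IsOpen Ω) (hv : ContDiffOn ℝ (⊤ : ℕ∞) v Ω) (hs : 0 < s)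
    (hD : IsNegativeRegion Ω v D)
    (hdis : Disjoint (connectedComponentIn {z | z ∈ Ω ∧ v z < 0} a) D)
    (hcomb : ∀ ψ, ContDiff ℝ (⊤ : ℕ∞) ψ → HasCompactSupport ψ → tsupport ψ ⊆ Ω →
      s * ((∫ z in Ω, restrictNeg (connectedComponentIn {z | z ∈ Ω ∧ v z < 0} a) id v z *
          eucLap ψ z) +
          μ * ∫ z in Ω, restrictNeg (connectedComponentIn {z | z ∈ Ω ∧ v z < 0} a) id v z *
            (ψ z / z.2 ^ 2)) =
        t * ((∫ z in Ω, restrictNeg D id v z * eucLap ψ z) +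
          μ * ∫ z in Ω, restrictNeg D id v z * (ψ z / z.2 ^ 2)))
    (hq : q ∈ Ω) (hdq : fderiv ℝ v q ≠ 0)
    (hqD : q ∈ frontier (connectedComponentIn {z | z ∈ Ω ∧ v z < 0} a)) : False := by
  have hDa := isNegativeRegion_connectedComponentIn hopen hv.continuousOn a
  set Da := connectedComponentIn {z | z ∈ Ω ∧ v z < 0} a
  have hvq := hDa.eq_zero_of_mem_frontier hopen hv.continuousOn hq hqD
  rw [hDa.isOpen.frontier_eq] at hqD
  obtain ⟨ρ, hρ, hball, hbD⟩ := exists_ball_subset_component hopen hv hq hvq hdq hqD.1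
  have hoff : ∀ z ∈ Metric.ball q ρ, restrictNeg D id v z = 0 := fun z hz =>
    restrictNeg_of_notMem fun hzD => disjoint_left.1 hdis (hbD z hz (hD.neg z hzD)) hzD
  have hzero := eventually_eq_zero_of_weak_solution hopen hμ
    (continuousOn_restrictNeg_id hDa hopen hv.continuousOn)
    (fun z => (restrictNeg_id_mem_Icc hDa z).1) (restrictNeg_of_notMem hqD.2) hρ hball
    (fun ψ hψ hψc hψb => by
      have h1 : ∀ z, restrictNeg D id v z * eucLap ψ z = 0 := fun z => by
        by_cases hz : z ∈ Metric.ball q ρ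
        · rw [hoff z hz, zero_mul]
        · have key : ∀ e, fderiv ℝ (fun y => fderiv ℝ ψ y e) z e = 0 := fun e =>
            image_eq_zero_of_notMem_tsupport (f := fun z => fderiv ℝ (fun y => fderiv ℝ ψ y e) z e)
              fun h => hz (tsupport_fderiv_apply_subset_of_subset
                (tsupport_fderiv_apply_subset_of_subset hψb e) e h)
          have : eucLap ψ z = 0 := by
            change fderiv ℝ (fun y => fderiv ℝ ψ y (1, 0)) z (1, 0) +
              fderiv ℝ (fun y => fderiv ℝ ψ y (0, 1)) z (0, 1) = 0
            rw [key, key, add_zero]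
          rw [this, mul_zero]
      have h2 : ∀ z, restrictNeg D id v z * (ψ z / z.2 ^ 2) = 0 := fun z => by
        by_cases hz : z ∈ Metric.ball q ρ
        · rw [hoff z hz, zero_mul]
        · rw [image_eq_zero_of_notMem_tsupport fun h => hz (hψb h), zero_div, mul_zero]
      have h3 := hcomb ψ hψ hψc (hψb.trans hball)
      simp only [h1, h2, integral_zero, mul_zero, add_zero] at h3
      exact (mul_eq_zero.1 h3).resolve_left hs.ne')
  obtain ⟨z, hz, hzD⟩ := mem_closure_iff_nhds.1 hqD.1 _ hzero
  rw [mem_ofPred_eq, restrictNeg_of_mem hzD] at hz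
  exact (hDa.neg z hzD).ne (neg_eq_zero.1 hz)

theorem false_of_supersolution (hΩ : Ω ⊆ H2) (hopen : IsOpen Ω) (hconn : IsPreconnected Ω)
    (hconv : Convex ℝ (straighten '' Ω)) (hp : p ∈ Ω) (hμ : 0 < μ) (hμ' : μ ≤ 1 / 4)
    (harea : IntegrableOn (fun z : ℝ × ℝ => 1 / z.2 ^ 2) Ω) (hgap : SpectralGap Ω μ)
    (hv : ContDiffOn ℝ (⊤ : ℕ∞) v Ω) (heq : ∀ z ∈ Ω, eucLap v z = -(μ / z.2 ^ 2) * v z)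
    (hv2 : IntegrableOn (fun z => v z ^ 2 / z.2 ^ 2) Ω) (hve : IntegrableOn (gradSq v) Ω)
    (hbd : BoundaryFluxNonneg Ω p v) (hvp : v p = 0) (hcrit : fderiv ℝ v p = 0)
    (hne : ∃ z ∈ Ω, v z ≠ 0) : False := by
  have hvc := hv.continuousOn
  obtain ⟨k, hk, c, hc, hexp, hreg⟩ :=
    expansion_of_ne_zero hμ.le hΩ hopen hconn hv heq hne hp hvp hcrit
  obtain ⟨a, b, ha, hb, hpa, hpb, hba⟩ :=
    exists_two_negative_components hΩ hopen hconv hvc hp hvp hk hc hexp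
      fun P hPo hPn hpos hPc hPΩ hfr =>
        false_of_positive_on_compact hμ' hΩ hopen hv heq hPo hPn hpos hPc hPΩ hfr
  set N := {z | z ∈ Ω ∧ v z < 0} with hN
  have hDa := isNegativeRegion_connectedComponentIn hopen hvc a
  have hE := hDa.diff
  have hdis : Disjoint (connectedComponentIn N a) (N \ connectedComponentIn N a) :=
    disjoint_sdiff_right
  have hbE : connectedComponentIn N b ⊆ N \ connectedComponentIn N a := fun z hz =>
    ⟨connectedComponentIn_subset _ _ hz, fun hza => hba <| by
      rw [connectedComponentIn_eq hza, ← connectedComponentIn_eq hz]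
      exact mem_connectedComponentIn hb⟩
  obtain ⟨s, t, hs, -, hcomb⟩ := hgap.exists_combination hμ.le hΩ hopen harea hDa hE hdis
    ⟨a, mem_connectedComponentIn ha⟩ ⟨b, hb, hba⟩ hv hv2 hve
    fun ψ hψ hψ0 hψ2 hψe => integral_gradDot_ge hΩ hopen hconv hp hv heq hv2 hve hbd hψ hψ0 hψ2 hψe
  obtain ⟨r, hr, hball⟩ := Metric.mem_nhds_iff.1
    (inter_mem (hopen.mem_nhds hp) (eventually_nhdsWithin_iff.1 hreg))
  have hmeet : ∀ D, IsNegativeRegion Ω v D → p ∈ closure D →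
      ((Metric.ball p r \ {p}) ∩ D).Nonempty := fun D hD hpD => by
    obtain ⟨z, hz, hzD⟩ := mem_closure_iff_nhds.1 hpD _ (Metric.ball_mem_nhds p hr)
    exact ⟨z, ⟨hz, fun h => (hD.neg z hzD).ne (by rw [mem_singleton_iff.1 h, hvp])⟩, hzD⟩
  obtain ⟨q, hq, hqD⟩ := (isPreconnected_ball_diff_singleton p hr).exists_mem_frontier
    hDa.isOpen hE.isOpen hdis (hmeet _ hDa hpa) (hmeet _ hE (closure_mono hbE hpb))
  exact false_of_combination hμ.le hopen hv hs hE hdis hcomb (hball hq.1).1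
    ((hball hq.1).2 hq.2) hqD

lemma pdx_neg (u : ℝ × ℝ → ℝ) : pdx (-u) = -pdx u := by
  ext z; simp only [pdx, fderiv_neg, Pi.neg_apply, neg_apply]

lemma pdy_neg (u : ℝ × ℝ → ℝ) : pdy (-u) = -pdy u := by
  ext z; simp only [pdy, fderiv_neg, Pi.neg_apply, neg_apply]

lemma gradSq_neg (u : ℝ × ℝ → ℝ) : gradSq (-u) = gradSq u := by
  ext z; simp [gradSq, pdx_neg, pdy_neg]

lemma eucLap_neg (u : ℝ × ℝ → ℝ) (z : ℝ × ℝ) : eucLap (-u) z = -eucLap u z := by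
  simp [eucLap, pdx_neg, pdy_neg, add_comm]

lemma gradDot_neg (u g : ℝ × ℝ → ℝ) (z : ℝ × ℝ) : gradDot (-u) g z = -gradDot u g z := by
  simp [gradDot, pdx_neg, pdy_neg, add_comm]

end

/-- **Theorem (Neumann hot spots, small eigenvalue).** On a nonempty open connected
geodesically convex domain `Ω ⊆ ℍ²` of finite hyperbolic area, a nonconstant Neumann
eigenfunction whose eigenvalue `μ ∈ (0, 1/4]` is the least element of the positive
Neumann spectrum (in the variational sense) has no interior critical points. -/
theorem neumann_hot_spots_small_eigenvalue
    (Ω : Set (ℝ × ℝ)) (hΩH : Ω ⊆ H2) (hne : Ω.Nonempty) (hopen : IsOpen Ω)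
    (hconn : IsConnected Ω) (hconv : GeodesicallyConvex Ω)
    (harea : IntegrableOn (fun p : ℝ × ℝ => 1 / p.2 ^ 2) Ω volume)
    (μ : ℝ) (hμpos : 0 < μ) (hμle : μ ≤ 1 / 4)
    (u : ℝ × ℝ → ℝ)
    (hnonconst : ¬ ∃ c : ℝ, ∀ p ∈ Ω, u p = c)
    (hsmooth : ContDiffOn ℝ (⊤ : ℕ∞) u Ω)
    (hC1 : ContDiffOn ℝ 1 u (closure Ω ∩ H2))
    (hL2 : IntegrableOn (fun p : ℝ × ℝ => u p ^ 2 / p.2 ^ 2) Ω volume)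
    (hH1 : IntegrableOn (gradSq u) Ω volume)
    (heigen : ∀ p ∈ Ω, -hypLap u p = μ * u p)
    (hneumann : ∀ q ∈ frontier Ω ∩ H2, ∀ ν : ℝ × ℝ, IsOutwardNormalAt Ω q ν →
      fderivWithin ℝ u (closure Ω ∩ H2) q ν = 0)
    (hleast : ∀ w : ℝ × ℝ → ℝ, ContDiffOn ℝ (⊤ : ℕ∞) w Ω →
      (∫ p in Ω, w p / p.2 ^ 2) = 0 →
      IntegrableOn (fun p : ℝ × ℝ => w p ^ 2 / p.2 ^ 2) Ω volume →
      IntegrableOn (gradSq w) Ω volume →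
      μ * ∫ p in Ω, w p ^ 2 / p.2 ^ 2 ≤ ∫ p in Ω, gradSq w p) :
    ∀ p ∈ Ω, fderiv ℝ u p ≠ 0 := by
  intro p hp hcrit
  have hconvS := hconv.convex_image hΩH
  have heq : ∀ z ∈ Ω, eucLap u z = -(μ / z.2 ^ 2) * u z := fun z hz => by
    have h := heigen z hz
    have hz2 : z.2 ≠ 0 := (show (0 : ℝ) < z.2 from hΩH hz).ne'
    change -(z.2 ^ 2 * eucLap u z) = μ * u z at h
    field_simp
    linarith
  have hnc : ∃ z ∈ Ω, u z ≠ 0 := by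
    by_contra! h
    exact hnonconst ⟨0, h⟩
  have hflux : ∀ K : Set (ℝ × ℝ), IsCompact K → K ⊆ H2 → ∀ ε : ℝ, 0 < ε → ∃ δ : ℝ, 0 < δ ∧
      ∀ z ∈ Ω ∩ K, DifferentiableAt ℝ (domainGauge Ω p) z → 1 - δ < domainGauge Ω p z →
        |gradDot u (domainGauge Ω p) z| ≤ ε := fun K hK hKH ε hε =>
    exists_abs_gradDot_domainGauge_le hΩH hopen hconvS hp hC1 hneumann hK hKH hε
  have hfin : ∀ w : ℝ × ℝ → ℝ, (∃ z ∈ Ω, w z ≠ 0) → ContDiffOn ℝ (⊤ : ℕ∞) w Ω →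
      (∀ z ∈ Ω, eucLap w z = -(μ / z.2 ^ 2) * w z) →
      IntegrableOn (fun z => w z ^ 2 / z.2 ^ 2) Ω → IntegrableOn (gradSq w) Ω →
      BoundaryFluxNonneg Ω p w → 0 ≤ w p → fderiv ℝ w p = 0 → False := by
    intro w h1 h2 h3 h4 h5 h6 h7 h8
    obtain ⟨v, hv, hve, hv2, hvg, hvb, hvp, hvc, hvn⟩ :=
      exists_supersolution hΩH hopen hconvS hp hμpos hμle harea h1 h2 h3 h4 h5 h6 h7 h8
    exact false_of_supersolution hΩH hopen hconn.isPreconnected hconvS hp hμpos hμle harea hleast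
      hv hve hv2 hvg hvb hvp hvc hvn
  rcases le_total 0 (u p) with hup | hup
  · refine hfin u hnc hsmooth heq hL2 hH1 (fun K hK hKH ε hε => ?_) hup hcrit
    obtain ⟨δ, hδ, h⟩ := hflux K hK hKH ε hε
    exact ⟨δ, hδ, fun z hz hd hG => (abs_le.1 (h z hz hd hG)).1⟩
  · refine hfin (-u) ?_ hsmooth.neg (fun z hz => ?_) ?_ ?_ (fun K hK hKH ε hε => ?_) ?_ ?_
    · simpa using hnc
    · rw [eucLap_neg, heq z hz, Pi.neg_apply]; ring
    · simpa using hL2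
    · rwa [gradSq_neg]
    · obtain ⟨δ, hδ, h⟩ := hflux K hK hKH ε hε
      refine ⟨δ, hδ, fun z hz hd hG => ?_⟩
      rw [gradDot_neg]
      exact neg_le_neg (abs_le.1 (h z hz hd hG)).2
    · simpa using hup
    · rw [fderiv_neg, hcrit, neg_zero]
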